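/- Let k: ℝ^{2n+1} → ℝ be cylindrically symmetric and such that k ∘ F extends to a C^∞ function on the unit sphere S^{2n+1} ⊂ ℂ^{n+1}, where F is the Cayley transform. Assume there exists s̄ ∈ ℝ such that k(0,s̄) = sup_{σ∈ℝ} k(0,σ) and Δ_{x,y}k(0,s̄) > 0, where Δ_{x,y}k = Σ_{i=1}^n (∂²k/∂x_i² + ∂²k/∂y_i²). Then there exists ε₀ > 0 such that for every ε with |ε| < ε₀ the equation −Δ_{ℍⁿ}u = (1+εk) u^{Q*−1} has a positive cylindrically symmetric finite-energy weak solution. -/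

import Mathlib

open MeasureTheory Filter Topology

noncomputable section

/-- Points of the Heisenberg group `ℍⁿ ≅ ℝⁿ × ℝⁿ × ℝ`, written `(x, y, t)`. -/
abbrev Pt (n : ℕ) : Type := (Fin n → ℝ) × (Fin n → ℝ) × ℝ

namespace Heis

/-- Unit vector in the `x_j` direction. -/
def ex (n : ℕ) (j : Fin n) : Pt n := (Pi.single j 1, 0, 0)

/-- Unit vector in the `y_j` direction. -/
def ey (n : ℕ) (j : Fin n) : Pt n := (0, Pi.single j 1, 0)

/-- Unit vector in the `t` direction. -/
def et (n : ℕ) : Pt n := (0, 0, 1)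

/-- The left-invariant vector field `X_j u = ∂u/∂x_j + 2 y_j ∂u/∂t`. -/
def Xd (n : ℕ) (j : Fin n) (u : Pt n → ℝ) (p : Pt n) : ℝ :=
  fderiv ℝ u p (ex n j) + 2 * p.2.1 j * fderiv ℝ u p (et n)

/-- The left-invariant vector field `Y_j u = ∂u/∂y_j - 2 x_j ∂u/∂t`. -/
def Yd (n : ℕ) (j : Fin n) (u : Pt n → ℝ) (p : Pt n) : ℝ :=
  fderiv ℝ u p (ey n j) - 2 * p.1 j * fderiv ℝ u p (et n)

/-- The Kohn Laplacian `Δ_{ℍⁿ} u = Σ_j (X_j² u + Y_j² u)`. -/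
def kohn (n : ℕ) (u : Pt n → ℝ) (p : Pt n) : ℝ :=
  ∑ j, (Xd n j (Xd n j u) p + Yd n j (Yd n j u) p)

/-- `|z|` for `p = (x, y, t)`, i.e. the Euclidean norm of `(x, y)`. -/
def znorm (n : ℕ) (p : Pt n) : ℝ :=
  Real.sqrt (∑ j, (p.1 j) ^ 2 + ∑ j, (p.2.1 j) ^ 2)

/-- Cylindrical symmetry: `u (z, t)` depends only on `(|z|, t)`. -/
def IsCyl (n : ℕ) (u : Pt n → ℝ) : Prop :=
  ∃ v : ℝ → ℝ → ℝ, ∀ p : Pt n, u p = v (znorm n p) p.2.2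

/-- Homogeneous dimension `Q = 2n + 2`. -/
def Qh (n : ℕ) : ℝ := 2 * n + 2

/-- Critical exponent `Q* = 2Q/(Q-2)`. -/
def Qs (n : ℕ) : ℝ := 2 * Qh n / (Qh n - 2)

/-- Smooth compactly supported test functions. -/
def TestFun (n : ℕ) (φ : Pt n → ℝ) : Prop :=
  ContDiff ℝ (⊤ : ℕ∞) φ ∧ HasCompactSupport φ

/-- Pointwise inner product of horizontal gradients `∇_{ℍⁿ}u · ∇_{ℍⁿ}v`. -/
def hDot (n : ℕ) (u v : Pt n → ℝ) (p : Pt n) : ℝ :=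
  ∑ j, (Xd n j u p * Xd n j v p + Yd n j u p * Yd n j v p)

/-- `|∇_{ℍⁿ}u|²`. -/
def hGradSq (n : ℕ) (u : Pt n → ℝ) (p : Pt n) : ℝ := hDot n u u p

/-- `G = (Gx, Gy)` is the weak horizontal gradient of `u`, and is in `L²`. -/
def HasWeakHGrad (n : ℕ) (u : Pt n → ℝ)
    (G : Pt n → (Fin n → ℝ) × (Fin n → ℝ)) : Prop :=
  (∀ j : Fin n, MemLp (fun p => (G p).1 j) 2 volume ∧
      MemLp (fun p => (G p).2 j) 2 volume) ∧
  ∀ φ : Pt n → ℝ, TestFun n φ → ∀ j : Fin n,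
    (∫ p : Pt n, u p * Xd n j φ p = -∫ p : Pt n, (G p).1 j * φ p) ∧
    (∫ p : Pt n, u p * Yd n j φ p = -∫ p : Pt n, (G p).2 j * φ p)

/-- `G · ∇_{ℍⁿ}φ` pointwise. -/
def gDot (n : ℕ) (G : Pt n → (Fin n → ℝ) × (Fin n → ℝ)) (φ : Pt n → ℝ)
    (p : Pt n) : ℝ :=
  ∑ j, ((G p).1 j * Xd n j φ p + (G p).2 j * Yd n j φ p)

/-- `u` is a positive cylindrically symmetric finite-energy weak solution of
`-Δ_{ℍⁿ} u = K u^{Q*-1}`. -/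
def IsWeakSol (n : ℕ) (K u : Pt n → ℝ) : Prop :=
  IsCyl n u ∧ MemLp u (ENNReal.ofReal (Qs n)) volume ∧
  (∀ᵐ p : Pt n, 0 < u p) ∧
  ∃ G : Pt n → (Fin n → ℝ) × (Fin n → ℝ), HasWeakHGrad n u G ∧
    ∀ φ : Pt n → ℝ, TestFun n φ →
      ∫ p : Pt n, gDot n G φ p = ∫ p : Pt n, K p * u p ^ (Qs n - 1) * φ p

/-- The standard bubble `U_{μ,s}`. -/
def bubble (n : ℕ) (μ s : ℝ) (p : Pt n) : ℝ :=
  μ ^ (-(Qh n - 2) / 2) *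
    (((p.2.2 - s) / μ ^ 2) ^ 2 + (1 + (znorm n p) ^ 2 / μ ^ 2) ^ 2)
      ^ (-(Qh n - 2) / 4)

/-- Local Hölder continuity of an uncurried function of two real variables on a set. -/
def LocHolderOn (f : ℝ → ℝ → ℝ) (s : Set (ℝ × ℝ)) : Prop :=
  ∀ x ∈ s, ∃ t ∈ nhdsWithin x s, ∃ C α : NNReal, 0 < α ∧
    HolderOnWith C α (fun q : ℝ × ℝ => f q.1 q.2) t

/-- `K` is cylindrically symmetric, `K(z,t) = K̃(|z|,t)`, with `K̃` locally Hölder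
continuous on `(0,∞) × ℝ`. -/
def CylHolder (n : ℕ) (K : Pt n → ℝ) : Prop :=
  ∃ Kt : ℝ → ℝ → ℝ, (∀ p : Pt n, K p = Kt (znorm n p) p.2.2) ∧
    LocHolderOn Kt (Set.Ioi 0 ×ˢ Set.univ)

/-- The standard solution `ω(z,t) = (Q-2)^{(Q-2)/2} (t² + (1+|z|²)²)^{-(Q-2)/4}`. -/
def omegaFun (n : ℕ) (p : Pt n) : ℝ :=
  (Qh n - 2) ^ ((Qh n - 2) / 2) *
    (p.2.2 ^ 2 + (1 + (znorm n p) ^ 2) ^ 2) ^ (-(Qh n - 2) / 4)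

end Heis
namespace Heis

/-- The Cayley transform `F : S^{2n+1} ∖ {(0,…,0,-1)} → ℍⁿ`. -/
def cayley (n : ℕ) (ζ : Fin (n + 1) → ℂ) : Pt n :=
  (fun j => (ζ j.castSucc / (1 + ζ (Fin.last n))).re,
   fun j => (ζ j.castSucc / (1 + ζ (Fin.last n))).im,
   (Complex.I * (1 - ζ (Fin.last n)) / (1 + ζ (Fin.last n))).re)

/-- The partial Laplacian `Δ_{x,y} k = Σ_i (∂²k/∂x_i² + ∂²k/∂y_i²)`. -/
def lapXY (n : ℕ) (k : Pt n → ℝ) (p : Pt n) : ℝ :=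
  ∑ j, (fderiv ℝ (fun q => fderiv ℝ k q (ex n j)) p (ex n j)
      + fderiv ℝ (fun q => fderiv ℝ k q (ey n j)) p (ey n j))

/-- The rescaling operator `(𝒰_{μ,s} u)(z,t) = μ^{-(Q-2)/2} u(z/μ, (t-s)/μ²)`. -/
def rescale (n : ℕ) (μ s : ℝ) (u : Pt n → ℝ) (p : Pt n) : ℝ :=
  μ ^ (-(Qh n - 2) / 2) *
    u (fun j => p.1 j / μ, fun j => p.2.1 j / μ, (p.2.2 - s) / μ ^ 2)

/-- The point `(μ z, μ² t + s)`. -/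
def scalePt (n : ℕ) (μ s : ℝ) (p : Pt n) : Pt n :=
  (fun j => μ * p.1 j, fun j => μ * p.2.1 j, μ ^ 2 * p.2.2 + s)

/-- The reduced functional `Γ(μ,s) = (1/Q*) ∫ k(μz, μ²t+s) ω^{Q*}`. -/
def Gam (n : ℕ) (k : Pt n → ℝ) (μ s : ℝ) : ℝ :=
  (1 / Qs n) * ∫ p : Pt n, k (scalePt n μ s p) * omegaFun n p ^ Qs n

/-- The Heisenberg group law
`(x,y,t) ∘ (x',y',t') = (x+x', y+y', t+t'+2x'·y-2x·y')`. -/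
def heisMul (n : ℕ) (a b : Pt n) : Pt n :=
  (fun j => a.1 j + b.1 j, fun j => a.2.1 j + b.2.1 j,
   a.2.2 + b.2.2 + 2 * (∑ j, b.1 j * a.2.1 j) - 2 * (∑ j, a.1 j * b.2.1 j))

end Heis

open Heis

namespace Heis

abbrev Poly := (ℕ × ℕ) →₀ ℂ

def mon (q : ℕ × ℕ) (w : ℂ) : ℂ := w ^ q.1 * (starRingEnd ℂ w) ^ q.2

def ev : Poly →ₗ[ℂ] (ℂ → ℂ) := Finsupp.linearCombination ℂ mon

lemma ev_single (q : ℕ × ℕ) (a : ℂ) (w : ℂ) : ev (Finsupp.single q a) w = a * mon q w := by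
  simp [ev, Finsupp.linearCombination_single]

def lam (n : ℕ) (q : ℕ × ℕ) : ℝ := (2 * q.1 + n) * (2 * q.2 + n)

def Lp (n : ℕ) : Poly →ₗ[ℂ] Poly := Finsupp.linearCombination ℂ
  (fun q => Finsupp.single q ((lam n q : ℝ) : ℂ) -
    Finsupp.single (q.1 - 1, q.2 - 1) (4 * (q.1 : ℂ) * q.2))

lemma Lp_single (n : ℕ) (q : ℕ × ℕ) (a : ℂ) : Lp n (Finsupp.single q a) =
    a • (Finsupp.single q ((lam n q : ℝ) : ℂ) -
    Finsupp.single (q.1 - 1, q.2 - 1) (4 * (q.1 : ℂ) * q.2)) := by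
  simp [Lp, Finsupp.linearCombination_single]

/-- coefficients of the eigenpolynomials -/
def co (n m k : ℕ) (i : ℕ) : ℝ :=
  ∏ l ∈ Finset.range i, (-(((k : ℝ) - l) * (m + n + l + k) / ((m + l + 1) * (l + 1))))

lemma co_zero (n m k : ℕ) : co n m k 0 = 1 := by simp [co]

lemma co_succ (n m k i : ℕ) : 4 * ((i : ℝ) + 1) * (m + i + 1) * co n m k (i + 1) =
    4 * ((i : ℝ) - k) * (m + n + i + k) * co n m k i := by
  have h1 : ((m : ℝ) + i + 1) ≠ 0 := by positivity
  have h2 : ((i : ℝ) + 1) ≠ 0 := by positivity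
  unfold co
  rw [Finset.prod_range_succ]
  field_simp
  ring

lemma co_gt (n m k i : ℕ) (h : k < i) : co n m k i = 0 := by
  unfold co
  apply Finset.prod_eq_zero (i := k) (by simpa using h)
  simp

lemma co_ne (n m k i : ℕ) (hn : 1 ≤ n) (h : i ≤ k) : co n m k i ≠ 0 := by
  unfold co
  rw [Finset.prod_ne_zero_iff]
  intro l hl
  have hl' : l < k := lt_of_lt_of_le (by simpa using hl) h
  have h0 : (0 : ℝ) < (k : ℝ) - l := by
    have : (l : ℝ) < k := by exact_mod_cast hl'
    linarith
  have hn' : (1 : ℝ) ≤ n := by exact_mod_cast hn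
  have : (0 : ℝ) < ((k : ℝ) - l) * (m + n + l + k) / ((m + l + 1) * (l + 1)) := by
    positivity
  exact (by linarith : _ < (0:ℝ)).ne

/-- min index -/
def mi (q : ℕ × ℕ) : ℕ := min q.1 q.2
/-- mode -/
def md (q : ℕ × ℕ) : ℕ := max q.1 q.2 - min q.1 q.2
/-- chain -/
def ch (q : ℕ × ℕ) (i : ℕ) : ℕ × ℕ := (q.1 - mi q + i, q.2 - mi q + i)

lemma ch_mi (q : ℕ × ℕ) : ch q (mi q) = q := by
  rcases q with ⟨a, b⟩
  simp only [ch, mi]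
  ext <;> simp

lemma md_or (q : ℕ × ℕ) : (q.1 - mi q = md q ∧ q.2 - mi q = 0) ∨
    (q.1 - mi q = 0 ∧ q.2 - mi q = md q) := by
  rcases q with ⟨a, b⟩
  simp only [md, mi]
  omega

def ep (n : ℕ) (q : ℕ × ℕ) : Poly :=
  ∑ i ∈ Finset.range (mi q + 1), Finsupp.single (ch q i) ((co n (md q) (mi q) i : ℝ) : ℂ)

lemma lam_ch (n : ℕ) (q : ℕ × ℕ) (i : ℕ) : lam n (ch q i) - lam n q =
    4 * ((i : ℝ) - mi q) * (md q + n + i + mi q) := by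
  have h := ch_mi q
  have key : lam n q = lam n (ch q (mi q)) := by rw [h]
  rw [key]
  simp only [lam, ch]
  rcases md_or q with ⟨h1, h2⟩ | ⟨h1, h2⟩ <;> rw [h1, h2] <;> push_cast <;> ring

lemma Lp_ep (n : ℕ) (q : ℕ × ℕ) : Lp n (ep n q) = ((lam n q : ℝ) : ℂ) • ep n q := by
  have hc : ∀ i, ((ch q i).1 : ℝ) * (ch q i).2 = (md q + i) * i := by
    intro i
    simp only [ch]
    rcases md_or q with ⟨h1, h2⟩ | ⟨h1, h2⟩ <;> rw [h1, h2] <;> push_cast <;> ring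
  set F : ℕ → Poly := fun i => Finsupp.single (ch q i)
      (((4 * ((i : ℝ) + 1) * (md q + i + 1) * co n (md q) (mi q) (i + 1) : ℝ)) : ℂ) with hF
  have h1 : ∀ i, Lp n (Finsupp.single (ch q i) ((co n (md q) (mi q) i : ℝ) : ℂ)) -
      ((lam n q : ℝ) : ℂ) • Finsupp.single (ch q i) ((co n (md q) (mi q) i : ℝ) : ℂ)
      = F i - (if i = 0 then 0 else F (i - 1)) := by
    intro i
    rw [Lp_single, smul_sub, sub_right_comm]
    congr 1
    · rw [hF]
      simp only [Finsupp.smul_single, smul_eq_mul]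
      rw [← Finsupp.single_sub]
      congr 1
      rw [co_succ, ← lam_ch]
      push_cast; ring
    · rcases i with _ | i
      · have : ((ch q 0).1 : ℂ) * (ch q 0).2 = 0 := by
          have := hc 0
          have h3 : (((ch q 0).1 : ℝ) : ℂ) * ((ch q 0).2 : ℝ) = 0 := by
            rw [← Complex.ofReal_mul, this]; simp
          simpa using h3
        simp [mul_assoc, this]
      · have : ((ch q (i+1)).1 : ℂ) * (ch q (i+1)).2 = (md q + i + 1) * (i + 1) := by
          have := hc (i+1)
          have h3 : (((ch q (i+1)).1 : ℝ) : ℂ) * ((ch q (i+1)).2 : ℝ) =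
             (md q + i + 1) * (i + 1) := by
            rw [← Complex.ofReal_mul, this]; push_cast; ring
          simpa using h3
        have h4 : ((ch q (i+1)).1 - 1, (ch q (i+1)).2 - 1) = ch q i := by
          simp [ch]
        simp only [h4, mul_assoc, this, hF, Finsupp.smul_single, smul_eq_mul]
        simp only [Nat.add_eq_zero_iff, one_ne_zero, and_false, if_false, Nat.add_sub_cancel]
        congr 1
        push_cast; ring
  have h2 : ∀ N : ℕ, ∑ i ∈ Finset.range (N + 1), (F i - (if i = 0 then 0 else F (i - 1))) = F N := by
    intro N
    induction N with
    | zero => simp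
    | succ N ih => rw [Finset.sum_range_succ, ih]; simp
  rw [← sub_eq_zero]
  unfold ep
  rw [map_sum, Finset.smul_sum, ← Finset.sum_sub_distrib, Finset.sum_congr rfl (fun i _ => h1 i),
    h2, hF]
  simp [co_gt]

def Bm (n : ℕ) : Poly →ₗ[ℂ] Poly := Finsupp.linearCombination ℂ (ep n)

lemma Bm_single (n : ℕ) (q : ℕ × ℕ) (a : ℂ) : Bm n (Finsupp.single q a) = a • ep n q := by
  simp [Bm, Finsupp.linearCombination_single]

lemma mi_ch (q : ℕ × ℕ) (i : ℕ) : mi (ch q i) = i := by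
  have : ∀ a b : ℕ, min a b = mi (a, b) := fun _ _ => rfl
  rcases md_or q with ⟨h1, h2⟩ | ⟨h1, h2⟩ <;> simp only [ch, h1, h2] <;> simp [mi]

lemma Bm_surj (n : ℕ) (hn : 1 ≤ n) : Function.Surjective (Bm n) := by
  rw [← LinearMap.range_eq_top, eq_top_iff]
  have key : ∀ N : ℕ, ∀ q : ℕ × ℕ, mi q = N → Finsupp.single q (1 : ℂ) ∈ LinearMap.range (Bm n) := by
    intro N
    induction N using Nat.strong_induction_on with
    | _ N ih =>
      intro q hq
      have h0 : ep n q ∈ LinearMap.range (Bm n) := ⟨Finsupp.single q 1, by simp [Bm_single]⟩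
      unfold ep at h0
      rw [Finset.sum_range_succ, ch_mi] at h0
      have h1 : ∑ i ∈ Finset.range (mi q), Finsupp.single (ch q i) ((co n (md q) (mi q) i : ℝ) : ℂ)
          ∈ LinearMap.range (Bm n) := by
        apply Submodule.sum_mem
        intro i hi
        have h2 := ih i (by rw [← hq]; simpa using hi) (ch q i) (mi_ch q i)
        have h3 := Submodule.smul_mem _ ((co n (md q) (mi q) i : ℝ) : ℂ) h2
        simpa using h3
      have h4 := (Submodule.add_mem_iff_right _ h1).1 h0
      have hne : ((co n (md q) (mi q) (mi q) : ℝ) : ℂ) ≠ 0 := by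
        exact_mod_cast co_ne n _ _ _ hn le_rfl
      have h5 := Submodule.smul_mem _ (((co n (md q) (mi q) (mi q) : ℝ) : ℂ)⁻¹) h4
      simpa [hne] using h5
  intro d _
  rw [← Finsupp.sum_single d]
  apply Submodule.sum_mem
  intro q _
  have h3 := Submodule.smul_mem _ (d q) (key _ q rfl)
  simpa using h3

/-- multiplier on coordinates -/
def mult (χ : ℕ × ℕ → ℝ) : Poly →ₗ[ℂ] Poly := Finsupp.linearCombination ℂ
  (fun q => Finsupp.single q ((χ q : ℝ) : ℂ))

lemma mult_apply (χ : ℕ × ℕ → ℝ) (γ : Poly) (q : ℕ × ℕ) : mult χ γ q = χ q * γ q := by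
  unfold mult
  induction γ using Finsupp.induction_linear with
  | zero => simp
  | add f g hf hg => rw [map_add, Finsupp.add_apply, hf, hg, Finsupp.add_apply]; ring
  | single a b =>
    simp only [Finsupp.linearCombination_single, Finsupp.smul_single, smul_eq_mul,
      Finsupp.single_apply]
    split_ifs with h
    · rw [h]; ring
    · ring

lemma Lp_Bm (n : ℕ) (γ : Poly) : Lp n (Bm n γ) = Bm n (mult (lam n) γ) := by
  have : Lp n ∘ₗ Bm n = Bm n ∘ₗ mult (lam n) := by
    ext q : 1
    ext1
    simp [Bm_single, Lp_ep, mult, Finsupp.linearCombination_single]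
  exact LinearMap.congr_fun this γ

lemma lam_pos (n : ℕ) (hn : 1 ≤ n) (q : ℕ × ℕ) : ((q.1 : ℝ) + 1) * (q.2 + 1) ≤ lam n q := by
  have hn' : (1 : ℝ) ≤ n := by exact_mod_cast hn
  have h1 : (0:ℝ) ≤ q.1 := by positivity
  have h2 : (0:ℝ) ≤ q.2 := by positivity
  unfold lam
  apply mul_le_mul <;> nlinarith

def lam1 (n : ℕ) : ℝ := n * (n + 2)

lemma lam_gap (n : ℕ) (hn : 1 ≤ n) (q : ℕ × ℕ) (h1 : q ≠ (1, 0)) (h2 : q ≠ (0, 1)) :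
    1 ≤ |lam n q - lam1 n| := by
  have hne : (((2 * q.1 + n) * (2 * q.2 + n) : ℕ) : ℤ) - (n * (n + 2) : ℕ) ≠ 0 := by
    rcases q with ⟨a, b⟩
    intro h
    have h' : (2 * a + n) * (2 * b + n) = n * (n + 2) := by
      have : (((2 * a + n) * (2 * b + n) : ℕ) : ℤ) = (n * (n + 2) : ℕ) := by
        simpa [sub_eq_zero] using h
      exact_mod_cast this
    have hab : a + b = 1 := by
      rcases Nat.lt_or_ge (a + b) 1 with h3 | h3
      · have ha : a = 0 := by omega
        have hb : b = 0 := by omega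
        subst ha hb; nlinarith
      · rcases Nat.lt_or_ge 1 (a + b) with h4 | h4
        · exfalso; nlinarith [Nat.zero_le (a * b), Nat.mul_le_mul_left n h4]
        · omega
    rcases Nat.eq_zero_or_pos a with ha | ha
    · exact h2 (by ext <;> simp <;> omega)
    · exact h1 (by ext <;> simp <;> omega)
  have := Int.one_le_abs hne
  have h3 : ((1 : ℤ) : ℝ) ≤ ((|(((2 * q.1 + n) * (2 * q.2 + n) : ℕ) : ℤ) - (n * (n + 2) : ℕ)| : ℤ) : ℝ) := by
    exact_mod_cast this
  rw [Int.cast_abs] at h3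
  push_cast at h3
  simpa [lam, lam1] using h3

end Heis

namespace Heis
open Complex (I)

def D2 (f : ℂ → ℂ) (w v : ℂ) : ℂ := fderiv ℝ (fun u => fderiv ℝ f u v) w v

def Lop (n : ℕ) (f : ℂ → ℂ) (w : ℂ) : ℂ :=
  -(((1 - ‖w‖ ^ 2 : ℝ) : ℂ)) * (D2 f w 1 + D2 f w I) + 2 * n * fderiv ℝ f w w + n ^ 2 * f w

def Reg (f : ℂ → ℂ) : Prop := ∀ w : ℂ, ‖w‖ ≤ 1 → ContDiffAt ℝ 2 f w

lemma Reg.da {f : ℂ → ℂ} (hf : Reg f) {w : ℂ} (hw : ‖w‖ ≤ 1) : DifferentiableAt ℝ f w :=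
  (hf w hw).differentiableAt (by norm_num)

lemma Reg.ev_da {f : ℂ → ℂ} (hf : Reg f) {w : ℂ} (hw : ‖w‖ ≤ 1) :
    ∀ᶠ u in 𝓝 w, DifferentiableAt ℝ f u := by
  filter_upwards [(hf w hw).eventually (by simp)] with u hu
  exact hu.differentiableAt (by norm_num)

lemma Reg.da2 {f : ℂ → ℂ} (hf : Reg f) {w : ℂ} (hw : ‖w‖ ≤ 1) (v : ℂ) :
    DifferentiableAt ℝ (fun u => fderiv ℝ f u v) w := by
  have h : ContDiffAt ℝ 1 (fderiv ℝ f) w := (hf w hw).fderiv_right (by norm_num)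
  exact (h.differentiableAt (by norm_num)).clm_apply (differentiableAt_const _)

lemma Reg.add {f g : ℂ → ℂ} (hf : Reg f) (hg : Reg g) : Reg (f + g) :=
  fun w hw => (hf w hw).add (hg w hw)

lemma Reg.smul {f : ℂ → ℂ} (hf : Reg f) (a : ℂ) : Reg (a • f) :=
  fun w hw => contDiffAt_const.smul (hf w hw)

lemma Reg.sub {f g : ℂ → ℂ} (hf : Reg f) (hg : Reg g) : Reg (f - g) :=
  fun w hw => (hf w hw).sub (hg w hw)

lemma Lop_add (n : ℕ) {f g : ℂ → ℂ} (hf : Reg f) (hg : Reg g) {w : ℂ} (hw : ‖w‖ ≤ 1) :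
    Lop n (f + g) w = Lop n f w + Lop n g w := by
  have h1 : fderiv ℝ (f + g) w = fderiv ℝ f w + fderiv ℝ g w := fderiv_add (hf.da hw) (hg.da hw)
  have h2 : ∀ v, D2 (f + g) w v = D2 f w v + D2 g w v := by
    intro v
    unfold D2
    have : (fun u => fderiv ℝ (f + g) u v) =ᶠ[𝓝 w]
        (fun u => fderiv ℝ f u v) + (fun u => fderiv ℝ g u v) := by
      filter_upwards [hf.ev_da hw, hg.ev_da hw] with u h1 h2
      simp [fderiv_add h1 h2]
    rw [this.fderiv_eq, fderiv_add (hf.da2 hw v) (hg.da2 hw v)]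
    rfl
  unfold Lop
  rw [h2, h2, h1]
  simp only [_root_.add_apply, Pi.add_apply]
  ring

lemma Lop_smul (n : ℕ) {f : ℂ → ℂ} (hf : Reg f) (a : ℂ) {w : ℂ} (hw : ‖w‖ ≤ 1) :
    Lop n (a • f) w = a * Lop n f w := by
  have h1 : fderiv ℝ (a • f) w = a • fderiv ℝ f w := fderiv_const_smul (hf.da hw) a
  have h2 : ∀ v, D2 (a • f) w v = a * D2 f w v := by
    intro v
    unfold D2
    have : (fun u => fderiv ℝ (a • f) u v) =ᶠ[𝓝 w] a • (fun u => fderiv ℝ f u v) := by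
      filter_upwards [hf.ev_da hw] with u h1
      simp [fderiv_const_smul h1]
    rw [this.fderiv_eq, fderiv_const_smul (hf.da2 hw v)]
    simp
  unfold Lop
  rw [h2, h2, h1]
  simp only [_root_.smul_apply, Pi.smul_apply, smul_eq_mul]
  ring

lemma Lop_sub (n : ℕ) {f g : ℂ → ℂ} (hf : Reg f) (hg : Reg g) {w : ℂ} (hw : ‖w‖ ≤ 1) :
    Lop n (f - g) w = Lop n f w - Lop n g w := by
  have : f - g = f + (-1 : ℂ) • g := by ext; simp [sub_eq_add_neg]
  rw [this, Lop_add n hf (hg.smul _) hw, Lop_smul n hg _ hw]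
  ring

/-- one-variable second derivative test -/
lemma second_deriv_nonpos (g : ℝ → ℝ) (b : ℝ) (hmax : IsLocalMax g 0)
    (hg : ContinuousAt g 0) (h2 : HasDerivAt (deriv g) b 0) : b ≤ 0 := by
  by_contra hb
  push Not at hb
  have h0 : deriv g 0 = 0 := hmax.deriv_eq_zero
  have hmin := isLocalMin_of_deriv_deriv_pos (f := g) (x₀ := 0) (by rw [h2.deriv]; exact hb) h0 hg
  have hc : g =ᶠ[𝓝 0] fun _ => g 0 := by
    filter_upwards [hmax, hmin] with x h1 h2 using le_antisymm h1 h2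
  have hd : deriv g =ᶠ[𝓝 0] fun _ => 0 := by
    have := hc.deriv
    filter_upwards [this] with x hx
    rw [hx]; simp
  have := hd.deriv_eq
  rw [h2.deriv] at this
  simp at this
  linarith

lemma line_hasDerivAt {f : ℂ → ℂ} {w v : ℂ} {s : ℝ} (h : DifferentiableAt ℝ f (w + s * v)) :
    HasDerivAt (fun s : ℝ => (f (w + s * v)).re) ((fderiv ℝ f (w + s * v) v).re) s := by
  have h1 : HasDerivAt (fun s : ℝ => w + s * v) v s := by
    have h2 : HasDerivAt (fun s : ℝ => (s : ℂ)) 1 s := Complex.ofRealCLM.hasDerivAt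
    simpa using (h2.mul_const v).const_add w
  have h3 := h.hasFDerivAt.comp_hasDerivAt s h1
  exact Complex.reCLM.hasFDerivAt.comp_hasDerivAt s h3

lemma MP (n : ℕ) {f : ℂ → ℂ} (hf : Reg f) (M : ℝ)
    (hM : ∀ w : ℂ, ‖w‖ ≤ 1 → (Lop n f w).re ≤ M) (w : ℂ) (hw : ‖w‖ ≤ 1) :
    (n : ℝ) ^ 2 * (f w).re ≤ M := by
  have hcont : ContinuousOn (fun w => (f w).re) (Metric.closedBall (0:ℂ) 1) := by
    intro w hw
    exact (Complex.continuous_re.continuousAt.comp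
      (hf w (by simpa using hw)).continuousAt).continuousWithinAt
  obtain ⟨w0, hw0, hmax⟩ := (isCompact_closedBall (0:ℂ) 1).exists_isMaxOn
    ⟨0, by simp⟩ hcont
  have hw0' : ‖w0‖ ≤ 1 := by simpa using hw0
  have hle : (f w).re ≤ (f w0).re := hmax (by simpa using hw)
  suffices h : (n : ℝ) ^ 2 * (f w0).re ≤ (Lop n f w0).re by
    have : (n : ℝ) ^ 2 * (f w).re ≤ (n : ℝ) ^ 2 * (f w0).re := by gcongr
    linarith [hM w0 hw0']
  have hre : (Lop n f w0).re = -(1 - ‖w0‖ ^ 2) * ((D2 f w0 1).re + (D2 f w0 I).re) +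
      2 * n * (fderiv ℝ f w0 w0).re + n ^ 2 * (f w0).re := by
    unfold Lop
    have : (n : ℂ) ^ 2 = (((n : ℝ) ^ 2 : ℝ) : ℂ) := by push_cast; rfl
    have h2 : (2 * n : ℂ) = ((2 * n : ℝ) : ℂ) := by push_cast; rfl
    rw [this, h2, ← Complex.ofReal_neg]
    simp only [Complex.add_re, Complex.re_ofReal_mul]
  rw [hre]
  rcases hw0'.lt_or_eq with hlt | heq
  · have hloc : IsLocalMax (fun w => (f w).re) w0 := by
      have : Metric.closedBall (0:ℂ) 1 ∈ 𝓝 w0 := by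
        apply Filter.mem_of_superset ((Metric.isOpen_ball (x := (0:ℂ)) (ε := 1)).mem_nhds (x := w0) (by simpa using hlt))
        exact Metric.ball_subset_closedBall
      exact hmax.isLocalMax this
    have hline : ∀ v : ℂ, IsLocalMax (fun s : ℝ => (f (w0 + s * v)).re) 0 := by
      intro v
      have hc : ContinuousAt (fun s : ℝ => w0 + s * v) 0 := by fun_prop
      have h0 : w0 + ((0:ℝ):ℂ) * v = w0 := by simp
      have : Tendsto (fun s : ℝ => w0 + s * v) (𝓝 0) (𝓝 w0) := by
        have := hc.tendsto; rwa [h0] at this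
      have h5 := this.eventually hloc
      unfold IsLocalMax IsMaxFilter
      filter_upwards [h5] with s hs
      simpa using hs
    have hD : ∀ v : ℂ, (fderiv ℝ f w0 v).re = 0 := by
      intro v
      have h1 := line_hasDerivAt (f := f) (w := w0) (v := v) (s := 0) (by simpa using hf.da hw0')
      have := (hline v).hasDerivAt_eq_zero h1
      simpa using this
    have hD2 : ∀ v : ℂ, (D2 f w0 v).re ≤ 0 := by
      intro v
      apply second_deriv_nonpos _ _ (hline v)
      · exact (line_hasDerivAt (by simpa using hf.da hw0')).continuousAt
      · have hc : ContinuousAt (fun s : ℝ => w0 + s * v) 0 := by fun_prop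
        have h0 : w0 + ((0:ℝ):ℂ) * v = w0 := by simp
        have : Tendsto (fun s : ℝ => w0 + s * v) (𝓝 0) (𝓝 w0) := by
          have := hc.tendsto; rwa [h0] at this
        have h5 := this.eventually (hf.ev_da hw0')
        have h6 : deriv (fun s : ℝ => (f (w0 + s * v)).re) =ᶠ[𝓝 0]
            fun s : ℝ => (fderiv ℝ f (w0 + s * v) v).re := by
          filter_upwards [h5] with s hs
          exact (line_hasDerivAt hs).deriv
        refine HasDerivAt.congr_of_eventuallyEq ?_ h6
        have := line_hasDerivAt (f := fun u => fderiv ℝ f u v) (w := w0) (v := v) (s := 0)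
          (by simpa using hf.da2 hw0' v)
        simpa [D2] using this
    have h1 : ‖w0‖ ^ 2 ≤ 1 := by nlinarith [norm_nonneg w0]
    rw [hD w0]
    nlinarith [hD2 1, hD2 I]
  · have h1 := line_hasDerivAt (f := f) (w := 0) (v := w0) (s := 1) (by simpa using hf.da hw0')
    have h2 : 0 ≤ (fderiv ℝ f w0 w0).re := by
      simp only [zero_add, Complex.ofReal_one, one_mul] at h1
      by_contra hneg
      push Not at hneg
      have h3 : ∀ᶠ s : ℝ in 𝓝[<] 1, slope (fun s : ℝ => (f (s * w0)).re) 1 s < 0 :=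
        ((hasDerivAt_iff_tendsto_slope.1 h1).mono_left
          (nhdsWithin_mono _ (fun x hx => ne_of_lt hx))).eventually_lt_const hneg
      have h4 : ∀ᶠ s : ℝ in 𝓝[<] 1, 0 < s ∧ s < 1 := by
        have : Set.Ioo (0:ℝ) 1 ∈ 𝓝[<] (1:ℝ) := Ioo_mem_nhdsLT (by norm_num)
        exact this
      obtain ⟨s, hs, hs0, hs1⟩ := (h3.and h4).exists
      have h5 : (f (s * w0)).re ≤ (f w0).re := hmax (by
        simp [heq, abs_of_pos hs0, hs1.le])
      rw [slope_def_field, div_neg_iff] at hs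
      simp only [Complex.ofReal_one, one_mul] at hs
      rcases hs with h | h <;> linarith [h.1, h.2]
    rw [heq]
    have : (0:ℝ) ≤ n := by positivity
    nlinarith [mul_nonneg this h2]

lemma MP_norm (n : ℕ) {f : ℂ → ℂ} (hf : Reg f) (M : ℝ)
    (hM : ∀ w : ℂ, ‖w‖ ≤ 1 → ‖Lop n f w‖ ≤ M) (w : ℂ) (hw : ‖w‖ ≤ 1) :
    (n : ℝ) ^ 2 * ‖f w‖ ≤ M := by
  by_cases h0 : f w = 0
  · simp only [h0, norm_zero, mul_zero]
    exact (norm_nonneg _).trans (hM w hw)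
  set a : ℂ := starRingEnd ℂ (f w) / ‖f w‖ with ha
  have hn0 : (‖f w‖ : ℂ) ≠ 0 := by simpa using h0
  have hna : ‖a‖ = 1 := by simp [ha, h0]
  have h1 := MP n (hf.smul a) M (fun u hu => by
    rw [Lop_smul n hf a hu]
    refine (Complex.re_le_norm _).trans ?_
    rw [norm_mul, hna, one_mul]; exact hM u hu) w hw
  have h2 : ((a • f) w).re = ‖f w‖ := by
    have : (a • f) w = (‖f w‖ : ℂ) := by
      simp only [ha, Pi.smul_apply, smul_eq_mul, div_mul_eq_mul_div]
      rw [div_eq_iff hn0, mul_comm, Complex.mul_conj, Complex.normSq_eq_norm_sq]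
      push_cast; ring
    rw [this]; simp
  rwa [h2] at h1

/-- two-sided real version -/
lemma MP_re (n : ℕ) {f : ℂ → ℂ} (hf : Reg f) (M : ℝ)
    (hM : ∀ w : ℂ, ‖w‖ ≤ 1 → |(Lop n f w).re| ≤ M) (w : ℂ) (hw : ‖w‖ ≤ 1) :
    (n : ℝ) ^ 2 * |(f w).re| ≤ M := by
  have h1 := MP n hf M (fun u hu => (le_abs_self _).trans (hM u hu)) w hw
  have h2 := MP n (hf.smul (-1)) M (fun u hu => by
    rw [Lop_smul n hf _ hu]
    have := (neg_le_abs (Lop n f u).re).trans (hM u hu)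
    simpa using this) w hw
  simp at h2
  rcases abs_cases (f w).re with ⟨h, _⟩ | ⟨h, _⟩ <;> rw [h] <;> linarith

lemma hol_pair_fderiv {F G : ℂ → ℂ} {u : ℂ} (hF : DifferentiableAt ℂ F u)
    (hG : DifferentiableAt ℂ G u) (v : ℂ) :
    fderiv ℝ (fun u => F u * starRingEnd ℂ (G u)) u v =
      F u * starRingEnd ℂ (deriv G u * v) + deriv F u * v * starRingEnd ℂ (G u) := by
  have h1 : HasFDerivAt F (deriv F u • (1 : ℂ →L[ℝ] ℂ)) u := hF.hasDerivAt.complexToReal_fderiv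
  have h2 : HasFDerivAt G (deriv G u • (1 : ℂ →L[ℝ] ℂ)) u := hG.hasDerivAt.complexToReal_fderiv
  have h3 : HasFDerivAt (fun u => starRingEnd ℂ (G u))
      ((Complex.conjCLE : ℂ →L[ℝ] ℂ).comp (deriv G u • (1 : ℂ →L[ℝ] ℂ))) u :=
    (Complex.conjCLE : ℂ →L[ℝ] ℂ).hasFDerivAt.comp u h2
  have h4 : HasFDerivAt (fun u => F u * starRingEnd ℂ (G u)) _ u := h1.mul h3
  rw [h4.fderiv]
  simp
  ring

lemma Reg_hol {F G : ℂ → ℂ} (hF : ∀ w : ℂ, ‖w‖ ≤ 1 → AnalyticAt ℂ F w)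
    (hG : ∀ w : ℂ, ‖w‖ ≤ 1 → AnalyticAt ℂ G w) : Reg (fun u => F u * starRingEnd ℂ (G u)) := by
  intro w hw
  have h1 : ContDiffAt ℝ 2 F w := ((hF w hw).contDiffAt (n := 2)).restrict_scalars ℝ
  have h2 : ContDiffAt ℝ 2 G w := ((hG w hw).contDiffAt (n := 2)).restrict_scalars ℝ
  exact h1.mul ((Complex.conjCLE : ℂ →L[ℝ] ℂ).contDiff.contDiffAt.comp w h2)

lemma Lop_hol (n : ℕ) {F G : ℂ → ℂ} {w : ℂ} (hF : AnalyticAt ℂ F w) (hG : AnalyticAt ℂ G w) :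
    Lop n (fun u => F u * starRingEnd ℂ (G u)) w =
      4 * ((w * deriv F w + n / 2 * F w) * starRingEnd ℂ (w * deriv G w + n / 2 * G w)
        - deriv F w * starRingEnd ℂ (deriv G w)) := by
  have h2 : ∀ v : ℂ, D2 (fun u => F u * starRingEnd ℂ (G u)) w v =
      F w * starRingEnd ℂ (deriv (deriv G) w * v * v) + 2 * (deriv F w * v * starRingEnd ℂ (deriv G w * v))
      + deriv (deriv F) w * v * v * starRingEnd ℂ (G w) := by
    intro v
    unfold D2
    have hA : ∀ᶠ u in 𝓝 w, AnalyticAt ℂ F u ∧ AnalyticAt ℂ G u :=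
      hF.eventually_analyticAt.and hG.eventually_analyticAt
    have he : (fun u => fderiv ℝ (fun u => F u * starRingEnd ℂ (G u)) u v) =ᶠ[𝓝 w]
        (fun u => F u * starRingEnd ℂ (deriv G u * v)) +
        (fun u => (deriv F u * v) * starRingEnd ℂ (G u)) := by
      filter_upwards [hA] with u hu
      rw [hol_pair_fderiv hu.1.differentiableAt hu.2.differentiableAt]
      rfl
    have dF := hF.differentiableAt
    have dG := hG.differentiableAt
    have dF' := hF.deriv.differentiableAt.mul_const v
    have dG' := hG.deriv.differentiableAt.mul_const v
    have e1 : deriv (fun u => deriv G u * v) w = deriv (deriv G) w * v :=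
      deriv_mul_const hG.deriv.differentiableAt v
    have e2 : deriv (fun u => deriv F u * v) w = deriv (deriv F) w * v :=
      deriv_mul_const hF.deriv.differentiableAt v
    have d1 : DifferentiableAt ℝ (fun u => F u * starRingEnd ℂ (deriv G u * v)) w :=
      (dF.restrictScalars ℝ).mul ((Complex.conjCLE : ℂ →L[ℝ] ℂ).differentiableAt.comp w
        (dG'.restrictScalars ℝ))
    have d2 : DifferentiableAt ℝ (fun u => (deriv F u * v) * starRingEnd ℂ (G u)) w :=
      (dF'.restrictScalars ℝ).mul ((Complex.conjCLE : ℂ →L[ℝ] ℂ).differentiableAt.comp w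
        (dG.restrictScalars ℝ))
    rw [he.fderiv_eq, fderiv_add d1 d2, _root_.add_apply,
      hol_pair_fderiv dF dG', hol_pair_fderiv dF' dG, e1, e2]
    ring
  unfold Lop
  rw [h2, h2, hol_pair_fderiv hF.differentiableAt hG.differentiableAt]
  have hnw : (((1 - ‖w‖ ^ 2 : ℝ)) : ℂ) = 1 - w * starRingEnd ℂ w := by
    rw [Complex.mul_conj, Complex.normSq_eq_norm_sq]; push_cast; rfl
  rw [hnw]
  simp only [map_mul, map_add, map_one, Complex.conj_I, map_div₀, Complex.conj_natCast, map_ofNat]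
  linear_combination (-(1 - w * starRingEnd ℂ w) * (F w * starRingEnd ℂ (deriv (deriv G) w)
    + deriv (deriv F) w * starRingEnd ℂ (G w) - 2 * deriv F w * starRingEnd ℂ (deriv G w))) * Complex.I_sq

lemma Lop_mon (n : ℕ) (q : ℕ × ℕ) (w : ℂ) :
    Lop n (mon q) w = ev (Lp n (Finsupp.single q 1)) w := by
  have hp : ∀ (m : ℕ), AnalyticAt ℂ (fun u : ℂ => u ^ m) w := fun m => by fun_prop
  have : mon q = fun u => u ^ q.1 * starRingEnd ℂ (u ^ q.2) := by ext u; simp [mon]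
  rw [this, Lop_hol n (hp _) (hp _), Lp_single, one_smul, map_sub, Pi.sub_apply, ev_single, ev_single]
  simp only [mon, lam, deriv_pow_field, map_mul, map_add, map_pow, Complex.conj_natCast, map_div₀,
    map_ofNat]
  rcases q with ⟨_ | j, _ | k⟩ <;> simp <;> ring

lemma Reg_mon (q : ℕ × ℕ) : Reg (mon q) := by
  have : mon q = fun u => u ^ q.1 * starRingEnd ℂ (u ^ q.2) := by ext u; simp [mon]
  rw [this]
  exact Reg_hol (fun w _ => by fun_prop) (fun w _ => by fun_prop)

lemma Reg_Lop_ev (n : ℕ) (c : Poly) : Reg (ev c) ∧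
    ∀ w : ℂ, ‖w‖ ≤ 1 → Lop n (ev c) w = ev (Lp n c) w := by
  induction c using Finsupp.induction_linear with
  | zero =>
    have h0 : ev (0 : Poly) = fun _ => 0 := by simp; rfl
    refine ⟨by rw [h0]; exact fun w _ => contDiffAt_const, fun w _ => ?_⟩
    rw [map_zero (Lp n), h0]; simp [Lop, D2]
  | add f g hf hg =>
    rw [map_add]
    exact ⟨hf.1.add hg.1, fun w hw => by
      rw [Lop_add n hf.1 hg.1 hw, hf.2 w hw, hg.2 w hw, map_add, map_add]; rfl⟩
  | single q a =>
    have h : ev (Finsupp.single q a) = a • mon q := by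
      ext w; rw [ev_single]; rfl
    have h1 : Finsupp.single q a = a • Finsupp.single q (1:ℂ) := by simp
    refine ⟨by rw [h]; exact (Reg_mon q).smul a, fun w hw => ?_⟩
    rw [h, Lop_smul n (Reg_mon q) a hw, Lop_mon, h1, map_smul, map_smul]; rfl

lemma ev_cont (c : Poly) : Continuous (ev c) := by
  induction c using Finsupp.induction_linear with
  | zero => rw [map_zero]; exact continuous_zero
  | add f g hf hg => rw [map_add]; exact hf.add hg
  | single q a =>
    have h : ev (Finsupp.single q a) = fun w => a * mon q w := by
      ext w; rw [ev_single]
    rw [h]; unfold mon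
    fun_prop

end Heis

namespace Heis
open Complex (I)

abbrev Dk : Set ℂ := Metric.closedBall (0:ℂ) 1

lemma Dk_le (w : Dk) : ‖(w:ℂ)‖ ≤ 1 := mem_closedBall_zero_iff.1 w.2

instance : Nonempty Dk := ⟨⟨0, by simp⟩⟩

instance : CompactSpace Dk := isCompact_iff_compactSpace.1 (isCompact_closedBall (0:ℂ) 1)

def nu (n : ℕ) : Measure Dk := ((volume : Measure ℂ).comap Subtype.val).withDensity
  (fun w => ENNReal.ofReal ((1 - ‖(w:ℂ)‖ ^ 2) ^ (n - 1)))

lemma dens_nonneg (n : ℕ) {w : ℂ} (hw : ‖w‖ ≤ 1) : 0 ≤ (1 - ‖w‖ ^ 2) ^ (n - 1) := by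
  apply pow_nonneg; nlinarith [norm_nonneg w]

lemma dens_meas (n : ℕ) : Measurable (fun w : Dk => ENNReal.ofReal ((1 - ‖(w:ℂ)‖ ^ 2) ^ (n - 1))) := by
  apply Measurable.ennreal_ofReal
  apply Continuous.measurable
  fun_prop

lemma integral_nu {F : Type*} [NormedAddCommGroup F] [NormedSpace ℝ F] (n : ℕ) (g : ℂ → F) :
    ∫ w : Dk, g w ∂nu n = ∫ w in Dk, ((1 - ‖w‖ ^ 2) ^ (n - 1)) • g w := by
  unfold nu
  rw [integral_withDensity_eq_integral_toReal_smul (dens_meas n) (by simp)]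
  rw [← integral_subtype_comap Metric.isClosed_closedBall.measurableSet]
  apply integral_congr_ae
  filter_upwards with w
  rw [ENNReal.toReal_ofReal (dens_nonneg n (Dk_le w))]

instance (n : ℕ) : IsFiniteMeasure (nu n) := by
  refine ⟨?_⟩
  unfold nu
  rw [withDensity_apply _ MeasurableSet.univ]
  calc _ ≤ ∫⁻ w in Set.univ, 1 ∂((volume : Measure ℂ).comap (Subtype.val : Dk → ℂ)) := by
        apply lintegral_mono
        intro w
        simp only
        rw [ENNReal.ofReal_le_one]
        apply pow_le_one₀
        · nlinarith [norm_nonneg (w:ℂ), Dk_le w]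
        · nlinarith [norm_nonneg (w:ℂ)]
    _ < ⊤ := by
        simp only [lintegral_one, Measure.restrict_univ]
        rw [comap_subtype_coe_apply Metric.isClosed_closedBall.measurableSet]
        refine lt_of_le_of_lt (measure_mono (t := Dk) (by rintro _ ⟨w, -, rfl⟩; exact w.2)) ?_
        exact (isCompact_closedBall (0:ℂ) 1).measure_lt_top

instance (n : ℕ) : (nu n).IsOpenPosMeasure := by
  refine ⟨fun U hU hne => ?_⟩
  obtain ⟨V, hV, rfl⟩ := isOpen_induced_iff.1 hU
  obtain ⟨w, hw⟩ := hne
  have h1 : (V ∩ Metric.ball (0:ℂ) 1).Nonempty := by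
    have : (w : ℂ) ∈ closure (Metric.ball (0:ℂ) 1) := by
      rw [closure_ball _ (by norm_num)]; exact w.2
    exact mem_closure_iff.1 this V hV hw
  have h2 : 0 < volume (V ∩ Metric.ball (0:ℂ) 1) :=
    (hV.inter Metric.isOpen_ball).measure_pos _ h1
  have hms : MeasurableSet (V ∩ Metric.ball (0:ℂ) 1) := (hV.inter Metric.isOpen_ball).measurableSet
  intro h0
  have h3 : nu n (Subtype.val ⁻¹' (V ∩ Metric.ball (0:ℂ) 1)) = 0 :=
    measure_mono_null (by intro x hx; exact hx.1) h0
  unfold nu at h3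
  rw [withDensity_apply_eq_zero' (dens_meas n).aemeasurable] at h3
  have h4 : {x : Dk | ENNReal.ofReal ((1 - ‖(x:ℂ)‖ ^ 2) ^ (n - 1)) ≠ 0} ∩
      (Subtype.val ⁻¹' (V ∩ Metric.ball (0:ℂ) 1)) = Subtype.val ⁻¹' (V ∩ Metric.ball (0:ℂ) 1) := by
    apply Set.inter_eq_right.2
    intro x hx
    have : ‖(x:ℂ)‖ < 1 := by simpa using hx.2
    simp only [Set.mem_ofPred_eq, ne_eq, ENNReal.ofReal_eq_zero, not_le]
    apply pow_pos; nlinarith [norm_nonneg (x:ℂ)]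
  rw [h4, comap_subtype_coe_apply Metric.isClosed_closedBall.measurableSet,
    Subtype.image_preimage_coe, Set.inter_eq_right.2
    (Set.inter_subset_right.trans Metric.ball_subset_closedBall)] at h3
  exact h2.ne' h3

lemma nu_integrable {F : Type*} [NormedAddCommGroup F] (n : ℕ)
    {g : Dk → F} (hg : Continuous g) : Integrable g (nu n) := by
  exact hg.integrable_of_hasCompactSupport (HasCompactSupport.of_compactSpace _)

lemma nu_rot (n : ℕ) (g : ℂ → ℂ) (a : Circle) :
    ∫ w : Dk, g (a * w) ∂nu n = ∫ w : Dk, g w ∂nu n := by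
  rw [integral_nu n (fun w => g (a * w)), integral_nu n g]
  have h := (LinearIsometryEquiv.measurePreserving (rotation a))
  have h2 := h.setIntegral_preimage_emb (rotation a).toHomeomorph.measurableEmbedding
    (fun w => ((1 - ‖w‖ ^ 2) ^ (n - 1)) • g w) Dk
  rw [← h2]
  have h3 : (rotation a) ⁻¹' Dk = Dk := by
    ext w
    simp only [Set.mem_preimage, mem_closedBall_zero_iff, LinearIsometryEquiv.norm_map]
  rw [h3]
  simp only [rotation_apply, norm_mul, Circle.norm_coe, one_mul]

lemma nu_radial (n : ℕ) (h : ℝ → ℝ) (hc : Continuous h) :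
    ∫ w : Dk, h (‖(w:ℂ)‖ ^ 2) ∂nu n = Real.pi * ∫ x in (0:ℝ)..1, (1 - x) ^ (n - 1) * h x := by
  rw [integral_nu n (fun w => h (‖w‖ ^ 2)), ← integral_indicator Metric.isClosed_closedBall.measurableSet]
  have h1 : (Dk.indicator fun w : ℂ => (1 - ‖w‖ ^ 2) ^ (n - 1) • h (‖w‖ ^ 2)) =
      fun w : ℂ => (fun y : ℝ => (Set.Iic (1:ℝ)).indicator
        (fun y => (1 - y ^ 2) ^ (n - 1) * h (y ^ 2)) y) ‖w‖ := by
    ext w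
    by_cases hw : ‖w‖ ≤ 1 <;> simp [Set.indicator, hw]
  rw [h1, integral_fun_norm_addHaar]
  have h2 : (volume : Measure ℂ).real (Metric.ball 0 1) = Real.pi := by
    simp [Measure.real, Complex.volume_ball]
  rw [h2, Complex.finrank_real_complex]
  have h3 : ∫ y in Set.Ioi (0:ℝ), y ^ (2 - 1) • (Set.Iic (1:ℝ)).indicator
        (fun y => (1 - y ^ 2) ^ (n - 1) * h (y ^ 2)) y =
      ∫ y in (0:ℝ)..1, y * ((1 - y ^ 2) ^ (n - 1) * h (y ^ 2)) := by
    rw [intervalIntegral.integral_of_le (by norm_num), ← Set.Ioi_inter_Iic,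
      ← setIntegral_indicator measurableSet_Iic]
    congr 1
    ext y
    by_cases hy : y ≤ 1 <;> simp [Set.indicator, hy]
  rw [h3]
  have h4 := intervalIntegral.integral_comp_mul_deriv (a := 0) (b := 1)
    (f := fun y : ℝ => y ^ 2) (f' := fun y => 2 * y)
    (g := fun x => (1 - x) ^ (n - 1) * h x) (fun x _ => by simpa using hasDerivAt_pow 2 x)
    (by fun_prop) (by fun_prop)
  simp only [Function.comp_def] at h4
  norm_num at h4
  rw [← h4]
  simp only [smul_eq_mul, nsmul_eq_mul]
  rw [← mul_assoc, mul_comm _ Real.pi, mul_assoc]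
  congr 1
  rw [← intervalIntegral.integral_const_mul]
  congr 1; ext y; push_cast; ring

/-- complex bilinear functional on functions on ℂ -/
def Ec (n : ℕ) (g : ℂ → ℂ) : ℂ := ∫ w : Dk, g w ∂nu n

lemma Ec_add (n : ℕ) {f g : ℂ → ℂ} (hf : Continuous f) (hg : Continuous g) :
    Ec n (f + g) = Ec n f + Ec n g := by
  exact integral_add (nu_integrable n (hf.comp continuous_subtype_val))
    (nu_integrable n (hg.comp continuous_subtype_val))

lemma Ec_smul (n : ℕ) (f : ℂ → ℂ) (a : ℂ) : Ec n (a • f) = a * Ec n f := by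
  exact integral_const_mul a _

lemma mon_add (q r : ℕ × ℕ) (w : ℂ) : mon q w * mon r w = mon (q + r) w := by
  simp [mon, pow_add]; ring

lemma mon_cont (q : ℕ × ℕ) : Continuous (mon q) := by unfold mon; fun_prop

lemma mom_off (n : ℕ) (q : ℕ × ℕ) (h : q.1 ≠ q.2) : Ec n (mon q) = 0 := by
  set θ : ℝ := Real.pi / ((q.1 : ℝ) - q.2) with hθ
  have hne : ((q.1 : ℝ) - q.2) ≠ 0 := by
    rw [sub_ne_zero]; exact_mod_cast h
  have h1 := nu_rot n (mon q) (Circle.exp θ)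
  have h2 : ∀ w : ℂ, mon q ((Circle.exp θ : ℂ) * w) = - mon q w := by
    intro w
    have : (Circle.exp θ : ℂ) ^ q.1 * (starRingEnd ℂ (Circle.exp θ : ℂ)) ^ q.2 = -1 := by
      rw [Circle.coe_exp, ← Complex.exp_conj, ← Complex.exp_nat_mul, ← Complex.exp_nat_mul,
        ← Complex.exp_add, ← Complex.exp_pi_mul_I]
      congr 1
      simp only [map_mul, Complex.conj_ofReal, Complex.conj_I, hθ]
      have hne' : ((q.1 : ℂ) - q.2) ≠ 0 := by exact_mod_cast hne
      push_cast
      field_simp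
      ring
    simp only [mon, map_mul, mul_pow]
    linear_combination (w ^ q.1 * (starRingEnd ℂ w) ^ q.2) * this
  simp only [h2] at h1
  rw [integral_neg] at h1
  have h3 : - Ec n (mon q) = Ec n (mon q) := h1
  linear_combination (-1/2 : ℂ) * h3

def mo (n j : ℕ) : ℝ := Real.pi * ∫ x in (0:ℝ)..1, (1 - x) ^ (n - 1) * x ^ j

lemma mom_diag (n j : ℕ) : Ec n (mon (j, j)) = mo n j := by
  have h := nu_radial n (fun x => x ^ j) (by fun_prop)
  rw [mo, ← h]
  have h2 := integral_ofReal (μ := nu n) (𝕜 := ℂ) (f := fun w : Dk => (‖(w:ℂ)‖ ^ 2) ^ j)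
  refine Eq.trans ?_ h2
  apply integral_congr_ae
  filter_upwards with w
  simp only [mon, ← mul_pow, Complex.mul_conj, Complex.normSq_eq_norm_sq]
  push_cast; rfl

lemma mo_pos (n j : ℕ) : 0 < mo n j := by
  apply mul_pos Real.pi_pos
  apply intervalIntegral.intervalIntegral_pos_of_pos_on
  · exact (by fun_prop : Continuous fun x : ℝ => (1 - x) ^ (n - 1) * x ^ j).intervalIntegrable _ _
  · intro x hx
    have := hx.1; have := hx.2
    have : 0 < 1 - x := by linarith
    positivity
  · norm_num

lemma mo_rec (n j : ℕ) (hn : 1 ≤ n) : ((j : ℝ) + 1 + n) * mo n (j + 1) = (j + 1) * mo n j := by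
  have h1 : ∀ x : ℝ, HasDerivAt (fun x : ℝ => (1 - x) ^ n * x ^ (j + 1))
      ((1 - x) ^ (n - 1) * ((j + 1) * x ^ j - ((j : ℝ) + 1 + n) * x ^ (j + 1))) x := by
    intro x
    have := (((hasDerivAt_id x).const_sub 1).pow n).mul (hasDerivAt_pow (j + 1) x)
    refine this.congr_deriv ?_
    obtain ⟨m, rfl⟩ : ∃ m, n = m + 1 := ⟨n - 1, by omega⟩
    simp
    ring
  have h2 := intervalIntegral.integral_eq_sub_of_hasDerivAt (a := 0) (b := 1) (fun x _ => h1 x)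
    (by apply Continuous.intervalIntegrable; fun_prop)
  have h3 : (∫ x in (0:ℝ)..1, (1 - x) ^ (n - 1) * ((j + 1) * x ^ j - ((j : ℝ) + 1 + n) * x ^ (j + 1))) =
      (j + 1) * (∫ x in (0:ℝ)..1, (1 - x) ^ (n - 1) * x ^ j) -
      ((j : ℝ) + 1 + n) * (∫ x in (0:ℝ)..1, (1 - x) ^ (n - 1) * x ^ (j + 1)) := by
    rw [← intervalIntegral.integral_const_mul, ← intervalIntegral.integral_const_mul,
      ← intervalIntegral.integral_sub]
    · congr 1; ext x; ring
    · apply Continuous.intervalIntegrable; fun_prop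
    · apply Continuous.intervalIntegrable; fun_prop
  rw [h3] at h2
  have hn0 : n ≠ 0 := by omega
  simp [hn0] at h2
  unfold mo
  linear_combination (-Real.pi) * h2

lemma Ec_sym_mon (n : ℕ) (hn : 1 ≤ n) (q r : ℕ × ℕ) :
    (lam n r : ℂ) * Ec n (mon (q + r)) - 4 * r.1 * r.2 * Ec n (mon (q + (r.1 - 1, r.2 - 1))) =
    (lam n q : ℂ) * Ec n (mon (q + r)) - 4 * q.1 * q.2 * Ec n (mon ((q.1 - 1, q.2 - 1) + r)) := by
  rcases q with ⟨a, b⟩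
  rcases r with ⟨j, k⟩
  have aux : ∀ (x y : ℕ) (z : ℂ), (1 ≤ x → 1 ≤ y → z = 0) → (x : ℂ) * y * z = 0 := by
    intro x y z h
    rcases x with _ | x
    · simp
    · rcases y with _ | y
      · simp
      · simp [h (by omega) (by omega)]
  by_cases hd : a + j = b + k
  · rcases Nat.eq_zero_or_pos (a + j) with h0 | h0
    · have h1 : a = 0 := by omega
      have h2 : b = 0 := by omega
      have h3 : j = 0 := by omega
      have h4 : k = 0 := by omega
      subst h1 h2 h3 h4; simp
    · obtain ⟨N, hN⟩ : ∃ N, a + j = N + 1 := ⟨a + j - 1, by omega⟩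
      have e1 : ((a, b) + (j, k) : ℕ × ℕ) = (N + 1, N + 1) := by ext <;> simp <;> omega
      have e2 : (j : ℂ) * k * (Ec n (mon ((a, b) + (j - 1, k - 1))) - mo n N) = 0 := by
        apply aux
        intro h1 h2
        have : ((a, b) + (j - 1, k - 1) : ℕ × ℕ) = (N, N) := by ext <;> simp <;> omega
        rw [this, mom_diag]; simp
      have e3 : (a : ℂ) * b * (Ec n (mon ((a - 1, b - 1) + (j, k))) - mo n N) = 0 := by
        apply aux
        intro h1 h2
        have : ((a - 1, b - 1) + (j, k) : ℕ × ℕ) = (N, N) := by ext <;> simp <;> omega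
        rw [this, mom_diag]; simp
      rw [e1, mom_diag]
      simp only at *
      have hr : ((N : ℂ) + 1 + n) * mo n (N + 1) = (N + 1) * mo n N := by
        have := mo_rec n N hn
        have h2 : ((((N : ℝ) + 1 + n) * mo n (N + 1) : ℝ) : ℂ) = (((N + 1) * mo n N : ℝ) : ℂ) := by
          rw [this]
        simpa using h2
      have hN1 : ((N : ℂ) + 1) ≠ 0 := by exact_mod_cast Nat.succ_ne_zero N
      have ha : (a : ℂ) = N + 1 - j := by
        have : ((a + j : ℕ) : ℂ) = ((N + 1 : ℕ) : ℂ) := by rw [hN]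
        push_cast at this; linear_combination this
      have hb : (b : ℂ) = N + 1 - k := by
        have : ((b + k : ℕ) : ℂ) = ((N + 1 : ℕ) : ℂ) := by rw [← hd, hN]
        push_cast at this; linear_combination this
      have hm : (mo n N : ℂ) = ((N : ℂ) + 1 + n) / (N + 1) * mo n (N + 1) := by
        field_simp; linear_combination -hr
      have e2' : (j : ℂ) * k * Ec n (mon ((a, b) + (j - 1, k - 1))) = j * k * mo n N := by
        linear_combination e2
      have e3' : (a : ℂ) * b * Ec n (mon ((a - 1, b - 1) + (j, k))) = a * b * mo n N := by
        linear_combination e3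
      have goal : (lam n (j, k) : ℂ) * mo n (N + 1) - 4 * (j * k * mo n N) =
          (lam n (a, b) : ℂ) * mo n (N + 1) - 4 * (a * b * mo n N) := by
        rw [hm]
        simp only [lam]
        push_cast
        rw [ha, hb]
        field_simp
        ring
      linear_combination goal - 4 * e2' + 4 * e3'
  · have e0 : Ec n (mon ((a, b) + (j, k))) = 0 := mom_off n _ (by simpa using hd)
    have e2 : (j : ℂ) * k * (Ec n (mon ((a, b) + (j - 1, k - 1)))) = 0 := by
      apply aux
      intro h1 h2
      apply mom_off; simp; omega
    have e3 : (a : ℂ) * b * (Ec n (mon ((a - 1, b - 1) + (j, k)))) = 0 := by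
      apply aux
      intro h1 h2
      apply mom_off; simp; omega
    rw [e0]
    simp only
    linear_combination -4 * e2 + 4 * e3

lemma Ec_sym (n : ℕ) (hn : 1 ≤ n) (c d : Poly) :
    Ec n (ev c * ev (Lp n d)) = Ec n (ev (Lp n c) * ev d) := by
  induction c using Finsupp.induction_linear with
  | zero => simp
  | add f g hf hg =>
    simp only [map_add, add_mul]
    rw [Ec_add n ((ev_cont _).mul (ev_cont _)) ((ev_cont _).mul (ev_cont _)),
      Ec_add n ((ev_cont _).mul (ev_cont _)) ((ev_cont _).mul (ev_cont _)), hf, hg]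
  | single q a =>
    induction d using Finsupp.induction_linear with
    | zero => simp
    | add f g hf hg =>
      simp only [map_add, mul_add]
      rw [Ec_add n ((ev_cont _).mul (ev_cont _)) ((ev_cont _).mul (ev_cont _)),
        Ec_add n ((ev_cont _).mul (ev_cont _)) ((ev_cont _).mul (ev_cont _)), hf, hg]
    | single r b =>
      have e1 : ev (Finsupp.single q a) * ev (Lp n (Finsupp.single r b)) =
          (a * b * lam n r) • mon (q + r) +
            (-(a * b * (4 * r.1 * r.2))) • mon (q + (r.1 - 1, r.2 - 1)) := by
        ext w
        simp only [Pi.mul_apply, Pi.add_apply, Pi.smul_apply, smul_eq_mul, ← mon_add, Lp_single,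
          map_smul, map_sub, Pi.sub_apply, ev_single]
        ring
      have e2 : ev (Lp n (Finsupp.single q a)) * ev (Finsupp.single r b) =
          (a * b * lam n q) • mon (q + r) +
            (-(a * b * (4 * q.1 * q.2))) • mon ((q.1 - 1, q.2 - 1) + r) := by
        ext w
        simp only [Pi.mul_apply, Pi.add_apply, Pi.smul_apply, smul_eq_mul, ← mon_add, Lp_single,
          map_smul, map_sub, Pi.sub_apply, ev_single]
        ring
      rw [e1, e2, Ec_add n ((mon_cont _).const_smul _) ((mon_cont _).const_smul _),
        Ec_add n ((mon_cont _).const_smul _) ((mon_cont _).const_smul _)]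
      simp only [Ec_smul]
      linear_combination (a * b) * Ec_sym_mon n hn q r

lemma star_ex (n : ℕ) (c : Poly) : ∃ c' : Poly, (∀ w, ev c' w = starRingEnd ℂ (ev c w)) ∧
    ∀ w, ev (Lp n c') w = starRingEnd ℂ (ev (Lp n c) w) := by
  induction c using Finsupp.induction_linear with
  | zero => exact ⟨0, by simp, by simp⟩
  | add f g hf hg =>
    obtain ⟨f', h1, h2⟩ := hf
    obtain ⟨g', h3, h4⟩ := hg
    refine ⟨f' + g', ?_, ?_⟩ <;> intro w <;> simp [h1, h2, h3, h4]
  | single q a =>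
    refine ⟨Finsupp.single q.swap (starRingEnd ℂ a), ?_, ?_⟩ <;> intro w
    · simp only [ev_single, mon, Prod.fst_swap, Prod.snd_swap, map_mul, map_pow, Complex.conj_conj]; ring
    · simp only [Lp_single, map_smul, map_sub, Pi.smul_apply, Pi.sub_apply, ev_single, smul_eq_mul,
        map_mul, mon, lam, Prod.fst_swap, Prod.snd_swap, map_pow, Complex.conj_conj,
        Complex.conj_ofReal, map_natCast, map_ofNat]
      push_cast; ring

end Heis

namespace Heis
open Complex (I)

lemma flux (n : ℕ) (hn : 1 ≤ n) (l : ℝ) (hl : 1 ≤ l) (q q' F' : ℝ → ℝ) (hq : ∀ x, HasDerivAt q (q' x) x)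
    (hF : ∀ x, HasDerivAt (fun x => x * (1 - x) ^ n * q' x) (F' x) x)
    (h0 : ∀ x, 0 ≤ x → 0 ≤ q x)
    (hF' : ∀ x, 0 ≤ x → x ≤ 1 → -(l / 2) * (1 - x) ^ (n - 1) * q x ≤ F' x) (y : ℝ) (hy0 : 0 ≤ y)
    (hy1 : y ≤ 1) :
    q y ≤ 2 * (2 * 4 ^ (n + 1) * l) ^ n * ∫ x in (0:ℝ)..1, (1 - x) ^ (n - 1) * q x := by
  have hqc : Continuous q := continuous_iff_continuousAt.2 fun x => (hq x).continuousAt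
  obtain ⟨x1, hx1, hmax⟩ := isCompact_Icc.exists_isMaxOn (Set.nonempty_Icc.2 (zero_le_one' ℝ))
    hqc.continuousOn
  set Q := q x1 with hQ
  have hQm : ∀ x, 0 ≤ x → x ≤ 1 → q x ≤ Q := fun x a b => hmax ⟨a, b⟩
  have hQ0 : 0 ≤ Q := h0 _ hx1.1
  have hn' : (1:ℝ) ≤ n := by exact_mod_cast hn
  obtain ⟨m, rfl⟩ : ∃ m, n = m + 1 := ⟨n - 1, by omega⟩
  set G : ℝ → ℝ := fun x => x * (1 - x) ^ (m + 1) * q' x - l * Q / (2 * (m + 1)) * (1 - x) ^ (m + 1) with hG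
  have hGd : ∀ x, HasDerivAt G (F' x + l / 2 * Q * (1 - x) ^ m) x := by
    intro x
    have := (hF x).sub ((((hasDerivAt_id x).const_sub 1).pow (m + 1)).const_mul (l * Q / (2 * (m + 1))))
    refine this.congr_deriv ?_
    have : (m : ℝ) + 1 ≠ 0 := by positivity
    simp
    field_simp
  have hmono : MonotoneOn G (Set.Icc 0 1) := by
    apply monotoneOn_of_deriv_nonneg (convex_Icc 0 1)
    · exact fun x _ => (hGd x).continuousAt.continuousWithinAt
    · exact fun x _ => (hGd x).differentiableAt.differentiableWithinAt
    · intro x hx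
      rw [interior_Icc] at hx
      rw [(hGd x).deriv]
      have h1 := hF' x hx.1.le hx.2.le
      have h2 := hQm x hx.1.le hx.2.le
      have h3 : 0 ≤ l / 2 * (1 - x) ^ m := by
        have : 0 ≤ 1 - x := by linarith [hx.2]
        positivity
      simp only [Nat.add_sub_cancel] at h1
      nlinarith
  have hup : ∀ s, 0 < s → s < 1 → s * q' s ≤ l * Q / 2 := by
    intro s hs0 hs1
    have h1 := hmono (show s ∈ Set.Icc (0:ℝ) 1 from ⟨hs0.le, hs1.le⟩) (show (1:ℝ) ∈ Set.Icc (0:ℝ) 1 by simp) hs1.le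
    simp only [hG] at h1
    have h2 : 0 < (1 - s) ^ (m + 1) := pow_pos (by linarith) _
    have h3 : s * q' s ≤ l * Q / (2 * (m + 1)) := by
      simp at h1
      by_contra hcon
      push Not at hcon
      nlinarith
    refine h3.trans ?_
    apply div_le_div_of_nonneg_left (by positivity) (by norm_num)
    have : (0:ℝ) ≤ m := by positivity
    linarith
  have hlo : ∀ s, 0 < s → s < 1 → -(l * Q / 2) ≤ (1 - s) ^ (m + 1) * q' s := by
    intro s hs0 hs1
    have h1 := hmono (show (0:ℝ) ∈ Set.Icc (0:ℝ) 1 by simp) (show s ∈ Set.Icc (0:ℝ) 1 from ⟨hs0.le, hs1.le⟩) hs0.le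
    simp only [hG] at h1
    have h2 : 1 + ((m + 1 : ℕ) : ℝ) * (-s) ≤ (1 + -s) ^ (m + 1) := one_add_mul_le_pow (by linarith) _
    have h3 : l * Q / (2 * (m + 1)) * (1 + ((m + 1 : ℕ) : ℝ) * (-s)) ≤
      l * Q / (2 * (m + 1)) * (1 + -s) ^ (m + 1) := mul_le_mul_of_nonneg_left h2 (by positivity)
    have h4 : l * Q / (2 * (m + 1)) * (1 + ((m + 1 : ℕ) : ℝ) * (-s)) = l * Q / (2 * (m + 1)) - l * Q / 2 * s := by
      have : (m : ℝ) + 1 ≠ 0 := by positivity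
      push_cast; field_simp; ring
    simp at h1
    rw [← sub_eq_add_neg] at h3
    have h5 : s * (-(l * Q / 2)) ≤ s * ((1 - s) ^ (m + 1) * q' s) := by nlinarith
    exact le_of_mul_le_mul_left h5 hs0
  set ℓ : ℝ := 1 / (4 ^ (m + 2) * l) with hℓ
  have h4 : (16:ℝ) ≤ 4 ^ (m + 2) := by
    have : (1:ℝ) ≤ 4 ^ m := one_le_pow₀ (by norm_num)
    rw [pow_add]; linarith
  have hℓ0 : 0 < ℓ := by positivity
  have hℓ1 : ℓ ≤ 1 / 16 := by
    apply div_le_div_of_nonneg_left (by norm_num) (by norm_num); nlinarith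
  have hlℓ : l * ℓ * 4 ^ (m + 2) = 1 := by rw [hℓ]; field_simp
  have hlℓ' : l * ℓ ≤ 1 / 16 := by
    have : l * ℓ = 1 / 4 ^ (m + 2) := by rw [eq_div_iff (by positivity)]; exact hlℓ
    rw [this]; exact div_le_div_of_nonneg_left (by norm_num) (by norm_num) h4
  -- good interval
  have key : ∃ a, 0 ≤ a ∧ a + ℓ / 2 ≤ 1 - ℓ / 2 ∧ ∀ x ∈ Set.Icc a (a + ℓ / 2), Q / 2 ≤ q x := by
    by_cases hc : 1 / 2 ≤ x1
    · refine ⟨x1 - ℓ, by linarith, by linarith [hx1.2], ?_⟩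
      intro x hx
      have hle : x ≤ x1 := by linarith [hx.2]
      have h1 := Convex.image_sub_le_mul_sub_of_deriv_le (f := q) (C := 2 * l * Q) (convex_Icc (1/4:ℝ) 1)
        hqc.continuousOn (fun x _ => (hq x).differentiableAt.differentiableWithinAt) (by
          intro s hs
          rw [interior_Icc] at hs
          rw [(hq s).deriv]
          have := hup s (by linarith [hs.1]) hs.2
          have h5 : 0 ≤ l * Q := by positivity
          by_contra hcon
          push Not at hcon
          nlinarith [hs.1]) x ⟨by linarith [hx.1], by linarith [hx1.2]⟩ x1 ⟨by linarith, hx1.2⟩ hle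
      have h6 : x1 - x ≤ ℓ := by linarith [hx.1]
      have h7 : 2 * l * Q * (x1 - x) ≤ 2 * l * Q * ℓ := mul_le_mul_of_nonneg_left h6 (by positivity)
      nlinarith
    · push Not at hc
      refine ⟨x1, hx1.1, by linarith, ?_⟩
      intro x hx
      have h1 := Convex.mul_sub_le_image_sub_of_le_deriv (f := q) (C := -(l * Q / 2 * 4 ^ (m + 1))) (convex_Icc (0:ℝ) (3/4))
        hqc.continuousOn (fun x _ => (hq x).differentiableAt.differentiableWithinAt) (by
          intro s hs
          rw [interior_Icc] at hs
          rw [(hq s).deriv]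
          have h2 := hlo s hs.1 (by linarith [hs.2])
          have h5 : 0 ≤ l * Q / 2 := by positivity
          have h6 : (1/4:ℝ) ^ (m + 1) ≤ (1 - s) ^ (m + 1) := pow_le_pow_left₀ (by norm_num) (by linarith [hs.2]) _
          have h7 : (1/4:ℝ) ^ (m + 1) * 4 ^ (m + 1) = 1 := by rw [← mul_pow]; norm_num
          have h8 : (0:ℝ) < 4 ^ (m + 1) := by positivity
          have h9 : (0:ℝ) < (1/4:ℝ) ^ (m + 1) := by positivity
          by_contra hcon
          push Not at hcon
          have h10 : q' s < 0 := by nlinarith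
          have h11 : (1 - s) ^ (m + 1) * q' s ≤ (1/4:ℝ) ^ (m + 1) * q' s := by nlinarith
          have h12 : (1/4:ℝ) ^ (m + 1) * q' s < (1/4:ℝ) ^ (m + 1) * (-(l * Q / 2 * 4 ^ (m + 1))) :=
            mul_lt_mul_of_pos_left hcon h9
          nlinarith) x1 ⟨hx1.1, by linarith⟩ x ⟨hx1.1.trans hx.1, by linarith [hx.2]⟩ hx.1
      have h6 : x - x1 ≤ ℓ := by linarith [hx.2]
      have h7 : l * Q / 2 * 4 ^ (m + 1) * (x - x1) ≤ l * Q / 2 * 4 ^ (m + 1) * ℓ :=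
        mul_le_mul_of_nonneg_left h6 (by positivity)
      have h8 : l * Q / 2 * 4 ^ (m + 1) * ℓ = Q / 8 * (l * ℓ * 4 ^ (m + 2)) := by ring
      rw [hlℓ] at h8
      nlinarith
  obtain ⟨a, ha0, ha1, hag⟩ := key
  have hint : (ℓ / 2) ^ (m + 1) * (Q / 2) ≤ ∫ x in (0:ℝ)..1, (1 - x) ^ (m + 1 - 1) * q x := by
    have hcont : Continuous fun x => (1 - x) ^ (m + 1 - 1) * q x := by fun_prop
    calc (ℓ / 2) ^ (m + 1) * (Q / 2) = ∫ x in a..(a + ℓ / 2), (ℓ / 2) ^ m * (Q / 2) := by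
          rw [intervalIntegral.integral_const]; simp; ring
      _ ≤ ∫ x in a..(a + ℓ / 2), (1 - x) ^ (m + 1 - 1) * q x := by
          apply intervalIntegral.integral_mono_on (by linarith) (by simp) (hcont.intervalIntegrable _ _)
          intro x hx
          apply mul_le_mul _ (hag x hx) (by positivity) (pow_nonneg (by linarith [hx.2]) _)
          exact pow_le_pow_left₀ (by positivity) (by linarith [hx.2]) _
      _ ≤ _ := by
          apply intervalIntegral.integral_mono_interval ha0 (by linarith) (by linarith)
          · filter_upwards [ae_restrict_mem measurableSet_Ioc] with x hx
            exact mul_nonneg (pow_nonneg (by linarith [hx.2]) _) (h0 x hx.1.le)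
          · exact hcont.intervalIntegrable _ _
  refine (hQm y hy0 hy1).trans ?_
  have h5 : (2 * 4 ^ (m + 1 + 1) * l) * (ℓ / 2) = 1 := by linear_combination hlℓ
  have h6 : (2 * 4 ^ (m + 1 + 1) * l) ^ (m + 1) * (ℓ / 2) ^ (m + 1) = 1 := by rw [← mul_pow, h5, one_pow]
  have h7 := mul_le_mul_of_nonneg_left hint (show 0 ≤ 2 * (2 * 4 ^ (m + 1 + 1) * l) ^ (m + 1) by positivity)
  calc Q = 2 * (2 * 4 ^ (m + 1 + 1) * l) ^ (m + 1) * ((ℓ / 2) ^ (m + 1) * (Q / 2)) := by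
        linear_combination (-Q) * h6
    _ ≤ _ := h7

open Polynomial in
def sp (n m k : ℕ) : ℝ[X] := ∑ i ∈ Finset.range (k + 1), Polynomial.monomial i (co n m k i)

lemma sp_coeff (n m k i : ℕ) : (sp n m k).coeff i = co n m k i := by
  simp only [sp, Polynomial.finsetSum_coeff, Polynomial.coeff_monomial]
  rw [Finset.sum_ite_eq']
  split_ifs with h
  · rfl
  · rw [co_gt]; simp at h; omega

open Polynomial in
lemma sp_ode (n m k : ℕ) : X * derivative (derivative (sp n m k)) + C ((m:ℝ) + 1) * derivative (sp n m k) =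
    X * (X * derivative (derivative (sp n m k))) + C (1 + (m:ℝ) + n) * (X * derivative (sp n m k))
      - C ((k:ℝ) * (m + n + k)) * sp n m k := by
  ext i
  have h := co_succ n m k i
  rcases i with _ | _ | i <;>
  simp only [coeff_add, coeff_sub, coeff_C_mul, coeff_X_mul_zero, coeff_X_mul, coeff_derivative, sp_coeff] <;>
  push_cast at * <;> ring_nf at * <;> linear_combination (1/4) * h

open Polynomial in
lemma sp_flux (n m k : ℕ) (hn : 1 ≤ n) (x : ℝ) (hx0 : 0 ≤ x) (hx1 : x ≤ 1) :
    x ^ m * (sp n m k).eval x ^ 2 ≤ 2 * (2 * 4 ^ (n + 1) * ((2 * k + 2 * m + n) * (2 * k + n))) ^ n *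
      ∫ x in (0:ℝ)..1, (1 - x) ^ (n - 1) * (x ^ m * (sp n m k).eval x ^ 2) := by
  set s := sp n m k with hs
  have hn' : (1:ℝ) ≤ n := by exact_mod_cast hn
  have hk' : (0:ℝ) ≤ k := by positivity
  have hm' : (0:ℝ) ≤ m := by positivity
  have d1 : ∀ x, HasDerivAt (fun x => s.eval x) ((derivative s).eval x) x := fun x => s.hasDerivAt x
  have d2 : ∀ x, HasDerivAt (fun x => (derivative s).eval x) ((derivative (derivative s)).eval x) x :=
    fun x => (derivative s).hasDerivAt x
  have ode : ∀ x, x * (derivative (derivative s)).eval x + ((m:ℝ) + 1) * (derivative s).eval x =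
    x * (x * (derivative (derivative s)).eval x) + (1 + (m:ℝ) + n) * (x * (derivative s).eval x)
      - ((k:ℝ) * (m + n + k)) * s.eval x := by
    intro x
    have := congrArg (fun p => p.eval x) (sp_ode n m k)
    simpa [← hs] using this
  have hmm : ∀ x : ℝ, (m:ℝ) * x ^ m = m * (x * x ^ (m - 1)) := by
    intro x
    rcases m with _ | m
    · simp
    · rw [Nat.add_sub_cancel, pow_succ]; ring
  refine flux n hn _ (by nlinarith) (fun x => x ^ m * s.eval x ^ 2)
    (fun x => m * x ^ (m - 1) * s.eval x ^ 2 + x ^ m * (2 * s.eval x * (derivative s).eval x))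
    (fun x => (1 - x) ^ (n - 1) * (-(n * m + 2 * k * (m + n + k)) * (x ^ m * s.eval x ^ 2) +
      (1 - x) * (m * (m * x ^ (m - 1)) * s.eval x ^ 2 + 2 * m * x ^ m * s.eval x * (derivative s).eval x +
        2 * (x * x ^ m) * (derivative s).eval x ^ 2))) ?_ ?_ ?_ ?_ x hx0 hx1
  · intro x
    have := (hasDerivAt_pow m x).fun_mul ((d1 x).fun_pow 2)
    refine this.congr_deriv ?_
    simp
  · intro x
    have e : (fun x => x * (1 - x) ^ n * (m * x ^ (m - 1) * s.eval x ^ 2 + x ^ m * (2 * s.eval x * (derivative s).eval x))) =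
      fun x => (1 - x) ^ n * (x ^ m * (m * s.eval x ^ 2 + x * (2 * (s.eval x * (derivative s).eval x)))) := by
      ext y
      linear_combination (-(1 - y) ^ n * s.eval y ^ 2) * hmm y
    rw [e]
    have h1 : HasDerivAt (fun x : ℝ => (1 - x) ^ n) (n * (1 - x) ^ (n - 1) * (-1)) x := by
      simpa using ((hasDerivAt_id x).const_sub 1).fun_pow n
    have := h1.fun_mul ((hasDerivAt_pow m x).fun_mul ((((d1 x).fun_pow 2).const_mul (m:ℝ)).fun_add
      ((hasDerivAt_id' x).fun_mul (((d1 x).fun_mul (d2 x)).const_mul 2))))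
    refine this.congr_deriv ?_
    obtain ⟨r, rfl⟩ : ∃ r, n = r + 1 := ⟨n - 1, by omega⟩
    have o := ode x
    have hm2 := hmm x
    push_cast at *
    simp only [pow_succ]
    set S := s.eval x
    set S1 := (derivative s).eval x
    set S2 := (derivative (derivative s)).eval x
    linear_combination (exp := 1) ((1 - x) ^ r * (2 * x ^ m * S)) * o - ((1 - x) ^ r * (1 - x) * (2 * S * S1)) * hm2
  · intro x hx
    positivity
  · intro x hx0 hx1
    have h1 : 0 ≤ (1 - x) ^ (n - 1) := pow_nonneg (by linarith) _
    have h2 : 0 ≤ m * (m * x ^ (m - 1)) * s.eval x ^ 2 + 2 * m * x ^ m * s.eval x * (derivative s).eval x +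
        2 * (x * x ^ m) * (derivative s).eval x ^ 2 := by
      rcases m with _ | m
      · simp; positivity
      · have : 0 ≤ x ^ m * ((((m + 1 : ℕ):ℝ) * s.eval x + x * (derivative s).eval x) ^ 2 + (x * (derivative s).eval x) ^ 2) := by
          positivity
        refine this.trans (le_of_eq ?_)
        simp only [Nat.add_sub_cancel]
        ring
    have h3 : 0 ≤ x ^ m * s.eval x ^ 2 := by positivity
    have h4 : 0 ≤ (1 - x) ^ (n - 1) * ((1 - x) * (m * (m * x ^ (m - 1)) * s.eval x ^ 2 + 2 * m * x ^ m * s.eval x * (derivative s).eval x +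
        2 * (x * x ^ m) * (derivative s).eval x ^ 2)) := mul_nonneg h1 (mul_nonneg (by linarith) h2)
    have h5 : 0 ≤ (n:ℝ) ^ 2 / 2 * ((1 - x) ^ (n - 1) * (x ^ m * s.eval x ^ 2)) := by positivity
    linear_combination (exp := 1) h4 + h5

end Heis

namespace Heis
open Complex (I)

lemma Ec_fsum {ι : Type*} (n : ℕ) (s : Finset ι) (f : ι → ℂ → ℂ) (hf : ∀ i ∈ s, Continuous (f i)) :
    Ec n (fun w => ∑ i ∈ s, f i w) = ∑ i ∈ s, Ec n (f i) := by
  unfold Ec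
  exact integral_finsetSum s fun i hi => nu_integrable n ((hf i hi).comp continuous_subtype_val)

lemma Ec_cmul (n : ℕ) (f : ℂ → ℂ) (a : ℂ) : Ec n (fun w => a * f w) = a * Ec n f := Ec_smul n f a

lemma conj_mon (q : ℕ × ℕ) (w : ℂ) : starRingEnd ℂ (mon q w) = mon q.swap w := by
  simp only [mon, map_mul, map_pow, Complex.conj_conj, Prod.fst_swap, Prod.snd_swap]; ring

lemma ev_ep (n : ℕ) (q : ℕ × ℕ) (w : ℂ) : ev (ep n q) w =
    ∑ i ∈ Finset.range (mi q + 1), (co n (md q) (mi q) i : ℂ) * mon (ch q i) w := by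
  simp only [ep, map_sum, Finset.sum_apply, ev_single]

lemma ev_Bm (n : ℕ) (γ : Poly) (w : ℂ) : ev (Bm n γ) w = ∑ q ∈ γ.support, γ q * ev (ep n q) w := by
  simp only [Bm, Finsupp.linearCombination_apply, Finsupp.sum, map_sum, Finset.sum_apply, map_smul,
    Pi.smul_apply, smul_eq_mul]

lemma norm_ep (n : ℕ) (q : ℕ × ℕ) (w : ℂ) : ‖ev (ep n q) w‖ ^ 2 =
    (‖w‖ ^ 2) ^ md q * (sp n (md q) (mi q)).eval (‖w‖ ^ 2) ^ 2 := by
  have h1 : ev (ep n q) w = mon (ch q 0) w * (((sp n (md q) (mi q)).eval (‖w‖ ^ 2) : ℝ) : ℂ) := by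
    rw [ev_ep, sp, Polynomial.eval_finsetSum]
    push_cast
    rw [Finset.mul_sum]
    apply Finset.sum_congr rfl
    intro i _
    rw [Polynomial.eval_monomial]
    have : (((‖w‖ ^ 2) ^ i : ℝ) : ℂ) = w ^ i * (starRingEnd ℂ w) ^ i := by
      rw [← mul_pow, Complex.mul_conj, Complex.normSq_eq_norm_sq]; push_cast; rfl
    rw [Complex.ofReal_mul, this]
    simp only [mon, ch, pow_add]; ring
  rw [h1, norm_mul, mul_pow, Complex.norm_real, Real.norm_eq_abs, sq_abs]
  congr 1
  simp only [mon, ch, norm_mul, norm_pow, RCLike.norm_conj]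
  rcases md_or q with ⟨h1, h2⟩ | ⟨h1, h2⟩ <;> rw [h1, h2] <;> simp <;> ring

def Nq (n : ℕ) (q : ℕ × ℕ) : ℝ := Real.pi * ∫ x in (0:ℝ)..1, (1 - x) ^ (n - 1) *
    (x ^ md q * (sp n (md q) (mi q)).eval x ^ 2)

def Cn (n : ℕ) : ℝ := 2 * (2 * 4 ^ (n + 1)) ^ n

lemma ep_sup (n : ℕ) (hn : 1 ≤ n) (q : ℕ × ℕ) (w : ℂ) (hw : ‖w‖ ≤ 1) :
    ‖ev (ep n q) w‖ ^ 2 ≤ Cn n * lam n q ^ n * Nq n q := by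
  rw [norm_ep]
  have hw0 := norm_nonneg w
  have h := sp_flux n (md q) (mi q) hn (‖w‖ ^ 2) (by positivity) (by nlinarith)
  refine h.trans ?_
  have h2 : (2 * (mi q : ℝ) + 2 * md q + n) * (2 * mi q + n) = lam n q := by
    conv_rhs => rw [← ch_mi q]
    simp only [lam, ch]
    rcases md_or q with ⟨h1, h2⟩ | ⟨h1, h2⟩ <;> rw [h1, h2] <;> push_cast <;> ring
  rw [h2]
  have h3 : 0 ≤ ∫ x in (0:ℝ)..1, (1 - x) ^ (n - 1) * (x ^ md q * (sp n (md q) (mi q)).eval x ^ 2) := by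
    apply intervalIntegral.integral_nonneg (by norm_num)
    intro x hx
    have : 0 ≤ 1 - x := by linarith [hx.2]
    have := hx.1
    positivity
  have hl : 0 ≤ lam n q := by unfold lam; positivity
  unfold Cn Nq
  rw [mul_pow]
  have : (1:ℝ) ≤ Real.pi := by linarith [Real.pi_gt_three]
  have h5 := mul_le_mul_of_nonneg_right this (mul_nonneg (show 0 ≤ 2 * ((2 * 4 ^ (n + 1)) ^ n * lam n q ^ n) by positivity) h3)
  linarith

lemma Nq_pos (n : ℕ) (hn : 1 ≤ n) (q : ℕ × ℕ) : 0 < Nq n q := by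
  by_contra hcon
  have hl : 0 ≤ lam n q := by unfold lam; positivity
  have h0 : ∀ x : ℝ, x ∈ Set.Ioo (0:ℝ) 1 → (sp n (md q) (mi q)).eval x = 0 := by
    intro x hx
    have h := ep_sup n hn q (Real.sqrt x : ℂ) (by
      rw [Complex.norm_real, Real.norm_eq_abs, abs_of_nonneg (Real.sqrt_nonneg _)]
      exact Real.sqrt_le_one.2 hx.2.le)
    rw [norm_ep, Complex.norm_real, Real.norm_eq_abs, sq_abs, Real.sq_sqrt hx.1.le] at h
    have h2 : Cn n * lam n q ^ n * Nq n q ≤ 0 :=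
      mul_nonpos_of_nonneg_of_nonpos (by unfold Cn; positivity) (by linarith)
    have h3 : 0 < x ^ md q := pow_pos hx.1 _
    have h4 : (sp n (md q) (mi q)).eval x ^ 2 ≤ 0 := by
      by_contra h5; push Not at h5; have := mul_pos h3 h5; linarith
    exact pow_eq_zero_iff (two_ne_zero) |>.1 (le_antisymm h4 (sq_nonneg _))
  have h1 : sp n (md q) (mi q) = 0 := by
    apply Polynomial.eq_zero_of_infinite_isRoot
    exact (Set.Ioo_infinite (zero_lt_one' ℝ)).mono h0
  have h2 := sp_coeff n (md q) (mi q) 0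
  rw [h1, co_zero] at h2
  simp at h2

lemma ip_self (n : ℕ) (q : ℕ × ℕ) :
    Ec n (fun w => ev (ep n q) w * starRingEnd ℂ (ev (ep n q) w)) = Nq n q := by
  rw [Nq, ← nu_radial n (fun x => x ^ md q * (sp n (md q) (mi q)).eval x ^ 2) (by fun_prop),
    ← integral_complex_ofReal]
  unfold Ec
  congr 1
  ext w
  simp only [Complex.mul_conj, Complex.normSq_eq_norm_sq, norm_ep]

lemma ip_sym (n : ℕ) (hn : 1 ≤ n) (c d : Poly) :
    Ec n (fun w => ev c w * starRingEnd ℂ (ev (Lp n d) w)) =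
    Ec n (fun w => ev (Lp n c) w * starRingEnd ℂ (ev d w)) := by
  obtain ⟨d', h1, h2⟩ := star_ex n d
  simp only [← h1, ← h2]
  exact Ec_sym n hn c d'

lemma ip_orth (n : ℕ) (hn : 1 ≤ n) (q r : ℕ × ℕ) (hqr : q ≠ r) :
    Ec n (fun w => ev (ep n q) w * starRingEnd ℂ (ev (ep n r) w)) = 0 := by
  by_cases hd : q.1 + r.2 = q.2 + r.1
  · have h := ip_sym n hn (ep n q) (ep n r)
    rw [Lp_ep, Lp_ep] at h
    have h2 : ∀ w, ev (ep n q) w * starRingEnd ℂ (ev ((lam n r : ℂ) • ep n r) w) =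
      (lam n r : ℂ) * (ev (ep n q) w * starRingEnd ℂ (ev (ep n r) w)) := by
      intro w; simp; ring
    have h3 : ∀ w, ev ((lam n q : ℂ) • ep n q) w * starRingEnd ℂ (ev (ep n r) w) =
      (lam n q : ℂ) * (ev (ep n q) w * starRingEnd ℂ (ev (ep n r) w)) := by
      intro w; simp; ring
    simp only [h2, h3, Ec_cmul] at h
    have hne : (lam n r : ℂ) - lam n q ≠ 0 := by
      have : lam n r - lam n q ≠ 0 := by
        have h5 : r.1 ≠ q.1 := by
          intro h; apply hqr; ext; exact h.symm; omega
        have e2 : (r.2 : ℝ) = q.2 + r.1 - q.1 := by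
          have : (q.1 : ℝ) + r.2 = q.2 + r.1 := by exact_mod_cast hd
          linarith
        have e3 : lam n r - lam n q = 4 * (((r.1 : ℝ) - q.1) * (n + q.2 + r.1)) := by
          simp only [lam]; rw [e2]; ring
        rw [e3]
        have h6 : (r.1 : ℝ) - q.1 ≠ 0 := by rw [sub_ne_zero]; exact_mod_cast h5
        have h7 : (n : ℝ) + q.2 + r.1 ≠ 0 := by positivity
        positivity
      exact_mod_cast this
    have h8 := mul_eq_zero.1 (show ((lam n r : ℂ) - lam n q) * Ec n (fun w => ev (ep n q) w * starRingEnd ℂ (ev (ep n r) w)) = 0 by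
      linear_combination h)
    exact h8.resolve_left hne
  · have h1 : ∀ w, ev (ep n q) w * starRingEnd ℂ (ev (ep n r) w) =
        ∑ i ∈ Finset.range (mi q + 1), ∑ j ∈ Finset.range (mi r + 1),
          ((co n (md q) (mi q) i : ℂ) * (co n (md r) (mi r) j : ℂ)) * mon (ch q i + (ch r j).swap) w := by
      intro w
      rw [ev_ep, ev_ep, map_sum, Finset.sum_mul_sum]
      apply Finset.sum_congr rfl; intro i _; apply Finset.sum_congr rfl; intro j _
      rw [← mon_add, map_mul, conj_mon, Complex.conj_ofReal]; ring
    simp only [h1]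
    have hc : ∀ a : ℂ, ∀ x, Continuous fun w => a * mon x w := fun a x => continuous_const.mul (mon_cont x)
    rw [Ec_fsum _ _ _ (fun i _ => continuous_finsetSum _ fun j _ => hc _ _)]
    apply Finset.sum_eq_zero; intro i _
    rw [Ec_fsum _ _ _ (fun j _ => hc _ _)]
    apply Finset.sum_eq_zero; intro j _
    rw [Ec_cmul, mom_off, mul_zero]
    have a1 : mi q ≤ q.1 := min_le_left _ _
    have a2 : mi q ≤ q.2 := min_le_right _ _
    have a3 : mi r ≤ r.1 := min_le_left _ _
    have a4 : mi r ≤ r.2 := min_le_right _ _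
    simp only [ch, Prod.fst_add, Prod.snd_add, Prod.fst_swap, Prod.snd_swap]
    omega

lemma ip_Bm (n : ℕ) (hn : 1 ≤ n) (γ : Poly) (r : ℕ × ℕ) :
    Ec n (fun w => ev (Bm n γ) w * starRingEnd ℂ (ev (ep n r) w)) = γ r * Nq n r := by
  simp only [ev_Bm, Finset.sum_mul, mul_assoc]
  have hc : ∀ q, Continuous fun w => ev (ep n q) w * starRingEnd ℂ (ev (ep n r) w) := fun q =>
    (ev_cont _).mul (Complex.continuous_conj.comp (ev_cont _))
  rw [Ec_fsum n _ (fun q w => γ q * (ev (ep n q) w * starRingEnd ℂ (ev (ep n r) w)))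
    fun q _ => continuous_const.mul (hc q)]
  simp only [Ec_cmul]
  by_cases hr : r ∈ γ.support
  · rw [Finset.sum_eq_single_of_mem r hr, ip_self]
    intro b _ hb
    rw [ip_orth n hn _ _ hb, mul_zero]
  · rw [Finsupp.notMem_support_iff.1 hr, zero_mul]
    apply Finset.sum_eq_zero
    intro q hq
    rw [ip_orth n hn, mul_zero]
    rintro rfl; exact hr hq

lemma parseval (n : ℕ) (hn : 1 ≤ n) (γ : Poly) :
    ∫ w : Dk, ‖ev (Bm n γ) w‖ ^ 2 ∂nu n = ∑ q ∈ γ.support, ‖γ q‖ ^ 2 * Nq n q := by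
  have h1 : Ec n (fun w => ev (Bm n γ) w * starRingEnd ℂ (ev (Bm n γ) w)) =
      ((∑ q ∈ γ.support, ‖γ q‖ ^ 2 * Nq n q : ℝ) : ℂ) := by
    have : ∀ w, ev (Bm n γ) w * starRingEnd ℂ (ev (Bm n γ) w) =
      ∑ q ∈ γ.support, starRingEnd ℂ (γ q) * (ev (Bm n γ) w * starRingEnd ℂ (ev (ep n q) w)) := by
      intro w
      nth_rewrite 2 [ev_Bm]
      rw [map_sum, Finset.mul_sum]
      apply Finset.sum_congr rfl; intro q _
      rw [map_mul]; ring
    simp only [this]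
    rw [Ec_fsum n _ (fun q w => starRingEnd ℂ (γ q) * (ev (Bm n γ) w * starRingEnd ℂ (ev (ep n q) w)))
      fun q _ => continuous_const.mul ((ev_cont _).mul (Complex.continuous_conj.comp (ev_cont _)))]
    push_cast
    apply Finset.sum_congr rfl; intro q _
    rw [Ec_cmul, ip_Bm n hn, ← mul_assoc, mul_comm (starRingEnd ℂ (γ q)), Complex.mul_conj, Complex.normSq_eq_norm_sq]
    push_cast; rfl
  have h2 : Ec n (fun w => ev (Bm n γ) w * starRingEnd ℂ (ev (Bm n γ) w)) =
      ((∫ w : Dk, ‖ev (Bm n γ) w‖ ^ 2 ∂nu n : ℝ) : ℂ) := by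
    rw [← integral_complex_ofReal]
    unfold Ec
    congr 1; ext w
    simp only [Complex.mul_conj, Complex.normSq_eq_norm_sq]
  exact_mod_cast h2.symm.trans h1

lemma MP_ev (n : ℕ) (hn : 1 ≤ n) (c : Poly) (M : ℝ) (hM : ∀ w : ℂ, ‖w‖ ≤ 1 → ‖ev (Lp n c) w‖ ≤ M)
    (w : ℂ) (hw : ‖w‖ ≤ 1) : ‖ev c w‖ ≤ M := by
  obtain ⟨h1, h2⟩ := Reg_Lop_ev n c
  have h := MP_norm n h1 M (fun w hw => by rw [h2 w hw]; exact hM w hw) w hw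
  have hn' : (1:ℝ) ≤ n := by exact_mod_cast hn
  have : ‖ev c w‖ ≤ (n:ℝ) ^ 2 * ‖ev c w‖ := le_mul_of_one_le_left (norm_nonneg _) (by nlinarith)
  linarith

lemma mult_mult (χ ψ : ℕ × ℕ → ℝ) (γ : Poly) : mult χ (mult ψ γ) = mult (fun q => χ q * ψ q) γ := by
  ext q; simp only [mult_apply]; push_cast; ring

lemma mult_add (χ ψ : ℕ × ℕ → ℝ) (γ : Poly) : mult (fun q => χ q + ψ q) γ = mult χ γ + mult ψ γ := by
  ext q; simp only [mult_apply, Finsupp.add_apply]; push_cast; ring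

lemma mult_smul (a : ℝ) (χ : ℕ × ℕ → ℝ) (γ : Poly) : mult (fun q => a * χ q) γ = (a : ℂ) • mult χ γ := by
  ext q; simp only [mult_apply, Finsupp.smul_apply, smul_eq_mul]; push_cast; ring

lemma lam_one (n : ℕ) (hn : 1 ≤ n) (q : ℕ × ℕ) : 1 ≤ lam n q := by
  have := lam_pos n hn q
  have h1 : (0:ℝ) ≤ q.1 := by positivity
  have h2 : (0:ℝ) ≤ q.2 := by positivity
  nlinarith

lemma inv_bd (n : ℕ) (hn : 1 ≤ n) (γ : Poly) (i : ℕ) (M : ℝ)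
    (hM : ∀ w : ℂ, ‖w‖ ≤ 1 → ‖ev (Bm n γ) w‖ ≤ M) (w : ℂ) (hw : ‖w‖ ≤ 1) :
    ‖ev (Bm n (mult (fun q => (lam n q)⁻¹ ^ i) γ)) w‖ ≤ M := by
  induction i generalizing w with
  | zero =>
    have : mult (fun q => (lam n q)⁻¹ ^ 0) γ = γ := by ext q; simp [mult_apply]
    rw [this]; exact hM w hw
  | succ i ih =>
    apply MP_ev n hn _ M _ w hw
    intro w hw
    rw [Lp_Bm, mult_mult]
    have : (fun q => lam n q * (lam n q)⁻¹ ^ (i + 1)) = fun q => (lam n q)⁻¹ ^ i := by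
      ext q
      have := lam_one n hn q
      rw [pow_succ]; field_simp
    rw [this]; exact ih w hw

/-- total mass -/
def vol (n : ℕ) : ℝ := (nu n).real Set.univ

lemma vol_nonneg (n : ℕ) : 0 ≤ vol n := measureReal_nonneg

lemma sumlam (n : ℕ) (hn : 1 ≤ n) : ∃ A, 0 ≤ A ∧ ∀ s : Finset (ℕ × ℕ), ∑ q ∈ s, (lam n q)⁻¹ ^ 2 ≤ A := by
  have h1 : Summable fun j : ℕ => (((j : ℝ) + 1)⁻¹) ^ 2 := by
    have := (summable_nat_add_iff 1).2 (Real.summable_one_div_nat_pow.2 (one_lt_two))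
    refine this.congr fun j => ?_
    push_cast; simp
  have h2 : Summable fun q : ℕ × ℕ => (((q.1 : ℝ) + 1)⁻¹) ^ 2 * (((q.2 : ℝ) + 1)⁻¹) ^ 2 :=
    h1.mul_of_nonneg h1 (fun _ => by positivity) (fun _ => by positivity)
  refine ⟨∑' q : ℕ × ℕ, (((q.1 : ℝ) + 1)⁻¹) ^ 2 * (((q.2 : ℝ) + 1)⁻¹) ^ 2, tsum_nonneg fun _ => by positivity, fun s => ?_⟩
  refine (Finset.sum_le_sum fun q _ => ?_).trans (h2.sum_le_tsum s fun _ _ => by positivity)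
  rw [← mul_pow, ← mul_inv]
  apply pow_le_pow_left₀ (by have := lam_one n hn q; positivity)
  exact inv_anti₀ (by positivity) (lam_pos n hn q)

lemma l2_le (n : ℕ) (c : Poly) (M : ℝ) (hM : ∀ w : ℂ, ‖w‖ ≤ 1 → ‖ev c w‖ ≤ M) :
    ∫ w : Dk, ‖ev c w‖ ^ 2 ∂nu n ≤ M ^ 2 * vol n := by
  have hc : Continuous fun w : Dk => ‖ev c w‖ ^ 2 := ((ev_cont c).comp continuous_subtype_val).norm.pow 2
  calc _ ≤ ∫ w : Dk, M ^ 2 ∂nu n := by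
        apply integral_mono (nu_integrable n hc) (integrable_const _)
        intro w
        exact pow_le_pow_left₀ (norm_nonneg _) (hM w (Dk_le w)) 2
    _ = _ := by rw [integral_const, vol]; simp [mul_comm]

/-- main linear estimate -/
lemma main_est (n : ℕ) (hn : 1 ≤ n) : ∃ C, 0 < C ∧ ∀ (γ : Poly) (M : ℝ), 0 ≤ M → γ (1, 0) = 0 → γ (0, 1) = 0 →
    (∀ w : ℂ, ‖w‖ ≤ 1 → ‖ev (Bm n (mult (fun q => lam n q - lam1 n) γ)) w‖ ≤ M) →
    ∀ w : ℂ, ‖w‖ ≤ 1 → ‖ev (Bm n γ) w‖ ≤ C * M := by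
  obtain ⟨A, hA0, hA⟩ := sumlam n hn
  have hl1 : 0 ≤ lam1 n := by unfold lam1; positivity
  set B := Real.sqrt (Cn n) * Real.sqrt (vol n) * A with hB
  refine ⟨∑ i ∈ Finset.range (n + 2), lam1 n ^ i + lam1 n ^ (n + 2) * B + 1, by positivity, ?_⟩
  intro γ M hM0 h10 h01 hM w hw
  -- l2 bound
  have hl2 : ∀ q, ‖γ q‖ ^ 2 * Nq n q ≤ M ^ 2 * vol n := by
    intro q
    by_cases hq : γ q = 0
    · rw [hq]; simp; exact mul_nonneg (sq_nonneg _) (vol_nonneg n)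
    · have h1 := l2_le n _ M hM
      rw [parseval n hn] at h1
      have hq1 : q ≠ (1, 0) := by rintro rfl; exact hq h10
      have hq2 : q ≠ (0, 1) := by rintro rfl; exact hq h01
      have hg := lam_gap n hn q hq1 hq2
      have hne : lam n q - lam1 n ≠ 0 := by intro h; rw [h] at hg; norm_num at hg
      have hmem : q ∈ (mult (fun q => lam n q - lam1 n) γ).support := by
        rw [Finsupp.mem_support_iff, mult_apply]
        exact mul_ne_zero (by exact_mod_cast hne) hq
      refine le_trans ?_ ((Finset.single_le_sum (f := fun q => ‖(mult (fun q => lam n q - lam1 n) γ) q‖ ^ 2 * Nq n q)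
        (fun q _ => mul_nonneg (sq_nonneg _) (Nq_pos n hn q).le) hmem).trans h1)
      apply mul_le_mul_of_nonneg_right _ (Nq_pos n hn q).le
      rw [mult_apply, norm_mul, Complex.norm_real, Real.norm_eq_abs, mul_pow]
      apply le_mul_of_one_le_left (sq_nonneg _)
      nlinarith
  have hK : ∀ w : ℂ, ‖w‖ ≤ 1 → ‖ev (Bm n (mult (fun q => (lam n q)⁻¹ ^ (n + 2)) γ)) w‖ ≤ B * M := by
    intro w hw
    rw [ev_Bm]
    refine (norm_sum_le _ _).trans ?_
    have hterm : ∀ q, ‖(mult (fun q => (lam n q)⁻¹ ^ (n + 2)) γ) q * ev (ep n q) w‖ ≤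
        Real.sqrt (Cn n) * Real.sqrt (vol n) * M * (lam n q)⁻¹ ^ 2 := by
      intro q
      have hl := lam_one n hn q
      have hC0 : 0 ≤ Cn n := by unfold Cn; positivity
      have h1 := ep_sup n hn q w hw
      have h2 := hl2 q
      have h3 : (‖γ q‖ * ‖ev (ep n q) w‖) ^ 2 ≤ (Real.sqrt (Cn n) * Real.sqrt (vol n) * M * lam n q ^ n) ^ 2 := by
        rw [mul_pow, mul_pow, mul_pow, mul_pow, Real.sq_sqrt hC0, Real.sq_sqrt (vol_nonneg n)]
        calc ‖γ q‖ ^ 2 * ‖ev (ep n q) w‖ ^ 2 ≤ ‖γ q‖ ^ 2 * (Cn n * lam n q ^ n * Nq n q) :=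
              mul_le_mul_of_nonneg_left h1 (sq_nonneg _)
          _ = Cn n * lam n q ^ n * (‖γ q‖ ^ 2 * Nq n q) := by ring
          _ ≤ Cn n * lam n q ^ n * (M ^ 2 * vol n) := mul_le_mul_of_nonneg_left h2 (by positivity)
          _ ≤ Cn n * (lam n q ^ n) ^ 2 * (M ^ 2 * vol n) := by
              have : lam n q ^ n ≤ (lam n q ^ n) ^ 2 := by
                have : 1 ≤ lam n q ^ n := one_le_pow₀ hl
                nlinarith
              gcongr
              exact mul_nonneg (sq_nonneg _) (vol_nonneg n)
          _ = _ := by ring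
      have h4 := le_of_sq_le_sq h3 (by positivity)
      rw [mult_apply, norm_mul, norm_mul, Complex.norm_real, Real.norm_eq_abs, abs_of_nonneg (by positivity), mul_assoc]
      calc _ ≤ (lam n q)⁻¹ ^ (n + 2) * (Real.sqrt (Cn n) * Real.sqrt (vol n) * M * lam n q ^ n) :=
            mul_le_mul_of_nonneg_left h4 (by positivity)
        _ = _ := by
            rw [pow_add]
            have : (lam n q)⁻¹ ^ n * lam n q ^ n = 1 := by rw [← mul_pow, inv_mul_cancel₀ (by positivity), one_pow]
            linear_combination (Real.sqrt (Cn n) * Real.sqrt (vol n) * M * (lam n q)⁻¹ ^ 2) * this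
    refine (Finset.sum_le_sum fun q _ => hterm q).trans ?_
    rw [← Finset.mul_sum]
    have := mul_le_mul_of_nonneg_left (hA (mult (fun q => (lam n q)⁻¹ ^ (n + 2)) γ).support)
      (show 0 ≤ Real.sqrt (Cn n) * Real.sqrt (vol n) * M by positivity)
    rw [hB]; linarith
  have hstep : ∀ i, i ≤ n + 2 → ∀ w : ℂ, ‖w‖ ≤ 1 → ‖ev (Bm n γ) w‖ ≤
      (∑ j ∈ Finset.range i, lam1 n ^ j) * M + lam1 n ^ i * ‖ev (Bm n (mult (fun q => (lam n q)⁻¹ ^ i) γ)) w‖ := by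
    intro i
    induction i with
    | zero =>
      intro _ w hw
      have : mult (fun q => (lam n q)⁻¹ ^ 0) γ = γ := by ext q; simp [mult_apply]
      rw [this]; simp
    | succ i ih =>
      intro hi w hw
      refine (ih (by omega) w hw).trans ?_
      have e : mult (fun q => (lam n q)⁻¹ ^ i) γ = mult (fun q => (lam n q)⁻¹ ^ (i + 1)) (mult (fun q => lam n q - lam1 n) γ)
          + (lam1 n : ℂ) • mult (fun q => (lam n q)⁻¹ ^ (i + 1)) γ := by
        rw [mult_mult, ← mult_smul, ← mult_add]
        congr 2; funext q
        have := lam_one n hn q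
        rw [pow_succ]; field_simp; ring
      have h1 : ‖ev (Bm n (mult (fun q => (lam n q)⁻¹ ^ i) γ)) w‖ ≤ M + lam1 n * ‖ev (Bm n (mult (fun q => (lam n q)⁻¹ ^ (i + 1)) γ)) w‖ := by
        rw [e, map_add, map_add, Pi.add_apply, map_smul, map_smul, Pi.smul_apply]
        refine (norm_add_le _ _).trans (add_le_add (inv_bd n hn _ _ M hM w hw) ?_)
        rw [norm_smul, Complex.norm_real, Real.norm_eq_abs, abs_of_nonneg hl1]
      rw [Finset.sum_range_succ]
      have := mul_le_mul_of_nonneg_left h1 (show 0 ≤ lam1 n ^ i by positivity)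
      rw [pow_succ]; linarith
  have h1 := hstep (n + 2) le_rfl w hw
  have h2 := mul_le_mul_of_nonneg_left (hK w hw) (show 0 ≤ lam1 n ^ (n + 2) by positivity)
  nlinarith

end Heis

namespace Heis
open Complex (I)

lemma ev_mul_ex (c d : Poly) : ∃ r : Poly, ∀ w, ev r w = ev c w * ev d w := by
  induction c using Finsupp.induction_linear with
  | zero => exact ⟨0, by simp⟩
  | add f g hf hg =>
    obtain ⟨a, ha⟩ := hf; obtain ⟨b, hb⟩ := hg
    exact ⟨a + b, fun w => by simp [ha, hb, add_mul]⟩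
  | single q x =>
    induction d using Finsupp.induction_linear with
    | zero => exact ⟨0, by simp⟩
    | add f g hf hg =>
      obtain ⟨a, ha⟩ := hf; obtain ⟨b, hb⟩ := hg
      exact ⟨a + b, fun w => by simp [ha, hb, mul_add]⟩
    | single r y =>
      refine ⟨Finsupp.single (q + r) (x * y), fun w => ?_⟩
      rw [ev_single, ev_single, ev_single, ← mon_add]; ring

def evAlg : StarSubalgebra ℂ C(Dk, ℂ) where
  carrier := {f | ∃ c : Poly, ∀ w : Dk, f w = ev c w}
  mul_mem' := by
    rintro f g ⟨c, hc⟩ ⟨d, hd⟩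
    obtain ⟨r, hr⟩ := ev_mul_ex c d
    exact ⟨r, fun w => by simp [hr, hc, hd]⟩
  add_mem' := by
    rintro f g ⟨c, hc⟩ ⟨d, hd⟩
    exact ⟨c + d, fun w => by simp [hc, hd]⟩
  algebraMap_mem' := by
    intro r
    refine ⟨Finsupp.single (0, 0) r, fun w => ?_⟩
    rw [ev_single]; simp [mon]
  star_mem' := by
    rintro f ⟨c, hc⟩
    obtain ⟨d, hd, -⟩ := star_ex 1 c
    exact ⟨d, fun w => by simp [hc, hd]⟩

lemma dense_ev (g : C(Dk, ℝ)) (ε : ℝ) (hε : 0 < ε) : ∃ d : Poly, ∀ w : Dk, ‖(g w : ℂ) - ev d w‖ ≤ ε := by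
  have h := ContinuousMap.starSubalgebra_topologicalClosure_eq_top_of_separatesPoints evAlg (by
    intro x y hxy
    refine ⟨fun w => (w : ℂ), ⟨⟨fun w => (w:ℂ), continuous_subtype_val⟩, ⟨Finsupp.single (1, 0) 1, fun w => ?_⟩, rfl⟩, ?_⟩
    · rw [ev_single]; simp [mon]
    · simpa [Subtype.ext_iff] using hxy)
  have h2 : (⟨fun w => (g w : ℂ), by fun_prop⟩ : C(Dk, ℂ)) ∈ evAlg.topologicalClosure := by rw [h]; trivial
  have h3 : (⟨fun w => (g w : ℂ), by fun_prop⟩ : C(Dk, ℂ)) ∈ closure (evAlg : Set C(Dk, ℂ)) := h2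
  obtain ⟨f, ⟨d, hd⟩, hf⟩ := Metric.mem_closure_iff.1 h3 ε hε
  refine ⟨d, fun w => ?_⟩
  rw [← hd]
  have := (ContinuousMap.dist_apply_le_dist (f := (⟨fun w => (g w : ℂ), by fun_prop⟩ : C(Dk, ℂ))) (g := f) w).trans hf.le
  rwa [dist_eq_norm] at this

abbrev V := C(Dk, ℝ)

def Gr (n : ℕ) (f g : V) : Prop := ∀ ε : ℝ, 0 < ε → ∃ c : Poly, ∀ w : Dk,
    ‖(f w : ℂ) - ev c w‖ ≤ ε ∧ ‖(g w : ℂ) - ev (Lp n c) w‖ ≤ ε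

lemma Gr_of_re (n : ℕ) {f g : V} (h : ∀ ε : ℝ, 0 < ε → ∃ c : Poly, ∀ w : Dk,
    |f w - (ev c w).re| ≤ ε ∧ |g w - (ev (Lp n c) w).re| ≤ ε) : Gr n f g := by
  intro ε hε
  obtain ⟨c, hc⟩ := h ε hε
  obtain ⟨d, h1, h2⟩ := star_ex n c
  have key : ∀ z : ℂ, (1/2:ℂ) * (z + starRingEnd ℂ z) = (z.re : ℂ) := by
    intro z; rw [Complex.add_conj]; push_cast; ring
  refine ⟨(1/2:ℂ) • (c + d), fun w => ⟨?_, ?_⟩⟩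
  · rw [map_smul, map_add, Pi.smul_apply, Pi.add_apply, h1, smul_eq_mul, key, ← Complex.ofReal_sub,
      Complex.norm_real]; exact (hc w).1
  · rw [map_smul, map_smul, map_add, map_add, Pi.smul_apply, Pi.add_apply, h2, smul_eq_mul, key, ← Complex.ofReal_sub,
      Complex.norm_real]; exact (hc w).2

lemma Gr.add {n : ℕ} {f g f' g' : V} (h : Gr n f g) (h' : Gr n f' g') : Gr n (f + f') (g + g') := by
  intro ε hε
  obtain ⟨c, hc⟩ := h (ε / 2) (by linarith)
  obtain ⟨d, hd⟩ := h' (ε / 2) (by linarith)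
  refine ⟨c + d, fun w => ⟨?_, ?_⟩⟩
  · have := norm_add_le ((f w : ℂ) - ev c w) ((f' w : ℂ) - ev d w)
    have e : ((f + f') w : ℂ) - ev (c + d) w = ((f w : ℂ) - ev c w) + ((f' w : ℂ) - ev d w) := by
      simp; ring
    rw [e]; linarith [(hc w).1, (hd w).1]
  · have := norm_add_le ((g w : ℂ) - ev (Lp n c) w) ((g' w : ℂ) - ev (Lp n d) w)
    have e : ((g + g') w : ℂ) - ev (Lp n (c + d)) w = ((g w : ℂ) - ev (Lp n c) w) + ((g' w : ℂ) - ev (Lp n d) w) := by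
      simp; ring
    rw [e]; linarith [(hc w).2, (hd w).2]

lemma Gr.smul {n : ℕ} {f g : V} (h : Gr n f g) (a : ℝ) : Gr n (a • f) (a • g) := by
  intro ε hε
  have hp : 0 < |a| + 1 := by positivity
  obtain ⟨c, hc⟩ := h (ε / (|a| + 1)) (by positivity)
  have key : |a| * (ε / (|a| + 1)) ≤ ε := by
    rw [mul_div_assoc', div_le_iff₀ hp]; nlinarith [abs_nonneg a]
  refine ⟨(a : ℂ) • c, fun w => ⟨?_, ?_⟩⟩
  · have e : ((a • f) w : ℂ) - ev ((a : ℂ) • c) w = (a : ℂ) * ((f w : ℂ) - ev c w) := by simp; ring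
    rw [e, norm_mul, Complex.norm_real, Real.norm_eq_abs]
    exact (mul_le_mul_of_nonneg_left (hc w).1 (abs_nonneg a)).trans key
  · have e : ((a • g) w : ℂ) - ev (Lp n ((a : ℂ) • c)) w = (a : ℂ) * ((g w : ℂ) - ev (Lp n c) w) := by simp; ring
    rw [e, norm_mul, Complex.norm_real, Real.norm_eq_abs]
    exact (mul_le_mul_of_nonneg_left (hc w).2 (abs_nonneg a)).trans key

lemma Gr.sub {n : ℕ} {f g f' g' : V} (h : Gr n f g) (h' : Gr n f' g') : Gr n (f - f') (g - g') := by
  have := h.add (h'.smul (-1))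
  simpa [sub_eq_add_neg] using this

lemma V_le (f : V) (w : Dk) : |f w| ≤ ‖f‖ := f.norm_coe_le_norm w

lemma Gr_closed (n : ℕ) {f g : V} (h : ∀ ε : ℝ, 0 < ε → ∃ f' g' : V, Gr n f' g' ∧ ‖f - f'‖ ≤ ε ∧ ‖g - g'‖ ≤ ε) :
    Gr n f g := by
  intro ε hε
  obtain ⟨f', g', hG, h1, h2⟩ := h (ε / 2) (by linarith)
  obtain ⟨c, hc⟩ := hG (ε / 2) (by linarith)
  have aux : ∀ (f f' : V) (w : Dk) (z : ℂ), ‖f - f'‖ ≤ ε / 2 → ‖(f' w : ℂ) - z‖ ≤ ε / 2 → ‖(f w : ℂ) - z‖ ≤ ε := by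
    intro f f' w z h1 h2
    have h3 := (V_le (f - f') w).trans h1
    rw [← Real.norm_eq_abs, ← Complex.norm_real] at h3
    have := norm_add_le (((f - f') w : ℝ) : ℂ) ((f' w : ℂ) - z)
    have e : (f w : ℂ) - z = (((f - f') w : ℝ) : ℂ) + ((f' w : ℂ) - z) := by simp
    rw [e]; linarith
  exact ⟨c, fun w => ⟨aux f f' w _ h1 (hc w).1, aux g g' w _ h2 (hc w).2⟩⟩

def reC (f : ℂ → ℂ) (hf : ContinuousOn f Dk) : V := ⟨fun w => (f w).re, Complex.continuous_re.comp hf.domRestrict⟩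

/-- regular functions are in the graph -/
lemma Gr_reg (n : ℕ) (hn : 1 ≤ n) {F : ℂ → ℂ} (hF : Reg F) (f h : V) (hf : ∀ w : Dk, f w = (F w).re)
    (hh : ∀ w : Dk, h w = (Lop n F w).re) : Gr n f h := by
  apply Gr_of_re
  intro ε hε
  obtain ⟨d, hd⟩ := dense_ev h ε hε
  obtain ⟨γ, rfl⟩ := Bm_surj n hn d
  set c := Bm n (mult (fun q => (lam n q)⁻¹) γ) with hc
  have hLc : Lp n c = Bm n γ := by
    rw [hc, Lp_Bm, mult_mult]
    congr 1; ext q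
    have := lam_one n hn q
    rw [mult_apply, mul_inv_cancel₀ (by linarith)]; simp
  obtain ⟨r1, r2⟩ := Reg_Lop_ev n c
  have hb : ∀ w : Dk, |h w - (ev (Bm n γ) w).re| ≤ ε := by
    intro w
    have := (Complex.abs_re_le_norm _).trans (hd w)
    simpa using this
  refine ⟨c, fun w => ⟨?_, by rw [hLc]; exact hb w⟩⟩
  have := MP_re n (hF.sub r1) ε (fun u hu => by
    rw [Lop_sub n hF r1 hu, r2 u hu, hLc, Complex.sub_re]
    have h1 := hb ⟨u, mem_closedBall_zero_iff.2 hu⟩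
    rwa [hh] at h1) w (Dk_le w)
  rw [hf]
  have hn' : (1:ℝ) ≤ n := by exact_mod_cast hn
  have h3 : |(F w).re - (ev c w).re| = |((F - ev c) w).re| := by simp
  have h4 : |((F - ev c) w).re| ≤ (n:ℝ) ^ 2 * |((F - ev c) w).re| :=
    le_mul_of_one_le_left (abs_nonneg _) (by nlinarith)
  rw [h3]; exact h4.trans this

lemma Gr_poly (n : ℕ) (hn : 1 ≤ n) (c : Poly) : Gr n (reC (ev c) (ev_cont c).continuousOn)
    (reC (ev (Lp n c)) (ev_cont _).continuousOn) := by
  obtain ⟨r1, r2⟩ := Reg_Lop_ev n c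
  exact Gr_reg n hn r1 _ _ (fun w => rfl) (fun w => by rw [r2 w (Dk_le w)]; rfl)

/-- integration functional -/
def E (n : ℕ) : V →L[ℝ] ℝ := LinearMap.mkContinuous
  { toFun := fun f => ∫ w : Dk, f w ∂nu n
    map_add' := fun f g => integral_add (nu_integrable n f.continuous) (nu_integrable n g.continuous)
    map_smul' := fun a f => integral_const_mul a _ } (vol n) (fun f => by
      have := norm_integral_le_of_norm_le_const (μ := nu n) (f := fun w => f w) (C := ‖f‖)
        (Eventually.of_forall fun w => f.norm_coe_le_norm w)
      rw [mul_comm]; exact this)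

lemma E_apply (n : ℕ) (f : V) : E n f = ∫ w : Dk, f w ∂nu n := rfl

lemma E_le (n : ℕ) (f : V) : |E n f| ≤ vol n * ‖f‖ := LinearMap.mkContinuous_norm_le _ (vol_nonneg n) _ |> fun h =>
  ((E n).le_opNorm f).trans (mul_le_mul_of_nonneg_right h (norm_nonneg _))

lemma E_mono (n : ℕ) {f g : V} (h : ∀ w, f w ≤ g w) : E n f ≤ E n g :=
  integral_mono (nu_integrable n f.continuous) (nu_integrable n g.continuous) h

lemma E_one (n : ℕ) : E n 1 = vol n := by simp [E_apply, vol]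

def aF : V := ⟨fun w => (w : ℂ).re, by fun_prop⟩
def bF : V := ⟨fun w => (w : ℂ).im, by fun_prop⟩

lemma Ec_close (n : ℕ) (f : ℂ → ℂ) (hf : Continuous f) (g : V) (u : ℂ → ℂ) (hu : Continuous u) (K : ℝ)
    (huK : ∀ w : Dk, ‖u w‖ ≤ K) (ε : ℝ) (h : ∀ w : Dk, ‖(g w : ℂ) - f w‖ ≤ ε) :
    ‖∫ w : Dk, (g w : ℂ) * u w ∂nu n - Ec n (fun w => f w * u w)‖ ≤ ε * K * vol n := by
  unfold Ec
  rw [← integral_sub]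
  · refine norm_integral_le_of_norm_le_const (Eventually.of_forall fun w => ?_)
    rw [← sub_mul, norm_mul]
    exact mul_le_mul (h w) (huK w) (norm_nonneg _) ((norm_nonneg _).trans (h w))
  · apply nu_integrable; fun_prop
  · apply nu_integrable; fun_prop

lemma ev_ep10 (n : ℕ) (w : ℂ) : ev (ep n (1, 0)) w = w := by
  simp [ev_ep, mi, co_zero, mon, ch]

lemma ev_ep01 (n : ℕ) (w : ℂ) : ev (ep n (0, 1)) w = starRingEnd ℂ w := by
  simp [ev_ep, mi, co_zero, mon, ch]

lemma Gr_sym (n : ℕ) (hn : 1 ≤ n) {f g f' g' : V} (h : Gr n f g) (h' : Gr n f' g') :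
    E n (f * g') = E n (g * f') := by
  have key : ∀ ε : ℝ, 0 < ε → ε ≤ 1 → |E n (f * g') - E n (g * f')| ≤
      ε * ((‖f‖ + ‖g'‖ + ‖g‖ + ‖f'‖ + 2) * vol n) := by
    intro ε hε hε1
    obtain ⟨c, hc⟩ := h ε hε
    obtain ⟨d, hd⟩ := h' ε hε
    have aux : ∀ (f g : V) (c d : Poly), (∀ w : Dk, ‖(f w : ℂ) - ev c w‖ ≤ ε) → (∀ w : Dk, ‖(g w : ℂ) - ev d w‖ ≤ ε) →
        ‖((E n (f * g) : ℝ) : ℂ) - Ec n (ev c * ev d)‖ ≤ ε * ((‖f‖ + ‖g‖ + 1) * vol n) := by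
      intro f g c d h1 h2
      rw [E_apply, ← integral_complex_ofReal]
      unfold Ec
      rw [← integral_sub]
      · have := norm_integral_le_of_norm_le_const (μ := nu n)
          (f := fun w : Dk => (((f * g) w : ℝ) : ℂ) - (ev c * ev d) (w:ℂ)) (C := ε * (‖f‖ + ‖g‖ + 1)) (Eventually.of_forall fun w => by
            have e : (((f * g) w : ℝ) : ℂ) - (ev c * ev d) (w:ℂ) = (f w : ℂ) * ((g w : ℂ) - ev d w) + ((f w : ℂ) - ev c w) * (g w : ℂ)
                - ((f w : ℂ) - ev c w) * ((g w : ℂ) - ev d w) := by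
              simp; ring
            rw [e]
            have a1 : ‖(f w : ℂ)‖ ≤ ‖f‖ := by rw [Complex.norm_real]; exact f.norm_coe_le_norm w
            have a2 : ‖(g w : ℂ)‖ ≤ ‖g‖ := by rw [Complex.norm_real]; exact g.norm_coe_le_norm w
            refine (norm_sub_le _ _).trans ?_
            refine (add_le_add (norm_add_le _ _) le_rfl).trans ?_
            rw [norm_mul, norm_mul, norm_mul]
            have b1 := mul_le_mul a1 (h2 w) (norm_nonneg _) (norm_nonneg _)
            have b2 := mul_le_mul (h1 w) a2 (norm_nonneg _) hε.le
            have b3 := mul_le_mul (h1 w) (h2 w) (norm_nonneg _) hε.le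
            nlinarith)
        refine this.trans (le_of_eq ?_)
        unfold vol; ring
      · apply nu_integrable; fun_prop
      · apply nu_integrable
        exact ((ev_cont c).mul (ev_cont d)).comp continuous_subtype_val
    have h1 := aux f g' c (Lp n d) (fun w => (hc w).1) (fun w => (hd w).2)
    have h2 := aux g f' (Lp n c) d (fun w => (hc w).2) (fun w => (hd w).1)
    rw [Ec_sym n hn] at h1
    rw [← Real.norm_eq_abs, ← Complex.norm_real]
    push_cast
    have := norm_sub_le (((E n (f * g') : ℝ) : ℂ) - Ec n (ev (Lp n c) * ev d)) (((E n (g * f') : ℝ) : ℂ) - Ec n (ev (Lp n c) * ev d))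
    rw [sub_sub_sub_cancel_right] at this
    linarith
  by_contra hne
  have hpos : 0 < |E n (f * g') - E n (g * f')| := abs_pos.2 (sub_ne_zero.2 hne)
  set K := (‖f‖ + ‖g'‖ + ‖g‖ + ‖f'‖ + 2) * vol n with hK
  have hK0 : 0 ≤ K := mul_nonneg (by positivity) (vol_nonneg n)
  set D := |E n (f * g') - E n (g * f')|
  have h1 := key (min 1 (D / (2 * (K + 1)))) (by positivity) (min_le_left _ _)
  have h2 : min 1 (D / (2 * (K + 1))) * K ≤ D / (2 * (K + 1)) * K := mul_le_mul_of_nonneg_right (min_le_right _ _) hK0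
  have h3 : D / (2 * (K + 1)) * K ≤ D / 2 := by
    rw [div_mul_eq_mul_div, div_le_div_iff₀ (by positivity) (by norm_num)]; nlinarith
  linarith

end Heis

namespace Heis
open Complex (I)

lemma le_eps {x y K : ℝ} (h : ∀ ε : ℝ, 0 < ε → ε ≤ 1 → x ≤ y + ε * K) : x ≤ y := by
  by_contra hc
  push Not at hc
  have hK : 0 < |K| + 1 := by positivity
  have h0 : 0 < min 1 ((x - y) / (2 * (|K| + 1))) := by
    apply lt_min one_pos; apply div_pos <;> linarith
  have h1 := h _ h0 (min_le_left _ _)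
  have h2 : min 1 ((x - y) / (2 * (|K| + 1))) * K ≤ (x - y) / (2 * (|K| + 1)) * (|K| + 1) :=
    (mul_le_mul_of_nonneg_left (by linarith [le_abs_self K]) h0.le).trans
      (mul_le_mul_of_nonneg_right (min_le_right _ _) hK.le)
  have h3 : (x - y) / (2 * (|K| + 1)) * (|K| + 1) = (x - y) / 2 := by field_simp
  linarith

def Orth (n : ℕ) (f : V) : Prop := E n (aF * f) = 0 ∧ E n (bF * f) = 0

lemma V_norm_le {f : V} {C : ℝ} (h : ∀ w, |f w| ≤ C) : ‖f‖ ≤ C := by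
  have : 0 ≤ C := (abs_nonneg _).trans (h ⟨0, by simp⟩)
  exact (ContinuousMap.norm_le _ this).2 h

lemma E_cplx (n : ℕ) (f : V) : ∫ w : Dk, (f w : ℂ) * starRingEnd ℂ (w:ℂ) ∂nu n = E n (aF * f) - I * E n (bF * f) ∧
    ∫ w : Dk, (f w : ℂ) * (w:ℂ) ∂nu n = E n (aF * f) + I * E n (bF * f) := by
  have i1 : Integrable (fun w : Dk => (((aF * f) w : ℝ) : ℂ)) (nu n) := nu_integrable n (by fun_prop)
  have i2 : Integrable (fun w : Dk => I * (((bF * f) w : ℝ) : ℂ)) (nu n) := nu_integrable n (by fun_prop)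
  have e1 : ∀ w : Dk, starRingEnd ℂ (w:ℂ) = (w:ℂ).re - I * (w:ℂ).im := fun w => by
    apply Complex.ext <;> simp
  have e2 : ∀ w : Dk, (w:ℂ) = (w:ℂ).re + I * (w:ℂ).im := fun w => by
    apply Complex.ext <;> simp
  rw [E_apply, E_apply, ← integral_complex_ofReal, ← integral_complex_ofReal, ← integral_const_mul,
    ← integral_sub i1 i2, ← integral_add i1 i2]
  constructor
  · refine integral_congr_ae (.of_forall fun w => ?_)
    simp only [e1, ContinuousMap.mul_apply, aF, bF, ContinuousMap.coe_mk]; push_cast; ring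
  · refine integral_congr_ae (.of_forall fun w => ?_)
    conv_lhs => simp only []; rw [e2 w]
    simp only [ContinuousMap.mul_apply, aF, bF, ContinuousMap.coe_mk]; push_cast; ring

def drop2 (γ : Poly) : Poly := (γ.erase (1, 0)).erase (0, 1)

lemma drop2_apply (γ : Poly) : drop2 γ (1, 0) = 0 ∧ drop2 γ (0, 1) = 0 ∧ ∀ q, q ≠ (1, 0) → q ≠ (0, 1) → drop2 γ q = γ q := by
  refine ⟨?_, ?_, fun q h1 h2 => ?_⟩
  · rw [drop2, Finsupp.erase_ne (by decide), Finsupp.erase_same]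
  · rw [drop2, Finsupp.erase_same]
  · rw [drop2, Finsupp.erase_ne h2, Finsupp.erase_ne h1]

lemma ev_drop2 (n : ℕ) (γ : Poly) (w : ℂ) : ev (Bm n γ) w = ev (Bm n (drop2 γ)) w + (γ (1, 0) * w + γ (0, 1) * starRingEnd ℂ w) := by
  obtain ⟨h1, h2, h3⟩ := drop2_apply γ
  have e : γ = drop2 γ + (Finsupp.single (1, 0) (γ (1, 0)) + Finsupp.single (0, 1) (γ (0, 1))) := by
    ext q
    by_cases q1 : q = (1, 0)
    · subst q1; simp [h1]
    by_cases q2 : q = (0, 1)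
    · subst q2; simp [h2]
    · simp [h3 q q1 q2, Ne.symm q1, Ne.symm q2]
  conv_lhs => rw [e]
  simp only [map_add, Bm_single, Pi.add_apply, map_smul, Pi.smul_apply, ev_ep10, ev_ep01, smul_eq_mul]

lemma coef_small (n : ℕ) (hn : 1 ≤ n) (γ : Poly) (g : V) (hg : Orth n g) (ε : ℝ)
    (h : ∀ w : Dk, ‖(g w : ℂ) - ev (Bm n γ) w‖ ≤ ε) :
    ‖γ (1, 0)‖ ≤ ε * (vol n * (Nq n (1, 0))⁻¹) ∧ ‖γ (0, 1)‖ ≤ ε * (vol n * (Nq n (0, 1))⁻¹) := by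
  obtain ⟨e1, e2⟩ := E_cplx n g
  rw [hg.1, hg.2] at e1 e2
  have a1 := Ec_close n _ (ev_cont (Bm n γ)) g (fun w => starRingEnd ℂ w) (by fun_prop) 1 (fun w => by simpa using Dk_le w) ε h
  have a2 := Ec_close n _ (ev_cont (Bm n γ)) g (fun w => w) (by fun_prop) 1 (fun w => by simpa using Dk_le w) ε h
  have b1 := ip_Bm n hn γ (1, 0)
  have b2 := ip_Bm n hn γ (0, 1)
  simp only [ev_ep10, ev_ep01, Complex.conj_conj] at b1 b2
  rw [e1, b1] at a1
  rw [e2, b2] at a2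
  simp only [Complex.ofReal_zero, mul_zero, sub_zero, add_zero, zero_sub, norm_neg, norm_mul, Complex.norm_real,
    Real.norm_eq_abs, mul_one] at a1 a2
  have n1 := Nq_pos n hn (1, 0)
  have n2 := Nq_pos n hn (0, 1)
  rw [abs_of_pos n1] at a1
  rw [abs_of_pos n2] at a2
  constructor
  · rw [← mul_assoc, ← div_eq_mul_inv, le_div_iff₀ n1]; exact a1
  · rw [← mul_assoc, ← div_eq_mul_inv, le_div_iff₀ n2]; exact a2

def Kd (n : ℕ) : ℝ := vol n * (Nq n (1, 0))⁻¹ + vol n * (Nq n (0, 1))⁻¹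

lemma drop_close (n : ℕ) (hn : 1 ≤ n) (γ : Poly) (g : V) (hg : Orth n g) (ε : ℝ)
    (h : ∀ w : Dk, ‖(g w : ℂ) - ev (Bm n γ) w‖ ≤ ε) (w : Dk) :
    ‖(g w : ℂ) - ev (Bm n (drop2 γ)) w‖ ≤ ε * (1 + Kd n) := by
  obtain ⟨c1, c2⟩ := coef_small n hn γ g hg ε h
  have e : (g w : ℂ) - ev (Bm n (drop2 γ)) w = ((g w : ℂ) - ev (Bm n γ) w) +
      (γ (1, 0) * w + γ (0, 1) * starRingEnd ℂ (w:ℂ)) := by rw [ev_drop2 n γ]; ring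
  rw [e]
  refine (norm_add_le _ _).trans ((add_le_add (h w) (norm_add_le _ _)).trans ?_)
  rw [norm_mul, norm_mul, RCLike.norm_conj]
  have hw := Dk_le w
  have := mul_le_of_le_one_right (norm_nonneg (γ (1,0))) hw
  have := mul_le_of_le_one_right (norm_nonneg (γ (0,1))) hw
  unfold Kd; nlinarith

lemma mult_gap_drop (n : ℕ) (γ : Poly) : mult (fun q => lam n q - lam1 n) (drop2 γ) = mult (lam n) γ - (lam1 n : ℂ) • γ := by
  obtain ⟨h1, h2, h3⟩ := drop2_apply γ
  ext q
  simp only [mult_apply, Finsupp.sub_apply, Finsupp.smul_apply, smul_eq_mul]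
  by_cases q1 : q = (1, 0)
  · subst q1; rw [h1]; simp [lam, lam1]; ring
  by_cases q2 : q = (0, 1)
  · subst q2; rw [h2]; simp [lam, lam1]; ring
  · rw [h3 q q1 q2]; push_cast; ring

lemma est (n : ℕ) (hn : 1 ≤ n) : ∃ C, 0 < C ∧ ∀ f h : V, Gr n f h → Orth n f → ‖f‖ ≤ C * ‖h - lam1 n • f‖ := by
  obtain ⟨C, hC, H⟩ := main_est n hn
  have hl : 0 ≤ lam1 n := by unfold lam1; positivity
  refine ⟨C, hC, fun f h hG hf => le_eps (K := 1 + Kd n + C * (1 + lam1 n)) fun ε hε _ => ?_⟩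
  obtain ⟨c, hc⟩ := hG ε hε
  obtain ⟨γ, rfl⟩ := Bm_surj n hn c
  have d1 := drop_close n hn γ f hf ε (fun w => (hc w).1)
  obtain ⟨h1, h2, h3⟩ := drop2_apply γ
  have key := H (drop2 γ) (‖h - lam1 n • f‖ + ε * (1 + lam1 n)) (by positivity) h1 h2 (fun w hw => by
    have hw' : w ∈ Dk := by simpa using hw
    have b := hc ⟨w, hw'⟩
    rw [mult_gap_drop, map_sub, ← Lp_Bm, map_smul, map_sub, map_smul, Pi.sub_apply, Pi.smul_apply, smul_eq_mul]
    have e : ev (Lp n (Bm n γ)) w - (lam1 n : ℂ) * ev (Bm n γ) w = (((h - lam1 n • f) ⟨w, hw'⟩ : ℝ) : ℂ)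
      - ((h ⟨w, hw'⟩ : ℂ) - ev (Lp n (Bm n γ)) w) + lam1 n * ((f ⟨w, hw'⟩ : ℂ) - ev (Bm n γ) w) := by
      simp; ring
    rw [e]
    refine (norm_add_le _ _).trans ((add_le_add (norm_sub_le _ _) le_rfl).trans ?_)
    rw [norm_mul, Complex.norm_real, Complex.norm_real, Real.norm_eq_abs, Real.norm_eq_abs, abs_of_nonneg hl]
    have := V_le (h - lam1 n • f) ⟨w, hw'⟩
    have := mul_le_mul_of_nonneg_left b.1 hl
    linarith [b.2])
  apply V_norm_le
  intro w
  have a := norm_add_le ((f w : ℂ) - ev (Bm n (drop2 γ)) w) (ev (Bm n (drop2 γ)) w)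
  rw [sub_add_cancel, Complex.norm_real, Real.norm_eq_abs] at a
  have := key w (Dk_le w)
  have := d1 w
  nlinarith

lemma Orth_sub {n : ℕ} {f g : V} (hf : Orth n f) (hg : Orth n g) : Orth n (f - g) := by
  unfold Orth; rw [mul_sub, mul_sub, map_sub, map_sub, hf.1, hf.2, hg.1, hg.2]; simp

lemma Orth_lim {n : ℕ} {u : ℕ → V} {f : V} (hu : ∀ i, Orth n (u i)) (h : Tendsto u atTop (𝓝 f)) : Orth n f := by
  have aux : ∀ a : V, (∀ i, E n (a * u i) = 0) → E n (a * f) = 0 := by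
    intro a ha
    have : Tendsto (fun i => E n (a * u i)) atTop (𝓝 (E n (a * f))) :=
      ((E n).continuous.tendsto _).comp (h.const_mul a)
    simp only [ha] at this
    exact (tendsto_nhds_unique this tendsto_const_nhds)
  exact ⟨aux _ fun i => (hu i).1, aux _ fun i => (hu i).2⟩

lemma Orth_poly (n : ℕ) (hn : 1 ≤ n) (γ : Poly) (h1 : γ (1, 0) = 0) (h2 : γ (0, 1) = 0) :
    Orth n (reC (ev (Bm n γ)) (ev_cont _).continuousOn) := by
  have b1 := ip_Bm n hn γ (1, 0)
  have b2 := ip_Bm n hn γ (0, 1)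
  simp only [ev_ep10, ev_ep01, Complex.conj_conj, h1, h2, zero_mul] at b1 b2
  have i1 : Integrable (fun w : Dk => ev (Bm n γ) w * starRingEnd ℂ (w:ℂ)) (nu n) :=
    nu_integrable n (by have := ev_cont (Bm n γ); fun_prop)
  have i2 : Integrable (fun w : Dk => ev (Bm n γ) w * (w:ℂ)) (nu n) :=
    nu_integrable n (by have := ev_cont (Bm n γ); fun_prop)
  unfold Ec at b1 b2
  have s := integral_add i1 i2
  have d := integral_sub i2 i1
  rw [b1, b2] at s d
  have rs := integral_re (i1.add i2)
  have rd := integral_im (i2.sub i1)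
  constructor
  · rw [E_apply]
    have : ∀ w : Dk, (aF * reC (ev (Bm n γ)) (ev_cont _).continuousOn) w =
      (1/2) * RCLike.re (((fun w : Dk => ev (Bm n γ) w * starRingEnd ℂ (w:ℂ)) + (fun w : Dk => ev (Bm n γ) w * (w:ℂ))) w) := by
      intro w; simp [aF, reC]; ring
    simp only [this]
    rw [integral_const_mul, rs]
    simp only [Pi.add_apply, s]; simp
  · rw [E_apply]
    have : ∀ w : Dk, (bF * reC (ev (Bm n γ)) (ev_cont _).continuousOn) w =
      (1/2) * RCLike.im (((fun w : Dk => ev (Bm n γ) w * (w:ℂ)) - (fun w : Dk => ev (Bm n γ) w * starRingEnd ℂ (w:ℂ))) w) := by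
      intro w; simp [bF, reC]; ring
    simp only [this]
    rw [integral_const_mul, rd]
    simp only [Pi.sub_apply, d]; simp

lemma solve (n : ℕ) (hn : 1 ≤ n) (g : V) (hg : Orth n g) : ∃ f : V, Gr n f (lam1 n • f + g) ∧ Orth n f := by
  have step : ∀ i : ℕ, ∃ f h : V, Gr n f h ∧ Orth n f ∧ ‖h - lam1 n • f - g‖ ≤ (1 / ((i:ℝ) + 1)) * (1 + Kd n) := by
    intro i
    obtain ⟨d, hd⟩ := dense_ev g (1 / ((i:ℝ) + 1)) (by positivity)
    obtain ⟨γ, rfl⟩ := Bm_surj n hn d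
    have d1 := drop_close n hn γ g hg _ hd
    obtain ⟨h1, h2, h3⟩ := drop2_apply γ
    set γ' := mult (fun q => (lam n q - lam1 n)⁻¹) (drop2 γ) with hγ'
    refine ⟨_, _, Gr_poly n hn (Bm n γ'), Orth_poly n hn γ' (by rw [hγ', mult_apply, h1, mul_zero]) (by rw [hγ', mult_apply, h2, mul_zero]), ?_⟩
    apply V_norm_le
    intro w
    have e : Lp n (Bm n γ') - (lam1 n : ℂ) • Bm n γ' = Bm n (drop2 γ) := by
      rw [Lp_Bm, ← map_smul, ← map_sub]
      congr 1
      ext q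
      simp only [hγ', mult_apply, Finsupp.sub_apply, Finsupp.smul_apply, smul_eq_mul]
      by_cases q1 : q = (1, 0)
      · subst q1; rw [h1]; simp
      by_cases q2 : q = (0, 1)
      · subst q2; rw [h2]; simp
      have : lam n q - lam1 n ≠ 0 := by
        intro h0; have := lam_gap n hn q q1 q2; rw [h0] at this; norm_num at this
      have h5 : ((lam n q : ℂ) - lam1 n) ≠ 0 := by exact_mod_cast this
      push_cast; field_simp
    have e2 : ev (Lp n (Bm n γ')) w - (lam1 n : ℂ) * ev (Bm n γ') w = ev (Bm n (drop2 γ)) w := by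
      rw [← e, map_sub, map_smul]; simp
    have e3 := congrArg Complex.re e2
    simp only [Complex.sub_re, Complex.re_ofReal_mul] at e3
    have e4 : (reC (ev (Lp n (Bm n γ'))) (ev_cont _).continuousOn - lam1 n • reC (ev (Bm n γ')) (ev_cont _).continuousOn - g) w =
      -((g w : ℂ) - ev (Bm n (drop2 γ)) w).re := by
      simp only [reC, ContinuousMap.sub_apply, ContinuousMap.smul_apply, ContinuousMap.coe_mk, smul_eq_mul, Complex.sub_re, Complex.ofReal_re]
      linarith
    rw [e4, abs_neg]
    exact (Complex.abs_re_le_norm _).trans (d1 w)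
  choose f h hG hO hb using step
  obtain ⟨C, hC, H⟩ := est n hn
  have hKd : 0 ≤ 1 + Kd n := by
    have := Nq_pos n hn (1,0); have := Nq_pos n hn (0,1); have := vol_nonneg n; unfold Kd; positivity
  have lim0 : Tendsto (fun i : ℕ => (1 / ((i:ℝ) + 1)) * (1 + Kd n)) atTop (𝓝 0) := by
    simpa using tendsto_one_div_add_atTop_nhds_zero_nat.mul_const (1 + Kd n)
  have hcau : CauchySeq f := by
    refine cauchySeq_of_le_tendsto_0 (fun N : ℕ => C * (2 * ((1 / ((N:ℝ) + 1)) * (1 + Kd n)))) (fun i j N hi hj => ?_)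
      (by simpa using (lim0.const_mul 2).const_mul C)
    rw [dist_eq_norm]
    refine (H _ _ ((hG i).sub (hG j)) (Orth_sub (hO i) (hO j))).trans (mul_le_mul_of_nonneg_left ?_ hC.le)
    have mono : ∀ i : ℕ, N ≤ i → 1 / ((i:ℝ) + 1) * (1 + Kd n) ≤ 1 / ((N:ℝ) + 1) * (1 + Kd n) := fun i hi => by
      gcongr
    have e : h i - h j - lam1 n • (f i - f j) = (h i - lam1 n • f i - g) - (h j - lam1 n • f j - g) := by
      rw [smul_sub]; abel
    rw [e]
    refine (norm_sub_le _ _).trans ?_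
    linarith [hb i, hb j, mono i hi, mono j hj]
  obtain ⟨F, hF⟩ := cauchySeq_tendsto_of_complete hcau
  refine ⟨F, Gr_closed n fun ε hε => ?_, Orth_lim hO hF⟩
  have hh : Tendsto h atTop (𝓝 (lam1 n • F + g)) := by
    have t1 : Tendsto (fun i => h i - lam1 n • f i - g) atTop (𝓝 0) := squeeze_zero_norm hb lim0
    have := (t1.add (hF.const_smul (lam1 n))).add_const g
    rw [zero_add] at this
    refine this.congr fun i => ?_
    abel
  obtain ⟨i, hi1, hi2⟩ := ((Metric.tendsto_nhds.1 hF ε hε).and (Metric.tendsto_nhds.1 hh ε hε)).exists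
  exact ⟨f i, h i, hG i, by rw [← dist_eq_norm, dist_comm]; exact hi1.le, by rw [← dist_eq_norm, dist_comm]; exact hi2.le⟩

lemma ev_Lp_single (n : ℕ) (q : ℕ × ℕ) (a w : ℂ) : ev (Lp n (Finsupp.single q a)) w =
    a * ((lam n q : ℂ) * mon q w - 4 * q.1 * q.2 * mon (q.1 - 1, q.2 - 1) w) := by
  rw [Lp_single, map_smul, map_sub, Pi.smul_apply, Pi.sub_apply, ev_single, ev_single, smul_eq_mul]

lemma Gr_one (n : ℕ) (hn : 1 ≤ n) : Gr n 1 (((n:ℝ) ^ 2) • (1 : V)) := by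
  have h := Gr_poly n hn (Finsupp.single (0, 0) 1)
  convert h using 1
  · ext w; simp [reC, ev_single, mon]
  · ext w; simp only [reC, ContinuousMap.coe_mk, ev_Lp_single]; simp [mon, lam]; ring

lemma Gr_aF (n : ℕ) (hn : 1 ≤ n) : Gr n aF (lam1 n • aF) := by
  have h := Gr_poly n hn (Finsupp.single (1, 0) 1)
  convert h using 1
  · ext w; simp [reC, ev_single, mon, aF]
  · ext w; simp only [reC, ContinuousMap.coe_mk, ev_Lp_single]; simp [mon, lam, lam1, aF]; left; ring

lemma Gr_bF (n : ℕ) (hn : 1 ≤ n) : Gr n bF (lam1 n • bF) := by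
  have h := Gr_poly n hn (Finsupp.single (1, 0) (-I))
  convert h using 1
  · ext w; simp [reC, ev_single, mon, bF]
  · ext w; simp only [reC, ContinuousMap.coe_mk, ev_Lp_single]; simp [mon, lam, lam1, bF]; left; ring

lemma vol_pos (n : ℕ) : 0 < vol n := by
  unfold vol; rw [measureReal_def]
  exact ENNReal.toReal_pos (isOpen_univ.measure_ne_zero _ Set.univ_nonempty) (measure_ne_top _ _)

/-- second moment -/
def m2 (n : ℕ) : ℝ := E n (aF * aF)

lemma moments (n : ℕ) : E n aF = 0 ∧ E n bF = 0 ∧ E n (aF * bF) = 0 ∧ E n (bF * bF) = m2 n ∧ 0 < m2 n := by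
  have h1 := mom_off n (1, 0) (by decide)
  have h2 := mom_off n (2, 0) (by decide)
  have a := (E_cplx n 1).2
  have b := (E_cplx n aF).2
  have c := (E_cplx n bF).2
  have e1 : E n aF + I * E n bF = 0 := by
    rw [mul_one, mul_one] at a
    rw [← a, ← h1]; unfold Ec mon; simp
  have e2 : ((E n (aF * aF) : ℝ) : ℂ) + I * E n (bF * aF) + I * (E n (aF * bF) + I * E n (bF * bF)) = 0 := by
    rw [← b, ← c, ← h2, ← integral_const_mul, ← integral_add]
    · unfold Ec
      refine integral_congr_ae (.of_forall fun w => ?_)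
      simp only [aF, bF, ContinuousMap.coe_mk, mon]
      have := Complex.re_add_im (w:ℂ)
      calc _ = (w:ℂ) * (((w:ℂ).re : ℂ) + (w:ℂ).im * I) := by ring
        _ = _ := by rw [this]; simp; ring
    · exact nu_integrable n (by fun_prop)
    · exact nu_integrable n (by fun_prop)
  have r1 := congrArg Complex.re e1
  have r2 := congrArg Complex.im e1
  have r3 := congrArg Complex.re e2
  have r4 := congrArg Complex.im e2
  simp at r1 r2 r3 r4
  rw [mul_comm bF aF] at r4
  refine ⟨r1, r2, by linarith, by unfold m2; linarith, ?_⟩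
  have h3 : m2 n + E n (bF * bF) = mo n 1 := by
    have := mom_diag n 1
    unfold Ec at this
    unfold m2
    rw [← Complex.ofReal_inj, ← this, ← map_add, E_apply, ← integral_complex_ofReal]
    refine integral_congr_ae (.of_forall fun w => ?_)
    simp only [aF, bF, ContinuousMap.coe_mk, mon, pow_one, Complex.mul_conj, ContinuousMap.add_apply, ContinuousMap.mul_apply, Complex.normSq_apply]
  have := mo_pos n 1
  unfold m2 at *; linarith

end Heis

namespace Heis
open Complex (I)

abbrev SU := {g : ℂ × ℂ // ‖g.1‖ ^ 2 - ‖g.2‖ ^ 2 = 1}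

lemma su_eq (g : SU) : g.1.1 * starRingEnd ℂ g.1.1 - g.1.2 * starRingEnd ℂ g.1.2 = 1 := by
  rw [Complex.mul_conj, Complex.mul_conj, Complex.normSq_eq_norm_sq, Complex.normSq_eq_norm_sq]
  exact_mod_cast g.2

lemma su_lt (g : SU) : ‖g.1.2‖ < ‖g.1.1‖ := by
  have := g.2
  by_contra h
  push Not at h
  nlinarith [norm_nonneg g.1.1]

def dn (g : SU) (w : ℂ) : ℂ := g.1.1 + g.1.2 * w

lemma dn_pos (g : SU) {w : ℂ} (hw : ‖w‖ ≤ 1) : 0 < ‖dn g w‖ := by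
  have h1 : ‖g.1.1‖ ≤ ‖dn g w‖ + ‖g.1.2 * w‖ := by
    have := norm_sub_le (dn g w) (g.1.2 * w)
    simpa [dn] using this
  rw [norm_mul] at h1
  nlinarith [su_lt g, norm_nonneg g.1.2]

lemma dn_ne (g : SU) {w : ℂ} (hw : ‖w‖ ≤ 1) : dn g w ≠ 0 := norm_pos_iff.1 (dn_pos g hw)

def tau (g : SU) (w : ℂ) : ℂ := (starRingEnd ℂ g.1.2 + starRingEnd ℂ g.1.1 * w) / dn g w

lemma tau_norm (g : SU) {w : ℂ} (hw : ‖w‖ ≤ 1) : 1 - ‖tau g w‖ ^ 2 = (1 - ‖w‖ ^ 2) / ‖dn g w‖ ^ 2 := by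
  have h0 := dn_pos g hw
  rw [tau, norm_div, div_pow, eq_div_iff (by positivity), sub_mul, div_mul_cancel₀ _ (by positivity), one_mul]
  have e := su_eq g
  have : ((‖dn g w‖ ^ 2 - ‖starRingEnd ℂ g.1.2 + starRingEnd ℂ g.1.1 * w‖ ^ 2 : ℝ) : ℂ) = ((1 - ‖w‖ ^ 2 : ℝ) : ℂ) := by
    push_cast
    simp only [← Complex.mul_conj', dn, map_add, map_mul, Complex.conj_conj]
    linear_combination (1 - w * starRingEnd ℂ w) * e
  exact_mod_cast this

lemma tau_le (g : SU) {w : ℂ} (hw : ‖w‖ ≤ 1) : ‖tau g w‖ ≤ 1 := by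
  have h := tau_norm g hw
  have : 0 ≤ (1 - ‖w‖ ^ 2) / ‖dn g w‖ ^ 2 := div_nonneg (by nlinarith [norm_nonneg w]) (by positivity)
  nlinarith [norm_nonneg (tau g w)]

lemma dn_cont (g : SU) : Continuous (dn g) := by unfold dn; fun_prop

def tauD (g : SU) : C(Dk, Dk) := ⟨fun w => ⟨tau g w, by simpa using tau_le g (Dk_le w)⟩, by
  apply Continuous.subtype_mk
  unfold tau
  have := dn_cont g
  exact Continuous.div (by fun_prop) (by fun_prop) fun w => dn_ne g (Dk_le w)⟩

lemma tauD_coe (g : SU) (w : Dk) : (tauD g w : ℂ) = tau g w := rfl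

def dV (g : SU) (k : ℕ) : V := ⟨fun w => (‖dn g w‖ ^ k)⁻¹, by
  have := dn_cont g
  exact Continuous.inv₀ (by fun_prop) fun w => pow_ne_zero _ (dn_pos g (Dk_le w)).ne'⟩

lemma dV_apply (g : SU) (k : ℕ) (w : Dk) : dV g k w = (‖dn g w‖ ^ k)⁻¹ := rfl
lemma dV_pos (g : SU) (k : ℕ) (w : Dk) : 0 < dV g k w := by
  have := dn_pos g (Dk_le w)
  rw [dV_apply]; positivity

/-- product -/
def gm (g h : SU) : SU := ⟨(g.1.2 * starRingEnd ℂ h.1.2 + g.1.1 * h.1.1, g.1.2 * starRingEnd ℂ h.1.1 + g.1.1 * h.1.2), by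
  have e1 := su_eq g
  have e2 := su_eq h
  have : ((‖g.1.2 * starRingEnd ℂ h.1.2 + g.1.1 * h.1.1‖ ^ 2 - ‖g.1.2 * starRingEnd ℂ h.1.1 + g.1.1 * h.1.2‖ ^ 2 : ℝ) : ℂ) = (1:ℝ) := by
    push_cast
    simp only [← Complex.mul_conj', map_add, map_mul, Complex.conj_conj]
    linear_combination e1 + (g.1.1 * starRingEnd ℂ g.1.1 - g.1.2 * starRingEnd ℂ g.1.2) * e2
  exact_mod_cast this⟩

def gi (g : SU) : SU := ⟨(starRingEnd ℂ g.1.1, -g.1.2), by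
  have := g.2
  simpa using this⟩

lemma dn_gm (g h : SU) {w : ℂ} (hw : ‖w‖ ≤ 1) : dn (gm g h) w = dn g (tau h w) * dn h w := by
  have h0 := dn_ne h hw
  simp only [dn, gm, tau] at *
  field_simp; ring

lemma tau_gm (g h : SU) {w : ℂ} (hw : ‖w‖ ≤ 1) : tau (gm g h) w = tau g (tau h w) := by
  have h0 := dn_ne h hw
  have h1 := dn_ne g (tau_le h hw)
  have e := dn_gm g h hw
  conv_lhs => rw [tau, e]
  conv_rhs => rw [tau]
  rw [div_eq_div_iff (mul_ne_zero h1 h0) h1]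
  have e2 : tau h w * dn h w = starRingEnd ℂ h.1.2 + starRingEnd ℂ h.1.1 * w := div_mul_cancel₀ _ h0
  have e3 : dn h w = h.1.1 + h.1.2 * w := rfl
  have : starRingEnd ℂ (gm g h).1.2 + starRingEnd ℂ (gm g h).1.1 * w =
    (starRingEnd ℂ g.1.2 + starRingEnd ℂ g.1.1 * tau h w) * dn h w := by
    rw [add_mul, mul_assoc, e2, e3]; simp only [gm, map_add, map_mul, Complex.conj_conj]; ring
  rw [this]; ring

lemma tauD_gm (g h : SU) (w : Dk) : tauD (gm g h) w = tauD g (tauD h w) := Subtype.ext (tau_gm g h (Dk_le w))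

lemma tau_gi (g : SU) {w : ℂ} (hw : ‖w‖ ≤ 1) : tau g (tau (gi g) w) = w := by
  rw [← tau_gm g (gi g) hw]
  have e1 := su_eq g
  have a1 : (gm g (gi g)).1.1 = 1 := by simp only [gm, gi, map_neg]; linear_combination e1
  have a2 : (gm g (gi g)).1.2 = 0 := by simp only [gm, gi, Complex.conj_conj]; ring
  simp [tau, dn, a1, a2]

lemma tauD_gi (g : SU) (w : Dk) : tauD g (tauD (gi g) w) = w := Subtype.ext (tau_gi g (Dk_le w))
lemma gi_gi (g : SU) : gi (gi g) = g := by apply Subtype.ext; simp [gi]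
lemma tauD_gi' (g : SU) (w : Dk) : tauD (gi g) (tauD g w) = w := by
  have := tauD_gi (gi g) w
  rwa [gi_gi] at this

lemma dn_gi (g : SU) {w : ℂ} (hw : ‖w‖ ≤ 1) : dn g (tau (gi g) w) * dn (gi g) w = 1 := by
  rw [← dn_gm g (gi g) hw]
  have e1 := su_eq g
  have a1 : (gm g (gi g)).1.1 = 1 := by simp only [gm, gi, map_neg]; linear_combination e1
  have a2 : (gm g (gi g)).1.2 = 0 := by simp only [gm, gi, Complex.conj_conj]; ring
  simp [dn, a1, a2]

lemma tau_deriv (g : SU) {w : ℂ} (hw : ‖w‖ ≤ 1) : HasDerivAt (tau g) (1 / dn g w ^ 2) w := by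
  have h0 := dn_ne g hw
  have e := su_eq g
  have hd : HasDerivAt (dn g) g.1.2 w := by
    have := ((hasDerivAt_id w).const_mul g.1.2).const_add g.1.1
    rw [mul_one] at this; exact this
  have hN : HasDerivAt (fun w => starRingEnd ℂ g.1.2 + starRingEnd ℂ g.1.1 * w) (starRingEnd ℂ g.1.1) w := by
    simpa using ((hasDerivAt_id w).const_mul (starRingEnd ℂ g.1.1)).const_add (starRingEnd ℂ g.1.2)
  refine (hN.fun_div hd h0).congr_deriv ?_
  congr 1
  unfold dn; linear_combination e

/-- change of variables -/
lemma E_inv (n : ℕ) (hn : 1 ≤ n) (g : SU) (f : V) : E n (dV g (2 * n + 2) * f.comp (tauD g)) = E n f := by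
  obtain ⟨F, hF⟩ : ∃ F : ℂ → ℝ, ∀ w : Dk, F w = f w :=
    ⟨fun w => by classical exact if h : w ∈ Dk then f ⟨w, h⟩ else 0, fun w => by simp only [dif_pos w.2]⟩
  have h1 : E n f = ∫ w : Dk, F w ∂nu n := by simp only [E_apply, hF]
  have h2 : E n (dV g (2 * n + 2) * f.comp (tauD g)) = ∫ w : Dk, (fun w => (‖dn g w‖ ^ (2 * n + 2))⁻¹ * F (tau g w)) (w:ℂ) ∂nu n := by
    rw [E_apply]
    refine integral_congr_ae (.of_forall fun w => ?_)
    simp only [ContinuousMap.mul_apply, dV_apply, ContinuousMap.comp_apply, ← hF, tauD_coe]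
  rw [h1, h2, integral_nu n F, integral_nu n (fun w => (‖dn g w‖ ^ (2 * n + 2))⁻¹ * F (tau g w))]
  have him : tau g '' Dk = Dk := by
    ext w
    constructor
    · rintro ⟨u, hu, rfl⟩; simpa using tau_le g (by simpa using hu)
    · intro hw
      have hw' : ‖w‖ ≤ 1 := by simpa using hw
      exact ⟨tau (gi g) w, by simpa using tau_le (gi g) hw', tau_gi g hw'⟩
  conv_rhs => rw [← him]
  rw [integral_image_eq_integral_abs_det_fderiv_smul volume Metric.isClosed_closedBall.measurableSet
    (f' := fun w => ((1 / dn g w ^ 2) • (1 : ℂ →L[ℂ] ℂ)).restrictScalars ℝ)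
    (fun w hw => by
      have := (tau_deriv g (w := w) (by simpa using hw)).hasFDerivAt.restrictScalars ℝ
      refine (this.congr_fderiv ?_).hasFDerivWithinAt
      ext; simp [mul_comm])
    (fun u hu v hv huv => by
      have a := tauD_gi' g ⟨u, hu⟩
      have b := tauD_gi' g ⟨v, hv⟩
      have c : tauD g ⟨u, hu⟩ = tauD g ⟨v, hv⟩ := Subtype.ext huv
      rw [c] at a
      exact congrArg Subtype.val (a.symm.trans b))]
  refine setIntegral_congr_fun Metric.isClosed_closedBall.measurableSet fun w hw => ?_
  have hw' : ‖w‖ ≤ 1 := by simpa using hw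
  have h0 := dn_pos g hw'
  have hdet : (((1 / dn g w ^ 2) • (1 : ℂ →L[ℂ] ℂ)).restrictScalars ℝ : ℂ →L[ℝ] ℂ).det = (‖dn g w‖ ^ 4)⁻¹ := by
    have e : (((1 / dn g w ^ 2) • (1 : ℂ →L[ℂ] ℂ)).restrictScalars ℝ : ℂ →L[ℝ] ℂ).det = Algebra.norm ℝ (1 / dn g w ^ 2) := by
      rw [Algebra.norm_apply, ContinuousLinearMap.det]
      congr 1
    rw [e, Algebra.norm_complex_apply, Complex.normSq_eq_norm_sq]
    rw [norm_div, norm_pow, norm_one, one_div, inv_pow, ← pow_mul]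
  simp only [hdet, smul_eq_mul, tau_norm g hw']
  rw [abs_of_pos (by positivity), div_pow]
  obtain ⟨m, rfl⟩ : ∃ m, n = m + 1 := ⟨n - 1, by omega⟩
  simp only [Nat.add_sub_cancel]
  field_simp
  ring

/-- half power -/
def sg (n : ℕ) (g : SU) (w : ℂ) : ℂ := (1 + g.1.2 / g.1.1 * w) ^ (-(n:ℂ) / 2)

lemma su_A (g : SU) : g.1.1 ≠ 0 := norm_pos_iff.1 ((norm_nonneg _).trans_lt (su_lt g))

lemma sg_slit (g : SU) {w : ℂ} (hw : ‖w‖ ≤ 1) : 1 + g.1.2 / g.1.1 * w ∈ Complex.slitPlane := by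
  left
  have h1 : ‖g.1.2 / g.1.1 * w‖ < 1 := by
    rw [norm_mul, norm_div]
    have hA := norm_pos_iff.2 (su_A g)
    have : ‖g.1.2‖ / ‖g.1.1‖ < 1 := by rw [div_lt_one hA]; exact su_lt g
    have h2 : 0 ≤ ‖g.1.2‖ / ‖g.1.1‖ := by positivity
    nlinarith [norm_nonneg w]
  have := Complex.abs_re_le_norm (g.1.2 / g.1.1 * w)
  rw [abs_le] at this
  simp only [Complex.add_re, Complex.one_re]; linarith

lemma sg_norm (n : ℕ) (g : SU) {w : ℂ} (hw : ‖w‖ ≤ 1) :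
    sg n g w * starRingEnd ℂ (sg n g w) = ((‖g.1.1‖ ^ n * (‖dn g w‖ ^ n)⁻¹ : ℝ) : ℂ) := by
  have hs := sg_slit g hw
  have hA := norm_pos_iff.2 (su_A g)
  have h0 := dn_pos g hw
  have e : 1 + g.1.2 / g.1.1 * w = dn g w / g.1.1 := by unfold dn; field_simp [su_A g]
  rw [Complex.mul_conj, Complex.normSq_eq_norm_sq]
  congr 1
  unfold sg
  rw [Complex.norm_cpow_of_ne_zero (Complex.slitPlane_ne_zero hs), e, norm_div]
  have : (-(n:ℂ) / 2) = ((-(n:ℝ) / 2 : ℝ) : ℂ) := by push_cast; ring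
  rw [this, Complex.ofReal_re, Complex.ofReal_im, mul_zero, Real.exp_zero, div_one, ← Real.rpow_natCast, ← Real.rpow_mul (by positivity)]
  have e2 : (-(n:ℝ) / 2 * ((2:ℕ):ℝ)) = -(n:ℝ) := by push_cast; ring
  rw [e2, Real.rpow_neg (by positivity), Real.rpow_natCast, div_pow]
  field_simp

lemma sg_deriv (n : ℕ) (g : SU) {w : ℂ} (hw : ‖w‖ ≤ 1) :
    HasDerivAt (sg n g) (-(n:ℂ) / 2 * g.1.2 / dn g w * sg n g w) w := by
  have hs := sg_slit g hw
  have hs0 := Complex.slitPlane_ne_zero hs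
  have h1 : HasDerivAt (fun w => 1 + g.1.2 / g.1.1 * w) (g.1.2 / g.1.1) w := by
    simpa using ((hasDerivAt_id w).const_mul (g.1.2 / g.1.1)).const_add 1
  refine (h1.cpow_const (c := -(n:ℂ) / 2) hs).congr_deriv ?_
  have e : 1 + g.1.2 / g.1.1 * w = dn g w / g.1.1 := by unfold dn; field_simp [su_A g]
  rw [Complex.cpow_sub _ _ hs0, Complex.cpow_one]
  unfold sg
  rw [e]
  have := su_A g; have := dn_ne g hw
  field_simp

lemma sg_an (n : ℕ) (g : SU) {w : ℂ} (hw : ‖w‖ ≤ 1) (j : ℕ) : AnalyticAt ℂ (fun u => sg n g u * tau g u ^ j) w := by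
  have h1 : AnalyticAt ℂ (sg n g) w := by
    unfold sg
    exact AnalyticAt.cpow (by fun_prop) (by fun_prop) (sg_slit g hw)
  have h2 : AnalyticAt ℂ (tau g) w := by
    unfold tau
    exact AnalyticAt.div (by fun_prop) (by unfold dn; fun_prop) (dn_ne g hw)
  exact h1.mul (h2.pow j)

lemma pair_deriv (n : ℕ) (g : SU) {w : ℂ} (hw : ‖w‖ ≤ 1) (j : ℕ) :
    deriv (fun u => sg n g u * tau g u ^ j) w = sg n g w / dn g w *
      (-g.1.2 * ((n:ℂ) / 2 * tau g w ^ j + tau g w * (j * tau g w ^ (j - 1))) + starRingEnd ℂ g.1.1 * (j * tau g w ^ (j - 1))) ∧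
    w * deriv (fun u => sg n g u * tau g u ^ j) w + n / 2 * (sg n g w * tau g w ^ j) = sg n g w / dn g w *
      (g.1.1 * ((n:ℂ) / 2 * tau g w ^ j + tau g w * (j * tau g w ^ (j - 1))) - starRingEnd ℂ g.1.2 * (j * tau g w ^ (j - 1))) := by
  have h0 := dn_ne g hw
  have e := su_eq g
  have hd := ((sg_deriv n g hw).fun_mul ((tau_deriv g hw).fun_pow j)).deriv
  rw [hd]
  generalize ha : (j:ℂ) * tau g w ^ (j - 1) = a
  generalize tau g w ^ j = m
  have ht : tau g w * dn g w = starRingEnd ℂ g.1.2 + starRingEnd ℂ g.1.1 * w := div_mul_cancel₀ _ h0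
  have hD : dn g w = g.1.1 + g.1.2 * w := rfl
  generalize tau g w = t at *
  generalize dn g w = D at *
  constructor
  · field_simp
    linear_combination sg n g w * (2 * a * g.1.2 * ht - 2 * a * starRingEnd ℂ g.1.1 * hD - 2 * a * e)
  · field_simp
    linear_combination sg n g w * (n * D * m * hD - 2 * a * g.1.1 * ht + 2 * a * starRingEnd ℂ g.1.2 * hD - 2 * a * w * e)

lemma pair_Lop (n : ℕ) (g : SU) {w : ℂ} (hw : ‖w‖ ≤ 1) (q : ℕ × ℕ) :
    Lop n (fun u => (sg n g u * tau g u ^ q.1) * starRingEnd ℂ (sg n g u * tau g u ^ q.2)) w =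
    ((‖g.1.1‖ ^ n * (‖dn g w‖ ^ (n + 2))⁻¹ : ℝ) : ℂ) * ev (Lp n (Finsupp.single q 1)) (tau g w) := by
  have h0 := dn_ne g hw
  have e := su_eq g
  rw [Lop_hol n (sg_an n g hw q.1) (sg_an n g hw q.2)]
  obtain ⟨a1, a2⟩ := pair_deriv n g hw q.1
  obtain ⟨b1, b2⟩ := pair_deriv n g hw q.2
  rw [a2, b2, a1, b1, ev_Lp_single]
  have hs : ((‖g.1.1‖ ^ n * (‖dn g w‖ ^ (n + 2))⁻¹ : ℝ) : ℂ) = sg n g w / dn g w * starRingEnd ℂ (sg n g w / dn g w) := by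
    rw [map_div₀, div_mul_div_comm, sg_norm n g hw, Complex.mul_conj, Complex.normSq_eq_norm_sq, ← Complex.ofReal_div]
    congr 1
    have := dn_pos g hw
    field_simp
    ring
  rw [hs]
  simp only [map_mul, map_add, map_sub, map_neg, Complex.conj_conj, map_natCast, map_pow, map_div₀, map_ofNat, mon, lam]
  have p1 : ∀ (t : ℂ) (j : ℕ), t * ((j:ℂ) * t ^ (j - 1)) = j * t ^ j := by
    intro t j; cases j with
    | zero => simp
    | succ j => simp [pow_succ]; ring
  rw [p1, p1]
  push_cast
  linear_combination (4 * (sg n g w / dn g w * (starRingEnd ℂ (sg n g w) / starRingEnd ℂ (dn g w))) *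
    (((n:ℂ) / 2 + q.1) * (n / 2 + q.2) * tau g w ^ q.1 * starRingEnd ℂ (tau g w) ^ q.2
     - q.1 * q.2 * tau g w ^ (q.1 - 1) * starRingEnd ℂ (tau g w) ^ (q.2 - 1))) * e

lemma poly_tau (n : ℕ) (g : SU) (c : Poly) : ∃ F : ℂ → ℂ, Reg F ∧ ∀ w : ℂ, ‖w‖ ≤ 1 →
    F w = (((‖dn g w‖ ^ n)⁻¹ : ℝ) : ℂ) * ev c (tau g w) ∧ Lop n F w = (((‖dn g w‖ ^ (n + 2))⁻¹ : ℝ) : ℂ) * ev (Lp n c) (tau g w) := by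
  induction c using Finsupp.induction_linear with
  | zero => exact ⟨0, fun w _ => contDiffAt_const, fun w _ => ⟨by simp, by
      have := Lop_smul n (f := fun _ => (0:ℂ)) (fun w _ => contDiffAt_const) 0 (w := w) ‹_›
      rw [zero_smul] at this; rw [this]; simp⟩⟩
  | add c d hc hd =>
    obtain ⟨F, h1, h2⟩ := hc
    obtain ⟨G, h3, h4⟩ := hd
    refine ⟨F + G, h1.add h3, fun w hw => ⟨?_, ?_⟩⟩
    · rw [Pi.add_apply, (h2 w hw).1, (h4 w hw).1, map_add, Pi.add_apply]; ring
    · rw [Lop_add n h1 h3 hw, (h2 w hw).2, (h4 w hw).2, map_add, map_add, Pi.add_apply]; ring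
  | single q a =>
    have hA := norm_pos_iff.2 (su_A g)
    have hR := Reg_hol (F := fun u => sg n g u * tau g u ^ q.1) (G := fun u => sg n g u * tau g u ^ q.2)
      (fun w hw => sg_an n g hw q.1) (fun w hw => sg_an n g hw q.2)
    refine ⟨((((‖g.1.1‖ ^ n)⁻¹ : ℝ) : ℂ) * a) • _, hR.smul _, fun w hw => ⟨?_, ?_⟩⟩
    · have e : (sg n g w * tau g w ^ q.1) * starRingEnd ℂ (sg n g w * tau g w ^ q.2) =
        (sg n g w * starRingEnd ℂ (sg n g w)) * mon q (tau g w) := by simp [mon]; ring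
      have hA' : (‖g.1.1‖ : ℂ) ≠ 0 := by exact_mod_cast hA.ne'
      simp only [Pi.smul_apply, smul_eq_mul, e, sg_norm n g hw, ev_single]
      push_cast; field_simp
    · have hA' : (‖g.1.1‖ : ℂ) ≠ 0 := by exact_mod_cast hA.ne'
      rw [Lop_smul n hR _ hw, pair_Lop n g hw, ev_Lp_single, ev_Lp_single]
      push_cast; field_simp

/-- covariance -/
lemma Gr_tau (n : ℕ) (hn : 1 ≤ n) (g : SU) {f h : V} (hG : Gr n f h) :
    Gr n (dV g n * f.comp (tauD g)) (dV g (n + 2) * h.comp (tauD g)) := by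
  apply Gr_closed
  intro ε hε
  set K := ‖dV g n‖ + ‖dV g (n + 2)‖ + 1 with hK
  have hK0 : 0 < K := by positivity
  obtain ⟨c, hc⟩ := hG (ε / K) (by positivity)
  obtain ⟨F, hF, hF2⟩ := poly_tau n g c
  refine ⟨dV g n * (reC (ev c) (ev_cont c).continuousOn).comp (tauD g), dV g (n + 2) * (reC (ev (Lp n c)) (ev_cont _).continuousOn).comp (tauD g), ?_, ?_, ?_⟩
  · apply Gr_reg n hn hF
    · intro w
      rw [(hF2 w (Dk_le w)).1, Complex.re_ofReal_mul]; rfl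
    · intro w
      rw [(hF2 w (Dk_le w)).2, Complex.re_ofReal_mul]; rfl
  all_goals
    rw [← mul_sub]
    refine (norm_mul_le _ _).trans ?_
    have hle : ∀ f' : V, (∀ w, |f' w| ≤ ε / K) → ‖f'‖ ≤ ε / K := fun f' h => V_norm_le h
    have e : ε = K * (ε / K) := by field_simp
    rw [e]
    refine mul_le_mul (by rw [hK]; linarith [norm_nonneg (dV g n), norm_nonneg (dV g (n + 2))]) (hle _ fun w => ?_) (norm_nonneg _) hK0.le
  · have := (Complex.abs_re_le_norm _).trans (hc (tauD g w)).1
    simpa [reC] using this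
  · have := (Complex.abs_re_le_norm _).trans (hc (tauD g w)).2
    simpa [reC] using this

end Heis

namespace Heis

def pp (n : ℕ) : ℝ := ((n:ℝ) + 2) / n

lemma pp_bd (n : ℕ) (hn : 1 ≤ n) : 1 < pp n ∧ pp n ≤ 3 := by
  have : (1:ℝ) ≤ n := by exact_mod_cast hn
  unfold pp
  constructor
  · rw [lt_div_iff₀ (by linarith)]; linarith
  · rw [div_le_iff₀ (by linarith)]; linarith

lemma pp_lam (n : ℕ) (hn : 1 ≤ n) : (n:ℝ) ^ 2 * pp n = lam1 n := by
  have : (1:ℝ) ≤ n := by exact_mod_cast hn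
  unfold pp lam1; field_simp

def Pw (n : ℕ) (v : V) : V := ⟨fun w => |v w| ^ pp n, by
  have h0 : 0 ≤ pp n := by unfold pp; positivity
  have := v.continuous
  exact Continuous.rpow_const (by fun_prop) fun _ => Or.inr h0⟩

lemma sc1 {q t r : ℝ} (hq0 : 0 < q) (hq : q ≤ 2) (hr : r ≤ 1/2) (ht : |t - 1| ≤ r) : |t ^ q - 1| ≤ 3 * r := by
  rw [abs_le] at ht
  have ht0 : 0 < t := by linarith
  rcases le_total 1 t with h | h
  · have a := Real.one_le_rpow h hq0.le
    have b := Real.rpow_le_rpow_of_exponent_le h hq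
    rw [Real.rpow_two] at b
    rw [abs_of_nonneg (by linarith)]; nlinarith
  · have a := Real.rpow_le_one ht0.le h hq0.le
    have b := Real.rpow_le_rpow_of_exponent_ge ht0 h hq
    rw [Real.rpow_two] at b
    rw [abs_of_nonpos (by linarith)]; nlinarith

lemma sc2 {p x y r : ℝ} (hp : 1 < p) (hp3 : p ≤ 3) (hr : r ≤ 1/2) (hx : |x - 1| ≤ r) (hy : |y - 1| ≤ r) :
    |x ^ p - y ^ p - p * (x - y)| ≤ 9 * r * |x - y| := by
  have hr0 : 0 ≤ r := (abs_nonneg _).trans hx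
  have h := Convex.norm_image_sub_le_of_norm_hasDerivWithin_le (f := fun t : ℝ => t ^ p - p * t)
    (f' := fun t => p * t ^ (p - 1) - p) (s := Set.Icc (1 - r) (1 + r)) (C := 9 * r) (x := y) (y := x)
    (fun t ht => by
      have : t ≠ 0 := by have := ht.1; linarith
      have := (Real.hasDerivAt_rpow_const (p := p) (Or.inl this)).sub ((hasDerivAt_id t).const_mul p)
      rw [mul_one] at this
      exact this.hasDerivWithinAt)
    (fun t ht => by
      have := sc1 (q := p - 1) (t := t) (by linarith) (by linarith) hr (by rw [abs_le]; constructor <;> linarith [ht.1, ht.2])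
      have e : p * t ^ (p - 1) - p = p * (t ^ (p - 1) - 1) := by ring
      rw [e, norm_mul, Real.norm_eq_abs, Real.norm_eq_abs, abs_of_pos (by linarith)]
      nlinarith [abs_nonneg (t ^ (p - 1) - 1)])
    (convex_Icc _ _) (by rw [abs_le] at hy; constructor <;> linarith) (by rw [abs_le] at hx; constructor <;> linarith)
  simp only [Real.norm_eq_abs] at h
  convert h using 2; ring

lemma sc3 {p x y : ℝ} (hp : 1 < p) (hp3 : p ≤ 3) (hx : |x - 1| ≤ 1/2) (hy : |y - 1| ≤ 1/2) :
    |x ^ p - y ^ p| ≤ 8 * |x - y| := by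
  have h := sc2 hp hp3 le_rfl hx hy
  have : x ^ p - y ^ p = (x ^ p - y ^ p - p * (x - y)) + p * (x - y) := by ring
  rw [this]
  refine (abs_add_le _ _).trans ?_
  rw [abs_mul, abs_of_pos (by linarith : (0:ℝ) < p)]
  nlinarith [abs_nonneg (x - y)]

lemma sc4 {p x y : ℝ} (hp : 1 < p) (hp3 : p ≤ 3) (hx : |x - 1| ≤ 1/2) (hy : |y - 1| ≤ 1/2) :
    |x * x ^ p - y * y ^ p - (p + 1) * y ^ p * (x - y)| ≤ 32 * |x - y| ^ 2 := by
  have hx' := abs_le.1 hx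
  have hy' := abs_le.1 hy
  have hI : Set.uIcc y x ⊆ Set.Icc (1/2) (3/2) := by
    apply Set.uIcc_subset_Icc <;> constructor <;> linarith
  have h := Convex.norm_image_sub_le_of_norm_hasDerivWithin_le (f := fun t : ℝ => t ^ (p + 1) - (p + 1) * y ^ p * t)
    (f' := fun t => (p + 1) * t ^ (p + 1 - 1) - (p + 1) * y ^ p) (s := Set.uIcc y x) (C := 32 * |x - y|) (x := y) (y := x)
    (fun t ht => by
      have : t ≠ 0 := by have := (hI ht).1; linarith
      have := (Real.hasDerivAt_rpow_const (p := p + 1) (Or.inl this)).sub ((hasDerivAt_id t).const_mul ((p + 1) * y ^ p))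
      rw [mul_one] at this
      exact this.hasDerivWithinAt)
    (fun t ht => by
      have ht' := hI ht
      have b := sc3 hp hp3 (x := t) (by rw [abs_le]; constructor <;> linarith [ht'.1, ht'.2]) hy
      have c : |t - y| ≤ |x - y| := Set.abs_sub_left_of_mem_uIcc ht
      rw [add_sub_cancel_right, ← mul_sub, norm_mul, Real.norm_eq_abs, Real.norm_eq_abs, abs_of_pos (by linarith)]
      have := abs_nonneg (t ^ p - y ^ p)
      nlinarith)
    (convex_uIcc _ _) Set.left_mem_uIcc Set.right_mem_uIcc
  simp only [Real.norm_eq_abs] at h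
  have ex : x ^ (p + 1) = x * x ^ p := by rw [Real.rpow_add_one (by linarith)]; ring
  have ey : y ^ (p + 1) = y * y ^ p := by rw [Real.rpow_add_one (by linarith)]; ring
  rw [ex, ey] at h
  calc _ = |x * x ^ p - (p + 1) * y ^ p * x - (y * y ^ p - (p + 1) * y ^ p * y)| := by congr 1; ring
    _ ≤ _ := h
    _ = _ := by ring

lemma near_pt {v : V} {r : ℝ} (h : ‖v - 1‖ ≤ r) (w : Dk) : |v w - 1| ≤ r := (V_le (v - 1) w).trans h

lemma Pw_near (n : ℕ) {v : V} (h : ‖v - 1‖ ≤ 1/2) (w : Dk) : Pw n v w = v w ^ pp n := by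
  have := abs_le.1 (near_pt h w)
  show |v w| ^ pp n = _
  rw [abs_of_pos (by linarith)]

lemma Pw_one (n : ℕ) : Pw n 1 = 1 := by ext w; simp [Pw]

lemma Pw_lin (n : ℕ) (hn : 1 ≤ n) {v1 v2 : V} {r : ℝ} (hr : r ≤ 1/2) (h1 : ‖v1 - 1‖ ≤ r) (h2 : ‖v2 - 1‖ ≤ r) :
    ‖Pw n v1 - Pw n v2 - pp n • (v1 - v2)‖ ≤ 9 * r * ‖v1 - v2‖ := by
  obtain ⟨p1, p3⟩ := pp_bd n hn
  apply V_norm_le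
  intro w
  have h := sc2 p1 p3 hr (near_pt h1 w) (near_pt h2 w)
  rw [← Pw_near n (h1.trans hr), ← Pw_near n (h2.trans hr)] at h
  exact h.trans (mul_le_mul_of_nonneg_left (V_le (v1 - v2) w) (by have := (norm_nonneg _).trans h1; linarith))

lemma Pw_lip (n : ℕ) (hn : 1 ≤ n) {v1 v2 : V} (h1 : ‖v1 - 1‖ ≤ 1/2) (h2 : ‖v2 - 1‖ ≤ 1/2) :
    ‖Pw n v1 - Pw n v2‖ ≤ 8 * ‖v1 - v2‖ := by
  obtain ⟨p1, p3⟩ := pp_bd n hn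
  apply V_norm_le
  intro w
  have h := sc3 p1 p3 (near_pt h1 w) (near_pt h2 w)
  rw [← Pw_near n h1, ← Pw_near n h2] at h
  exact h.trans (mul_le_mul_of_nonneg_left (V_le (v1 - v2) w) (by norm_num))

lemma V_one : ‖(1 : V)‖ = 1 := norm_one

lemma Pw_bd (n : ℕ) (hn : 1 ≤ n) {v : V} (h1 : ‖v - 1‖ ≤ 1/2) : ‖Pw n v‖ ≤ 5 := by
  have a := Pw_lip n hn h1 (v2 := 1) (by simp)
  rw [Pw_one] at a
  have b := norm_add_le (Pw n v - 1) 1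
  rw [sub_add_cancel, V_one] at b
  linarith

lemma E_mul_le (n : ℕ) (f g : V) : |E n (f * g)| ≤ vol n * (‖f‖ * ‖g‖) :=
  (E_le n _).trans (mul_le_mul_of_nonneg_left (norm_mul_le _ _) (vol_nonneg n))

lemma ab_le : ‖aF‖ ≤ 1 ∧ ‖bF‖ ≤ 1 :=
  ⟨V_norm_le fun w => (Complex.abs_re_le_norm _).trans (Dk_le w), V_norm_le fun w => (Complex.abs_im_le_norm _).trans (Dk_le w)⟩

/-- projection -/
def Pj (n : ℕ) : V →L[ℝ] V := ContinuousLinearMap.id ℝ V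
  - (((m2 n)⁻¹ • (E n)).comp (ContinuousLinearMap.mul ℝ V aF)).smulRight aF
  - (((m2 n)⁻¹ • (E n)).comp (ContinuousLinearMap.mul ℝ V bF)).smulRight bF

lemma Pj_apply (n : ℕ) (f : V) : Pj n f = f - ((m2 n)⁻¹ * E n (aF * f)) • aF - ((m2 n)⁻¹ * E n (bF * f)) • bF := rfl

lemma Pj_orth (n : ℕ) (f : V) : Orth n (Pj n f) := by
  obtain ⟨-, -, h3, h4, h5⟩ := moments n
  have h3' : E n (bF * aF) = 0 := by rw [mul_comm]; exact h3
  have h6 : E n (aF * aF) = m2 n := rfl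
  rw [Pj_apply]
  constructor
  · rw [mul_sub, mul_sub, map_sub, map_sub, mul_smul_comm, mul_smul_comm, map_smul, map_smul, h3, h6]
    simp only [smul_eq_mul]; field_simp; ring
  · rw [mul_sub, mul_sub, map_sub, map_sub, mul_smul_comm, mul_smul_comm, map_smul, map_smul, h3', h4]
    simp only [smul_eq_mul]; field_simp; ring

lemma Pj_of_orth (n : ℕ) {f : V} (h : Orth n f) : Pj n f = f := by
  rw [Pj_apply, h.1, h.2]; simp

lemma Pj_ab (n : ℕ) (x y : ℝ) : Pj n (x • aF + y • bF) = 0 := by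
  obtain ⟨-, -, h3, h4, h5⟩ := moments n
  have h3' : E n (bF * aF) = 0 := by rw [mul_comm]; exact h3
  have h6 : E n (aF * aF) = m2 n := rfl
  have a : Pj n aF = 0 := by rw [Pj_apply, h6, h3']; simp [h5.ne']
  have b : Pj n bF = 0 := by rw [Pj_apply, h4, h3]; simp [h5.ne']
  rw [map_add, map_smul, map_smul, a, b]; simp

lemma Gr_orth (n : ℕ) (hn : 1 ≤ n) {f h : V} (hG : Gr n f h) : Orth n f → Orth n (h - lam1 n • f) := by
  intro hO
  have a := Gr_sym n hn hG (Gr_aF n hn)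
  have b := Gr_sym n hn hG (Gr_bF n hn)
  rw [mul_smul_comm, map_smul, mul_comm, hO.1, smul_zero] at a
  rw [mul_smul_comm, map_smul, mul_comm, hO.2, smul_zero] at b
  constructor
  · rw [mul_sub, map_sub, mul_smul_comm, map_smul, hO.1, mul_comm, ← a]; simp
  · rw [mul_sub, map_sub, mul_smul_comm, map_smul, hO.2, mul_comm, ← b]; simp

/-- stability -/
lemma stab (n : ℕ) (hn : 1 ≤ n) : ∃ r θ0 C : ℝ, 0 < r ∧ r ≤ 1/2 ∧ 0 < θ0 ∧ θ0 ≤ 1 ∧ 0 < C ∧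
    ∀ (v1 v2 θ1 θ2 e1 e2 : V) (x y : ℝ), ‖v1 - 1‖ ≤ r → ‖v2 - 1‖ ≤ r → ‖θ1‖ ≤ θ0 →
    Gr n v1 (((n:ℝ) ^ 2) • ((1 + θ1) * Pw n v1) - e1) → Gr n v2 (((n:ℝ) ^ 2) • ((1 + θ2) * Pw n v2) - e2) →
    ‖v1 - v2‖ ≤ C * (‖θ1 - θ2‖ + ‖e1 - e2 - (x • aF + y • bF)‖ + |E n (aF * (v1 - v2))| + |E n (bF * (v1 - v2))|) := by
  obtain ⟨C, hC, H⟩ := est n hn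
  set K := ‖Pj n‖ with hK
  have hK0 : 0 ≤ K := norm_nonneg (Pj n)
  have hm := (moments n).2.2.2.2
  have hn1 : (1:ℝ) ≤ n := by exact_mod_cast hn
  set T := C * K * n ^ 2 with hT
  have hT0 : 0 ≤ T := by positivity
  set r := 1 / (36 * (T + 1)) with hr
  have hr0 : 0 < r := by positivity
  have hrT : r * (36 * (T + 1)) = 1 := by rw [hr]; field_simp
  have hr1 : r ≤ 1/36 := by nlinarith
  refine ⟨r, r, 2 * (5 * T + C * K + 2 * (m2 n)⁻¹ + 1), hr0, by linarith, hr0, by linarith, by positivity, ?_⟩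
  intro v1 v2 θ1 θ2 e1 e2 x y h1 h2 ht g1 g2
  set d := v1 - v2 with hd
  set x' := (m2 n)⁻¹ * E n (aF * d) with hx'
  set y' := (m2 n)⁻¹ * E n (bF * d) with hy'
  have hf : Pj n d = d - x' • aF - y' • bF := Pj_apply n d
  have hG := ((g1.sub g2).sub ((Gr_aF n hn).smul x')).sub ((Gr_bF n hn).smul y')
  rw [← hd, ← hf] at hG
  have hO := Pj_orth n d
  have hb := H _ _ hG hO
  have hQ := Gr_orth n hn hG hO
  set M := ((n:ℝ) ^ 2) • ((Pw n v1 - Pw n v2 - pp n • d) + θ1 * (Pw n v1 - Pw n v2) + (θ1 - θ2) * Pw n v2) with hM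
  have key : ((n:ℝ) ^ 2 • ((1 + θ1) * Pw n v1) - e1 - ((n:ℝ) ^ 2 • ((1 + θ2) * Pw n v2) - e2) - x' • lam1 n • aF - y' • lam1 n • bF)
      - lam1 n • Pj n d = M - (e1 - e2) := by
    rw [hf, hM, ← pp_lam n hn]
    simp only [smul_sub, smul_add, smul_smul, add_mul, sub_mul, mul_sub, one_mul]
    module
  rw [key] at hb hQ
  rw [← Pj_of_orth n hQ] at hb
  have e3 : Pj n (M - (e1 - e2)) = Pj n (M - (e1 - e2 - (x • aF + y • bF))) := by
    have : M - (e1 - e2) = M - (e1 - e2 - (x • aF + y • bF)) - (x • aF + y • bF) := by abel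
    rw [this, map_sub, Pj_ab, sub_zero]
  rw [e3] at hb
  have hP := (Pj n).le_opNorm (M - (e1 - e2 - (x • aF + y • bF)))
  have hP2 := norm_sub_le M (e1 - e2 - (x • aF + y • bF))
  have hM1 : ‖M‖ ≤ n ^ 2 * (9 * r * ‖d‖ + r * (8 * ‖d‖) + ‖θ1 - θ2‖ * 5) := by
    rw [hM, norm_smul, Real.norm_eq_abs, abs_of_pos (by positivity)]
    refine mul_le_mul_of_nonneg_left ?_ (by positivity)
    refine (norm_add_le _ _).trans (add_le_add ((norm_add_le _ _).trans (add_le_add (Pw_lin n hn (by linarith) h1 h2) ?_)) ?_)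
    · exact (norm_mul_le _ _).trans (mul_le_mul ht (Pw_lip n hn (by linarith) (by linarith)) (norm_nonneg _) hr0.le)
    · exact (norm_mul_le _ _).trans (mul_le_mul_of_nonneg_left (Pw_bd n hn (by linarith)) (norm_nonneg _))
  have hd1 : ‖d‖ ≤ ‖Pj n d‖ + |x'| + |y'| := by
    have e : d = Pj n d + x' • aF + y' • bF := by rw [hf]; abel
    have a1 := norm_add_le (Pj n d + x' • aF) (y' • bF)
    have a2 := norm_add_le (Pj n d) (x' • aF)
    rw [← e] at a1
    rw [norm_smul, Real.norm_eq_abs] at a1 a2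
    have := mul_le_of_le_one_right (abs_nonneg x') ab_le.1
    have := mul_le_of_le_one_right (abs_nonneg y') ab_le.2
    linarith
  set Z := ‖e1 - e2 - (x • aF + y • bF)‖
  set W := ‖θ1 - θ2‖
  have hxa : |x'| = (m2 n)⁻¹ * |E n (aF * d)| := by rw [hx', abs_mul, abs_of_pos (by positivity)]
  have hya : |y'| = (m2 n)⁻¹ * |E n (bF * d)| := by rw [hy', abs_mul, abs_of_pos (by positivity)]
  rw [hxa, hya] at hd1
  have s1 : ‖Pj n d‖ ≤ C * (K * (n ^ 2 * (9 * r * ‖d‖ + r * (8 * ‖d‖) + W * 5) + Z)) :=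
    hb.trans (mul_le_mul_of_nonneg_left (hP.trans (mul_le_mul_of_nonneg_left (by linarith) hK0)) hC.le)
  have s2 : C * (K * (n ^ 2 * (9 * r * ‖d‖ + r * (8 * ‖d‖) + W * 5) + Z)) = 17 * (T * r) * ‖d‖ + 5 * T * W + C * K * Z := by
    rw [hT]; ring
  have s3 : 17 * (T * r) ≤ 1/2 := by nlinarith
  have s4 : 17 * (T * r) * ‖d‖ ≤ 1/2 * ‖d‖ := mul_le_mul_of_nonneg_right s3 (norm_nonneg _)
  have hA := abs_nonneg (E n (aF * d))
  have hB := abs_nonneg (E n (bF * d))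
  have hW : 0 ≤ W := norm_nonneg _
  have hZ : 0 ≤ Z := norm_nonneg _
  have hmi : 0 < (m2 n)⁻¹ := by positivity
  have hCK : 0 ≤ C * K := by positivity
  have q1 : 0 ≤ T * Z := by positivity
  have q2 : 0 ≤ T * (|E n (aF * d)| + |E n (bF * d)|) := by positivity
  have q3 : 0 ≤ C * K * (W + |E n (aF * d)| + |E n (bF * d)|) := by positivity
  have q4 : 0 ≤ (m2 n)⁻¹ * (W + Z + |E n (aF * d)| + |E n (bF * d)|) := by positivity
  nlinarith

/-- Lyapunov-Schmidt existence -/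
lemma LSex (n : ℕ) (hn : 1 ≤ n) (r : ℝ) (hr : 0 < r) : ∃ θ0 C : ℝ, 0 < θ0 ∧ 0 < C ∧ ∀ θ : V, ‖θ‖ ≤ θ0 →
    ∃ (v : V) (α β : ℝ), ‖v - 1‖ ≤ r ∧ ‖v - 1‖ ≤ C * ‖θ‖ ∧ |α| ≤ C * ‖θ‖ ∧ |β| ≤ C * ‖θ‖ ∧ Orth n (v - 1) ∧
      Gr n v (((n:ℝ) ^ 2) • ((1 + θ) * Pw n v) - (α • aF + β • bF)) := by
  obtain ⟨C, hC, H⟩ := est n hn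
  choose R hR1 hR2 using fun g : V => solve n hn (Pj n g) (Pj_orth n g)
  set K := ‖Pj n‖ with hK
  have hK0 : 0 ≤ K := norm_nonneg (Pj n)
  have hm := (moments n).2.2.2.2
  have hn1 : (1:ℝ) ≤ n := by exact_mod_cast hn
  set T := C * K * n ^ 2 with hT
  have hT0 : 0 ≤ T := by positivity
  have Rlip : ∀ f g, ‖R f - R g‖ ≤ C * (K * ‖f - g‖) := by
    intro f g
    have h := H _ _ ((hR1 f).sub (hR1 g)) (Orth_sub (hR2 f) (hR2 g))
    have e : lam1 n • R f + Pj n f - (lam1 n • R g + Pj n g) - lam1 n • (R f - R g) = Pj n (f - g) := by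
      rw [map_sub, smul_sub]; abel
    rw [e] at h
    exact h.trans (mul_le_mul_of_nonneg_left ((Pj n).le_opNorm _) hC.le)
  have R0 : R 0 = 0 := by
    have h := H _ _ (hR1 0) (hR2 0)
    simp only [map_zero, add_zero, sub_self, norm_zero, mul_zero] at h
    exact norm_le_zero_iff.1 h
  set r1 := min r (1 / (36 * (T + 1))) with hr1
  have hr10 : 0 < r1 := lt_min hr (by positivity)
  have hr1T : r1 * (36 * (T + 1)) ≤ 1 := by
    have := min_le_right r (1 / (36 * (T + 1)))
    calc _ ≤ (1 / (36 * (T + 1))) * (36 * (T + 1)) := mul_le_mul_of_nonneg_right this (by positivity)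
      _ = 1 := by field_simp
  have hr1h : r1 ≤ 1/36 := by nlinarith
  refine ⟨r1 / (2 * (T + 1)), 2 * T + (m2 n)⁻¹ * vol n * (n ^ 2 * (1 + 17 * (2 * T))) + 1, by positivity, ?_, ?_⟩
  · have := vol_nonneg n; positivity
  intro θ hθ
  have hθ1 : ‖θ‖ * (2 * (T + 1)) ≤ r1 := by rwa [le_div_iff₀ (by positivity)] at hθ
  have hθr : ‖θ‖ ≤ r1 := by nlinarith [norm_nonneg θ]
  set N : V → V := fun w => ((n:ℝ) ^ 2) • ((1 + θ) * Pw n (1 + w) - 1 - pp n • w) with hN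
  have Nlip : ∀ w1 w2 : V, ‖w1‖ ≤ r1 → ‖w2‖ ≤ r1 → ‖N w1 - N w2‖ ≤ n ^ 2 * (17 * r1 * ‖w1 - w2‖) := by
    intro w1 w2 h1 h2
    have e : N w1 - N w2 = ((n:ℝ) ^ 2) • ((Pw n (1 + w1) - Pw n (1 + w2) - pp n • (1 + w1 - (1 + w2))) + θ * (Pw n (1 + w1) - Pw n (1 + w2))) := by
      simp only [hN, smul_sub, smul_add, add_mul, mul_sub, one_mul]; module
    have a1 := Pw_lin n hn (v1 := 1 + w1) (v2 := 1 + w2) (r := r1) (by linarith) (by simpa using h1) (by simpa using h2)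
    have a2 := Pw_lip n hn (v1 := 1 + w1) (v2 := 1 + w2) (by simpa using h1.trans (by linarith)) (by simpa using h2.trans (by linarith))
    have e2 : 1 + w1 - (1 + w2) = w1 - w2 := by abel
    rw [e, norm_smul, Real.norm_eq_abs, abs_of_pos (by positivity)]
    refine mul_le_mul_of_nonneg_left ?_ (by positivity)
    refine (norm_add_le _ _).trans ?_
    have a3 := (norm_mul_le θ (Pw n (1 + w1) - Pw n (1 + w2))).trans (mul_le_mul hθr a2 (norm_nonneg _) hr10.le)
    rw [e2] at a1 a3 ⊢
    linarith
  have hN0 : ‖N 0‖ ≤ n ^ 2 * ‖θ‖ := by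
    have : N 0 = ((n:ℝ) ^ 2) • θ := by simp [hN, Pw_one]
    rw [this, norm_smul, Real.norm_eq_abs, abs_of_pos (by positivity)]
  have half : ∀ t : ℝ, 0 ≤ t → C * (K * (n ^ 2 * (17 * r1 * t))) ≤ 1/2 * t := by
    intro t ht
    have : C * (K * (n ^ 2 * (17 * r1 * t))) = (17 * (T * r1)) * t := by rw [hT]; ring
    rw [this]
    exact mul_le_mul_of_nonneg_right (by nlinarith) ht
  have Phi_lip : ∀ w1 w2 : V, ‖w1‖ ≤ r1 → ‖w2‖ ≤ r1 → ‖R (N w1) - R (N w2)‖ ≤ 1/2 * ‖w1 - w2‖ := by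
    intro w1 w2 h1 h2
    refine (Rlip _ _).trans (le_trans ?_ (half _ (norm_nonneg _)))
    exact mul_le_mul_of_nonneg_left (mul_le_mul_of_nonneg_left (Nlip w1 w2 h1 h2) hK0) hC.le
  have Phi0 : ‖R (N 0)‖ ≤ T * ‖θ‖ := by
    have := Rlip (N 0) 0
    rw [R0, sub_zero, sub_zero] at this
    refine this.trans ((mul_le_mul_of_nonneg_left (mul_le_mul_of_nonneg_left hN0 hK0) hC.le).trans (le_of_eq ?_))
    rw [hT]; ring
  have hmaps : Set.MapsTo (fun w => R (N w)) (Metric.closedBall (0:V) r1) (Metric.closedBall (0:V) r1) := by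
    intro w hw
    rw [mem_closedBall_zero_iff] at hw ⊢
    have a := Phi_lip w 0 hw (by simpa using hr10.le)
    rw [sub_zero] at a
    have b := norm_add_le (R (N w) - R (N 0)) (R (N 0))
    rw [sub_add_cancel] at b
    nlinarith [norm_nonneg θ]
  have hcon : ContractingWith (1/2 : NNReal) (hmaps.restrict (fun w => R (N w)) _ _) := by
    refine ⟨by rw [← NNReal.coe_lt_coe]; norm_num, LipschitzWith.of_dist_le_mul fun x y => ?_⟩
    have := Phi_lip x.1 y.1 (mem_closedBall_zero_iff.1 x.2) (mem_closedBall_zero_iff.1 y.2)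
    rw [Subtype.dist_eq, Subtype.dist_eq, dist_eq_norm, dist_eq_norm]
    simpa using this
  obtain ⟨w, hw, hfix, -⟩ := hcon.exists_fixedPoint' Metric.isClosed_closedBall.isComplete hmaps (x := 0) (by simpa using hr10.le) (edist_ne_top _ _)
  have hfix' : R (N w) = w := hfix
  have hw1 := mem_closedBall_zero_iff.1 hw
  have hwθ : ‖w‖ ≤ 2 * T * ‖θ‖ := by
    have a := Phi_lip w 0 hw1 (by simpa using hr10.le)
    rw [sub_zero, hfix'] at a
    have b := norm_add_le (w - R (N 0)) (R (N 0))
    rw [sub_add_cancel] at b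
    linarith
  have hNw : ‖N w‖ ≤ n ^ 2 * (1 + 17 * (2 * T)) * ‖θ‖ := by
    have a := Nlip w 0 hw1 (by simpa using hr10.le)
    have b := norm_add_le (N w - N 0) (N 0)
    rw [sub_add_cancel] at b
    rw [sub_zero] at a
    have c : 17 * r1 * ‖w‖ ≤ 17 * (2 * T * ‖θ‖) := by
      have : r1 * ‖w‖ ≤ 1 * (2 * T * ‖θ‖) := mul_le_mul (by linarith) hwθ (norm_nonneg _) one_pos.le
      linarith
    have d := mul_le_mul_of_nonneg_left c (by positivity : (0:ℝ) ≤ (n:ℝ) ^ 2)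
    linarith
  have hαb : ∀ a : V, ‖a‖ ≤ 1 → |(m2 n)⁻¹ * E n (a * N w)| ≤ (2 * T + (m2 n)⁻¹ * vol n * (n ^ 2 * (1 + 17 * (2 * T))) + 1) * ‖θ‖ := by
    intro a ha
    rw [abs_mul, abs_of_pos (by positivity)]
    have h1 := (E_mul_le n a (N w)).trans (mul_le_mul_of_nonneg_left (mul_le_mul ha hNw (norm_nonneg _) one_pos.le) (vol_nonneg n))
    have h2 := mul_le_mul_of_nonneg_left h1 (by positivity : (0:ℝ) ≤ (m2 n)⁻¹)
    have : 0 ≤ (2 * T + 1) * ‖θ‖ := by positivity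
    nlinarith
  refine ⟨1 + w, (m2 n)⁻¹ * E n (aF * N w), (m2 n)⁻¹ * E n (bF * N w), ?_, ?_, hαb _ ab_le.1, hαb _ ab_le.2, ?_, ?_⟩
  · simpa using hw1.trans (min_le_left _ _)
  · rw [add_sub_cancel_left]
    have := vol_nonneg n
    have : 0 ≤ ((m2 n)⁻¹ * vol n * (n ^ 2 * (1 + 17 * (2 * T))) + 1) * ‖θ‖ := by positivity
    nlinarith
  · rw [add_sub_cancel_left, ← hfix']; exact hR2 _
  · have hg := (Gr_one n hn).add (hR1 (N w))
    rw [hfix', Pj_apply] at hg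
    convert hg using 1
    rw [hN, ← pp_lam n hn]
    simp only [smul_sub, smul_add, smul_smul]
    module

def Jf (n : ℕ) (θ v h : V) : ℝ := 1/2 * E n (v * h) - (n:ℝ) ^ 2 / (pp n + 1) * E n ((1 + θ) * (v * Pw n v))

lemma J_taylor (n : ℕ) (hn : 1 ≤ n) {θ v v' h h' : V} (hv : ‖v - 1‖ ≤ 1/2) (hv' : ‖v' - 1‖ ≤ 1/2) (hθ : ‖θ‖ ≤ 1)
    (g : Gr n v h) (g' : Gr n v' h') :
    |Jf n θ v' h' - Jf n θ v h - E n ((h - ((n:ℝ) ^ 2) • ((1 + θ) * Pw n v)) * (v' - v))| ≤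
      vol n * (64 * n ^ 2) * (‖v' - v‖ * ‖h' - h‖ + ‖v' - v‖ ^ 2) := by
  obtain ⟨p1, p3⟩ := pp_bd n hn
  have hn1 : (1:ℝ) ≤ n := by exact_mod_cast hn
  set d := v' - v with hd
  set k := h' - h with hk
  have hs : E n (v * k) = E n (h * d) := Gr_sym n hn g (g'.sub g)
  set Q := v' * Pw n v' - v * Pw n v - (pp n + 1) • (Pw n v * d) with hQ
  have hQb : ‖Q‖ ≤ 32 * ‖d‖ ^ 2 := by
    apply V_norm_le
    intro w
    have h := sc4 p1 p3 (near_pt hv' w) (near_pt hv w)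
    rw [← Pw_near n hv', ← Pw_near n hv] at h
    have hdw : |v' w - v w| ≤ ‖d‖ := V_le d w
    have : Q w = v' w * Pw n v' w - v w * Pw n v w - (pp n + 1) * Pw n v w * (v' w - v w) := by
      simp [hQ, hd]; ring
    rw [this]
    refine h.trans ?_
    gcongr
  have e : Jf n θ v' h' - Jf n θ v h - E n ((h - ((n:ℝ) ^ 2) • ((1 + θ) * Pw n v)) * d) =
      1/2 * E n (d * k) - (n:ℝ) ^ 2 / (pp n + 1) * E n ((1 + θ) * Q) := by
    have e1 : v' * h' = v * h + v * k + h * d + d * k := by rw [hd, hk]; ring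
    have e2 : v' * Pw n v' = v * Pw n v + (pp n + 1) • (Pw n v * d) + Q := by rw [hQ]; abel
    unfold Jf
    rw [e1, e2]
    simp only [map_add, mul_add, sub_mul, map_sub, smul_mul_assoc, map_smul, hs, mul_smul_comm, smul_eq_mul, add_mul, one_mul, mul_assoc]
    field_simp
    ring
  rw [e]
  have b1 := E_mul_le n d k
  have b2 := E_mul_le n (1 + θ) Q
  have b3 : ‖1 + θ‖ ≤ 2 := (norm_add_le _ _).trans (by rw [V_one]; linarith)
  have b4 : ‖1 + θ‖ * ‖Q‖ ≤ 2 * (32 * ‖d‖ ^ 2) := mul_le_mul b3 hQb (norm_nonneg _) (by norm_num)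
  have hv0 := vol_nonneg n
  have b5 : |E n ((1 + θ) * Q)| ≤ vol n * (64 * ‖d‖ ^ 2) := b2.trans (mul_le_mul_of_nonneg_left (by linarith) hv0)
  have c1 : (n:ℝ) ^ 2 / (pp n + 1) ≤ n ^ 2 := div_le_self (by positivity) (by linarith)
  have c0 : 0 ≤ (n:ℝ) ^ 2 / (pp n + 1) := div_nonneg (by positivity) (by linarith)
  refine (abs_sub _ _).trans ?_
  rw [abs_mul, abs_mul, abs_of_nonneg c0, abs_of_pos (by norm_num : (0:ℝ) < 1/2)]
  have c2 := mul_le_mul c1 b5 (abs_nonneg _) (by positivity)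
  have c3 : vol n * (‖d‖ * ‖k‖) ≤ n ^ 2 * (vol n * (‖d‖ * ‖k‖)) := le_mul_of_one_le_left (by positivity) (by nlinarith)
  have c4 : 0 ≤ (n:ℝ) ^ 2 * (vol n * (‖d‖ * ‖k‖)) := by positivity
  nlinarith

end Heis

namespace Heis
open Complex (I)

def hB (b : ℂ) : SU := ⟨((Real.sqrt (1 + ‖b‖ ^ 2) : ℝ), b), by
  rw [Complex.norm_real, Real.norm_eq_abs, sq_abs, Real.sq_sqrt (by positivity)]; ring⟩

lemma pow_lin (k : ℕ) : ∃ C : ℝ, 0 ≤ C ∧ ∀ z : ℝ, |z| ≤ 2 → |z ^ k - 1 - k * (z - 1)| ≤ C * (z - 1) ^ 2 := by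
  induction k with
  | zero => exact ⟨0, le_rfl, fun z _ => by simp⟩
  | succ k ih =>
    obtain ⟨C, hC, h⟩ := ih
    refine ⟨2 * C + k, by positivity, fun z hz => ?_⟩
    have e : z ^ (k + 1) - 1 - ((k + 1 : ℕ):ℝ) * (z - 1) = z * (z ^ k - 1 - k * (z - 1)) + k * (z - 1) ^ 2 := by
      push_cast; ring
    rw [e]
    refine (abs_add_le _ _).trans ?_
    rw [abs_mul, abs_of_nonneg (by positivity : (0:ℝ) ≤ k * (z - 1) ^ 2)]
    have := mul_le_mul hz (h z hz) (abs_nonneg _) (by norm_num)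
    nlinarith

lemma re_mul_le {b w : ℂ} (hw : ‖w‖ ≤ 1) : |(b * w).re| ≤ ‖b‖ ∧ ‖b * w‖ ≤ ‖b‖ := by
  have h : ‖b * w‖ ≤ ‖b‖ := by
    rw [norm_mul]; exact mul_le_of_le_one_right (norm_nonneg _) hw
  exact ⟨(Complex.abs_re_le_norm _).trans h, h⟩

lemma dn_exp {b w : ℂ} (hb : ‖b‖ ≤ 1/4) (hw : ‖w‖ ≤ 1) :
    |‖dn (hB b) w‖⁻¹ - 1 + (b * w).re| ≤ 12 * ‖b‖ ^ 2 ∧ |‖dn (hB b) w‖⁻¹ - 1| ≤ 4 * ‖b‖ ∧ 1/2 ≤ ‖dn (hB b) w‖ := by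
  obtain ⟨h1, h2⟩ := re_mul_le (b := b) hw
  have hb0 := norm_nonneg b
  set A := Real.sqrt (1 + ‖b‖ ^ 2) with hA
  have hA2 : A ^ 2 = 1 + ‖b‖ ^ 2 := Real.sq_sqrt (by positivity)
  have hA1 : 1 ≤ A := by rw [hA]; exact Real.one_le_sqrt.2 (by nlinarith)
  have hA3 : A ≤ 1 + ‖b‖ ^ 2 := by nlinarith
  set y := ‖dn (hB b) w‖ with hy
  set x := (b * w).re with hx
  have hy2 : y ^ 2 = A ^ 2 + 2 * A * x + ‖b * w‖ ^ 2 := by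
    rw [hy, ← Complex.normSq_eq_norm_sq, ← Complex.normSq_eq_norm_sq]
    have : dn (hB b) w = (A:ℂ) + b * w := rfl
    rw [this, Complex.normSq_apply, Complex.normSq_apply]; simp only [Complex.add_re, Complex.add_im, Complex.ofReal_re, Complex.ofReal_im]
    rw [← hx]; ring
  have hy0 : 0 ≤ y := norm_nonneg _
  have hbw := norm_nonneg (b * w)
  have hx1 := abs_le.1 h1
  have hyl : A - ‖b‖ ≤ y := by
    have h4 : ‖(A:ℂ)‖ ≤ ‖dn (hB b) w‖ + ‖b * w‖ := by
      have : (A:ℂ) = dn (hB b) w - b * w := by simp [dn, hB, ← hA]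
      rw [this]; exact norm_sub_le _ _
    rw [Complex.norm_real, Real.norm_of_nonneg (by linarith)] at h4; linarith
  have hyu : y ≤ A + ‖b‖ := by
    have h4 : ‖dn (hB b) w‖ ≤ ‖(A:ℂ)‖ + ‖b * w‖ := norm_add_le _ _
    rw [Complex.norm_real, Real.norm_of_nonneg (by linarith)] at h4; linarith
  have hyh : 3/4 ≤ y := by linarith
  have d1 : |y - 1| ≤ 5/4 * ‖b‖ := abs_le.2 ⟨by nlinarith, by nlinarith⟩
  have hbw2 : ‖b * w‖ ^ 2 ≤ ‖b‖ ^ 2 := by nlinarith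
  have hx2 : |(A - 1) * x| ≤ ‖b‖ ^ 2 := by
    rw [abs_mul, abs_of_nonneg (by linarith)]; nlinarith [abs_nonneg x]
  have d2 : |y - 1 - x| ≤ 4 * ‖b‖ ^ 2 := by
    have e : 2 * (y - 1 - x) = (2 * ((A - 1) * x) + ‖b‖ ^ 2 + ‖b * w‖ ^ 2) - (y - 1) ^ 2 := by
      nlinarith
    have h5 : (y - 1) ^ 2 ≤ (5/4 * ‖b‖) ^ 2 := sq_le_sq.2 (by rwa [abs_of_nonneg (by positivity : (0:ℝ) ≤ 5/4 * ‖b‖)])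
    have h6 := abs_le.1 hx2
    refine abs_le.2 ⟨by nlinarith [sq_nonneg (y - 1), sq_nonneg (‖b * w‖)], by nlinarith [sq_nonneg (y-1)]⟩
  have hyp : 0 < y := by linarith
  have hi : y⁻¹ ≤ 4/3 := by rw [inv_le_comm₀ hyp (by norm_num)]; linarith
  have hi0 : 0 ≤ y⁻¹ := by positivity
  have e1 : y⁻¹ - 1 = -(y - 1) * y⁻¹ := by field_simp; ring
  have e2 : y⁻¹ - 1 + x = -(y - 1 - x) + (y - 1) ^ 2 * y⁻¹ := by field_simp; ring
  refine ⟨?_, ?_, by linarith⟩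
  · rw [e2]
    refine (abs_add_le _ _).trans ?_
    rw [abs_neg, abs_mul, abs_of_nonneg hi0, abs_of_nonneg (sq_nonneg (y - 1))]
    have h5 : (y - 1) ^ 2 ≤ (5/4 * ‖b‖) ^ 2 := sq_le_sq.2 (by rwa [abs_of_nonneg (by positivity : (0:ℝ) ≤ 5/4 * ‖b‖)])
    have := mul_le_mul h5 hi hi0 (by positivity)
    nlinarith
  · rw [e1, abs_mul, abs_neg, abs_of_nonneg hi0]
    have := mul_le_mul d1 hi hi0 (by positivity)
    nlinarith

lemma dV_exp (k : ℕ) : ∃ C : ℝ, 0 < C ∧ ∀ b : ℂ, ‖b‖ ≤ 1/4 →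
    ‖dV (hB b) k - (1 - (k:ℝ) • (b.re • aF - b.im • bF))‖ ≤ C * ‖b‖ ^ 2 ∧ ‖dV (hB b) k - 1‖ ≤ C * ‖b‖ := by
  obtain ⟨C, hC, H⟩ := pow_lin k
  refine ⟨16 * C + 12 * k + 1, by positivity, fun b hb => ?_⟩
  have hb0 := norm_nonneg b
  have key : ∀ w : Dk, |dV (hB b) k w - (1 - k * ((b * w).re))| ≤ (16 * C + 12 * k) * ‖b‖ ^ 2 ∧ |dV (hB b) k w - 1| ≤ (16 * C + 12 * k) * ‖b‖ := by
    intro w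
    obtain ⟨h1, h2, h3⟩ := dn_exp hb (Dk_le w)
    rw [dV_apply, ← inv_pow]
    set z := ‖dn (hB b) w‖⁻¹
    have hz := abs_le.1 h2
    have hz2 := H z (abs_le.2 ⟨by linarith, by linarith⟩)
    have h4 : (z - 1) ^ 2 ≤ 16 * ‖b‖ ^ 2 := by
      have := sq_le_sq.2 (h2.trans (le_abs_self _)); nlinarith
    have h5 := mul_le_mul_of_nonneg_left h4 hC
    have h6 := mul_le_mul_of_nonneg_left h1 (Nat.cast_nonneg (α := ℝ) k)
    have h7 := mul_le_mul_of_nonneg_left h2 (Nat.cast_nonneg (α := ℝ) k)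
    constructor
    · have e : z ^ k - (1 - k * ((b * w).re)) = (z ^ k - 1 - k * (z - 1)) + k * (z - 1 + (b * w).re) := by ring
      rw [e]; refine (abs_add_le _ _).trans ?_
      rw [abs_mul, Nat.abs_cast]; linarith
    · have e : z ^ k - 1 = (z ^ k - 1 - k * (z - 1)) + k * (z - 1) := by ring
      rw [e]; refine (abs_add_le _ _).trans ?_
      rw [abs_mul, Nat.abs_cast]
      nlinarith [mul_nonneg hC hb0, mul_nonneg hC (sq_nonneg ‖b‖), mul_le_mul_of_nonneg_left (by nlinarith : ‖b‖ ^ 2 ≤ ‖b‖) hC, mul_nonneg (Nat.cast_nonneg (α := ℝ) k) hb0]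
  constructor
  · refine V_norm_le fun w => ?_
    have e : (dV (hB b) k - (1 - (k:ℝ) • (b.re • aF - b.im • bF)) : V) w = dV (hB b) k w - (1 - k * ((b * w).re)) := by
      simp [aF, bF, Complex.mul_re]
    rw [e]; nlinarith [(key w).1]
  · refine V_norm_le fun w => ?_
    have e : (dV (hB b) k - 1 : V) w = dV (hB b) k w - 1 := rfl
    rw [e]; nlinarith [(key w).2]

lemma tau_exp {b : ℂ} (hb : ‖b‖ ≤ 1/4) : ‖aF.comp (tauD (hB b)) - aF‖ ≤ 4 * ‖b‖ ∧ ‖bF.comp (tauD (hB b)) - bF‖ ≤ 4 * ‖b‖ := by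
  have key : ∀ w : Dk, ‖(tauD (hB b) w : ℂ) - w‖ ≤ 4 * ‖b‖ := by
    intro w
    have hw := Dk_le w
    have hd := dn_ne (hB b) hw
    obtain ⟨-, -, h3⟩ := dn_exp hb hw
    have e : (tauD (hB b) w : ℂ) - w = (starRingEnd ℂ b - b * w * w) / dn (hB b) w := by
      rw [tauD_coe, tau, div_sub' hd]; congr 1; simp only [dn, hB, Complex.conj_ofReal]; ring
    rw [e, norm_div, div_le_iff₀ (by linarith)]
    have h4 : ‖starRingEnd ℂ b - b * w * w‖ ≤ ‖b‖ + ‖b‖ := by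
      refine (norm_sub_le _ _).trans (add_le_add (by simp) ?_)
      rw [norm_mul]
      calc _ ≤ ‖b‖ * 1 := mul_le_mul (re_mul_le hw).2 hw (norm_nonneg _) (norm_nonneg _)
        _ = _ := mul_one _
    nlinarith [norm_nonneg b]
  constructor
  · refine V_norm_le fun w => ?_
    have := (Complex.abs_re_le_norm _).trans (key w)
    rwa [Complex.sub_re] at this
  · refine V_norm_le fun w => ?_
    have := (Complex.abs_im_le_norm _).trans (key w)
    rwa [Complex.sub_im] at this

lemma comp_norm (f : V) (g : C(Dk, Dk)) : ‖f.comp g‖ ≤ ‖f‖ := V_norm_le fun w => V_le f (g w)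

/-- one constant -/
lemma h_exp (n : ℕ) : ∃ K : ℝ, 0 < K ∧ ∀ b : ℂ, ‖b‖ ≤ 1/4 →
    ‖dV (hB b) n - (1 - (n:ℝ) • (b.re • aF - b.im • bF))‖ ≤ K * ‖b‖ ^ 2 ∧ ‖dV (hB b) n - 1‖ ≤ K * ‖b‖ ∧
    ∀ c : V, (c = aF ∨ c = bF) → ‖dV (hB b) (n + 2) * c.comp (tauD (hB b)) - c‖ ≤ K * ‖b‖ ∧
      ‖c * dV (hB b) n - dV (hB b) (2 * n + 2) * c.comp (tauD (hB b))‖ ≤ K * ‖b‖ := by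
  obtain ⟨C1, hC1, H1⟩ := dV_exp n
  obtain ⟨C2, hC2, H2⟩ := dV_exp (n + 2)
  obtain ⟨C3, hC3, H3⟩ := dV_exp (2 * n + 2)
  refine ⟨C1 + C2 + C3 + 4, by positivity, fun b hb => ?_⟩
  have hb0 := norm_nonneg b
  have p1 := mul_nonneg hC1.le hb0
  have p2 := mul_nonneg hC2.le hb0
  have p3 := mul_nonneg hC3.le hb0
  have q1 := sq_nonneg ‖b‖
  have p1 := mul_nonneg hC1.le q1
  have p2 := mul_nonneg hC2.le q1
  have p3 := mul_nonneg hC3.le q1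
  refine ⟨by nlinarith [(H1 b hb).1], by nlinarith [(H1 b hb).2], fun c hc => ?_⟩
  have hc1 : ‖c‖ ≤ 1 := by rcases hc with rfl | rfl; exacts [ab_le.1, ab_le.2]
  have hct : ‖c.comp (tauD (hB b)) - c‖ ≤ 4 * ‖b‖ := by rcases hc with rfl | rfl; exacts [(tau_exp hb).1, (tau_exp hb).2]
  have hc2 := (comp_norm c (tauD (hB b))).trans hc1
  have m2' : ‖(dV (hB b) (n + 2) - 1) * c.comp (tauD (hB b))‖ ≤ C2 * ‖b‖ :=
    (norm_mul_le _ _).trans ((mul_le_of_le_one_right (norm_nonneg _) hc2).trans (H2 b hb).2)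
  have m3' : ‖(dV (hB b) (2 * n + 2) - 1) * c.comp (tauD (hB b))‖ ≤ C3 * ‖b‖ :=
    (norm_mul_le _ _).trans ((mul_le_of_le_one_right (norm_nonneg _) hc2).trans (H3 b hb).2)
  have m1' : ‖(dV (hB b) n - 1) * c‖ ≤ C1 * ‖b‖ :=
    (norm_mul_le _ _).trans ((mul_le_of_le_one_right (norm_nonneg _) hc1).trans (H1 b hb).2)
  constructor
  · have e : dV (hB b) (n + 2) * c.comp (tauD (hB b)) - c = (dV (hB b) (n + 2) - 1) * c.comp (tauD (hB b)) + (c.comp (tauD (hB b)) - c) := by ring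
    rw [e]; refine (norm_add_le _ _).trans ?_
    nlinarith
  · have e : c * dV (hB b) n - dV (hB b) (2 * n + 2) * c.comp (tauD (hB b)) = (dV (hB b) n - 1) * c - (c.comp (tauD (hB b)) - c) - (dV (hB b) (2 * n + 2) - 1) * c.comp (tauD (hB b)) := by ring
    rw [e]; refine (norm_sub_le _ _).trans ((add_le_add_left (norm_sub_le _ _) _).trans ?_)
    nlinarith

lemma Pw_tau (n : ℕ) (hn : 1 ≤ n) (g : SU) (v : V) : Pw n (dV g n * v.comp (tauD g)) = dV g (n + 2) * (Pw n v).comp (tauD g) := by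
  ext w
  change |dV g n w * v (tauD g w)| ^ pp n = dV g (n + 2) w * |v (tauD g w)| ^ pp n
  have hd := dn_pos g (Dk_le w)
  have hn0 : (n:ℝ) ≠ 0 := by positivity
  rw [abs_mul, abs_of_pos (dV_pos g n w), Real.mul_rpow (dV_pos g n w).le (abs_nonneg _)]
  congr 1
  rw [dV_apply, dV_apply, Real.inv_rpow (by positivity), ← Real.rpow_natCast, ← Real.rpow_mul hd.le, ← Real.rpow_natCast]
  congr 2
  rw [pp]; push_cast; field_simp

/-- equation transport -/
lemma Gr_trans (n : ℕ) (hn : 1 ≤ n) (g : SU) {v θ e : V} (h : Gr n v (((n:ℝ) ^ 2) • ((1 + θ) * Pw n v) - e)) :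
    Gr n (dV g n * v.comp (tauD g)) (((n:ℝ) ^ 2) • ((1 + θ.comp (tauD g)) * Pw n (dV g n * v.comp (tauD g))) - dV g (n + 2) * e.comp (tauD g)) := by
  have := Gr_tau n hn g h
  convert this using 1
  rw [Pw_tau n hn]
  ext w
  simp only [ContinuousMap.sub_apply, ContinuousMap.smul_apply, ContinuousMap.mul_apply, ContinuousMap.add_apply, ContinuousMap.comp_apply, ContinuousMap.one_apply, smul_eq_mul]
  ring

lemma dV_mul (g : SU) (n : ℕ) : dV g n * dV g (n + 2) = dV g (2 * n + 2) := by
  ext w; change dV g n w * dV g (n + 2) w = _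
  rw [dV_apply, dV_apply, dV_apply, ← mul_inv, ← pow_add]; congr 2; ring

lemma Jf_inv (n : ℕ) (hn : 1 ≤ n) (g : SU) (θ v h : V) :
    Jf n (θ.comp (tauD g)) (dV g n * v.comp (tauD g)) (dV g (n + 2) * h.comp (tauD g)) = Jf n θ v h := by
  rw [Jf, Jf, Pw_tau n hn]
  have e1 : dV g n * v.comp (tauD g) * (dV g (n + 2) * h.comp (tauD g)) = dV g (2 * n + 2) * (v * h).comp (tauD g) := by
    rw [← dV_mul]; ext w
    simp only [ContinuousMap.mul_apply, ContinuousMap.comp_apply]; ring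
  have e2 : (1 + θ.comp (tauD g)) * (dV g n * v.comp (tauD g) * (dV g (n + 2) * (Pw n v).comp (tauD g))) = dV g (2 * n + 2) * ((1 + θ) * (v * Pw n v)).comp (tauD g) := by
    rw [← dV_mul]; ext w
    simp only [ContinuousMap.mul_apply, ContinuousMap.comp_apply, ContinuousMap.add_apply, ContinuousMap.one_apply]; ring
  rw [e1, e2, E_inv n hn, E_inv n hn]

end Heis

namespace Heis
open Complex (I)

lemma E_ab_v (n : ℕ) {v : V} (h : Orth n (v - 1)) : E n (aF * v) = 0 ∧ E n (bF * v) = 0 := by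
  obtain ⟨m1, m2', -⟩ := moments n
  obtain ⟨h1, h2⟩ := h
  rw [mul_sub, map_sub, mul_one] at h1 h2
  exact ⟨by linarith, by linarith⟩

/-- variation: moments of the transported function -/
lemma var_mom (n : ℕ) (hn : 1 ≤ n) (K : ℝ) {b : ℂ}
    (h1 : ‖dV (hB b) n - (1 - (n:ℝ) • (b.re • aF - b.im • bF))‖ ≤ K * ‖b‖ ^ 2)
    (h2 : ∀ c : V, (c = aF ∨ c = bF) → ‖c * dV (hB b) n - dV (hB b) (2 * n + 2) * c.comp (tauD (hB b))‖ ≤ K * ‖b‖)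
    {v : V} (hv : Orth n (v - 1)) :
    |E n (aF * (dV (hB b) n * v.comp (tauD (hB b)))) + n * b.re * m2 n| ≤ vol n * (K * ‖b‖ ^ 2) + vol n * (K * ‖b‖ * ‖v - 1‖) ∧
    |E n (bF * (dV (hB b) n * v.comp (tauD (hB b)))) - n * b.im * m2 n| ≤ vol n * (K * ‖b‖ ^ 2) + vol n * (K * ‖b‖ * ‖v - 1‖) := by
  obtain ⟨ma, mb, mab, mbb, -⟩ := moments n
  set h := hB b
  have hvol := vol_nonneg n
  have gen : ∀ c : V, (c = aF ∨ c = bF) → ‖c‖ ≤ 1 → E n (c * (v - 1)) = 0 →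
      |E n (c * (dV h n * v.comp (tauD h))) - (E n c - n * (b.re * E n (c * aF) - b.im * E n (c * bF)))| ≤ vol n * (K * ‖b‖ ^ 2) + vol n * (K * ‖b‖ * ‖v - 1‖) := by
    intro c hc hc1 hcv
    have e0 : E n (dV h (2 * n + 2) * (c.comp (tauD h)) * ((v - 1).comp (tauD h))) = 0 := by
      refine Eq.trans ?_ ((E_inv n hn h (c * (v - 1))).trans hcv); congr 1; ext w
      simp only [ContinuousMap.mul_apply, ContinuousMap.comp_apply]; ring
    have e : c * (dV h n * v.comp (tauD h)) = c - (n:ℝ) • (b.re • (c * aF) - b.im • (c * bF))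
        + c * (dV h n - (1 - (n:ℝ) • (b.re • aF - b.im • bF)))
        + (c * dV h n - dV h (2 * n + 2) * c.comp (tauD h)) * (v - 1).comp (tauD h)
        + dV h (2 * n + 2) * (c.comp (tauD h)) * ((v - 1).comp (tauD h)) := by
      ext w
      simp only [ContinuousMap.sub_apply, ContinuousMap.smul_apply, ContinuousMap.mul_apply, ContinuousMap.add_apply, ContinuousMap.comp_apply, ContinuousMap.one_apply, smul_eq_mul]
      ring
    have e1 : E n (c * (dV h n * v.comp (tauD h))) - (E n c - n * (b.re * E n (c * aF) - b.im * E n (c * bF))) =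
        E n (c * (dV h n - (1 - (n:ℝ) • (b.re • aF - b.im • bF)))) + E n ((c * dV h n - dV h (2 * n + 2) * c.comp (tauD h)) * (v - 1).comp (tauD h)) := by
      rw [e]
      simp only [map_add, map_sub, map_smul, smul_eq_mul, e0]
      ring
    rw [e1]
    refine (abs_add_le _ _).trans (add_le_add ?_ ?_)
    · refine (E_mul_le n _ _).trans (mul_le_mul_of_nonneg_left ?_ hvol)
      calc _ ≤ 1 * (K * ‖b‖ ^ 2) := mul_le_mul hc1 h1 (norm_nonneg _) zero_le_one
        _ = _ := one_mul _
    · refine (E_mul_le n _ _).trans (mul_le_mul_of_nonneg_left ?_ hvol)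
      exact mul_le_mul (h2 c hc) (comp_norm _ _) (norm_nonneg _) ((norm_nonneg _).trans (h2 c hc))
  constructor
  · have := gen aF (Or.inl rfl) ab_le.1 hv.1
    rw [ma, mab] at this
    convert this using 2; rw [← m2]; ring
  · have := gen bF (Or.inr rfl) ab_le.2 hv.2
    rw [mb, mul_comm bF aF, mab, mbb] at this
    convert this using 2; ring

def Eq' (n : ℕ) (θ v : V) (α β : ℝ) : V := ((n:ℝ) ^ 2) • ((1 + θ) * Pw n v) - (α • aF + β • bF)

set_option maxHeartbeats 2000000 in
/-- quantitative comparison -/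
lemma compare (n : ℕ) (hn : 1 ≤ n) : ∃ r1 θ1 K : ℝ, 0 < r1 ∧ r1 ≤ 1/4 ∧ 0 < θ1 ∧ θ1 ≤ 1 ∧ 0 < K ∧ ∀ α β : ℝ, ∃ D δ0 : ℝ, 0 < D ∧ 0 < δ0 ∧
    ∀ (θ v v' : V) (α' β' : ℝ) (b : ℂ), ‖b‖ ≤ δ0 → ‖θ‖ ≤ θ1 → ‖v - 1‖ ≤ r1 → ‖v' - 1‖ ≤ r1 → Orth n (v - 1) → Orth n (v' - 1) →
    Gr n v (Eq' n θ v α β) → Gr n v' (Eq' n (θ.comp (tauD (hB b))) v' α' β') →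
    |Jf n (θ.comp (tauD (hB b))) v' (Eq' n (θ.comp (tauD (hB b))) v' α' β') - Jf n θ v (Eq' n θ v α β)
      + n * m2 n * (α * b.re - β * b.im)| ≤ D * ‖b‖ ^ 2 + (|α| + |β|) * (K * ‖b‖ * ‖v - 1‖) := by
  obtain ⟨r, θ0, C, hr, hr2, hθ0, hθ01, hC, S⟩ := stab n hn
  obtain ⟨K, hK, H⟩ := h_exp n
  have hvol := vol_nonneg n
  have hvolp := vol_pos n
  have hm := (moments n).2.2.2.2
  have hn1 : (1:ℝ) ≤ n := by exact_mod_cast hn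
  refine ⟨r / 4, θ0, vol n * K, by positivity, by linarith, hθ0, hθ01, by positivity, fun α β => ?_⟩
  set N := |α| + |β| with hN
  have hN0 : 0 ≤ N := by positivity
  -- constants
  obtain ⟨D1, hD1⟩ : ∃ x, x = n * m2 n + 2 * (vol n * K) := ⟨_, rfl⟩
  obtain ⟨D2, hD2⟩ : ∃ x, x = C * (N * K + D1 + D1) := ⟨_, rfl⟩
  obtain ⟨D3, hD3⟩ : ∃ x, x = (m2 n)⁻¹ * (vol n * (16 * n ^ 2 * D2 + N * K + lam1 n * D2)) := ⟨_, rfl⟩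
  obtain ⟨D4, hD4⟩ : ∃ x, x = 16 * n ^ 2 * D2 + (D3 + D3 + N * K) := ⟨_, rfl⟩
  have hlam : 0 ≤ lam1 n := by rw [← pp_lam n hn]; have := (pp_bd n hn).1; positivity
  have D1p : 0 ≤ D1 := by rw [hD1]; positivity
  have D2p : 0 ≤ D2 := by rw [hD2]; positivity
  have D3p : 0 ≤ D3 := by rw [hD3]; positivity
  have D4p : 0 ≤ D4 := by rw [hD4]; positivity
  refine ⟨vol n * (64 * n ^ 2) * (D2 * D4 + D2 ^ 2) + vol n * (N * K * D2) + N * (vol n * K) + 1, min (1/4) (r / (4 * K)), by positivity, by positivity, ?_⟩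
  intro θ v v' α' β' b hb hθ hv hv' ho ho' G G'
  have hb1 : ‖b‖ ≤ 1/4 := hb.trans (min_le_left _ _)
  have hb2 : K * ‖b‖ ≤ r / 4 := by
    have := hb.trans (min_le_right _ _)
    rw [le_div_iff₀ (by positivity)] at this; linarith
  have hb0 := norm_nonneg b
  obtain ⟨x1, x2, x3⟩ := H b hb1
  set h := hB b with hh
  set θ' := θ.comp (tauD h) with hθ'
  have hθ'n : ‖θ'‖ ≤ θ0 := (comp_norm _ _).trans hθ
  set vt := dV h n * v.comp (tauD h) with hvt
  set e := α • aF + β • bF with he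
  set et := dV h (n + 2) * e.comp (tauD h) with het
  have Gt : Gr n vt (((n:ℝ) ^ 2) • ((1 + θ') * Pw n vt) - et) := Gr_trans n hn h G
  set Ht := ((n:ℝ) ^ 2) • ((1 + θ') * Pw n vt) - et with hHt
  set H' := Eq' n θ' v' α' β' with hH'
  -- vt near 1
  have hvt1 : ‖vt - 1‖ ≤ r := by
    have e1 : vt - 1 = (dV h n - 1) + (dV h n - 1) * (v - 1).comp (tauD h) + (v - 1).comp (tauD h) := by
      rw [hvt]; ext w
      simp only [ContinuousMap.sub_apply, ContinuousMap.mul_apply, ContinuousMap.add_apply, ContinuousMap.comp_apply, ContinuousMap.one_apply]; ring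
    have e2 := (comp_norm (v - 1) (tauD h)).trans hv
    rw [e1]
    refine (norm_add_le _ _).trans ?_
    refine (add_le_add (norm_add_le _ _) le_rfl).trans ?_
    have e3 := norm_mul_le (dV h n - 1) ((v - 1).comp (tauD h))
    have e4 := mul_le_of_le_one_right (norm_nonneg (dV h n - 1)) (e2.trans (by linarith))
    linarith
  have hvt2 : ‖vt - 1‖ ≤ 1/2 := hvt1.trans hr2
  have hv'2 : ‖v' - 1‖ ≤ 1/2 := by linarith
  -- et close to e
  have hee : ‖et - e‖ ≤ N * K * ‖b‖ := by
    have e1 : et - e = α • (dV h (n + 2) * aF.comp (tauD h) - aF) + β • (dV h (n + 2) * bF.comp (tauD h) - bF) := by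
      rw [het, he]; ext w
      simp only [ContinuousMap.sub_apply, ContinuousMap.smul_apply, ContinuousMap.mul_apply, ContinuousMap.add_apply, ContinuousMap.comp_apply, smul_eq_mul]; ring
    rw [e1]
    refine (norm_add_le _ _).trans ?_
    rw [norm_smul, norm_smul, Real.norm_eq_abs, Real.norm_eq_abs, hN]
    have a1 := mul_le_mul_of_nonneg_left (x3 aF (Or.inl rfl)).1 (abs_nonneg α)
    have a2 := mul_le_mul_of_nonneg_left (x3 bF (Or.inr rfl)).1 (abs_nonneg β)
    linarith
  obtain ⟨y1, y2⟩ := var_mom n hn K x1 (fun c hc => (x3 c hc).2) ho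
  rw [← hh, ← hvt] at y1 y2
  obtain ⟨z1, z2⟩ := E_ab_v n ho'
  set d := v' - vt with hd
  have hda : E n (aF * d) = - E n (aF * vt) := by rw [hd, mul_sub, map_sub, z1]; ring
  have hdb : E n (bF * d) = - E n (bF * vt) := by rw [hd, mul_sub, map_sub, z2]; ring
  have hK1 : vol n * (K * ‖b‖ ^ 2) + vol n * (K * ‖b‖ * ‖v - 1‖) ≤ 2 * (vol n * K) * ‖b‖ := by
    have a1 : K * ‖b‖ ^ 2 ≤ K * ‖b‖ := mul_le_mul_of_nonneg_left (by rw [sq]; exact mul_le_of_le_one_right hb0 (by linarith)) hK.le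
    have a2 : K * ‖b‖ * ‖v - 1‖ ≤ K * ‖b‖ := mul_le_of_le_one_right (by positivity) (by linarith)
    linarith [mul_le_mul_of_nonneg_left a1 hvol, mul_le_mul_of_nonneg_left a2 hvol]
  have hDa : |E n (aF * d)| ≤ D1 * ‖b‖ := by
    rw [hda, abs_neg, hD1]
    have a1 : |n * b.re * m2 n| ≤ n * m2 n * ‖b‖ := by
      rw [abs_mul, abs_mul, Nat.abs_cast, abs_of_pos hm]
      linarith [mul_le_mul_of_nonneg_left (Complex.abs_re_le_norm b) (by positivity : (0:ℝ) ≤ n * m2 n)]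
    have a2 := abs_sub_abs_le_abs_sub (E n (aF * vt)) (-(n * b.re * m2 n))
    rw [abs_neg, sub_neg_eq_add] at a2
    linarith
  have hDb : |E n (bF * d)| ≤ D1 * ‖b‖ := by
    rw [hdb, abs_neg, hD1]
    have a1 : |n * b.im * m2 n| ≤ n * m2 n * ‖b‖ := by
      rw [abs_mul, abs_mul, Nat.abs_cast, abs_of_pos hm]
      linarith [mul_le_mul_of_nonneg_left (Complex.abs_im_le_norm b) (by positivity : (0:ℝ) ≤ n * m2 n)]
    have a2 := abs_sub_abs_le_abs_sub (E n (bF * vt)) (n * b.im * m2 n)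
    linarith
  -- stability
  set x := α' - α with hx
  set y := β' - β with hy
  have hdn : ‖d‖ ≤ D2 * ‖b‖ := by
    have a := S v' vt θ' θ' (α' • aF + β' • bF) et x y (by linarith) hvt1 hθ'n G' Gt
    rw [sub_self, norm_zero] at a
    have a1 : α' • aF + β' • bF - et - (x • aF + y • bF) = -(et - e) := by rw [hx, hy, he]; module
    rw [a1, norm_neg] at a
    refine a.trans ?_
    rw [hD2, mul_assoc]
    apply mul_le_mul_of_nonneg_left _ hC.le
    linarith
  -- coefficient bounds
  have hPl := Pw_lip n hn hv'2 hvt2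
  set q := ((n:ℝ) ^ 2) • ((1 + θ') * (Pw n v' - Pw n vt)) with hq
  have hqn : ‖q‖ ≤ 16 * n ^ 2 * D2 * ‖b‖ := by
    rw [hq, norm_smul, Real.norm_of_nonneg (by positivity)]
    have a1 : ‖1 + θ'‖ ≤ 2 := (norm_add_le _ _).trans (by rw [V_one]; linarith)
    have a2 : ‖(1 + θ') * (Pw n v' - Pw n vt)‖ ≤ 2 * (8 * (D2 * ‖b‖)) := by
      refine (norm_mul_le _ _).trans (mul_le_mul a1 (hPl.trans ?_) (norm_nonneg _) (by norm_num))
      linarith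
    linarith [mul_le_mul_of_nonneg_left a2 (by positivity : (0:ℝ) ≤ (n:ℝ) ^ 2)]
  have hHd : H' - Ht = q - (x • aF + y • bF) + (et - e) := by
    rw [hH', hHt, Eq', hq, hx, hy, he, mul_sub]; module
  have coef : ∀ c : V, ‖c‖ ≤ 1 → Gr n c (lam1 n • c) → |E n (c * (x • aF + y • bF))| ≤ vol n * (16 * n ^ 2 * D2 + N * K + lam1 n * D2) * ‖b‖ := by
    intro c hc hGc
    have a1 : E n (c * (H' - Ht)) = E n (lam1 n • c * d) := Gr_sym n hn hGc (G'.sub Gt)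
    rw [hHd] at a1
    have a2 : E n (c * (x • aF + y • bF)) = E n (c * (q + (et - e) - lam1 n • d)) := by
      have : c * (x • aF + y • bF) = c * (q + (et - e) - lam1 n • d) - (c * (q - (x • aF + y • bF) + (et - e)) - lam1 n • c * d) := by
        rw [smul_mul_assoc, mul_sub c _ (lam1 n • d), mul_smul_comm]; ring
      rw [this, map_sub, map_sub (E n) (c * (q - (x • aF + y • bF) + (et - e))), a1]; ring
    rw [a2]
    refine (E_mul_le n _ _).trans ?_
    rw [mul_assoc]
    apply mul_le_mul_of_nonneg_left _ hvol
    refine (mul_le_of_le_one_left (norm_nonneg _) hc).trans ?_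
    refine (norm_sub_le _ _).trans ?_
    have a3 := norm_add_le q (et - e)
    rw [norm_smul, Real.norm_of_nonneg hlam]
    linarith [mul_le_mul_of_nonneg_left hdn hlam]
  obtain ⟨-, -, mab, mbb, -⟩ := moments n
  have hxb : |x| ≤ D3 * ‖b‖ := by
    have a := coef aF ab_le.1 (Gr_aF n hn)
    have a1 : E n (aF * (x • aF + y • bF)) = m2 n * x := by
      rw [mul_add, mul_smul_comm, mul_smul_comm, map_add, map_smul, map_smul, mab, m2]; simp; ring
    rw [a1, abs_mul, abs_of_pos hm] at a
    rw [hD3, mul_assoc, ← div_eq_inv_mul, le_div_iff₀ hm]; linarith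
  have hyb : |y| ≤ D3 * ‖b‖ := by
    have a := coef bF ab_le.2 (Gr_bF n hn)
    have a1 : E n (bF * (x • aF + y • bF)) = m2 n * y := by
      rw [mul_add, mul_smul_comm, mul_smul_comm, map_add, map_smul, map_smul, mul_comm bF aF, mab, mbb]; simp; ring
    rw [a1, abs_mul, abs_of_pos hm] at a
    rw [hD3, mul_assoc, ← div_eq_inv_mul, le_div_iff₀ hm]; linarith
  have hHb : ‖H' - Ht‖ ≤ D4 * ‖b‖ := by
    rw [hHd]
    refine (norm_add_le _ _).trans ((add_le_add (norm_sub_le _ _) le_rfl).trans ?_)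
    have a1 : ‖x • aF + y • bF‖ ≤ |x| + |y| := by
      refine (norm_add_le _ _).trans ?_
      rw [norm_smul, norm_smul, Real.norm_eq_abs, Real.norm_eq_abs]
      exact add_le_add (mul_le_of_le_one_right (abs_nonneg _) ab_le.1) (mul_le_of_le_one_right (abs_nonneg _) ab_le.2)
    rw [hD4]; linarith
  -- functional
  have J := J_taylor n hn (θ := θ') hvt2 hv'2 (hθ'n.trans hθ01) Gt G'
  have hinv : Jf n θ' vt Ht = Jf n θ v (Eq' n θ v α β) := by
    rw [← Jf_inv n hn h θ v]
    congr 1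
    rw [hHt, Eq', hvt, Pw_tau n hn, het, hθ', he]
    ext w
    simp only [ContinuousMap.sub_apply, ContinuousMap.smul_apply, ContinuousMap.mul_apply, ContinuousMap.add_apply, ContinuousMap.comp_apply, ContinuousMap.one_apply, smul_eq_mul]
    ring
  have e5 : Ht - ((n:ℝ) ^ 2) • ((1 + θ') * Pw n vt) = -et := by rw [hHt]; abel
  rw [hinv, e5] at J
  have e6 : E n (-et * d) = (α * E n (aF * vt) + β * E n (bF * vt)) - E n ((et - e) * d) := by
    have a0 : -et * d = -(α • (aF * d) + β • (bF * d)) - (et - e) * d := by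
      rw [sub_mul, he, add_mul, smul_mul_assoc, smul_mul_assoc, neg_mul]; abel
    rw [a0, map_sub, map_neg, map_add, map_smul, map_smul, hda, hdb]; simp only [smul_eq_mul]; ring
  rw [e6] at J
  have e7 : |E n ((et - e) * d)| ≤ vol n * (N * K * D2) * ‖b‖ ^ 2 := by
    refine (E_mul_le n _ _).trans ?_
    have := mul_le_mul hee hdn (norm_nonneg _) (by positivity)
    linarith [mul_le_mul_of_nonneg_left this hvol]
  have e8 : vol n * (64 * n ^ 2) * (‖d‖ * ‖H' - Ht‖ + ‖d‖ ^ 2) ≤ vol n * (64 * n ^ 2) * (D2 * D4 + D2 ^ 2) * ‖b‖ ^ 2 := by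
    rw [mul_assoc _ (D2 * D4 + D2 ^ 2)]
    apply mul_le_mul_of_nonneg_left _ (by positivity)
    have a1 := mul_le_mul hdn hHb (norm_nonneg _) (by positivity)
    have a2 := mul_le_mul hdn hdn (norm_nonneg _) (by positivity)
    linarith
  have e9 : |α * (E n (aF * vt) + n * b.re * m2 n) + β * (E n (bF * vt) - n * b.im * m2 n)| ≤ N * (vol n * (K * ‖b‖ ^ 2) + vol n * (K * ‖b‖ * ‖v - 1‖)) := by
    refine (abs_add_le _ _).trans ?_
    rw [abs_mul, abs_mul, hN, add_mul]
    exact add_le_add (mul_le_mul_of_nonneg_left y1 (abs_nonneg _)) (mul_le_mul_of_nonneg_left y2 (abs_nonneg _))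
  have f1 := abs_le.1 J
  have f2 := abs_le.1 e7
  have f3 := abs_le.1 e9
  have hs := sq_nonneg ‖b‖
  rw [abs_le]
  constructor <;> linarith
end Heis

namespace Heis
open Complex (I)

set_option maxHeartbeats 1000000 in
lemma crit (n : ℕ) (hn : 1 ≤ n) : ∃ r1 θ1 : ℝ, 0 < r1 ∧ r1 ≤ 1/4 ∧ 0 < θ1 ∧ ∀ (θ v : V) (α β s : ℝ), s ≠ 0 →
    ‖θ‖ ≤ θ1 → ‖v - 1‖ ≤ r1 → Orth n (v - 1) → Gr n v (Eq' n θ v α β) →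
    (∀ b : ℂ, ∃ (v' : V) (α' β' : ℝ), ‖v' - 1‖ ≤ r1 ∧ Orth n (v' - 1) ∧ Gr n v' (Eq' n (θ.comp (tauD (hB b))) v' α' β') ∧
      s * Jf n θ v (Eq' n θ v α β) ≤ s * Jf n (θ.comp (tauD (hB b))) v' (Eq' n (θ.comp (tauD (hB b))) v' α' β')) → α = 0 ∧ β = 0 := by
  obtain ⟨r1, θ1, K, hr, hr4, hθ1, -, hK, H⟩ := compare n hn
  have hm := (moments n).2.2.2.2
  have hn1 : (1:ℝ) ≤ n := by exact_mod_cast hn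
  refine ⟨min r1 (n * m2 n / (8 * K)), θ1, by positivity, (min_le_left _ _).trans hr4, hθ1, ?_⟩
  intro θ v α β s hs hθ hv ho G hb
  by_contra hne
  have hN : 0 < α ^ 2 + β ^ 2 := by
    by_contra h0
    apply hne
    constructor <;> nlinarith [sq_nonneg α, sq_nonneg β]
  obtain ⟨D, δ0, hD, hδ0, Q⟩ := H α β
  set ρ := Real.sqrt (α ^ 2 + β ^ 2) with hρ
  have hρ0 : 0 < ρ := Real.sqrt_pos.2 hN
  have hρ2 : ρ ^ 2 = α ^ 2 + β ^ 2 := Real.sq_sqrt hN.le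
  have hs0 : 0 < |s| := abs_pos.2 hs
  have hs2 : |s| ^ 2 = s ^ 2 := sq_abs s
  set t := min (δ0 / (|s| * ρ)) (n * m2 n / (4 * (|s| * D))) with ht
  have ht0 : 0 < t := by positivity
  set b : ℂ := ⟨t * s * α, -(t * s * β)⟩ with hbd
  have hbn : ‖b‖ = t * (|s| * ρ) := by
    rw [Complex.norm_def, Complex.normSq_mk]
    have : t * s * α * (t * s * α) + -(t * s * β) * -(t * s * β) = (t * (|s| * ρ)) ^ 2 := by
      rw [mul_pow, mul_pow, hρ2, hs2]; ring
    rw [this, Real.sqrt_sq (by positivity)]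
  obtain ⟨v', α', β', h1, h2, h3, h4⟩ := hb b
  have hbδ : ‖b‖ ≤ δ0 := by
    rw [hbn, ← le_div_iff₀ (by positivity)]; exact min_le_left _ _
  have q := Q θ v v' α' β' b hbδ hθ (hv.trans (min_le_left _ _)) (h1.trans (min_le_left _ _)) ho h2 G h3
  set dj := Jf n (θ.comp (tauD (hB b))) v' (Eq' n (θ.comp (tauD (hB b))) v' α' β') - Jf n θ v (Eq' n θ v α β) with hdj
  have hsd : 0 ≤ s * dj := by rw [hdj, mul_sub]; linarith
  have e1 : α * b.re - β * b.im = t * s * ρ ^ 2 := by rw [hρ2, hbd]; ring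
  rw [e1] at q
  have h5 : |α| + |β| ≤ 2 * ρ := by
    have a1 : |α| ≤ ρ := Real.abs_le_sqrt (by nlinarith [sq_nonneg β])
    have a2 : |β| ≤ ρ := Real.abs_le_sqrt (by nlinarith [sq_nonneg α])
    linarith
  have h6 : ‖v - 1‖ ≤ n * m2 n / (8 * K) := hv.trans (min_le_right _ _)
  have h7 : (|α| + |β|) * (K * ‖b‖ * ‖v - 1‖) ≤ n * m2 n / 4 * (t * |s| * ρ ^ 2) := by
    calc _ ≤ 2 * ρ * (K * ‖b‖ * (n * m2 n / (8 * K))) := by gcongr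
      _ = _ := by rw [hbn]; field_simp; ring
  have h8 : D * ‖b‖ ^ 2 ≤ n * m2 n / 4 * (t * |s| * ρ ^ 2) := by
    have a : t * (4 * (|s| * D)) ≤ n * m2 n := by
      rw [← le_div_iff₀ (by positivity)]; exact min_le_right _ _
    have := mul_le_mul_of_nonneg_right a (by positivity : 0 ≤ t * |s| * ρ ^ 2)
    rw [hbn]; nlinarith
  have h9 : |s| * |dj + n * m2 n * (t * s * ρ ^ 2)| ≤ |s| * (n * m2 n / 2 * (t * |s| * ρ ^ 2)) :=
    mul_le_mul_of_nonneg_left (by linarith) hs0.le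
  rw [← abs_mul] at h9
  have h10 := (le_abs_self _).trans h9
  have h11 : |s| * (n * m2 n / 2 * (t * |s| * ρ ^ 2)) = n * m2 n / 2 * (t * s ^ 2 * ρ ^ 2) := by rw [← hs2]; ring
  rw [h11] at h10
  have h12 : 0 < n * m2 n * (t * s ^ 2 * ρ ^ 2) := by positivity
  nlinarith

lemma jform (n : ℕ) {θ v : V} {α β : ℝ} (h : Orth n (v - 1)) :
    Jf n θ v (Eq' n θ v α β) = (n:ℝ) ^ 2 * (1/2 - 1 / (pp n + 1)) * E n ((1 + θ) * (v * Pw n v)) := by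
  obtain ⟨h1, h2⟩ := E_ab_v n h
  have e : v * Eq' n θ v α β = ((n:ℝ) ^ 2) • ((1 + θ) * (v * Pw n v)) - (α • (aF * v) + β • (bF * v)) := by
    rw [Eq', mul_sub, mul_add, mul_smul_comm, mul_smul_comm, mul_smul_comm, mul_comm v aF, mul_comm v bF]
    congr 2; ring
  rw [Jf, e, map_sub, map_add, map_smul, map_smul, map_smul, h1, h2]
  simp only [smul_eq_mul]; ring

lemma jexp (n : ℕ) (hn : 1 ≤ n) (C : ℝ) (hC : 0 < C) : ∃ C3 : ℝ, 0 < C3 ∧ ∀ (θ v : V) (α β : ℝ), ‖θ‖ ≤ 1 → ‖v - 1‖ ≤ 1/2 →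
    ‖v - 1‖ ≤ C * ‖θ‖ → |α| ≤ C * ‖θ‖ → |β| ≤ C * ‖θ‖ → Gr n v (Eq' n θ v α β) →
    |Jf n θ v (Eq' n θ v α β) - (Jf n 0 1 (((n:ℝ) ^ 2) • 1) - (n:ℝ) ^ 2 / (pp n + 1) * E n θ)| ≤ C3 * ‖θ‖ ^ 2 := by
  have hvol := vol_pos n
  have hn1 : (1:ℝ) ≤ n := by exact_mod_cast hn
  refine ⟨vol n * (64 * n ^ 2) * (C * ((n:ℝ) ^ 2 * (5 + 8 * C) + 2 * C) + C ^ 2) + vol n * ((n:ℝ) ^ 2 * C), by positivity, ?_⟩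
  intro θ v α β hθ hv hv2 hα hβ G
  set T := ‖θ‖ with hT
  have hT0 : 0 ≤ T := norm_nonneg _
  have hone : ‖(1 : V) - 1‖ ≤ 1/2 := by simp
  have J := J_taylor n hn (θ := θ) hone hv hθ (Gr_one n hn) G
  rw [Pw_one, mul_one] at J
  have e1 : Jf n θ 1 (((n:ℝ) ^ 2) • 1) = Jf n 0 1 (((n:ℝ) ^ 2) • 1) - (n:ℝ) ^ 2 / (pp n + 1) * E n θ := by
    rw [Jf, Jf, Pw_one]; simp only [mul_one, add_zero, map_add]; ring
  rw [e1] at J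
  have e2 : |E n ((((n:ℝ) ^ 2) • (1:V) - ((n:ℝ) ^ 2) • (1 + θ)) * (v - 1))| ≤ vol n * ((n:ℝ) ^ 2 * C) * T ^ 2 := by
    refine (E_mul_le n _ _).trans ?_
    have a : ((n:ℝ) ^ 2) • (1:V) - ((n:ℝ) ^ 2) • (1 + θ) = -(((n:ℝ) ^ 2) • θ) := by module
    rw [a, norm_neg, norm_smul, Real.norm_of_nonneg (by positivity), mul_assoc (vol n)]
    apply mul_le_mul_of_nonneg_left _ hvol.le
    calc _ ≤ (n:ℝ) ^ 2 * T * (C * T) := by gcongr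
      _ = _ := by ring
  have e3 : ‖Eq' n θ v α β - ((n:ℝ) ^ 2) • 1‖ ≤ ((n:ℝ) ^ 2 * (5 + 8 * C) + 2 * C) * T := by
    have a : Eq' n θ v α β - ((n:ℝ) ^ 2) • 1 = ((n:ℝ) ^ 2) • (θ * Pw n v + (Pw n v - Pw n 1)) - (α • aF + β • bF) := by
      rw [Eq', Pw_one, add_mul, one_mul]; module
    rw [a]
    have b1 : ‖θ * Pw n v + (Pw n v - Pw n 1)‖ ≤ T * 5 + 8 * (C * T) := by
      refine (norm_add_le _ _).trans (add_le_add ((norm_mul_le _ _).trans ?_) ((Pw_lip n hn hv hone).trans ?_))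
      · exact mul_le_mul_of_nonneg_left (Pw_bd n hn hv) hT0
      · linarith
    have b2 : ‖α • aF + β • bF‖ ≤ C * T + C * T := by
      refine (norm_add_le _ _).trans ?_
      rw [norm_smul, norm_smul, Real.norm_eq_abs, Real.norm_eq_abs]
      exact add_le_add ((mul_le_of_le_one_right (abs_nonneg _) ab_le.1).trans hα) ((mul_le_of_le_one_right (abs_nonneg _) ab_le.2).trans hβ)
    refine (norm_sub_le _ _).trans ?_
    rw [norm_smul, Real.norm_of_nonneg (by positivity)]
    have := mul_le_mul_of_nonneg_left b1 (by positivity : (0:ℝ) ≤ (n:ℝ) ^ 2)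
    linarith
  have e4 : vol n * (64 * n ^ 2) * (‖v - 1‖ * ‖Eq' n θ v α β - ((n:ℝ) ^ 2) • 1‖ + ‖v - 1‖ ^ 2) ≤
      vol n * (64 * n ^ 2) * (C * ((n:ℝ) ^ 2 * (5 + 8 * C) + 2 * C) + C ^ 2) * T ^ 2 := by
    rw [mul_assoc _ (C * _ + _)]
    apply mul_le_mul_of_nonneg_left _ (by positivity)
    have a1 := mul_le_mul hv2 e3 (norm_nonneg _) (by positivity)
    have a2 := mul_le_mul hv2 hv2 (norm_nonneg _) (by positivity)
    linarith
  have f1 := abs_le.1 J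
  have f2 := abs_le.1 e2
  rw [abs_le]; constructor <;> linarith

lemma cont_dom {X : Type*} [TopologicalSpace X] {F G : X → V} (C : ℝ) (hG : Continuous G) (h : ∀ x y, ‖F x - F y‖ ≤ C * ‖G x - G y‖) : Continuous F := by
  rw [continuous_iff_continuousAt]
  intro y
  rw [ContinuousAt, tendsto_iff_norm_sub_tendsto_zero]
  refine squeeze_zero (fun _ => norm_nonneg _) (fun x => h x y) ?_
  have := (tendsto_iff_norm_sub_tendsto_zero.1 (hG.tendsto y)).const_mul C
  simpa using this

lemma kap_cont (κ : V) : Continuous fun g : SU => κ.comp (tauD g) := by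
  apply ContinuousMap.continuous_of_continuous_uncurry
  change Continuous fun p : SU × Dk => κ (tauD p.1 p.2)
  apply κ.continuous.comp
  refine Continuous.subtype_mk (f := fun p : SU × Dk => tau p.1 p.2) ?_ _
  unfold tau
  refine Continuous.div (by fun_prop) (by unfold dn; fun_prop) fun p => dn_ne p.1 (Dk_le p.2)

lemma su_compact (C : ℝ) : IsCompact {g : SU | ‖g.1.1‖ ≤ C} := by
  have hc : Topology.IsClosedEmbedding (Subtype.val : SU → ℂ × ℂ) := by
    refine IsClosed.isClosedEmbedding_subtypeVal ?_
    exact isClosed_eq (by fun_prop) continuous_const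
  have := hc.isCompact_preimage (isCompact_closedBall (0 : ℂ × ℂ) C)
  convert this using 1
  ext g
  simp only [Set.mem_ofPred_eq, Set.mem_preimage, mem_closedBall_zero_iff, Prod.norm_def, sup_le_iff]
  exact ⟨fun h => ⟨h, (su_lt g).le.trans h⟩, fun h => h.1⟩

theorem reduce (n : ℕ) (hn : 1 ≤ n) (κ : V) (kb : ℝ) (g1 : SU) (h1 : vol n * kb < E n (κ.comp (tauD g1)))
    (h2 : ∀ m : ℝ, 0 < m → ∃ C, ∀ g : SU, C ≤ ‖g.1.1‖ → E n (κ.comp (tauD g)) ≤ vol n * kb + m) :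
    ∃ ε₀ : ℝ, 0 < ε₀ ∧ ∀ ε : ℝ, |ε| < ε₀ → ∃ v : V, (∀ w, 0 < v w) ∧ Gr n v (((n:ℝ) ^ 2) • ((1 + ε • κ) * Pw n v)) := by
  obtain ⟨r1, θ1, hr1, hr14, hθ1, CR⟩ := crit n hn
  obtain ⟨rs, θs, Cs, hrs, hrs2, hθs, hθs1, hCs, S⟩ := stab n hn
  obtain ⟨θ0, C, hθ0, hC, L⟩ := LSex n hn (min r1 rs) (by positivity)
  obtain ⟨C3, hC3, JE⟩ := jexp n hn C hC
  have hp := (pp_bd n hn).1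
  have hn1 : (1:ℝ) ≤ n := by exact_mod_cast hn
  set c := (n:ℝ) ^ 2 / (pp n + 1) with hc
  have hc0 : 0 < c := by positivity
  set m := (E n (κ.comp (tauD g1)) - vol n * kb) / 4 with hm
  have hm0 : 0 < m := by rw [hm]; linarith
  obtain ⟨R, hR⟩ := h2 m hm0
  set M := ‖κ‖ + 1 with hM
  have hM0 : 0 < M := by positivity
  refine ⟨min (min (min θ1 θs) θ0 / M) (c * m / (C3 * M ^ 2)), by positivity, fun ε hε => ?_⟩
  rcases eq_or_ne ε 0 with rfl | hε0
  · refine ⟨1, fun w => by simp, ?_⟩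
    rw [Pw_one]; simpa using Gr_one n hn
  have hεM : |ε| * M ≤ min (min θ1 θs) θ0 := by
    rw [← le_div_iff₀ hM0]; exact hε.le.trans (min_le_left _ _)
  have hεc : C3 * M ^ 2 * |ε| ≤ c * m := by
    have := hε.le.trans (min_le_right _ _)
    rw [le_div_iff₀ (by positivity)] at this; linarith
  set Θ : SU → V := fun g => ε • κ.comp (tauD g) with hΘ
  have hΘn : ∀ g, ‖Θ g‖ ≤ |ε| * M := by
    intro g; rw [hΘ]; simp only [norm_smul, Real.norm_eq_abs]
    exact mul_le_mul_of_nonneg_left ((comp_norm _ _).trans (by linarith)) (abs_nonneg _)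
  have hΘ1 : ∀ g, ‖Θ g‖ ≤ θ1 := fun g => (hΘn g).trans (hεM.trans ((min_le_left _ _).trans (min_le_left _ _)))
  have hΘs : ∀ g, ‖Θ g‖ ≤ θs := fun g => (hΘn g).trans (hεM.trans ((min_le_left _ _).trans (min_le_right _ _)))
  have hΘ0 : ∀ g, ‖Θ g‖ ≤ θ0 := fun g => (hΘn g).trans (hεM.trans (min_le_right _ _))
  have hΘc : Continuous Θ := (kap_cont κ).const_smul ε
  choose v α β a1 a2 a3 a4 a5 a6 using fun g => L (Θ g) (hΘ0 g)
  have b1 : ∀ g, ‖v g - 1‖ ≤ r1 := fun g => (a1 g).trans (min_le_left _ _)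
  have b2 : ∀ g, ‖v g - 1‖ ≤ rs := fun g => (a1 g).trans (min_le_right _ _)
  have b3 : ∀ g, ‖v g - 1‖ ≤ 1/2 := fun g => (b2 g).trans hrs2
  have hvl : ∀ g g', ‖v g - v g'‖ ≤ Cs * ‖Θ g - Θ g'‖ := by
    intro g g'
    have q := S (v g) (v g') (Θ g) (Θ g') _ _ (α g - α g') (β g - β g') (b2 g) (b2 g') (hΘs g) (a6 g) (a6 g')
    have e1 : α g • aF + β g • bF - (α g' • aF + β g' • bF) - ((α g - α g') • aF + (β g - β g') • bF) = 0 := by module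
    have e2 : Orth n (v g - v g') := by
      have := Orth_sub (a5 g) (a5 g'); rwa [sub_sub_sub_cancel_right] at this
    rw [e1, e2.1, e2.2] at q
    simpa using q
  have hvc : Continuous v := cont_dom Cs hΘc hvl
  have hPc : Continuous fun g => Pw n (v g) := cont_dom 8 hvc fun x y => Pw_lip n hn (b3 x) (b3 y)
  set j : SU → ℝ := fun g => Jf n (Θ g) (v g) (Eq' n (Θ g) (v g) (α g) (β g)) with hj
  have hjc : Continuous j := by
    have : j = fun g => (n:ℝ) ^ 2 * (1/2 - 1 / (pp n + 1)) * E n ((1 + Θ g) * (v g * Pw n (v g))) := by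
      ext g; exact jform n (a5 g)
    rw [this]; fun_prop
  set J0 := Jf n 0 1 (((n:ℝ) ^ 2) • 1) with hJ0
  have hje : ∀ g, |ε * j g - (ε * J0 - c * ε ^ 2 * E n (κ.comp (tauD g)))| ≤ c * ε ^ 2 * m := by
    intro g
    have q := JE (Θ g) (v g) (α g) (β g) ((hΘs g).trans hθs1) (b3 g) (a2 g) (a3 g) (a4 g) (a6 g)
    have q2 : C3 * ‖Θ g‖ ^ 2 ≤ C3 * (|ε| * M) ^ 2 := by
      have := hΘn g; gcongr
    have q3 := mul_le_mul_of_nonneg_left (q.trans q2) (abs_nonneg ε)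
    rw [← abs_mul] at q3
    have e1 : E n (Θ g) = ε * E n (κ.comp (tauD g)) := by rw [hΘ]; simp
    rw [e1] at q3
    have q4 := mul_le_mul_of_nonneg_right hεc (by positivity : 0 ≤ |ε| ^ 2)
    rw [sq_abs] at q4
    have e2 : ε * j g - (ε * J0 - c * ε ^ 2 * E n (κ.comp (tauD g))) = ε * (j g - (J0 - c * (ε * E n (κ.comp (tauD g))))) := by ring
    rw [e2]
    refine q3.trans ?_
    have e3 : |ε| * (C3 * (|ε| * M) ^ 2) = C3 * M ^ 2 * |ε| * ε ^ 2 := by rw [mul_pow, sq_abs]; ring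
    rw [e3]; linarith
  obtain ⟨g0, -, hmin⟩ := (su_compact (max R ‖g1.1.1‖)).exists_isMinOn ⟨g1, by rw [Set.mem_ofPred_eq]; exact le_max_right _ _⟩ (f := fun g => ε * j g) (by fun_prop)
  have hglob : ∀ g, ε * j g0 ≤ ε * j g := by
    intro g
    by_cases hg : ‖g.1.1‖ ≤ max R ‖g1.1.1‖
    · exact isMinOn_iff.1 hmin g (by rw [Set.mem_ofPred_eq]; exact hg)
    · have hgR : R ≤ ‖g.1.1‖ := (le_max_left _ _).trans (not_le.1 hg).le
      have q1 : ε * j g0 ≤ ε * j g1 := isMinOn_iff.1 hmin g1 (by rw [Set.mem_ofPred_eq]; exact le_max_right _ _)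
      have q2 := abs_le.1 (hje g1)
      have q3 := abs_le.1 (hje g)
      have hce : 0 ≤ c * ε ^ 2 := by positivity
      have q4 := mul_le_mul_of_nonneg_left (hR g hgR) hce
      have q5 : E n (κ.comp (tauD g1)) = vol n * kb + 4 * m := by rw [hm]; ring
      rw [q5] at q2
      have := mul_nonneg hce hm0.le
      linarith [q2.2, q3.1]
  have hmul : ∀ b, Θ (gm g0 (hB b)) = (Θ g0).comp (tauD (hB b)) := by
    intro b; rw [hΘ]; ext w
    simp [tauD_gm]
  obtain ⟨hα, hβ⟩ := CR (Θ g0) (v g0) (α g0) (β g0) ε hε0 (hΘ1 g0) (b1 g0) (a5 g0) (a6 g0) (by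
    intro b
    refine ⟨v (gm g0 (hB b)), α (gm g0 (hB b)), β (gm g0 (hB b)), b1 _, a5 _, ?_, ?_⟩
    · rw [← hmul]; exact a6 _
    · rw [← hmul]; exact hglob _)
  have G := a6 g0
  rw [hα, hβ] at G
  have G2 := Gr_trans n hn (gi g0) G
  refine ⟨dV (gi g0) n * (v g0).comp (tauD (gi g0)), fun w => ?_, ?_⟩
  · have := abs_le.1 (near_pt (b1 g0) (tauD (gi g0) w))
    exact mul_pos (dV_pos _ _ _) (by change 0 < v g0 (tauD (gi g0) w); linarith [this.1])
  · convert G2 using 1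
    have e1 : (Θ g0).comp (tauD (gi g0)) = ε • κ := by
      ext w; simp [hΘ, tauD_gi]
    have e2 : dV (gi g0) (n + 2) * ((0:ℝ) • aF + (0:ℝ) • bF).comp (tauD (gi g0)) = 0 := by
      ext w; simp
    rw [e1, e2, sub_zero]

end Heis

namespace Heis
open Complex (I)

def z2 (n : ℕ) (p : Pt n) : ℝ := ∑ j, (p.1 j) ^ 2 + ∑ j, (p.2.1 j) ^ 2

lemma z2_nonneg (n : ℕ) (p : Pt n) : 0 ≤ z2 n p := by unfold z2; positivity

def eta (n : ℕ) (p : Pt n) : ℂ := ⟨z2 n p, -p.2.2⟩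

def Wf (η : ℂ) : ℂ := (1 - η) / (1 + η)

lemma one_eta_ne {η : ℂ} (h : 0 ≤ η.re) : 1 + η ≠ 0 := by
  intro h0
  have := congrArg Complex.re h0
  simp at this; linarith

lemma Wf_add {η : ℂ} (h : 0 ≤ η.re) : 1 + Wf η = 2 / (1 + η) := by
  have := one_eta_ne h
  unfold Wf; field_simp; ring

lemma Wf_inv {η : ℂ} (h : 0 ≤ η.re) : (1 - Wf η) / (1 + Wf η) = η := by
  have := one_eta_ne h
  rw [Wf_add h, Wf]; field_simp; ring

lemma Wf_sq {η : ℂ} (h : 0 ≤ η.re) : 1 - ‖Wf η‖ ^ 2 = 4 * η.re / ‖1 + η‖ ^ 2 := by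
  have h1 := one_eta_ne h
  have h2 : ‖1 + η‖ ^ 2 ≠ 0 := by simp [h1]
  rw [Wf, norm_div, div_pow, eq_div_iff h2, sub_mul, div_mul_cancel₀ _ h2, ← Complex.normSq_eq_norm_sq,
    ← Complex.normSq_eq_norm_sq, Complex.normSq_apply, Complex.normSq_apply]
  simp; ring

lemma Wf_le {η : ℂ} (h : 0 ≤ η.re) : ‖Wf η‖ ≤ 1 := by
  have h1 := Wf_sq h
  have : 0 ≤ 4 * η.re / ‖1 + η‖ ^ 2 := by positivity
  have h2 : ‖Wf η‖ ^ 2 ≤ 1 := by linarith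
  exact (sq_le_one_iff₀ (norm_nonneg _)).1 h2

def WD (n : ℕ) (p : Pt n) : Dk := ⟨Wf (eta n p), mem_closedBall_zero_iff.2 (Wf_le (z2_nonneg n p))⟩

def kv (n : ℕ) (w : ℂ) (i : Fin (n + 1)) : ℂ :=
  if i = Fin.last n then w else if i = 0 then (Real.sqrt (1 - ‖w‖ ^ 2) : ℂ) else 0

lemma kv_cont (n : ℕ) : Continuous (kv n) := by
  refine continuous_pi fun i => ?_
  unfold kv
  split_ifs <;> fun_prop

lemma kv_last (n : ℕ) (w : ℂ) : kv n w (Fin.last n) = w := by simp [kv]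

lemma kv_sum (n : ℕ) (hn : 1 ≤ n) (w : ℂ) (c : ℂ) :
    ∑ j : Fin n, Complex.normSq (kv n w j.castSucc / c) = Complex.normSq ((Real.sqrt (1 - ‖w‖ ^ 2) : ℂ) / c) := by
  obtain ⟨m, rfl⟩ : ∃ m, n = m + 1 := ⟨n - 1, by omega⟩
  rw [Fin.sum_univ_succ]
  have h : ∀ i : Fin m, kv (m + 1) w (i.succ).castSucc = 0 := by
    intro i
    simp only [kv]
    rw [if_neg (Fin.castSucc_lt_last _).ne, if_neg]
    rw [Fin.castSucc_eq_zero_iff]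
    exact Fin.succ_ne_zero _
  simp only [h, zero_div, map_zero, Finset.sum_const_zero, add_zero]
  congr 2

lemma kW (n : ℕ) (hn : 1 ≤ n) (k : Pt n → ℝ) (hkcyl : IsCyl n k) (kbar : (Fin (n + 1) → ℂ) → ℝ)
    (hb : ∀ ζ : Fin (n + 1) → ℂ, (∑ i, Complex.normSq (ζ i)) = 1 →
          ζ (Fin.last n) ≠ -1 → k (cayley n ζ) = kbar ζ) (p : Pt n) :
    k p = kbar (kv n (Wf (eta n p))) := by
  have hp : 0 ≤ (eta n p).re := z2_nonneg n p
  have hne := one_eta_ne hp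
  set w := Wf (eta n p) with hw
  have hw1 : ‖w‖ ≤ 1 := Wf_le hp
  have hs : 0 ≤ 1 - ‖w‖ ^ 2 := by nlinarith [norm_nonneg w]
  have h1w := Wf_add hp
  rw [← hb (kv n w)]
  · obtain ⟨v, hv⟩ := hkcyl
    rw [hv, hv]
    congr 1
    · unfold znorm
      congr 1
      simp only [cayley, kv_last]
      rw [← Finset.sum_add_distrib (f := fun j : Fin n => ((kv n w j.castSucc / (1 + w)).re) ^ 2)]
      have e : ∀ j : Fin n, ((kv n w j.castSucc / (1 + w)).re) ^ 2 + ((kv n w j.castSucc / (1 + w)).im) ^ 2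
          = Complex.normSq (kv n w j.castSucc / (1 + w)) := by
        intro j; rw [Complex.normSq_apply]; ring
      simp only [e]
      rw [kv_sum n hn, map_div₀, Complex.normSq_ofReal, Real.mul_self_sqrt hs, hw, Wf_sq hp, h1w,
        map_div₀, Complex.normSq_eq_norm_sq, Complex.normSq_eq_norm_sq]
      have : ‖1 + eta n p‖ ≠ 0 := by simpa using hne
      simp only [Complex.norm_ofNat]
      field_simp
      simp [eta, z2]; ring
    · simp only [cayley, kv_last]
      rw [mul_div_assoc, hw, Wf_inv hp]
      simp [eta]
  · rw [Fin.sum_univ_castSucc, kv_last]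
    have := kv_sum n hn w 1
    simp only [div_one] at this
    rw [this, Complex.normSq_ofReal, Real.mul_self_sqrt hs, Complex.normSq_eq_norm_sq]; ring
  · rw [kv_last]
    intro h
    rw [← hw, h] at h1w
    rw [add_neg_cancel, eq_comm, div_eq_zero_iff] at h1w
    exact h1w.elim (by norm_num) hne

lemma circ_le (n : ℕ) (κ : ℂ → ℝ) (hκ : Continuous κ) (kb : ℝ)
    (h : ∀ σ : ℝ, κ (Wf (eta n (0, 0, σ))) ≤ kb) (w : ℂ) (hw : ‖w‖ = 1) : κ w ≤ kb := by
  have key : ∀ w : ℂ, ‖w‖ = 1 → w ≠ -1 → κ w ≤ kb := by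
    intro w hw hw1
    have h1 : 1 + w ≠ 0 := by
      intro h; apply hw1; linear_combination h
    have e : Wf (eta n (0, 0, -((1 - w) / (1 + w)).im)) = w := by
      have e1 : eta n (0, 0, -((1 - w) / (1 + w)).im) = (1 - w) / (1 + w) := by
        apply Complex.ext
        · have : ((1 - w) / (1 + w)).re = 0 := by
            rw [Complex.div_re, ← add_div]
            have : w.re * w.re + w.im * w.im = 1 := by
              rw [← Complex.normSq_apply, Complex.normSq_eq_norm_sq, hw]; norm_num
            rw [div_eq_zero_iff]; left
            simp; linarith
          rw [this]; simp [eta, z2]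
        · simp [eta]
      rw [e1, Wf]
      have : 1 + (1 - w) / (1 + w) = 2 / (1 + w) := by field_simp; ring
      rw [this]; field_simp; ring
    rw [← e]; exact h _
  by_cases hw1 : w = -1
  · have hcl : IsClosed {θ : ℝ | κ (Complex.exp (θ * I)) ≤ kb} :=
      isClosed_le (by fun_prop) continuous_const
    have hsub : Set.Ioo 0 Real.pi ⊆ {θ : ℝ | κ (Complex.exp (θ * I)) ≤ kb} := by
      intro θ hθ
      rw [Set.mem_ofPred_eq]
      apply key _ (Complex.norm_exp_ofReal_mul_I θ)
      intro h
      have := congrArg Complex.im h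
      rw [Complex.exp_ofReal_mul_I_im] at this
      have h2 := Real.sin_pos_of_mem_Ioo hθ
      simp at this; linarith
    have h3 := (closure_mono hsub).trans hcl.closure_subset
    rw [closure_Ioo Real.pi_pos.ne] at h3
    have h4 := h3 (Set.right_mem_Icc.2 Real.pi_pos.le)
    rw [Set.mem_ofPred_eq, Complex.exp_pi_mul_I] at h4
    rw [hw1]; exact h4
  · exact key w hw hw1

lemma nu_le (n : ℕ) : nu n ≤ (volume : Measure ℂ).comap (Subtype.val : Dk → ℂ) := by
  unfold nu
  conv_rhs => rw [← withDensity_one (μ := (volume : Measure ℂ).comap (Subtype.val : Dk → ℂ))]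
  apply withDensity_mono
  filter_upwards with w
  have h1 := Dk_le w
  rw [Pi.one_apply, ENNReal.ofReal_le_one]
  exact pow_le_one₀ (by nlinarith [norm_nonneg (w:ℂ)]) (by nlinarith [norm_nonneg (w:ℂ)])

lemma nu_int (n : ℕ) {g : ℂ → ℝ} (hg : IntegrableOn g Dk) : Integrable (fun w : Dk => g w) (nu n) := by
  refine Integrable.mono_measure ?_ (nu_le n)
  exact (integrableOn_iff_comap_subtypeVal Metric.isClosed_closedBall.measurableSet).1 hg

lemma nu_ae (n : ℕ) {s : Set ℂ} (hs : volume s = 0) : ∀ᵐ w : Dk ∂(nu n), (w:ℂ) ∉ s := by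
  have h2 : ∀ᵐ w : Dk ∂((volume : Measure ℂ).comap (Subtype.val : Dk → ℂ)), (w:ℂ) ∉ s := by
    have h : ∀ᵐ x : ℂ ∂(volume.restrict Dk), x ∉ s := ae_restrict_of_ae (measure_eq_zero_iff_ae_notMem.1 hs)
    rw [← map_comap_subtype_coe Metric.isClosed_closedBall.measurableSet] at h
    exact ae_of_ae_map measurable_subtype_coe.aemeasurable h
  exact (Measure.absolutelyContinuous_of_le (nu_le n)).ae_le h2

lemma G2 (n : ℕ) (κ : V) (kb : ℝ) (hκ : ∀ w : Dk, ‖(w:ℂ)‖ = 1 → κ w ≤ kb) :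
    ∀ m > 0, ∃ C, ∀ g : SU, C ≤ ‖g.1.1‖ → E n (κ.comp (tauD g)) ≤ vol n * kb + m := by
  have key : Tendsto (fun g : SU => ∫ w : Dk, (1 - ‖tau g w‖ ^ 2) ∂nu n)
      (comap (fun g : SU => ‖g.1.1‖) atTop) (𝓝 (∫ w : Dk, (0:ℝ) ∂nu n)) := by
    apply tendsto_integral_filter_of_dominated_convergence (fun _ => 1)
    · filter_upwards with g
      have : Continuous (fun w : Dk => 1 - ‖tau g w‖ ^ 2) := by
        have : Continuous fun w : Dk => tau g w := continuous_subtype_val.comp (tauD g).continuous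
        fun_prop
      exact (nu_integrable n this).aestronglyMeasurable
    · filter_upwards with g
      filter_upwards with w
      have := tau_le g (Dk_le w)
      rw [Real.norm_eq_abs, abs_le]
      constructor <;> nlinarith [norm_nonneg (tau g w)]
    · exact integrable_const _
    · filter_upwards [nu_ae n (Measure.addHaar_sphere volume (0:ℂ) 1)] with w hw
      have hw1 : ‖(w:ℂ)‖ < 1 := lt_of_le_of_ne (Dk_le w) fun h => hw (by simp [h])
      have h0 : Tendsto (fun a : ℝ => (a * (1 - ‖(w:ℂ)‖))⁻¹ ^ 2) atTop (𝓝 0) := by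
        have : Tendsto (fun a : ℝ => (a * (1 - ‖(w:ℂ)‖))⁻¹) atTop (𝓝 0) :=
          tendsto_inv_atTop_zero.comp (tendsto_id.atTop_mul_const (by linarith))
        simpa using this.pow 2
      refine squeeze_zero (fun g => ?_) (fun g => ?_) (h0.comp tendsto_comap)
      · have := tau_le g (Dk_le w)
        nlinarith [norm_nonneg (tau g w)]
      · rw [tau_norm g (Dk_le w)]
        have ha : 0 < ‖g.1.1‖ := by
          have := g.2
          rw [norm_pos_iff]; intro h; rw [h] at this; simp at this
          nlinarith [sq_nonneg ‖g.1.2‖]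
        have hba : ‖g.1.2‖ ≤ ‖g.1.1‖ := by
          have := g.2
          exact abs_le_of_sq_le_sq' (by linarith) ha.le |>.2
        have hd : ‖g.1.1‖ * (1 - ‖(w:ℂ)‖) ≤ ‖dn g w‖ := by
          have h1 : ‖g.1.1‖ ≤ ‖dn g w‖ + ‖g.1.2 * w‖ := by
            have := norm_sub_le (dn g w) (g.1.2 * w)
            simpa [dn] using this
          rw [norm_mul] at h1
          have := mul_le_mul_of_nonneg_right hba (norm_nonneg (w:ℂ))
          linarith
        have hpos : 0 < ‖g.1.1‖ * (1 - ‖(w:ℂ)‖) := mul_pos ha (by linarith)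
        simp only [Function.comp]
        rw [inv_pow, ← one_div]
        gcongr
        nlinarith [norm_nonneg (w:ℂ)]
  rw [integral_zero] at key
  intro m hm
  set m' := m / (2 * (vol n + 1)) with hm'
  have hv := vol_nonneg n
  have hm0 : 0 < m' := by positivity
  -- κ ≤ kb + m' + C (1-|w|^2)
  obtain ⟨C, hC0, hC⟩ : ∃ C, 0 < C ∧ ∀ w : Dk, κ w ≤ kb + m' + C * (1 - ‖(w:ℂ)‖ ^ 2) := by
    have hcpt : IsCompact {w : Dk | kb + m' ≤ κ w} :=
      (isClosed_le continuous_const κ.continuous).isCompact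
    rcases Set.eq_empty_or_nonempty {w : Dk | kb + m' ≤ κ w} with h | h
    · refine ⟨1, one_pos, fun w => ?_⟩
      have : w ∉ {w : Dk | kb + m' ≤ κ w} := by rw [h]; simp
      rw [Set.mem_ofPred_eq, not_le] at this
      have := Dk_le w
      nlinarith [norm_nonneg (w:ℂ)]
    · obtain ⟨w0, hw0, hmin⟩ := hcpt.exists_isMinOn h (f := fun w : Dk => 1 - ‖(w:ℂ)‖ ^ 2) (by fun_prop)
      rw [Set.mem_ofPred_eq] at hw0
      have hlt : ‖(w0:ℂ)‖ < 1 := lt_of_le_of_ne (Dk_le w0) fun h => by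
        have := hκ w0 h; linarith
      set δ := 1 - ‖(w0:ℂ)‖ ^ 2 with hδ
      have hδ0 : 0 < δ := by nlinarith [norm_nonneg (w0:ℂ)]
      refine ⟨(‖κ‖ + |kb| + 1) / δ, by positivity, fun w => ?_⟩
      by_cases hw : kb + m' ≤ κ w
      · have h1 := isMinOn_iff.1 hmin w (by rw [Set.mem_ofPred_eq]; exact hw)
        have h2 : ‖κ‖ + |kb| + 1 ≤ (‖κ‖ + |kb| + 1) / δ * (1 - ‖(w:ℂ)‖ ^ 2) := by
          rw [div_mul_eq_mul_div, le_div_iff₀ hδ0]; gcongr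
        have := (abs_le.1 (V_le κ w)).2
        have := neg_abs_le kb
        linarith
      · have := Dk_le w
        have : 0 ≤ (‖κ‖ + |kb| + 1) / δ * (1 - ‖(w:ℂ)‖ ^ 2) := by
          apply mul_nonneg (by positivity); nlinarith [norm_nonneg (w:ℂ)]
        linarith
  have h5 := key.eventually (gt_mem_nhds (show (0:ℝ) < m / (2 * C) by positivity))
  rw [eventually_comap] at h5
  obtain ⟨R, hR⟩ := eventually_atTop.1 h5
  refine ⟨R, fun g hg => ?_⟩
  have h6 := hR _ hg g rfl
  have hct : Continuous (fun w : Dk => 1 - ‖tau g w‖ ^ 2) := by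
    have : Continuous fun w : Dk => tau g w := continuous_subtype_val.comp (tauD g).continuous
    fun_prop
  have h7 : E n (κ.comp (tauD g)) ≤ E n ((kb + m') • (1 : V) + C • (⟨_, hct⟩ : V)) := by
    apply E_mono
    intro w
    have := hC (tauD g w)
    rw [tauD_coe] at this
    simpa using this
  rw [map_add, map_smul, map_smul, E_one, E_apply n (⟨_, hct⟩ : V)] at h7
  simp only [smul_eq_mul, ContinuousMap.coe_mk] at h7
  have h8 : C * ∫ w : Dk, (1 - ‖tau g w‖ ^ 2) ∂nu n ≤ m / 2 := by
    have := mul_le_mul_of_nonneg_left h6.le hC0.le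
    refine this.trans (le_of_eq ?_)
    field_simp
  have h9 : m' * vol n ≤ m / 2 := by
    rw [hm', div_mul_eq_mul_div, div_le_iff₀ (by positivity)]
    nlinarith
  linarith

end Heis

namespace Heis
open Complex (I)

lemma eta_eq (n : ℕ) (p : Pt n) : eta n p = (z2 n p : ℂ) - (p.2.2 : ℂ) * I := by
  apply Complex.ext <;> simp [eta]

lemma z2_smooth (n : ℕ) : ContDiff ℝ (⊤ : ℕ∞) (z2 n) := by
  unfold z2
  apply ContDiff.add <;> refine ContDiff.sum fun j _ => ContDiff.pow ?_ 2 <;> fun_prop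

lemma eta_smooth (n : ℕ) : ContDiff ℝ (⊤ : ℕ∞) (eta n) := by
  have h : eta n = fun p => Complex.ofRealCLM (z2 n p) - Complex.ofRealCLM p.2.2 * I := by
    ext p; rw [eta_eq]; simp
  rw [h]
  have := z2_smooth n
  fun_prop

lemma inv_smooth (n : ℕ) : ContDiff ℝ (⊤ : ℕ∞) (fun p => (1 + eta n p)⁻¹) := by
  have := eta_smooth n
  exact ContDiff.inv (by fun_prop) fun p => one_eta_ne (z2_nonneg n p)

lemma k_smooth (n : ℕ) (k : Pt n → ℝ) (kbar : (Fin (n + 1) → ℂ) → ℝ) (hk : ContDiff ℝ (⊤ : ℕ∞) kbar)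
    (hb : ∀ ζ : Fin (n + 1) → ℂ, (∑ i, Complex.normSq (ζ i)) = 1 →
          ζ (Fin.last n) ≠ -1 → k (cayley n ζ) = kbar ζ) : ContDiff ℝ (⊤ : ℕ∞) k := by
  set Z : Pt n → Fin (n + 1) → ℂ := fun p => Fin.snoc (α := fun _ => ℂ)
    (fun j : Fin n => ((p.1 j : ℂ) + (p.2.1 j : ℂ) * I) * (2 * (1 + eta n p)⁻¹)) (Wf (eta n p)) with hZ
  have hZs : ContDiff ℝ (⊤ : ℕ∞) Z := by
    have h1 := inv_smooth n
    have h2 := eta_smooth n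
    rw [contDiff_pi]
    intro i
    refine Fin.lastCases ?_ (fun j => ?_) i
    · simp only [hZ, Fin.snoc_last, Wf, div_eq_mul_inv]
      fun_prop
    · simp only [hZ, Fin.snoc_castSucc]
      have : ContDiff ℝ (⊤ : ℕ∞) (fun p : Pt n => Complex.ofRealCLM (p.1 j) + Complex.ofRealCLM (p.2.1 j) * I) := by
        fun_prop
      exact ContDiff.mul this (by fun_prop)
  have he : k = kbar ∘ Z := by
    ext p
    have hp : 0 ≤ (eta n p).re := z2_nonneg n p
    have hne := one_eta_ne hp
    have h1w := Wf_add hp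
    rw [Function.comp, ← hb (Z p)]
    · congr 1
      have e : ∀ j : Fin n, Z p j.castSucc / (1 + Z p (Fin.last n)) = (p.1 j : ℂ) + (p.2.1 j : ℂ) * I := by
        intro j
        simp only [hZ, Fin.snoc_last, Fin.snoc_castSucc]
        rw [h1w]; field_simp
      unfold cayley
      ext j
      · simp only [e]; simp
      · simp only [e]; simp
      · simp only [hZ, Fin.snoc_last]
        rw [mul_div_assoc, Wf_inv hp]; simp [eta]
    · rw [Fin.sum_univ_castSucc]
      have e : ∀ j : Fin n, Complex.normSq (Z p j.castSucc) = ((p.1 j) ^ 2 + (p.2.1 j) ^ 2) * (4 / ‖1 + eta n p‖ ^ 2) := by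
        intro j
        simp only [hZ, Fin.snoc_castSucc]
        rw [map_mul, map_mul, map_inv₀, Complex.normSq_add_mul_I, Complex.normSq_eq_norm_sq (1 + eta n p)]
        have : Complex.normSq 2 = 4 := by rw [Complex.normSq_ofNat]; norm_num
        rw [this]; ring
      simp only [e]
      rw [← Finset.sum_mul, Finset.sum_add_distrib]
      simp only [hZ, Fin.snoc_last]
      have h3 := Wf_sq hp
      rw [Complex.normSq_eq_norm_sq]
      have : (eta n p).re = ∑ j, (p.1 j) ^ 2 + ∑ j, (p.2.1 j) ^ 2 := rfl
      rw [this] at h3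
      linear_combination -h3
    · simp only [hZ, Fin.snoc_last]
      intro h
      rw [h, add_neg_cancel, eq_comm, div_eq_zero_iff] at h1w
      exact h1w.elim (by norm_num) hne
  rw [he]
  exact hk.comp hZs

/-- local lower bound -/
lemma k_loc (n : ℕ) (k : Pt n → ℝ) (hk : ContDiff ℝ (⊤ : ℕ∞) k) (κ : ℂ → ℝ)
    (hκ : ∀ p, k p = κ (Wf (eta n p))) (sb : ℝ) (hmax : ∀ σ : ℝ, k (0, 0, σ) ≤ k (0, 0, sb))
    (e : Pt n) (he : ∀ r t : ℝ, eta n ((0, 0, sb) + r • e + t • et n) = ⟨r ^ 2, -(sb + t)⟩)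
    (hpos : 0 < fderiv ℝ (fun q => fderiv ℝ k q e) (0, 0, sb) e) :
    ∃ c > 0, ∀ δ > 0, ∃ ρ > 0, ∀ η : ℂ, 0 ≤ η.re → ‖η‖ < ρ →
      k (0, 0, sb) + c * η.re - δ * ‖η‖ ≤ κ (Wf (η - I * sb)) := by
  set p0 : Pt n := (0, 0, sb) with hp0
  set c2 := fderiv ℝ (fun q => fderiv ℝ k q e) p0 e with hc2
  have hkd : Differentiable ℝ k := hk.differentiable (by simp)
  have hkd2 : Differentiable ℝ (fun q => fderiv ℝ k q e) := by
    have : ContDiff ℝ 1 (fderiv ℝ k) := hk.fderiv_right (by norm_cast)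
    exact (this.differentiable (by norm_num)).clm_apply (differentiable_const _)
  have hline : ∀ r : ℝ, HasDerivAt (fun r : ℝ => p0 + r • e) e r := by
    intro r
    simpa using ((hasDerivAt_id r).smul_const e).const_add p0
  have hline2 : ∀ r : ℝ, HasDerivAt (fun r : ℝ => p0 + r • et n) (et n) r := by
    intro r
    simpa using ((hasDerivAt_id r).smul_const (et n)).const_add p0
  set φ : ℝ → ℝ := fun r => k (p0 + r • e) with hφ
  have hφ1 : ∀ r, HasDerivAt φ (fderiv ℝ k (p0 + r • e) e) r := fun r =>
    (hkd _).hasFDerivAt.comp_hasDerivAt r (hline r)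
  have hφ2 : HasDerivAt (fun r : ℝ => fderiv ℝ k (p0 + r • e) e) c2 0 := by
    have := (hkd2 (p0 + (0:ℝ) • e)).hasFDerivAt.comp_hasDerivAt 0 (hline 0)
    rw [zero_smul, add_zero] at this
    exact this
  have hev : ∀ r, φ (-r) = φ r := by
    intro r
    simp only [hφ, hκ]
    have h1 := he (-r) 0
    have h2 := he r 0
    simp only [zero_smul, add_zero, neg_sq] at h1 h2
    rw [h1, h2]
  have hφ0 : fderiv ℝ k p0 e = 0 := by
    have h1 := hφ1 0
    have h2 : HasDerivAt (fun r => φ (-r)) (-(fderiv ℝ k (p0 + (0:ℝ) • e) e)) 0 := by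
      have h3 := hφ1 0
      rw [← neg_zero] at h3
      have h4 : HasDerivAt (fun r => φ (-r)) _ 0 := h3.comp (0:ℝ) (hasDerivAt_neg (0:ℝ))
      exact h4.congr_deriv (by simp)
    rw [funext hev] at h2
    have := h1.unique h2
    simp only [zero_smul, add_zero] at this
    linarith
  set c := c2 / 4 with hc
  have hc0 : 0 < c := by positivity
  have hmin : IsLocalMin (fun r => φ r - c * r ^ 2) 0 := by
    have hd : ∀ r, HasDerivAt (fun r => φ r - c * r ^ 2) (fderiv ℝ k (p0 + r • e) e - c * (2 * r)) r := by
      intro r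
      have := (hφ1 r).fun_sub ((hasDerivAt_pow 2 r).const_mul c)
      exact this.congr_deriv (by simp)
    have hd2 : deriv (fun r => φ r - c * r ^ 2) = fun r => fderiv ℝ k (p0 + r • e) e - c * (2 * r) :=
      funext fun r => (hd r).deriv
    apply isLocalMin_of_deriv_deriv_pos
    · rw [hd2]
      have : HasDerivAt (fun r => fderiv ℝ k (p0 + r • e) e - c * (2 * r)) (c2 - c * 2) 0 := by
        have := hφ2.fun_sub (((hasDerivAt_id (0:ℝ)).const_mul 2).const_mul c)
        exact this.congr_deriv (by simp)
      rw [this.deriv, hc]; linarith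
    · rw [hd2]; simp [hφ0]
    · exact (hd 0).continuousAt
  have ht0 : fderiv ℝ k p0 (et n) = 0 := by
    have h1 : HasDerivAt (fun t : ℝ => k (p0 + t • et n)) (fderiv ℝ k (p0 + (0:ℝ) • et n) (et n)) 0 :=
      (hkd _).hasFDerivAt.comp_hasDerivAt 0 (hline2 0)
    have h2 : IsLocalMax (fun t : ℝ => k (p0 + t • et n)) 0 := by
      apply Filter.Eventually.of_forall
      intro t
      have e1 : p0 + t • et n = (0, 0, sb + t) := by simp [hp0, et]
      have e2 : p0 + (0:ℝ) • et n = (0, 0, sb) := by simp [hp0]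
      change k (p0 + t • et n) ≤ k (p0 + (0:ℝ) • et n)
      rw [e1, e2]; exact hmax _
    have := h2.hasDerivAt_eq_zero h1
    simpa using this
  refine ⟨c, hc0, fun δ hδ => ?_⟩
  have hst : HasStrictFDerivAt k (fderiv ℝ k p0) p0 := hk.contDiffAt.hasStrictFDerivAt (by simp)
  have hlo := hst.isLittleO.def (show (0:ℝ) < δ / (‖et n‖ + 1) by positivity)
  have hcont : Tendsto (fun q : ℝ × ℝ => ((p0 + q.1 • e + q.2 • et n, p0 + q.1 • e) : Pt n × Pt n)) (𝓝 (0, 0)) (𝓝 (p0, p0)) := by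
    have : Continuous (fun q : ℝ × ℝ => ((p0 + q.1 • e + q.2 • et n, p0 + q.1 • e) : Pt n × Pt n)) := by fun_prop
    have := this.tendsto (0, 0)
    simpa using this
  have h5 := hcont.eventually hlo
  have h6 : ∀ᶠ q : ℝ × ℝ in 𝓝 (0, 0), φ 0 - c * 0 ^ 2 ≤ φ q.1 - c * q.1 ^ 2 :=
    (continuous_fst.tendsto ((0:ℝ), (0:ℝ))).eventually hmin
  obtain ⟨ρ, hρ, hball⟩ := Metric.eventually_nhds_iff.1 (h5.and h6)
  refine ⟨min 1 (ρ ^ 2 / 2) ⊓ (ρ / 2), by positivity, fun η hη hηρ => ?_⟩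
  obtain ⟨h7, h8⟩ := lt_inf_iff.1 hηρ
  have h9 : ‖η‖ < ρ ^ 2 / 2 := h7.trans_le (min_le_right _ _)
  have hre := (Complex.abs_re_le_norm η)
  have him := (Complex.abs_im_le_norm η)
  have hr : |√η.re| < ρ := by
    rw [abs_of_nonneg (Real.sqrt_nonneg _), Real.sqrt_lt' hρ]
    have := le_abs_self η.re
    nlinarith
  have ht : |-η.im| < ρ := by rw [abs_neg]; linarith
  obtain ⟨q1, q2⟩ := @hball (√η.re, -η.im) (by
    rw [Prod.dist_eq, Real.dist_eq, Real.dist_eq, sub_zero, sub_zero]; exact max_lt hr ht)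
  simp only at q1 q2
  rw [add_sub_cancel_left, map_smul, ht0, smul_zero, sub_zero, norm_smul, Real.norm_eq_abs, Real.norm_eq_abs, abs_neg] at q1
  rw [Real.sq_sqrt hη] at q2
  have q3 : δ / (‖et n‖ + 1) * (|η.im| * ‖et n‖) ≤ δ * ‖η‖ := by
    rw [div_mul_eq_mul_div, div_le_iff₀ (by positivity)]
    have : |η.im| * ‖et n‖ ≤ ‖η‖ * (‖et n‖ + 1) := by gcongr; linarith
    nlinarith
  have q4 : k (p0 + √η.re • e + (-η.im) • et n) = κ (Wf (η - I * sb)) := by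
    rw [hκ, he, Real.sq_sqrt hη]
    congr 2
    apply Complex.ext <;> simp
    ring
  have q5 : φ 0 = k p0 := by simp [hφ]
  have q6 := (abs_le.1 (q1.trans q3)).1
  rw [q4] at q6
  simp only [hφ] at q2
  have q7 : k (p0 + (0:ℝ) • e) = k p0 := by simp
  rw [q7] at q2
  linarith

lemma k_dir (n : ℕ) (k : Pt n → ℝ) (sb : ℝ) (hlap : 0 < lapXY n k (0, 0, sb)) :
    ∃ e : Pt n, (∀ r t : ℝ, eta n ((0, 0, sb) + r • e + t • et n) = ⟨r ^ 2, -(sb + t)⟩) ∧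
    0 < fderiv ℝ (fun q => fderiv ℝ k q e) (0, 0, sb) e := by
  have h1 : ∀ j r t, eta n ((0, 0, sb) + r • ex n j + t • et n) = ⟨r ^ 2, -(sb + t)⟩ := by
    intro j r t
    have : z2 n ((0, 0, sb) + r • ex n j + t • et n) = r ^ 2 := by
      simp [z2, ex, et, Pi.single_apply]
    simp only [eta, this]; congr 1; simp [ex, et]
  have h2 : ∀ j r t, eta n ((0, 0, sb) + r • ey n j + t • et n) = ⟨r ^ 2, -(sb + t)⟩ := by
    intro j r t
    have : z2 n ((0, 0, sb) + r • ey n j + t • et n) = r ^ 2 := by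
      simp [z2, ey, et, Pi.single_apply]
    simp only [eta, this]; congr 1; simp [ey, et]
  by_contra hcon
  push Not at hcon
  apply absurd hlap
  rw [not_lt]
  unfold lapXY
  exact Finset.sum_nonpos fun j _ => add_nonpos (hcon _ (h1 j)) (hcon _ (h2 j))

def etaw (w : ℂ) : ℂ := (1 - w) / (1 + w)

lemma nu_eta (n : ℕ) : Integrable (fun w : Dk => ‖etaw w‖ * √‖etaw w‖) (nu n) := by
  have h0 : IntegrableOn (fun x : ℂ => ‖x‖ ^ (-(3/2 : ℝ))) (Metric.closedBall (0:ℂ) 2) := by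
    refine (locallyIntegrable_of_norm_le_rpow (C := 1) (α := 3/2) ?_ ?_ ?_ ?_).integrableOn_isCompact
      (isCompact_closedBall (0:ℂ) 2)
    · simp
    · simp; norm_num
    · filter_upwards with x
      rw [one_mul, Real.norm_eq_abs, abs_of_nonneg (by positivity)]
    · exact (by fun_prop : Measurable fun x : ℂ => ‖x‖ ^ (-(3/2 : ℝ))).aestronglyMeasurable
  have h1 := ((measurePreserving_add_left (volume : Measure ℂ) 1).integrableOn_comp_preimage
    (measurableEmbedding_addLeft (1:ℂ))).2 h0
  have h2 : Dk ⊆ (fun x : ℂ => 1 + x) ⁻¹' Metric.closedBall (0:ℂ) 2 := by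
    intro w hw
    have : ‖w‖ ≤ 1 := mem_closedBall_zero_iff.1 hw
    rw [Set.mem_preimage, mem_closedBall_zero_iff]
    have := norm_add_le (1:ℂ) w
    rw [norm_one] at this; linarith
  have h3 := (h1.mono_set h2).const_mul (2 * √2)
  have hm : Measurable (fun w : ℂ => ‖etaw w‖ * √‖etaw w‖) := by
    unfold etaw
    fun_prop
  refine nu_int n (g := fun w : ℂ => ‖etaw w‖ * √‖etaw w‖) ?_
  refine Integrable.mono' h3 hm.aestronglyMeasurable ?_
  refine (ae_restrict_iff' Metric.isClosed_closedBall.measurableSet).2 (Eventually.of_forall fun w hw => ?_)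
  have hw1 : ‖w‖ ≤ 1 := mem_closedBall_zero_iff.1 hw
  have h4 : ‖etaw w‖ ≤ 2 / ‖1 + w‖ := by
    rw [etaw, norm_div]
    gcongr
    have := norm_sub_le (1:ℂ) w
    rw [norm_one] at this; linarith
  rw [Real.norm_eq_abs, abs_of_nonneg (by positivity)]
  have h5 : ‖etaw w‖ * √‖etaw w‖ ≤ 2 / ‖1 + w‖ * √(2 / ‖1 + w‖) := by gcongr
  refine h5.trans (le_of_eq ?_)
  simp only [Function.comp]
  by_cases h0 : ‖1 + w‖ = 0
  · rw [h0]; simp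
  · have hp : 0 < ‖1 + w‖ := lt_of_le_of_ne (norm_nonneg _) (Ne.symm h0)
    rw [Real.sqrt_div (by norm_num), Real.rpow_neg hp.le, show (3/2:ℝ) = 1 + 1/2 by norm_num, Real.rpow_add hp,
      Real.rpow_one, ← Real.sqrt_eq_rpow]
    field_simp

def gms (μ s : ℝ) (hμ : 0 < μ) : SU := ⟨(⟨(1 + μ ^ 2) / (2 * μ), -s / (2 * μ)⟩, ⟨(1 - μ ^ 2) / (2 * μ), -s / (2 * μ)⟩), by
  rw [← Complex.normSq_eq_norm_sq, ← Complex.normSq_eq_norm_sq, Complex.normSq_apply, Complex.normSq_apply]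
  simp only
  field_simp; ring⟩

lemma etaw_re {w : ℂ} : (etaw w).re = (1 - ‖w‖ ^ 2) / ‖1 + w‖ ^ 2 := by
  rw [etaw, Complex.div_re, ← add_div, ← Complex.normSq_eq_norm_sq, ← Complex.normSq_eq_norm_sq, Complex.normSq_apply w]
  congr 1
  simp; ring

lemma tau_gms (μ s : ℝ) (hμ : 0 < μ) {w : ℂ} (hw : ‖w‖ ≤ 1) (hw1 : w ≠ -1) :
    tau (gms μ s hμ) w = Wf (((μ ^ 2 : ℝ) : ℂ) * etaw w - I * s) := by
  have h1 : 1 + w ≠ 0 := by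
    intro h; apply hw1; linear_combination h
  have hre : 0 ≤ (((μ ^ 2 : ℝ) : ℂ) * etaw w - I * s).re := by
    have : (((μ ^ 2 : ℝ) : ℂ) * etaw w - I * s).re = μ ^ 2 * (etaw w).re := by
      rw [Complex.sub_re, Complex.re_ofReal_mul]; simp
    rw [this, etaw_re]
    have : 0 ≤ 1 - ‖w‖ ^ 2 := by nlinarith [norm_nonneg w]
    positivity
  have h2 := one_eta_ne hre
  have h3 := dn_ne (gms μ s hμ) hw
  have hA : (gms μ s hμ).1.1 = (1 + μ ^ 2 - I * s) / (2 * μ) := by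
    have : (1 + (μ:ℂ) ^ 2 - I * s) / (2 * μ) = ((1 + (μ:ℂ) ^ 2 - I * s)) * (((2 * μ)⁻¹ : ℝ) : ℂ) := by push_cast; rw [div_eq_mul_inv]
    rw [this]
    apply Complex.ext
    · rw [Complex.re_mul_ofReal]; simp [gms, ← Complex.ofReal_pow, div_eq_mul_inv]
    · rw [Complex.im_mul_ofReal]; simp [gms, ← Complex.ofReal_pow, div_eq_mul_inv]
  have hB' : (gms μ s hμ).1.2 = (1 - μ ^ 2 - I * s) / (2 * μ) := by
    have : (1 - (μ:ℂ) ^ 2 - I * s) / (2 * μ) = ((1 - (μ:ℂ) ^ 2 - I * s)) * (((2 * μ)⁻¹ : ℝ) : ℂ) := by push_cast; rw [div_eq_mul_inv]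
    rw [this]
    apply Complex.ext
    · rw [Complex.re_mul_ofReal]; simp [gms, ← Complex.ofReal_pow, div_eq_mul_inv]
    · rw [Complex.im_mul_ofReal]; simp [gms, ← Complex.ofReal_pow, div_eq_mul_inv]
  have hμ' : (μ:ℂ) ≠ 0 := by exact_mod_cast hμ.ne'
  rw [tau, Wf, div_eq_div_iff h3 h2, dn, hA, hB', etaw]
  simp only [map_div₀, map_sub, map_add, map_mul, map_one, map_pow, Complex.conj_ofReal, Complex.conj_I, map_ofNat]
  push_cast
  field_simp
  ring_nf

lemma G1 (n : ℕ) (κ : V) (κC : ℂ → ℝ) (hκC : ∀ w : Dk, κ w = κC w) (kb sb : ℝ)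
    (H : ∃ c > 0, ∀ δ > 0, ∃ ρ > 0, ∀ η : ℂ, 0 ≤ η.re → ‖η‖ < ρ →
      kb + c * η.re - δ * ‖η‖ ≤ κC (Wf (η - I * sb))) :
    ∃ g1 : SU, vol n * kb < E n (κ.comp (tauD g1)) := by
  obtain ⟨c, hc, H⟩ := H
  have i3 := nu_eta n
  have hm : Measurable (fun w : Dk => etaw w) := by
    unfold etaw
    fun_prop
  have i2 : Integrable (fun w : Dk => ‖etaw w‖) (nu n) := by
    refine Integrable.mono' (g := fun w : Dk => 1 + ‖etaw w‖ * √‖etaw w‖) ((integrable_const (1:ℝ)).add i3) hm.norm.aestronglyMeasurable (Eventually.of_forall fun w => ?_)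
    rw [norm_norm]
    set y := ‖etaw w‖ with hy
    have : 0 ≤ y := norm_nonneg _
    by_cases h : y ≤ 1
    · have : 0 ≤ y * √y := by positivity
      linarith
    · have : 1 ≤ √y := Real.one_le_sqrt.2 (by linarith)
      nlinarith
  have i1 : Integrable (fun w : Dk => (etaw w).re) (nu n) := by
    refine Integrable.mono' i2 (Complex.measurable_re.comp hm).aestronglyMeasurable (Eventually.of_forall fun w => ?_)
    exact Complex.abs_re_le_norm _
  set I1 := ∫ w : Dk, (etaw w).re ∂nu n with hI1
  set I2 := ∫ w : Dk, ‖etaw w‖ ∂nu n with hI2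
  set I3 := ∫ w : Dk, ‖etaw w‖ * √‖etaw w‖ ∂nu n with hI3
  have I2n : 0 ≤ I2 := integral_nonneg fun w => norm_nonneg _
  have I3n : 0 ≤ I3 := integral_nonneg fun w => mul_nonneg (norm_nonneg _) (Real.sqrt_nonneg _)
  have hne1 := nu_ae n (measure_singleton (μ := (volume : Measure ℂ)) (-1))
  have I1p : 0 < I1 := by
    have h1 := nu_radial n (fun x => (1 - x) / 4) (by fun_prop)
    have h2 : 0 < Real.pi * ∫ x in (0:ℝ)..1, (1 - x) ^ (n - 1) * ((1 - x) / 4) := by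
      apply mul_pos Real.pi_pos
      apply intervalIntegral.intervalIntegral_pos_of_pos_on
      · exact Continuous.intervalIntegrable (by fun_prop) _ _
      · intro x hx
        have : 0 < 1 - x := by linarith [hx.2]
        positivity
      · norm_num
    rw [← h1] at h2
    refine h2.trans_le (integral_mono_ae (nu_integrable n (by fun_prop)) i1 ?_)
    filter_upwards [hne1] with w hw
    have hw1 := Dk_le w
    rw [etaw_re]
    have h3 : 0 < ‖1 + (w:ℂ)‖ := by
      rw [norm_pos_iff]; intro h; apply hw
      rw [Set.mem_singleton_iff]; linear_combination h
    have h4 : ‖1 + (w:ℂ)‖ ≤ 2 := by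
      have := norm_add_le (1:ℂ) w
      rw [norm_one] at this; linarith
    have h5 : 0 ≤ 1 - ‖(w:ℂ)‖ ^ 2 := by nlinarith [norm_nonneg (w:ℂ)]
    gcongr
    nlinarith
  set δ := c * I1 / (2 * (I2 + 1)) with hδ
  have hδ0 : 0 < δ := by positivity
  obtain ⟨ρ, hρ, H⟩ := H δ hδ0
  set C := (|kb| + ‖κ‖) / (ρ * √ρ) + c / √ρ with hC
  have hC0 : 0 ≤ C := by positivity
  have H2 : ∀ η : ℂ, 0 ≤ η.re → (hd : ‖Wf (η - I * sb)‖ ≤ 1) →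
      kb + c * η.re - δ * ‖η‖ - C * (‖η‖ * √‖η‖) ≤ κC (Wf (η - I * sb)) := by
    intro η hη hd
    by_cases h : ‖η‖ < ρ
    · have := H η hη h
      have : 0 ≤ C * (‖η‖ * √‖η‖) := by positivity
      linarith
    · push Not at h
      have h1 := hκC ⟨Wf (η - I * sb), mem_closedBall_zero_iff.2 hd⟩
      have h2 := (abs_le.1 (V_le κ ⟨Wf (η - I * sb), mem_closedBall_zero_iff.2 hd⟩)).1
      rw [h1] at h2
      simp only at h2
      have h3 : |kb| + ‖κ‖ ≤ (|kb| + ‖κ‖) / (ρ * √ρ) * (‖η‖ * √‖η‖) := by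
        rw [div_mul_eq_mul_div, le_div_iff₀ (by positivity)]
        gcongr
      have h4 : c * ‖η‖ ≤ c / √ρ * (‖η‖ * √‖η‖) := by
        rw [div_mul_eq_mul_div, le_div_iff₀ (by positivity), ← mul_assoc]
        gcongr
      have h5 : c * η.re ≤ c * ‖η‖ := by
        have := (le_abs_self _).trans (Complex.abs_re_le_norm η)
        gcongr
      have h6 : C * (‖η‖ * √‖η‖) = (|kb| + ‖κ‖) / (ρ * √ρ) * (‖η‖ * √‖η‖) + c / √ρ * (‖η‖ * √‖η‖) := by rw [hC]; ring
      have h7 : 0 ≤ δ * ‖η‖ := by positivity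
      have := le_abs_self kb
      linarith
  set μ := c * I1 / (4 * (C * I3 + 1)) with hμd
  have hμ : 0 < μ := by positivity
  refine ⟨gms μ sb hμ, ?_⟩
  have key : ∫ w : Dk, (kb + c * μ ^ 2 * (etaw w).re - δ * μ ^ 2 * ‖etaw w‖ - C * μ ^ 3 * (‖etaw w‖ * √‖etaw w‖)) ∂nu n
      ≤ E n (κ.comp (tauD (gms μ sb hμ))) := by
    rw [E_apply]
    refine integral_mono_ae ?_ (nu_integrable n (ContinuousMap.continuous _)) ?_
    · exact (((integrable_const _).add (i1.const_mul _)).sub (i2.const_mul _)).sub (i3.const_mul _)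
    filter_upwards [hne1] with w hw
    have e1 := tau_gms μ sb hμ (Dk_le w) (by simpa using hw)
    have e2 : (κ.comp (tauD (gms μ sb hμ))) w = κC (tau (gms μ sb hμ) w) := by
      rw [ContinuousMap.comp_apply, hκC, tauD_coe]
    rw [e2, e1]
    have h1 : 0 ≤ (etaw w).re := by
      rw [etaw_re]
      have : 0 ≤ 1 - ‖(w:ℂ)‖ ^ 2 := by nlinarith [norm_nonneg (w:ℂ), Dk_le w]
      positivity
    have h2 := H2 (((μ ^ 2 : ℝ) : ℂ) * etaw w) (by rw [Complex.re_ofReal_mul]; positivity)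
      (by rw [← e1]; exact tau_le _ (Dk_le w))
    rw [Complex.re_ofReal_mul, norm_mul, Complex.norm_real, Real.norm_of_nonneg (by positivity), Real.sqrt_mul (by positivity),
      Real.sqrt_sq hμ.le] at h2
    refine le_trans (le_of_eq ?_) h2
    ring
  have hval : ∫ w : Dk, (kb + c * μ ^ 2 * (etaw w).re - δ * μ ^ 2 * ‖etaw w‖ - C * μ ^ 3 * (‖etaw w‖ * √‖etaw w‖)) ∂nu n
      = kb * vol n + c * μ ^ 2 * I1 - δ * μ ^ 2 * I2 - C * μ ^ 3 * I3 := by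
    have j1 : Integrable (fun w : Dk => kb + c * μ ^ 2 * (etaw w).re) (nu n) := (integrable_const _).add (i1.const_mul _)
    have j2 : Integrable (fun w : Dk => kb + c * μ ^ 2 * (etaw w).re - δ * μ ^ 2 * ‖etaw w‖) (nu n) := j1.sub (i2.const_mul _)
    rw [integral_sub j2 (i3.const_mul _), integral_sub j1 (i2.const_mul _),
      integral_add (integrable_const _) (i1.const_mul _), integral_const_mul, integral_const_mul, integral_const_mul]
    have : ∫ _ : Dk, kb ∂nu n = kb * vol n := by
      have := E_apply n (kb • (1 : V))
      rw [map_smul, E_one] at this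
      simpa using this.symm
    rw [this]
  rw [hval] at key
  have k1 : δ * I2 ≤ c * I1 / 2 := by
    rw [hδ, div_mul_eq_mul_div, div_le_div_iff₀ (by positivity) (by norm_num)]
    have : 0 < c * I1 := by positivity
    nlinarith
  have k2 : C * μ * I3 ≤ c * I1 / 4 := by
    rw [hμd, mul_div_assoc', div_mul_eq_mul_div, div_le_div_iff₀ (by positivity) (by norm_num)]
    have : 0 < c * I1 := by positivity
    have : 0 ≤ C * I3 := by positivity
    nlinarith
  have k3 : 0 < μ ^ 2 := by positivity
  have k4 : 0 < c * I1 := by positivity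
  have k5 : 0 < μ ^ 2 * (c * I1 - δ * I2 - C * μ * I3) := mul_pos k3 (by linarith)
  nlinarith

end Heis

namespace Heis
open Complex (I)
open Polynomial (derivative)

def hv (n : ℕ) (j : Fin n) (σ : ℂ) (p : Pt n) : Pt n :=
  (Pi.single j σ.re, Pi.single j σ.im, 2 * (p.2.1 j * σ.re - p.1 j * σ.im))

def DD (n : ℕ) (j : Fin n) (σ : ℂ) (u : Pt n → ℝ) (p : Pt n) : ℝ := fderiv ℝ u p (hv n j σ p)

def DC (n : ℕ) (j : Fin n) (σ : ℂ) (u : Pt n → ℂ) (p : Pt n) : ℂ := fderiv ℝ u p (hv n j σ p)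

lemma hv_eq (n : ℕ) (j : Fin n) (σ : ℂ) (p : Pt n) :
    hv n j σ p = (Pi.single j σ.re, Pi.single j σ.im, 0) + (2 * (p.2.1 j * σ.re - p.1 j * σ.im)) • et n := by
  simp [hv, et]

lemma Xd_eq (n : ℕ) (j : Fin n) (u : Pt n → ℝ) : Xd n j u = DD n j 1 u := by
  ext p
  rw [DD, hv_eq, map_add, map_smul, Xd, ex]
  simp

lemma Yd_eq (n : ℕ) (j : Fin n) (u : Pt n → ℝ) : Yd n j u = DD n j I u := by
  ext p
  rw [DD, hv_eq, map_add, map_smul, Yd, ey]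
  simp; ring

lemma hv_smooth (n : ℕ) (j : Fin n) (σ : ℂ) : ContDiff ℝ (⊤ : ℕ∞) (hv n j σ) := by
  have : hv n j σ = fun p => (Pi.single j σ.re, Pi.single j σ.im, 0) + (2 * (p.2.1 j * σ.re - p.1 j * σ.im)) • et n := by
    ext1 p; exact hv_eq n j σ p
  rw [this]; fun_prop

lemma DD_smooth {n : ℕ} (j : Fin n) (σ : ℂ) {u : Pt n → ℝ} (hu : ContDiff ℝ (⊤ : ℕ∞) u) :
    ContDiff ℝ (⊤ : ℕ∞) (DD n j σ u) := by
  unfold DD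
  exact (hu.fderiv_right (m := (⊤ : ℕ∞)) (by simp)).clm_apply (hv_smooth n j σ)

lemma DD_mul {n : ℕ} (j : Fin n) (σ : ℂ) {u v : Pt n → ℝ} {p : Pt n} (hu : DifferentiableAt ℝ u p)
    (hv : DifferentiableAt ℝ v p) :
    DD n j σ (fun p => u p * v p) p = u p * DD n j σ v p + DD n j σ u p * v p := by
  unfold DD
  rw [fderiv_fun_mul hu hv]; simp; ring

lemma DD_add {n : ℕ} (j : Fin n) (σ : ℂ) {u v : Pt n → ℝ} {p : Pt n} (hu : DifferentiableAt ℝ u p)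
    (hv : DifferentiableAt ℝ v p) :
    DD n j σ (fun p => u p + v p) p = DD n j σ u p + DD n j σ v p := by
  unfold DD
  rw [fderiv_fun_add hu hv]; simp

lemma DC_mul {n : ℕ} (j : Fin n) (σ : ℂ) {u v : Pt n → ℂ} {p : Pt n} (hu : DifferentiableAt ℝ u p)
    (hv : DifferentiableAt ℝ v p) :
    DC n j σ (fun p => u p * v p) p = u p * DC n j σ v p + DC n j σ u p * v p := by
  unfold DC
  rw [fderiv_fun_mul hu hv]; simp; ring

lemma DC_add {n : ℕ} (j : Fin n) (σ : ℂ) {u v : Pt n → ℂ} {p : Pt n} (hu : DifferentiableAt ℝ u p)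
    (hv : DifferentiableAt ℝ v p) :
    DC n j σ (fun p => u p + v p) p = DC n j σ u p + DC n j σ v p := by
  unfold DC
  rw [fderiv_fun_add hu hv]; simp

lemma DD_re {n : ℕ} (j : Fin n) (σ : ℂ) {u : Pt n → ℂ} (a : ℂ) (hu : Differentiable ℝ u) :
    DD n j σ (fun p => (a * u p).re) = fun p => (a * DC n j σ u p).re := by
  ext p
  have h := (Complex.reCLM.hasFDerivAt (x := a * u p)).comp p ((hu p).hasFDerivAt.const_mul a)
  unfold DD DC
  have h2 : HasFDerivAt (fun p => (a * u p).re) (Complex.reCLM.comp (a • fderiv ℝ u p)) p := h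
  rw [h2.fderiv]; simp

def zc (n : ℕ) (j : Fin n) (p : Pt n) : ℂ := (p.1 j : ℂ) + (p.2.1 j : ℂ) * I

lemma zc_smooth (n : ℕ) (j : Fin n) : ContDiff ℝ (⊤ : ℕ∞) (zc n j) := by
  have : zc n j = fun p : Pt n => Complex.ofRealCLM (p.1 j) + Complex.ofRealCLM (p.2.1 j) * I := by
    ext p; simp [zc]
  rw [this]; fun_prop

def zb (n : ℕ) (j : Fin n) (p : Pt n) : ℂ := (starRingEnd ℂ) (zc n j p)

lemma zb_smooth (n : ℕ) (j : Fin n) : ContDiff ℝ (⊤ : ℕ∞) (zb n j) :=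
  (Complex.conjCLE : ℂ →L[ℝ] ℂ).contDiff.comp (zc_smooth n j)

lemma DC_z (n : ℕ) (j : Fin n) (σ : ℂ) (p : Pt n) : DC n j σ (zc n j) p = σ := by
  have h1 : HasFDerivAt (fun p : Pt n => p.1 j) ((ContinuousLinearMap.proj (R := ℝ) j).comp (ContinuousLinearMap.fst ℝ _ _)) p :=
    ((ContinuousLinearMap.proj (R := ℝ) (φ := fun _ : Fin n => ℝ) j).comp (ContinuousLinearMap.fst ℝ _ ((Fin n → ℝ) × ℝ))).hasFDerivAt
  have h2 : HasFDerivAt (fun p : Pt n => p.2.1 j) ((ContinuousLinearMap.proj (R := ℝ) j).comp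
      ((ContinuousLinearMap.fst ℝ _ _).comp (ContinuousLinearMap.snd ℝ _ _))) p :=
    ((ContinuousLinearMap.proj (R := ℝ) (φ := fun _ : Fin n => ℝ) j).comp
      ((ContinuousLinearMap.fst ℝ _ ℝ).comp (ContinuousLinearMap.snd ℝ (Fin n → ℝ) _))).hasFDerivAt
  have h3 := (Complex.ofRealCLM.hasFDerivAt.comp p h1).add ((Complex.ofRealCLM.hasFDerivAt.comp p h2).mul_const I)
  have h4 : HasFDerivAt (zc n j) _ p := h3
  rw [DC, h4.fderiv]
  apply Complex.ext <;> simp [hv]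

lemma DC_zb (n : ℕ) (j : Fin n) (σ : ℂ) (p : Pt n) : DC n j σ (zb n j) p = (starRingEnd ℂ) σ := by
  have h := ((Complex.conjCLE : ℂ →L[ℝ] ℂ).hasFDerivAt (x := zc n j p)).comp p ((zc_smooth n j).differentiable (by simp) p).hasFDerivAt
  have h4 : HasFDerivAt (zb n j) _ p := h
  have := DC_z n j σ p
  rw [DC] at this
  rw [DC, h4.fderiv]
  simp [this]

lemma fderiv_z2 (n : ℕ) (p v : Pt n) : fderiv ℝ (z2 n) p v =
    ∑ i, 2 * p.1 i * v.1 i + ∑ i, 2 * p.2.1 i * v.2.1 i := by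
  have h1 : ∀ i, HasFDerivAt (fun p : Pt n => p.1 i) ((ContinuousLinearMap.proj (R := ℝ) i).comp (ContinuousLinearMap.fst ℝ _ _)) p := fun i =>
    ((ContinuousLinearMap.proj (R := ℝ) (φ := fun _ : Fin n => ℝ) i).comp (ContinuousLinearMap.fst ℝ _ ((Fin n → ℝ) × ℝ))).hasFDerivAt
  have h2 : ∀ i, HasFDerivAt (fun p : Pt n => p.2.1 i) ((ContinuousLinearMap.proj (R := ℝ) i).comp
      ((ContinuousLinearMap.fst ℝ _ _).comp (ContinuousLinearMap.snd ℝ _ _))) p := fun i =>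
    ((ContinuousLinearMap.proj (R := ℝ) (φ := fun _ : Fin n => ℝ) i).comp
      ((ContinuousLinearMap.fst ℝ _ ℝ).comp (ContinuousLinearMap.snd ℝ (Fin n → ℝ) _))).hasFDerivAt
  have h3 : HasFDerivAt (z2 n) _ p := (HasFDerivAt.fun_sum (u := Finset.univ) fun i _ => (h1 i).pow 2).add
    (HasFDerivAt.fun_sum (u := Finset.univ) fun i _ => (h2 i).pow 2)
  rw [h3.fderiv]
  simp

lemma fderiv_eta (n : ℕ) (j : Fin n) (σ : ℂ) (p : Pt n) :
    fderiv ℝ (eta n) p (hv n j σ p) = 2 * zb n j p * σ := by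
  have h0 : HasFDerivAt (z2 n) (fderiv ℝ (z2 n) p) p := ((z2_smooth n).differentiable (by simp) p).hasFDerivAt
  have h2 : HasFDerivAt (fun p : Pt n => p.2.2) ((ContinuousLinearMap.snd ℝ _ _).comp (ContinuousLinearMap.snd ℝ _ _)) p :=
    ((ContinuousLinearMap.snd ℝ (Fin n → ℝ) ℝ).comp (ContinuousLinearMap.snd ℝ (Fin n → ℝ) _)).hasFDerivAt
  have h3 := (Complex.ofRealCLM.hasFDerivAt.comp p h0).sub ((Complex.ofRealCLM.hasFDerivAt.comp p h2).mul_const I)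
  have h4 : HasFDerivAt (eta n) _ p := h3.congr_of_eventuallyEq (Eventually.of_forall fun q => by rw [eta_eq]; simp)
  have h5 := fderiv_z2 n p (hv n j σ p)
  have e1 : ∑ i, 2 * p.1 i * (hv n j σ p).1 i = 2 * p.1 j * σ.re := by simp [hv, Pi.single_apply]
  have e2 : ∑ i, 2 * p.2.1 i * (hv n j σ p).2.1 i = 2 * p.2.1 j * σ.im := by simp [hv, Pi.single_apply]
  rw [e1, e2] at h5
  rw [h4.fderiv]
  simp only [_root_.sub_apply, ContinuousLinearMap.comp_apply, h5, Complex.ofRealCLM_apply, _root_.smul_apply]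
  apply Complex.ext <;> simp [hv, zb, zc] <;> ring

def RR (n : ℕ) (p : Pt n) : ℝ := ‖1 + eta n p‖

lemma RR_re (n : ℕ) (p : Pt n) : 1 + z2 n p ≤ RR n p := by
  have := (le_abs_self _).trans (Complex.abs_re_le_norm (1 + eta n p))
  simpa [eta, RR] using this

lemma RR_one (n : ℕ) (p : Pt n) : 1 ≤ RR n p := by
  have := RR_re n p
  have := z2_nonneg n p
  linarith

lemma RR_pos (n : ℕ) (p : Pt n) : 0 < RR n p := by
  have := RR_one n p
  linarith

lemma RR_sq (n : ℕ) (p : Pt n) : RR n p ^ 2 = (1 + z2 n p) ^ 2 + p.2.2 ^ 2 := by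
  rw [RR, ← Complex.normSq_eq_norm_sq, Complex.normSq_apply]
  simp [eta]; ring

lemma RR_cont (n : ℕ) : Continuous (RR n) := by
  have := (eta_smooth n).continuous
  unfold RR; fun_prop

lemma zc_le (n : ℕ) (j : Fin n) (p : Pt n) : ‖zc n j p‖ ≤ RR n p ^ (1/2 : ℝ) := by
  rw [← Real.sqrt_eq_rpow]
  apply Real.le_sqrt_of_sq_le
  refine le_trans ?_ (RR_re n p)
  rw [← Complex.normSq_eq_norm_sq, Complex.normSq_apply]
  have h1 := Finset.single_le_sum (f := fun j => (p.1 j) ^ 2) (fun i _ => sq_nonneg _) (Finset.mem_univ j)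
  have h2 := Finset.single_le_sum (f := fun j => (p.2.1 j) ^ 2) (fun i _ => sq_nonneg _) (Finset.mem_univ j)
  simp [zc, z2]; nlinarith

lemma zb_le (n : ℕ) (j : Fin n) (p : Pt n) : ‖zb n j p‖ ≤ RR n p ^ (1/2 : ℝ) := by
  rw [zb, Complex.norm_conj]; exact zc_le n j p

def SF (a : ℝ) (f : Polynomial ℂ) (η : ℂ) : ℂ := (1 + η) ^ (-a : ℂ) * f.eval (Wf η)

def nx (a : ℝ) (f : Polynomial ℂ) : Polynomial ℂ :=
  -(Polynomial.C (a : ℂ) * f + (1 + Polynomial.X) * derivative f)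

lemma Wf_deriv {η : ℂ} (h : 0 ≤ η.re) : HasDerivAt Wf (-(2 / (1 + η) ^ 2)) η := by
  have h1 := ((hasDerivAt_id η).const_sub 1).fun_div ((hasDerivAt_id η).const_add 1) (one_eta_ne h)
  exact h1.congr_deriv (by simp only [id]; have := one_eta_ne h; field_simp; ring)

lemma SF_deriv (a : ℝ) (f : Polynomial ℂ) {η : ℂ} (h : 0 ≤ η.re) :
    HasDerivAt (SF a f) (SF (a + 1) (nx a f) η) η := by
  have hs : 1 + η ∈ Complex.slitPlane := by left; simp; linarith
  have h1 := ((hasDerivAt_id η).const_add 1).cpow_const (c := (-a : ℂ)) hs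
  have h2 := (f.hasDerivAt (Wf η)).comp η (Wf_deriv h)
  have h3 := h1.fun_mul h2
  refine h3.congr_deriv ?_
  have hne := one_eta_ne h
  have e : (1 + η) ^ (-((a + 1 : ℝ) : ℂ)) = (1 + η) ^ (-a : ℂ) / (1 + η) := by
    rw [show (-((a + 1 : ℝ) : ℂ)) = -a - 1 by push_cast; ring, Complex.cpow_sub _ _ hne, Complex.cpow_one]
  have e' : (1 + η) ^ (-a - 1 : ℂ) = (1 + η) ^ (-a : ℂ) / (1 + η) := by
    rw [Complex.cpow_sub _ _ hne, Complex.cpow_one]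
  simp only [id, SF, nx, Function.comp, e, e', Polynomial.eval_neg, Polynomial.eval_add, Polynomial.eval_mul, Polynomial.eval_C,
    Polynomial.eval_one, Polynomial.eval_X, Wf_add h]
  field_simp
  ring

lemma SF_bd (a : ℝ) (f : Polynomial ℂ) : ∃ C, 0 ≤ C ∧ ∀ η : ℂ, 0 ≤ η.re → ‖SF a f η‖ ≤ C * ‖1 + η‖ ^ (-a) := by
  obtain ⟨C, hC⟩ := (isCompact_closedBall (0:ℂ) 1).exists_bound_of_continuousOn (f := fun w => f.eval w) f.continuous.continuousOn
  refine ⟨C, le_trans (norm_nonneg _) (hC 0 (by simp)), fun η h => ?_⟩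
  have h1 := hC (Wf η) (mem_closedBall_zero_iff.2 (Wf_le h))
  rw [SF, norm_mul, ← Complex.ofReal_neg, Complex.norm_cpow_real, mul_comm]
  gcongr

def PS (n : ℕ) (a : ℝ) (f : Polynomial ℂ) (b : ℝ) (g : Polynomial ℂ) (p : Pt n) : ℂ :=
  SF a f (eta n p) * (starRingEnd ℂ) (SF b g (eta n p))

lemma SF_smooth (n : ℕ) (a : ℝ) (f : Polynomial ℂ) : ContDiff ℝ (⊤ : ℕ∞) (fun p => SF a f (eta n p)) := by
  rw [contDiff_iff_contDiffAt]
  intro p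
  have h : 0 ≤ (eta n p).re := z2_nonneg n p
  have h1 : AnalyticAt ℂ (SF a f) (eta n p) := by
    have : DifferentiableOn ℂ (SF a f) {η | -1 < η.re} := by
      intro η hη
      have hs : 1 + η ∈ Complex.slitPlane := by
        left; have : -1 < η.re := hη
        simp; linarith
      have hne : 1 + η ≠ 0 := Complex.slitPlane_ne_zero hs
      have h1 := (((hasDerivAt_id η).const_add 1).cpow_const (c := (-a : ℂ)) hs).differentiableAt
      have h2 : DifferentiableAt ℂ Wf η := ((hasDerivAt_id η).const_sub 1).differentiableAt.div ((hasDerivAt_id η).const_add 1).differentiableAt hne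
      exact (h1.mul (f.differentiable.differentiableAt.comp η h2)).differentiableWithinAt
    exact this.analyticAt ((isOpen_lt continuous_const Complex.continuous_re).mem_nhds (by simp only [Set.mem_ofPred_eq]; linarith))
  have h2 : ContDiffAt ℝ (⊤ : ℕ∞) (SF a f) (eta n p) := (h1.contDiffAt (n := (⊤ : ℕ∞))).restrict_scalars ℝ
  exact h2.comp p (eta_smooth n).contDiffAt

lemma PS_smooth (n : ℕ) (a : ℝ) (f : Polynomial ℂ) (b : ℝ) (g : Polynomial ℂ) : ContDiff ℝ (⊤ : ℕ∞) (PS n a f b g) :=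
  (SF_smooth n a f).mul ((Complex.conjCLE : ℂ →L[ℝ] ℂ).contDiff.comp (SF_smooth n b g))

lemma PS_bd (n : ℕ) (a : ℝ) (f : Polynomial ℂ) (b : ℝ) (g : Polynomial ℂ) :
    ∃ C, 0 ≤ C ∧ ∀ p, ‖PS n a f b g p‖ ≤ C * RR n p ^ (-(a + b)) := by
  obtain ⟨C, h0, hC⟩ := SF_bd a f
  obtain ⟨C', h0', hC'⟩ := SF_bd b g
  refine ⟨C * C', by positivity, fun p => ?_⟩
  have hp := RR_pos n p
  rw [PS, norm_mul, Complex.norm_conj, neg_add, Real.rpow_add hp]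
  have h1 := hC (eta n p) (z2_nonneg n p)
  have h2 := hC' (eta n p) (z2_nonneg n p)
  change _ ≤ C * RR n p ^ (-a) at h1
  change _ ≤ C' * RR n p ^ (-b) at h2
  calc _ ≤ (C * RR n p ^ (-a)) * (C' * RR n p ^ (-b)) := mul_le_mul h1 h2 (norm_nonneg _) (by positivity)
    _ = _ := by ring

lemma DC_PS (n : ℕ) (j : Fin n) (σ : ℂ) (a : ℝ) (f : Polynomial ℂ) (b : ℝ) (g : Polynomial ℂ) :
    DC n j σ (PS n a f b g) = fun p => 2 * (starRingEnd ℂ) σ * (zc n j p * PS n a f (b + 1) (nx b g) p)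
      + 2 * σ * (zb n j p * PS n (a + 1) (nx a f) b g p) := by
  ext p
  have h : 0 ≤ (eta n p).re := z2_nonneg n p
  have hf := SF_deriv a f h
  have hg := SF_deriv b g h
  have e := hol_pair_fderiv hf.differentiableAt hg.differentiableAt (2 * zb n j p * σ)
  rw [hf.deriv, hg.deriv, ← fderiv_eta] at e
  have hd : DifferentiableAt ℝ (fun u => SF a f u * (starRingEnd ℂ) (SF b g u)) (eta n p) := by
    have h1 : DifferentiableAt ℝ (SF a f) (eta n p) := hf.differentiableAt.restrictScalars ℝ
    have h2 : DifferentiableAt ℝ (SF b g) (eta n p) := hg.differentiableAt.restrictScalars ℝ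
    exact h1.mul ((Complex.conjCLE : ℂ →L[ℝ] ℂ).differentiableAt.comp _ h2)
  have e2 := fderiv_comp p hd ((eta_smooth n).differentiable (by simp) p)
  have e3 : PS n a f b g = (fun u => SF a f u * (starRingEnd ℂ) (SF b g u)) ∘ eta n := rfl
  rw [DC, e3, e2, ContinuousLinearMap.comp_apply, e, fderiv_eta]
  simp only [PS, zb, map_mul, Complex.conj_conj, map_ofNat]
  ring

lemma DC_DC_PS (n : ℕ) (j : Fin n) (σ : ℂ) (hσ : ‖σ‖ = 1) (a : ℝ) (f : Polynomial ℂ) (b : ℝ) (g : Polynomial ℂ) (p : Pt n) :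
    DC n j σ (DC n j σ (PS n a f b g)) p = 2 * PS n a f (b + 1) (nx b g) p + 2 * PS n (a + 1) (nx a f) b g p
      + 8 * (zc n j p * zb n j p) * PS n (a + 1) (nx a f) (b + 1) (nx b g) p
      + 4 * ((starRingEnd ℂ) σ) ^ 2 * zc n j p ^ 2 * PS n a f (b + 1 + 1) (nx (b + 1) (nx b g)) p
      + 4 * σ ^ 2 * zb n j p ^ 2 * PS n (a + 1 + 1) (nx (a + 1) (nx a f)) b g p := by
  have hz := (zc_smooth n j).differentiable (by simp) p
  have hz' := (zb_smooth n j).differentiable (by simp) p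
  have hP : ∀ a f b g, DifferentiableAt ℝ (PS n a f b g) p := fun a f b g => (PS_smooth n a f b g).differentiable (by simp) p
  have hs : σ * (starRingEnd ℂ) σ = 1 := by rw [Complex.mul_conj, Complex.normSq_eq_norm_sq, hσ]; simp
  have hc : ∀ (c : ℂ), DC n j σ (fun _ => c) p = 0 := fun c => by simp [DC]
  have hcm : ∀ (c : ℂ) (u : Pt n → ℂ), DifferentiableAt ℝ u p → DC n j σ (fun p => c * u p) p = c * DC n j σ u p := by
    intro c u hu
    rw [DC_mul j σ (differentiableAt_const _) hu, hc]; ring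
  have h1 : DifferentiableAt ℝ (fun p => zc n j p * PS n a f (b + 1) (nx b g) p) p := hz.fun_mul (hP _ _ _ _)
  have h2 : DifferentiableAt ℝ (fun p => zb n j p * PS n (a + 1) (nx a f) b g p) p := hz'.fun_mul (hP _ _ _ _)
  rw [DC_PS, DC_add j σ (h1.const_mul _) (h2.const_mul _), hcm _ _ h1, hcm _ _ h2, DC_mul j σ hz (hP _ _ _ _), DC_mul j σ hz' (hP _ _ _ _), DC_z, DC_zb, DC_PS, DC_PS]
  linear_combination (2 * PS n a f (b + 1) (nx b g) p + 2 * PS n (a + 1) (nx a f) b g p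
      + 8 * (zc n j p * zb n j p) * PS n (a + 1) (nx a f) (b + 1) (nx b g) p) * hs

end Heis

namespace Heis
open Complex (I)

def Bd (n : ℕ) (s : ℝ) {E : Type} [NormedRing E] (U : Pt n → E) : Prop :=
  ∃ C : ℝ, 0 ≤ C ∧ ∀ p, ‖U p‖ ≤ C * RR n p ^ (-s)

lemma Bd.add {n : ℕ} {s : ℝ} {E : Type} [NormedRing E] {U U' : Pt n → E} (h : Bd n s U) (h' : Bd n s U') :
    Bd n s (fun p => U p + U' p) := by
  obtain ⟨C, h0, hC⟩ := h
  obtain ⟨C', h0', hC'⟩ := h'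
  refine ⟨C + C', by positivity, fun p => (norm_add_le _ _).trans ?_⟩
  rw [add_mul]; exact add_le_add (hC p) (hC' p)

lemma Bd.mul {n : ℕ} {s t : ℝ} {E : Type} [NormedRing E] {U U' : Pt n → E} (h : Bd n s U) (h' : Bd n t U') :
    Bd n (s + t) (fun p => U p * U' p) := by
  obtain ⟨C, h0, hC⟩ := h
  obtain ⟨C', h0', hC'⟩ := h'
  refine ⟨C * C', by positivity, fun p => (norm_mul_le _ _).trans ?_⟩
  have := RR_pos n p
  rw [neg_add, Real.rpow_add this, mul_mul_mul_comm]
  exact mul_le_mul (hC p) (hC' p) (norm_nonneg _) (by positivity)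

lemma Bd.cmul {n : ℕ} {s : ℝ} {E : Type} [NormedRing E] {U : Pt n → E} (h : Bd n s U) (c : E) :
    Bd n s (fun p => c * U p) := by
  obtain ⟨C, h0, hC⟩ := h
  refine ⟨‖c‖ * C, by positivity, fun p => (norm_mul_le _ _).trans ?_⟩
  rw [mul_assoc]; gcongr; exact hC p

lemma Bd.of_eq {n : ℕ} {s t : ℝ} {E : Type} [NormedRing E] {U : Pt n → E} (h : Bd n s U) (e : s = t) : Bd n t U := e ▸ h

lemma Bd.re {n : ℕ} {s : ℝ} {U : Pt n → ℂ} (h : Bd n s U) : Bd n s (fun p => (U p).re) := by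
  obtain ⟨C, h0, hC⟩ := h
  exact ⟨C, h0, fun p => (Complex.abs_re_le_norm _).trans (hC p)⟩

lemma Bd_zc (n : ℕ) (j : Fin n) : Bd n (-(1/2)) (zc n j) :=
  ⟨1, by norm_num, fun p => by rw [one_mul, neg_neg]; exact zc_le n j p⟩

lemma Bd_zb (n : ℕ) (j : Fin n) : Bd n (-(1/2)) (zb n j) :=
  ⟨1, by norm_num, fun p => by rw [one_mul, neg_neg]; exact zb_le n j p⟩

structure Nice (n : ℕ) (u h : Pt n → ℝ) : Prop where
  smooth : ContDiff ℝ (⊤ : ℕ∞) u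
  bd0 : Bd n n u
  bd1 : ∀ j σ, ‖σ‖ = 1 → Bd n (n + 1/2) (DD n j σ u)
  bd2 : ∀ j σ, ‖σ‖ = 1 → Bd n (n + 1) (DD n j σ (DD n j σ u))
  eq : ∀ p, ∑ j, (DD n j 1 (DD n j 1 u) p + DD n j I (DD n j I u) p) = -h p

lemma DD_add_fun {n : ℕ} (j : Fin n) (σ : ℂ) {u v : Pt n → ℝ} (hu : ContDiff ℝ (⊤ : ℕ∞) u)
    (hv : ContDiff ℝ (⊤ : ℕ∞) v) : DD n j σ (fun p => u p + v p) = fun p => DD n j σ u p + DD n j σ v p := by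
  ext p
  exact DD_add j σ (hu.differentiable (by simp) p) (hv.differentiable (by simp) p)

lemma Nice.add {n : ℕ} {u h u' h' : Pt n → ℝ} (a : Nice n u h) (b : Nice n u' h') :
    Nice n (fun p => u p + u' p) (fun p => h p + h' p) := by
  have e1 : ∀ j σ, DD n j σ (fun p => u p + u' p) = fun p => DD n j σ u p + DD n j σ u' p := fun j σ =>
    DD_add_fun j σ a.smooth b.smooth
  have e2 : ∀ j σ, DD n j σ (DD n j σ (fun p => u p + u' p)) = fun p => DD n j σ (DD n j σ u) p + DD n j σ (DD n j σ u') p := fun j σ => by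
    rw [e1]; exact DD_add_fun j σ (DD_smooth j σ a.smooth) (DD_smooth j σ b.smooth)
  refine ⟨a.smooth.add b.smooth, a.bd0.add b.bd0, fun j σ hs => ?_, fun j σ hs => ?_, fun p => ?_⟩
  · rw [e1]; exact (a.bd1 j σ hs).add (b.bd1 j σ hs)
  · rw [e2]; exact (a.bd2 j σ hs).add (b.bd2 j σ hs)
  · simp only [e2]
    rw [neg_add, ← a.eq p, ← b.eq p, ← Finset.sum_add_distrib]
    exact Finset.sum_congr rfl fun j _ => by ring

lemma Bd_zero (n : ℕ) (s : ℝ) : Bd n s (fun _ : Pt n => (0:ℝ)) :=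
  ⟨0, le_rfl, fun p => by simp⟩

lemma Nice.zero (n : ℕ) : Nice n (fun _ => 0) (fun _ => 0) := by
  have e : ∀ j σ, DD n j σ (fun _ => (0:ℝ)) = fun _ => 0 := by
    intro j σ; ext p; simp [DD]
  refine ⟨contDiff_const, Bd_zero n _, fun j σ _ => ?_, fun j σ _ => ?_, fun p => ?_⟩
  · rw [e]; exact Bd_zero n _
  · rw [e, e]; exact Bd_zero n _
  · simp [e]

lemma alg (e e' a a1 b b1 A : ℂ) (he : e ≠ 0) (he' : e' ≠ 0) :
    16 * ((e + e') / 2 - 1) * (-(A * a + 2 / e * a1)) * (-(A * b + 2 / e' * b1)) / (e * e') +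
      8 * A * (-(A * a + 2 / e * a1) * b / e + a * (-(A * b + 2 / e' * b1)) / e') =
    -(16 / (e * e') * (((2 / e - 1) * a1 + A * a) * ((2 / e' - 1) * b1 + A * b) - a1 * b1)) := by
  field_simp; ring

lemma cp_norm (a : ℝ) {e : ℂ} : e ^ (-a : ℂ) * (starRingEnd ℂ) (e ^ (-a : ℂ)) = ((‖e‖ ^ (-(a + a)) : ℝ) : ℂ) ∨ e = 0 := by
  by_cases h : e = 0
  · exact Or.inr h
  left
  rw [Complex.mul_conj, Complex.normSq_eq_norm_sq, ← Complex.ofReal_neg, Complex.norm_cpow_real, neg_add,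
    Real.rpow_add (norm_pos_iff.2 h), sq]

lemma sum_z (n : ℕ) (p : Pt n) : ∑ j, zc n j p * zb n j p = (z2 n p : ℂ) := by
  rw [z2, ← Finset.sum_add_distrib, Complex.ofReal_sum]
  refine Finset.sum_congr rfl fun j _ => ?_
  rw [zb, Complex.mul_conj, Complex.normSq_apply]
  simp [zc]; ring

def uc (n : ℕ) (c : Poly) (p : Pt n) : ℝ := RR n p ^ (-(n:ℝ)) * (ev c (Wf (eta n p))).re

def hc (n : ℕ) (c : Poly) (p : Pt n) : ℝ := 4 * RR n p ^ (-((n:ℝ) + 2)) * (ev (Lp n c) (Wf (eta n p))).re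

lemma kohn_PS (n : ℕ) (q : ℕ × ℕ) (p : Pt n) :
    16 * (z2 n p : ℂ) * PS n (n / 2 + 1) (nx (n / 2) (Polynomial.X ^ q.1)) (n / 2 + 1) (nx (n / 2) (Polynomial.X ^ q.2)) p
      + 4 * n * (PS n (n / 2) (Polynomial.X ^ q.1) (n / 2 + 1) (nx (n / 2) (Polynomial.X ^ q.2)) p +
        PS n (n / 2 + 1) (nx (n / 2) (Polynomial.X ^ q.1)) (n / 2) (Polynomial.X ^ q.2) p) =
      -((4 * RR n p ^ (-((n:ℝ) + 2)) : ℝ) : ℂ) * ev (Lp n (Finsupp.single q 1)) (Wf (eta n p)) := by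
  have h : 0 ≤ (eta n p).re := z2_nonneg n p
  have hne := one_eta_ne h
  have hne' : (starRingEnd ℂ) (1 + eta n p) ≠ 0 := (map_ne_zero _).2 hne
  have hW := Wf_add h
  set w := Wf (eta n p) with hw
  set e := 1 + eta n p with he
  have hR : (RR n p : ℂ) ^ 2 = e * (starRingEnd ℂ) e := by
    rw [Complex.mul_conj, Complex.normSq_eq_norm_sq, RR, ← he]; push_cast; rfl
  have hz : (z2 n p : ℂ) = (e + (starRingEnd ℂ) e) / 2 - 1 := by
    rw [Complex.add_conj, he]; simp [eta]
  have hr := (cp_norm ((n:ℝ) / 2) (e := e)).resolve_right hne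
  rw [add_halves] at hr
  set S := e ^ (-((n / 2 : ℝ) : ℂ)) with hS
  have hS1 : e ^ (-((n / 2 + 1 : ℝ) : ℂ)) = S / e := by
    rw [show (-((n / 2 + 1 : ℝ) : ℂ)) = -((n / 2 : ℝ) : ℂ) - 1 by push_cast; ring, Complex.cpow_sub _ _ hne, Complex.cpow_one]
  have hRp := RR_pos n p
  have hrr : ((4 * RR n p ^ (-((n:ℝ) + 2)) : ℝ) : ℂ) = 4 * (S * (starRingEnd ℂ) S) / (e * (starRingEnd ℂ) e) := by
    rw [hr, ← hR, neg_add, Real.rpow_add hRp, Real.rpow_neg hRp.le 2]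
    change _ = 4 * ((RR n p ^ (-(n:ℝ)) : ℝ) : ℂ) / _
    norm_cast
    rw [div_eq_mul_inv, mul_assoc]
  have hLp : ev (Lp n (Finsupp.single q 1)) w = 4 * ((w * (q.1 * w ^ (q.1 - 1)) + n / 2 * w ^ q.1) *
      ((starRingEnd ℂ) w * (q.2 * (starRingEnd ℂ) w ^ (q.2 - 1)) + n / 2 * (starRingEnd ℂ) w ^ q.2) -
      (q.1 * w ^ (q.1 - 1)) * (q.2 * (starRingEnd ℂ) w ^ (q.2 - 1))) := by
    rw [Lp_single, map_smul, map_sub]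
    have k : ∀ (m : ℕ) (x : ℂ), x * (m * x ^ (m - 1)) = m * x ^ m := by
      intro m x
      rcases m with _ | m
      · simp
      · rw [Nat.add_sub_cancel, pow_succ]; ring
    rw [k, k, Pi.smul_apply, Pi.sub_apply, ev_single, ev_single, mon, mon, lam]
    simp only [smul_eq_mul]; push_cast; ring
  have hw1 : w = 2 / e - 1 := by rw [← hW]; ring
  have hw1' : (starRingEnd ℂ) w = 2 / (starRingEnd ℂ) e - 1 := by rw [hw1]; simp [map_ofNat]
  have key := alg e ((starRingEnd ℂ) e) (w ^ q.1) (q.1 * w ^ (q.1 - 1)) ((starRingEnd ℂ) w ^ q.2)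
    (q.2 * (starRingEnd ℂ) w ^ (q.2 - 1)) (n / 2) hne hne'
  rw [← hw1, ← hw1', ← hz] at key
  have ef : ∀ m : ℕ, (nx (n / 2) (Polynomial.X ^ m : Polynomial ℂ)).eval w = -(n / 2 * w ^ m + 2 / e * (m * w ^ (m - 1))) := by
    intro m
    simp [nx, hW, Polynomial.derivative_X_pow]
  rw [hrr, hLp]
  simp only [PS, SF, ← hw, ← he, hS1, ← hS, map_mul, map_div₀, ef, Polynomial.eval_pow, Polynomial.eval_X, map_pow, map_neg, map_add,
    map_ofNat, map_natCast]
  clear_value S w e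
  linear_combination (S * (starRingEnd ℂ) S) * key

lemma uc_single (n : ℕ) (q : ℕ × ℕ) (a : ℂ) : uc n (Finsupp.single q a) =
    fun p => (a * PS n (n / 2) (Polynomial.X ^ q.1) (n / 2) (Polynomial.X ^ q.2) p).re := by
  ext p
  have h : 0 ≤ (eta n p).re := z2_nonneg n p
  have hne := one_eta_ne h
  have hr := (cp_norm ((n:ℝ) / 2) (e := 1 + eta n p)).resolve_right hne
  rw [add_halves] at hr
  rw [uc, ev_single, mon, ← Complex.re_ofReal_mul]
  simp only [PS, SF, Polynomial.eval_pow, Polynomial.eval_X, map_mul, map_pow]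
  rw [RR, ← hr]
  congr 1
  ring

lemma nice_single (n : ℕ) (q : ℕ × ℕ) (a : ℂ) : Nice n (uc n (Finsupp.single q a)) (hc n (Finsupp.single q a)) := by
  rw [uc_single]
  set A : ℝ := (n:ℝ) / 2 with hA
  set f : Polynomial ℂ := Polynomial.X ^ q.1 with hf
  set g : Polynomial ℂ := Polynomial.X ^ q.2 with hg
  have sm := PS_smooth n A f A g
  have sm1 : ∀ j σ, ContDiff ℝ (⊤ : ℕ∞) (DC n j σ (PS n A f A g)) := by
    intro j σ
    unfold DC
    exact (sm.fderiv_right (m := (⊤ : ℕ∞)) (by simp)).clm_apply (hv_smooth n j σ)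
  have e1 : ∀ j σ, DD n j σ (fun p => (a * PS n A f A g p).re) = fun p => (a * DC n j σ (PS n A f A g) p).re :=
    fun j σ => DD_re j σ a (sm.differentiable (by simp))
  have e2 : ∀ j σ, DD n j σ (DD n j σ (fun p => (a * PS n A f A g p).re)) =
      fun p => (a * DC n j σ (DC n j σ (PS n A f A g)) p).re :=
    fun j σ => by rw [e1]; exact DD_re j σ a ((sm1 j σ).differentiable (by simp))
  have B : ∀ a f b g, Bd n (a + b) (PS n a f b g) := PS_bd n
  refine ⟨?_, ?_, fun j σ hs => ?_, fun j σ hs => ?_, fun p => ?_⟩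
  · exact Complex.reCLM.contDiff.comp (contDiff_const.mul sm)
  · exact (((B A f A g).cmul a).re).of_eq (by rw [hA]; ring)
  · rw [e1]
    refine (Bd.cmul ?_ a).re
    rw [DC_PS]
    exact ((((Bd_zc n j).mul (B A f (A + 1) (nx A g))).of_eq (by rw [hA]; ring)).cmul _).add
      ((((Bd_zb n j).mul (B (A + 1) (nx A f) A g)).of_eq (by rw [hA]; ring)).cmul _)
  · rw [e2]
    refine (Bd.cmul ?_ a).re
    have e3 : DC n j σ (DC n j σ (PS n A f A g)) = _ := funext fun p => DC_DC_PS n j σ hs A f A g p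
    rw [e3]
    refine Bd.add (Bd.add (Bd.add (Bd.add ?_ ?_) ?_) ?_) ?_
    · exact ((B A f (A + 1) (nx A g)).of_eq (by rw [hA]; ring)).cmul _
    · exact ((B (A + 1) (nx A f) A g).of_eq (by rw [hA]; ring)).cmul _
    · exact ((((Bd_zc n j).mul (Bd_zb n j)).cmul 8).mul (B (A + 1) (nx A f) (A + 1) (nx A g))).of_eq (by rw [hA]; ring)
    · simp only [sq (zc n j _)]
      exact ((((Bd_zc n j).mul (Bd_zc n j)).cmul _).mul (B A f (A + 1 + 1) (nx (A + 1) (nx A g)))).of_eq (by rw [hA]; ring)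
    · simp only [sq (zb n j _)]
      exact ((((Bd_zb n j).mul (Bd_zb n j)).cmul _).mul (B (A + 1 + 1) (nx (A + 1) (nx A f)) A g)).of_eq (by rw [hA]; ring)
  · simp only [e2]
    simp only [← Complex.add_re, ← Complex.re_sum, ← mul_add, ← Finset.mul_sum]
    have key := kohn_PS n q p
    rw [← hf, ← hg, ← hA] at key
    have e4 : ∑ j, (DC n j 1 (DC n j 1 (PS n A f A g)) p + DC n j I (DC n j I (PS n A f A g)) p) =
        -((4 * RR n p ^ (-((n:ℝ) + 2)) : ℝ) : ℂ) * ev (Lp n (Finsupp.single q 1)) (Wf (eta n p)) := by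
      rw [← key]
      have : ∀ j, DC n j 1 (DC n j 1 (PS n A f A g)) p + DC n j I (DC n j I (PS n A f A g)) p =
          zc n j p * zb n j p * (16 * PS n (A + 1) (nx A f) (A + 1) (nx A g) p) +
          4 * (PS n A f (A + 1) (nx A g) p + PS n (A + 1) (nx A f) A g p) := by
        intro j
        rw [DC_DC_PS n j 1 (by simp), DC_DC_PS n j I (by simp)]
        simp only [map_one, Complex.conj_I, neg_sq, Complex.I_sq]
        ring
      rw [Finset.sum_congr rfl fun j _ => this j, Finset.sum_add_distrib, ← Finset.sum_mul, sum_z, Finset.sum_const]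
      simp; ring
    rw [e4, hc, ← Complex.re_ofReal_mul, ← Complex.neg_re]
    congr 1
    have : Finsupp.single q a = a • Finsupp.single q (1:ℂ) := by simp
    rw [this, map_smul, map_smul, Pi.smul_apply, smul_eq_mul]
    ring

lemma nice_uc (n : ℕ) (c : Poly) : Nice n (uc n c) (hc n c) := by
  induction c using Finsupp.induction_linear with
  | zero =>
    have e1 : uc n 0 = fun _ => 0 := by ext p; simp [uc]
    have e2 : hc n 0 = fun _ => 0 := by ext p; simp [hc]
    rw [e1, e2]; exact Nice.zero n
  | add c d hc' hd =>
    have e1 : uc n (c + d) = fun p => uc n c p + uc n d p := by ext p; simp [uc, mul_add]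
    have e2 : hc n (c + d) = fun p => hc n c p + hc n d p := by ext p; simp [hc, mul_add]
    rw [e1, e2]; exact hc'.add hd
  | single q a => exact nice_single n q a

end Heis

namespace Heis
open Complex (I)

lemma int_RR0 (n : ℕ) (hn : 1 ≤ n) : Integrable (fun p : Pt n => RR n p ^ (-(2 * n + 1 : ℝ))) := by
  have hn' : (1:ℝ) ≤ n := by exact_mod_cast hn
  have : (volume : Measure ((Fin n → ℝ) × (Fin n → ℝ))).IsAddHaarMeasure := Measure.prod.instIsAddHaarMeasure _ _
  have i1 : Integrable (fun x : (Fin n → ℝ) × (Fin n → ℝ) => ((1:ℝ) + ‖x‖ ^ 2) ^ (-(4 * n - 1 : ℝ) / 2)) :=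
    integrable_rpow_neg_one_add_norm_sq (by
      rw [Module.finrank_prod, Module.finrank_fin_fun]; push_cast; linarith)
  have i2 : Integrable (fun x : ℝ => ((1:ℝ) + ‖x‖ ^ 2) ^ (-(3 / 2 : ℝ) / 2)) :=
    integrable_rpow_neg_one_add_norm_sq (by rw [Module.finrank_self]; norm_num)
  have i3 := i1.mul_prod i2
  have i4 : Integrable (fun p : Pt n => (fun z : ((Fin n → ℝ) × (Fin n → ℝ)) × ℝ => ((1:ℝ) + ‖z.1‖ ^ 2) ^ (-(4 * n - 1 : ℝ) / 2)
      * ((1:ℝ) + ‖z.2‖ ^ 2) ^ (-(3 / 2 : ℝ) / 2)) (MeasurableEquiv.prodAssoc.symm p)) :=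
    (volume_preserving_prodAssoc (α₁ := Fin n → ℝ) (β₁ := Fin n → ℝ) (γ₁ := ℝ)).symm.integrable_comp_of_integrable i3
  refine i4.mono' (((RR_cont n).rpow_const fun p => Or.inl (RR_pos n p).ne').aestronglyMeasurable) (Eventually.of_forall fun p => ?_)
  have hp := RR_pos n p
  rw [Real.norm_of_nonneg (by positivity)]
  have h1 : 1 + ‖(p.1, p.2.1)‖ ^ 2 ≤ RR n p := by
    refine le_trans ?_ (RR_re n p)
    gcongr
    have hx : ∀ x : Fin n → ℝ, ‖x‖ ^ 2 ≤ ∑ j, x j ^ 2 := by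
      intro x
      have : ‖x‖ ≤ √(∑ j, x j ^ 2) := by
        rw [pi_norm_le_iff_of_nonneg (by positivity)]
        intro i
        rw [Real.norm_eq_abs]
        apply Real.abs_le_sqrt
        exact Finset.single_le_sum (f := fun j => (x j) ^ 2) (fun i _ => sq_nonneg _) (Finset.mem_univ i)
      calc ‖x‖ ^ 2 ≤ √(∑ j, x j ^ 2) ^ 2 := by gcongr
        _ = _ := Real.sq_sqrt (by positivity)
    have h0 : ∀ x : Fin n → ℝ, 0 ≤ ∑ j, x j ^ 2 := fun x => by positivity
    rw [Prod.norm_mk, z2]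
    rcases max_cases ‖p.1‖ ‖p.2.1‖ with ⟨h, _⟩ | ⟨h, _⟩ <;> rw [h]
    · linarith [hx p.1, h0 p.2.1]
    · linarith [hx p.2.1, h0 p.1]
  have h2 : 1 + ‖p.2.2‖ ^ 2 ≤ RR n p ^ 2 := by
    rw [RR_sq, Real.norm_eq_abs, sq_abs]
    have := z2_nonneg n p
    nlinarith
  have e : RR n p ^ (-(2 * n + 1 : ℝ)) = RR n p ^ (-(4 * n - 1 : ℝ) / 2) * (RR n p ^ 2) ^ (-(3 / 2 : ℝ) / 2) := by
    rw [← Real.rpow_natCast, ← Real.rpow_mul hp.le, ← Real.rpow_add hp]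
    congr 1; push_cast; ring
  rw [e]
  change _ ≤ ((1:ℝ) + ‖(p.1, p.2.1)‖ ^ 2) ^ (-(4 * n - 1 : ℝ) / 2) * ((1:ℝ) + ‖p.2.2‖ ^ 2) ^ (-(3 / 2 : ℝ) / 2)
  gcongr ?_ * ?_
  · exact Real.rpow_le_rpow_of_nonpos (by positivity) h1 (by linarith)
  · exact Real.rpow_le_rpow_of_nonpos (by positivity) h2 (by norm_num)

lemma int_RR (n : ℕ) (hn : 1 ≤ n) {s : ℝ} (hs : 2 * n + 1 ≤ s) : Integrable (fun p : Pt n => RR n p ^ (-s)) := by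
  refine (int_RR0 n hn).mono' (((RR_cont n).rpow_const fun p => Or.inl (RR_pos n p).ne').aestronglyMeasurable) (Eventually.of_forall fun p => ?_)
  have hp := RR_pos n p
  rw [Real.norm_of_nonneg (by positivity)]
  exact Real.rpow_le_rpow_of_exponent_le (RR_one n p) (by linarith)

lemma Bd.int {n : ℕ} (hn : 1 ≤ n) {s : ℝ} (hs : 2 * n + 1 ≤ s) {U : Pt n → ℝ} (h : Bd n s U) (hU : Continuous U) : Integrable U := by
  obtain ⟨C, h0, hC⟩ := h
  exact ((int_RR n hn hs).const_mul C).mono' hU.aestronglyMeasurable (Eventually.of_forall hC)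

lemma norm_le_RR (n : ℕ) (p : Pt n) : ‖p‖ ≤ RR n p := by
  have h1 := RR_re n p
  have hR := RR_pos n p
  have h0 : ∀ x : Fin n → ℝ, 0 ≤ ∑ j, x j ^ 2 := fun x => by positivity
  have hx : ∀ x : Fin n → ℝ, 1 + ∑ j, x j ^ 2 ≤ RR n p → ‖x‖ ≤ RR n p := by
    intro x h
    rw [pi_norm_le_iff_of_nonneg hR.le]
    intro i
    have := Finset.single_le_sum (f := fun j => (x j) ^ 2) (fun i _ => sq_nonneg _) (Finset.mem_univ i)
    rw [Real.norm_eq_abs]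
    have h2 := sq_abs (x i)
    nlinarith [sq_nonneg (|x i| - 1)]
  unfold z2 at h1
  refine max_le (hx _ ?_) (max_le (hx _ ?_) ?_)
  · linarith [h0 p.2.1]
  · linarith [h0 p.1]
  · have := RR_sq n p
    refine Real.abs_le_sqrt (y := RR n p ^ 2) ?_ |>.trans (by rw [Real.sqrt_sq hR.le])
    rw [this]; nlinarith [sq_nonneg (1 + z2 n p)]

lemma ibpc {n : ℕ} {F : Pt n → ℝ} (hF : ContDiff ℝ (⊤ : ℕ∞) F) (hc : HasCompactSupport F) (v : Pt n) :
    ∫ p, fderiv ℝ F p v = 0 := by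
  have : (volume : Measure ((Fin n → ℝ) × ℝ)).IsAddHaarMeasure := Measure.prod.instIsAddHaarMeasure _ _
  have : (volume : Measure (Pt n)).IsAddHaarMeasure := Measure.prod.instIsAddHaarMeasure _ _
  have c1 : Continuous (fun p => fderiv ℝ F p v) := (hF.continuous_fderiv (by simp)).clm_apply continuous_const
  have i1 : Integrable (fun p => fderiv ℝ F p v) := c1.integrable_of_hasCompactSupport (hc.fderiv_apply ℝ v)
  have i0 : Integrable F := hF.continuous.integrable_of_hasCompactSupport hc
  have := integral_mul_fderiv_eq_neg_fderiv_mul_of_integrable (μ := (volume : Measure (Pt n))) (f := fun _ : Pt n => (1:ℝ)) (g := F) (v := v)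
    (by simp) (by simpa using i1) (by simpa using i0) (by fun_prop) (fun p _ => hF.differentiable (by simp) p)
  simpa using this

lemma DD_cont {n : ℕ} (j : Fin n) (σ : ℂ) {F : Pt n → ℝ} (hF : ContDiff ℝ (⊤ : ℕ∞) F) : Continuous (DD n j σ F) :=
  (DD_smooth j σ hF).continuous

lemma DD_supp {n : ℕ} (j : Fin n) (σ : ℂ) {F : Pt n → ℝ} (hc : HasCompactSupport F) : HasCompactSupport (DD n j σ F) := by
  refine (hc.fderiv ℝ).mono ?_
  intro p hp h
  apply hp
  rw [DD, h]; simp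

lemma ibp0 {n : ℕ} (j : Fin n) (σ : ℂ) {F : Pt n → ℝ} (hF : ContDiff ℝ (⊤ : ℕ∞) F) (hc : HasCompactSupport F) :
    ∫ p, DD n j σ F p = 0 := by
  set l : Pt n → ℝ := fun p => 2 * (p.2.1 j * σ.re - p.1 j * σ.im) with hl
  have hls : ContDiff ℝ (⊤ : ℕ∞) l := by rw [hl]; fun_prop
  have hlF : ContDiff ℝ (⊤ : ℕ∞) (fun p => l p * F p) := hls.mul hF
  have hlc : HasCompactSupport (fun p => l p * F p) := hc.mul_left
  have hlt : ∀ p, fderiv ℝ l p (et n) = 0 := by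
    intro p
    have h : ∀ t : ℝ, l (p + t • et n) = l p := by
      intro t; simp [hl, et]
    have h1 := ((hls.differentiable (by simp) p).hasFDerivAt.hasLineDerivAt (et n)).lineDeriv
    rw [← h1, lineDeriv]
    simp [h]
  have e : ∀ p, DD n j σ F p = fderiv ℝ F p (Pi.single j σ.re, Pi.single j σ.im, 0) + fderiv ℝ (fun p => l p * F p) p (et n) := by
    intro p
    rw [fderiv_fun_mul (hls.differentiable (by simp) p) (hF.differentiable (by simp) p), DD, hv_eq, map_add, map_smul]
    simp only [_root_.add_apply, _root_.smul_apply, hlt, smul_eq_mul, mul_zero, add_zero]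
    rfl
  simp only [e]
  have i1 : ∀ {G : Pt n → ℝ} (_ : ContDiff ℝ (⊤ : ℕ∞) G) (_ : HasCompactSupport G) (v : Pt n), Integrable (fun p => fderiv ℝ G p v) :=
    fun hG hc v => ((hG.continuous_fderiv (by simp)).clm_apply continuous_const).integrable_of_hasCompactSupport (hc.fderiv_apply ℝ v)
  rw [integral_add (i1 hF hc _) (i1 hlF hlc _), ibpc hF hc, ibpc hlF hlc, add_zero]

def th (x : ℝ) : ℝ := Real.smoothTransition (2 - x)

lemma th_smooth : ContDiff ℝ (⊤ : ℕ∞) th := by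
  unfold th
  exact Real.smoothTransition.contDiff.comp (contDiff_const.sub contDiff_id)

lemma th_zero {x : ℝ} (h : 2 ≤ x) : th x = 0 := Real.smoothTransition.zero_of_nonpos (by linarith)

lemma th_one {x : ℝ} (h : x ≤ 1) : th x = 1 := Real.smoothTransition.one_of_one_le (by linarith)

lemma th_abs (x : ℝ) : |th x| ≤ 1 := by
  unfold th
  rw [abs_of_nonneg (Real.smoothTransition.nonneg _)]; exact Real.smoothTransition.le_one _

lemma th_deriv : ∃ C, 0 ≤ C ∧ ∀ x, 0 ≤ x → |deriv th x| ≤ C ∧ (2 < x → deriv th x = 0) := by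
  have hc : Continuous (deriv th) := th_smooth.continuous_deriv (by simp)
  have hz : ∀ x, 2 < x → deriv th x = 0 := by
    intro x hx
    have : th =ᶠ[𝓝 x] fun _ => 0 := by
      filter_upwards [lt_mem_nhds hx] with y hy
      exact th_zero hy.le
    rw [this.deriv_eq]; simp
  obtain ⟨C, hC⟩ := (isCompact_Icc (a := (0:ℝ)) (b := 2)).exists_bound_of_continuousOn hc.continuousOn
  refine ⟨C, (norm_nonneg _).trans (hC 0 (by simp)), fun x hx => ⟨?_, hz x⟩⟩
  by_cases h : 2 < x
  · rw [hz x h]; simpa using (norm_nonneg _).trans (hC 0 (by simp))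
  · exact hC x ⟨hx, by linarith⟩

def chi (n m : ℕ) (p : Pt n) : ℝ := th (RR n p ^ 2 / (m + 1))

lemma RRsq_smooth (n : ℕ) : ContDiff ℝ (⊤ : ℕ∞) (fun p => RR n p ^ 2) := by
  have : (fun p => RR n p ^ 2) = fun p => (1 + z2 n p) ^ 2 + p.2.2 ^ 2 := by ext p; exact RR_sq n p
  rw [this]
  have := z2_smooth n
  fun_prop

lemma chi_smooth (n m : ℕ) : ContDiff ℝ (⊤ : ℕ∞) (chi n m) :=
  th_smooth.comp ((RRsq_smooth n).div_const _)

lemma chi_supp (n m : ℕ) : HasCompactSupport (chi n m) := by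
  refine HasCompactSupport.intro (isCompact_closedBall (0 : Pt n) (2 * (m + 1))) fun p hp => ?_
  rw [mem_closedBall_zero_iff] at hp
  push Not at hp
  apply th_zero
  have h1 := norm_le_RR n p
  have h2 := RR_one n p
  rw [le_div_iff₀ (by positivity)]
  nlinarith

lemma DD_RR {n : ℕ} (j : Fin n) (σ : ℂ) (hσ : ‖σ‖ = 1) (p : Pt n) :
    |DD n j σ (fun p => RR n p ^ 2) p| ≤ 4 * (RR n p * RR n p ^ (1/2 : ℝ)) := by
  have h1 := ((eta_smooth n).differentiable (by simp) p).hasFDerivAt.const_add 1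
  have h2 : HasFDerivAt (fun p => RR n p ^ 2) _ p := h1.norm_sq
  rw [DD, h2.fderiv]
  simp only [_root_.smul_apply, ContinuousLinearMap.comp_apply, fderiv_eta, innerSL_apply_apply, nsmul_eq_mul]
  have h3 := abs_real_inner_le_norm (1 + eta n p) (2 * zb n j p * σ)
  rw [norm_mul, norm_mul, hσ] at h3
  have h4 := zb_le n j p
  have hp := RR_pos n p
  have h5 : ‖1 + eta n p‖ = RR n p := rfl
  rw [h5] at h3
  rw [abs_mul]
  have h6 : RR n p * (‖(2:ℂ)‖ * ‖zb n j p‖ * 1) ≤ RR n p * (2 * RR n p ^ (1/2 : ℝ)) := by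
    rw [Complex.norm_ofNat, mul_one]; gcongr
  have : |((2:ℕ) : ℝ)| = 2 := by norm_num
  rw [this]
  linarith

lemma DD_chi {n : ℕ} (j : Fin n) (σ : ℂ) (hσ : ‖σ‖ = 1) : ∃ C, 0 ≤ C ∧ ∀ m p,
    |DD n j σ (chi n m) p| ≤ C * RR n p ^ (-(1/2) : ℝ) ∧ |DD n j σ (chi n m) p| ≤ C * (RR n p * RR n p ^ (1/2 : ℝ)) / (m + 1) := by
  obtain ⟨C, h0, hC⟩ := th_deriv
  refine ⟨8 * C, by positivity, fun m p => ?_⟩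
  have hp := RR_pos n p
  have hd := (RRsq_smooth n).differentiable (by simp) p
  have h1 : HasFDerivAt (chi n m) _ p :=
    ((th_smooth.differentiable (by simp) (RR n p ^ 2 * ((m:ℝ) + 1)⁻¹)).hasDerivAt).comp_hasFDerivAt p (hd.hasFDerivAt.mul_const ((m:ℝ) + 1)⁻¹)
  have e : DD n j σ (chi n m) p = deriv th (RR n p ^ 2 / (m + 1)) * (DD n j σ (fun p => RR n p ^ 2) p / (m + 1)) := by
    rw [DD, h1.fderiv, DD, div_eq_mul_inv, div_eq_mul_inv]
    simp only [_root_.smul_apply, smul_eq_mul]; ring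
  have h2 := DD_RR j σ hσ p
  obtain ⟨h3, h4⟩ := hC (RR n p ^ 2 / (m + 1)) (by positivity)
  have hm : (0:ℝ) < m + 1 := by positivity
  have h5 : |DD n j σ (chi n m) p| ≤ C * (4 * (RR n p * RR n p ^ (1/2 : ℝ)) / (m + 1)) := by
    rw [e, abs_mul, abs_div, abs_of_pos hm]
    gcongr
  refine ⟨?_, h5.trans ?_⟩
  · by_cases h : 2 < RR n p ^ 2 / (m + 1)
    · rw [e, h4 h]; simp; positivity
    · push Not at h
      rw [div_le_iff₀ hm] at h
      refine h5.trans ?_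
      have e2 : RR n p ^ (-(1/2) : ℝ) * RR n p ^ 2 = RR n p * RR n p ^ (1/2 : ℝ) := by
        rw [← Real.rpow_natCast, ← Real.rpow_add hp]
        nth_rewrite 2 [← Real.rpow_one (RR n p)]
        rw [← Real.rpow_add hp]; norm_num
      rw [← e2, mul_div_assoc', div_le_iff₀ hm]
      have : 0 ≤ C * RR n p ^ (-(1/2) : ℝ) := by positivity
      nlinarith
  · rw [mul_div_assoc']
    refine div_le_div_of_nonneg_right ?_ hm.le
    have : 0 ≤ C * (RR n p * RR n p ^ (1/2 : ℝ)) := by positivity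
    linarith

lemma ibp {n : ℕ} (hn : 1 ≤ n) (j : Fin n) (σ : ℂ) (hσ : ‖σ‖ = 1) {F : Pt n → ℝ} (hF : ContDiff ℝ (⊤ : ℕ∞) F)
    (hB : Bd n (2 * n + 1/2) F) (hi : Integrable (DD n j σ F)) : ∫ p, DD n j σ F p = 0 := by
  obtain ⟨C, h0, hC⟩ := DD_chi j σ hσ
  obtain ⟨B, hB0, hB⟩ := hB
  have e : ∀ m p, DD n j σ (fun p => chi n m p * F p) p = chi n m p * DD n j σ F p + DD n j σ (chi n m) p * F p := fun m p =>
    DD_mul j σ ((chi_smooth n m).differentiable (by simp) p) (hF.differentiable (by simp) p)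
  have z : ∀ m, ∫ p, DD n j σ (fun p => chi n m p * F p) p = 0 := fun m =>
    ibp0 j σ ((chi_smooth n m).mul hF) ((chi_supp n m).mul_right)
  have lim : Tendsto (fun m : ℕ => ∫ p, DD n j σ (fun p => chi n m p * F p) p) atTop (𝓝 (∫ p, DD n j σ F p)) := by
    refine tendsto_integral_of_dominated_convergence (fun p => ‖DD n j σ F p‖ + (C * B) * RR n p ^ (-(2 * n + 1 : ℝ))) ?_ ?_ ?_ ?_
    · exact fun m => (DD_cont j σ ((chi_smooth n m).mul hF)).aestronglyMeasurable
    · exact hi.norm.add ((int_RR n hn le_rfl).const_mul _)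
    · refine fun m => Eventually.of_forall fun p => ?_
      have hp := RR_pos n p
      rw [e]
      refine (norm_add_le _ _).trans (add_le_add ?_ ?_)
      · rw [norm_mul]
        exact mul_le_of_le_one_left (norm_nonneg _) (th_abs _)
      · rw [norm_mul]
        have e3 : RR n p ^ (-(2 * n + 1 : ℝ)) = RR n p ^ (-(1/2) : ℝ) * RR n p ^ (-(2 * n + 1/2 : ℝ)) := by
          rw [← Real.rpow_add hp]; congr 1; ring
        rw [e3, mul_mul_mul_comm]
        exact mul_le_mul (hC m p).1 (hB p) (norm_nonneg _) (by positivity)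
    · refine Eventually.of_forall fun p => ?_
      simp only [e]
      have t1 : Tendsto (fun m : ℕ => DD n j σ (chi n m) p) atTop (𝓝 0) := by
        refine squeeze_zero_norm (fun m => (hC m p).2) ?_
        exact (tendsto_const_div_atTop_nhds_zero_nat (C * (RR n p * RR n p ^ (1/2 : ℝ)))).comp (tendsto_add_atTop_nat 1) |>.congr
          (fun m => by simp)
      have t2 : Tendsto (fun m : ℕ => chi n m p) atTop (𝓝 1) := by
        refine tendsto_const_nhds.congr' ?_
        filter_upwards [tendsto_natCast_atTop_atTop.eventually_ge_atTop (RR n p ^ 2)] with m hm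
        rw [chi, th_one]
        rw [div_le_one (by positivity)]; linarith
      have := (t2.mul_const (DD n j σ F p)).add (t1.mul_const (F p))
      simpa using this
  simp only [z] at lim
  exact (tendsto_nhds_unique lim tendsto_const_nhds)

end Heis

namespace Heis
open Complex (I)

lemma ibpt {n : ℕ} (j : Fin n) (σ : ℂ) {u φ : Pt n → ℝ} (hu : ContDiff ℝ (⊤ : ℕ∞) u) (hφ : TestFun n φ) :
    ∫ p, u p * DD n j σ φ p = -∫ p, DD n j σ u p * φ p := by
  have i1 : Integrable (fun p => u p * DD n j σ φ p) :=
    (hu.continuous.mul (DD_cont j σ hφ.1)).integrable_of_hasCompactSupport (DD_supp j σ hφ.2).mul_left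
  have i2 : Integrable (fun p => DD n j σ u p * φ p) :=
    ((DD_cont j σ hu).mul hφ.1.continuous).integrable_of_hasCompactSupport hφ.2.mul_left
  have h := ibp0 j σ (hu.mul hφ.1) (hφ.2.mul_left (f := u))
  have e : ∀ p, DD n j σ (fun p => u p * φ p) p = u p * DD n j σ φ p + DD n j σ u p * φ p := fun p =>
    DD_mul j σ (hu.differentiable (by simp) p) (hφ.1.differentiable (by simp) p)
  have h' : ∫ p, DD n j σ (fun p => u p * φ p) p = 0 := h
  simp only [e] at h'
  rw [integral_add i1 i2] at h'
  linarith

lemma int_sum2 {n : ℕ} {F G : Fin n → Pt n → ℝ} (hF : ∀ j, Integrable (F j)) (hG : ∀ j, Integrable (G j)) :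
    ∫ p, ∑ j, (F j p + G j p) = ∑ j, ((∫ p, F j p) + ∫ p, G j p) := by
  have h : ∀ j, Integrable (fun p => F j p + G j p) := fun j => (hF j).add (hG j)
  rw [integral_finsetSum _ fun j _ => h j]
  exact Finset.sum_congr rfl fun j _ => integral_add (hF j) (hG j)

lemma energy {n : ℕ} (hn : 1 ≤ n) {u h : Pt n → ℝ} (a : Nice n u h) (j : Fin n) :
    ∫ p, (DD n j 1 u p) ^ 2 ≤ ∫ p, u p * h p ∧ ∫ p, (DD n j I u p) ^ 2 ≤ ∫ p, u p * h p := by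
  have iB : ∀ j σ, ‖σ‖ = 1 → Integrable (fun p => u p * DD n j σ (DD n j σ u) p) := fun j σ hσ =>
    (a.bd0.mul (a.bd2 j σ hσ)).int hn (by linarith)
      (a.smooth.continuous.mul (DD_cont j σ (DD_smooth j σ a.smooth)))
  have key : ∀ j σ, ‖σ‖ = 1 → ∫ p, (DD n j σ u p) ^ 2 = -∫ p, u p * DD n j σ (DD n j σ u) p := by
    intro j σ hσ
    have hD := DD_smooth j σ a.smooth
    have i2 : Integrable (fun p => DD n j σ u p * DD n j σ u p) :=
      ((a.bd1 j σ hσ).mul (a.bd1 j σ hσ)).int hn (by linarith) (hD.continuous.mul hD.continuous)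
    have e : (DD n j σ (fun p => u p * DD n j σ u p)) =
        fun p => u p * DD n j σ (DD n j σ u) p + DD n j σ u p * DD n j σ u p := by
      ext p
      exact DD_mul j σ (a.smooth.differentiable (by simp) p) (hD.differentiable (by simp) p)
    have h0 := ibp hn j σ hσ (a.smooth.mul hD) ((a.bd0.mul (a.bd1 j σ hσ)).of_eq (by ring))
      (by change Integrable (DD n j σ (fun p => u p * DD n j σ u p)); rw [e]; exact (iB j σ hσ).add i2)
    have h1 : ∫ p, DD n j σ (fun p => u p * DD n j σ u p) p = 0 := h0
    rw [e, integral_add (iB j σ hσ) i2] at h1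
    simp only [sq]
    linarith
  have k1 : ‖(1:ℂ)‖ = 1 := by simp
  have kI : ‖I‖ = 1 := by simp
  have s : ∑ j, ((∫ p, (DD n j 1 u p) ^ 2) + ∫ p, (DD n j I u p) ^ 2) = ∫ p, u p * h p := by
    have : ∀ p, u p * h p = ∑ j, (-(u p * DD n j 1 (DD n j 1 u) p) + -(u p * DD n j I (DD n j I u) p)) := by
      intro p
      have h1 := a.eq p
      have h2 : h p = -∑ j, (DD n j 1 (DD n j 1 u) p + DD n j I (DD n j I u) p) := by rw [h1, neg_neg]
      rw [h2, mul_neg, Finset.mul_sum, ← Finset.sum_neg_distrib]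
      exact Finset.sum_congr rfl fun j _ => by ring
    simp only [this]
    rw [int_sum2 (F := fun j p => -(u p * DD n j 1 (DD n j 1 u) p)) (G := fun j p => -(u p * DD n j I (DD n j I u) p))
      (fun j => (iB j 1 k1).neg) (fun j => (iB j I kI).neg)]
    refine Finset.sum_congr rfl fun j _ => ?_
    rw [key j 1 k1, key j I kI, integral_neg, integral_neg]
  have p1 : ∀ j σ, 0 ≤ ∫ p, (DD n j σ u p) ^ 2 := fun j σ => integral_nonneg fun p => sq_nonneg _
  have h3 := Finset.single_le_sum (f := fun j => ((∫ p, (DD n j 1 u p) ^ 2) + ∫ p, (DD n j I u p) ^ 2))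
    (fun j _ => add_nonneg (p1 j 1) (p1 j I)) (Finset.mem_univ j)
  rw [s] at h3
  exact ⟨by linarith [p1 j I], by linarith [p1 j 1]⟩

lemma L2lim {n : ℕ} {f : ℕ → Pt n → ℝ} (hf : ∀ i, MemLp (f i) 2 volume) {K : ℝ} (hK : 0 ≤ K)
    (hc : ∀ i k : ℕ, ∫ p, (f i p - f k p) ^ 2 ≤ K * (1 / (i + 1) + 1 / (k + 1)) ^ 2) :
    ∃ g : Pt n → ℝ, MemLp g 2 volume ∧ ∀ φ : Pt n → ℝ, MemLp φ 2 volume →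
      Tendsto (fun i => ∫ p, f i p * φ p) atTop (𝓝 (∫ p, g p * φ p)) := by
  have hn : ∀ i k : ℕ, dist ((hf i).toLp) ((hf k).toLp) ≤ √K * (1 / (i + 1) + 1 / (k + 1)) := by
    intro i k
    rw [dist_eq_norm]
    refine abs_le_of_sq_le_sq' ?_ (by positivity) |>.2
    rw [mul_pow, Real.sq_sqrt hK]
    refine le_trans (le_of_eq ?_) (hc i k)
    rw [← real_inner_self_eq_norm_sq, L2.inner_def, ← MemLp.toLp_sub]
    refine integral_congr_ae ?_
    filter_upwards [((hf i).sub (hf k)).coeFn_toLp] with p hp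
    rw [hp]; simp [sq]
  have hcs : CauchySeq fun i => (hf i).toLp := by
    refine cauchySeq_of_le_tendsto_0' (b := fun i : ℕ => √K * (2 * (1 / ((i:ℝ) + 1)))) (fun i k hik => (hn i k).trans ?_) ?_
    · have : (1:ℝ) / (k + 1) ≤ 1 / (i + 1) := by gcongr
      gcongr; linarith
    · simpa using (tendsto_one_div_add_atTop_nhds_zero_nat (𝕜 := ℝ)).const_mul 2 |>.const_mul √K
  obtain ⟨g, hg⟩ := cauchySeq_tendsto_of_complete hcs
  refine ⟨g, MeasureTheory.Lp.memLp g, fun φ hφ => ?_⟩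
  have h := hg.inner (𝕜 := ℝ) (tendsto_const_nhds (x := hφ.toLp))
  have e : ∀ F : MeasureTheory.Lp ℝ 2 (volume : Measure (Pt n)), ∀ F' : Pt n → ℝ, (F =ᵐ[volume] F') →
      inner ℝ F hφ.toLp = ∫ p, F' p * φ p := by
    intro F F' hF
    rw [L2.inner_def]
    refine integral_congr_ae ?_
    filter_upwards [hφ.coeFn_toLp, hF] with p hp hp'
    rw [hp, hp']; simp [mul_comm]
  rw [e g g EventuallyEq.rfl] at h
  exact h.congr fun i => e _ _ (hf i).coeFn_toLp

lemma unifl {n : ℕ} {U : ℕ → Pt n → ℝ} {u ψ : Pt n → ℝ} (hU : ∀ i, Continuous (U i)) (hu : Continuous u) (hψ : Continuous ψ)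
    (hc : HasCompactSupport ψ) (hb : ∀ (i : ℕ) p, |U i p - u p| ≤ 4 * (1 / ((i:ℝ) + 1))) :
    Tendsto (fun i => ∫ p, U i p * ψ p) atTop (𝓝 (∫ p, u p * ψ p)) := by
  have i1 : ∀ {f : Pt n → ℝ}, Continuous f → Integrable (fun p => f p * ψ p) := fun hf =>
    (hf.mul hψ).integrable_of_hasCompactSupport hc.mul_left
  have i0 : Integrable ψ := hψ.integrable_of_hasCompactSupport hc
  rw [tendsto_iff_norm_sub_tendsto_zero]
  refine squeeze_zero (fun i => norm_nonneg _) (g := fun i : ℕ => 4 * (1 / ((i:ℝ) + 1)) * ∫ p, ‖ψ p‖) (fun i => ?_) ?_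
  · rw [← integral_sub (i1 (hU i)) (i1 hu), ← integral_const_mul]
    refine norm_integral_le_of_norm_le (i0.norm.const_mul _) (Eventually.of_forall fun p => ?_)
    rw [← sub_mul, norm_mul]
    exact mul_le_mul_of_nonneg_right (hb i p) (norm_nonneg _)
  · simpa using ((tendsto_one_div_add_atTop_nhds_zero_nat (𝕜 := ℝ)).const_mul 4).mul_const (∫ p, ‖ψ p‖)

lemma WD_cont (n : ℕ) : Continuous (WD n) := by
  refine Continuous.subtype_mk ?_ _
  unfold Wf
  have := (eta_smooth n).continuous
  exact (continuous_const.sub this).div (continuous_const.add this) fun p => one_eta_ne (z2_nonneg n p)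

lemma RRp_cont (n : ℕ) (s : ℝ) : Continuous (fun p => RR n p ^ s) :=
  (RR_cont n).rpow_const fun p => Or.inl (RR_pos n p).ne'

lemma RRp_le (n : ℕ) {s : ℝ} (hs : 0 ≤ s) (p : Pt n) : RR n p ^ (-s) ≤ 1 :=
  Real.rpow_le_one_of_one_le_of_nonpos (RR_one n p) (by linarith)

lemma energy_uc {n : ℕ} (hn : 1 ≤ n) (c : Poly) {a : ℝ} (h1 : ∀ w : Dk, ‖ev c w‖ ≤ a) (h2 : ∀ w : Dk, ‖ev (Lp n c) w‖ ≤ a) :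
    ∫ p, uc n c p * hc n c p ≤ (4 * ∫ p, RR n p ^ (-(2 * n + 2 : ℝ))) * a ^ 2 := by
  refine (le_abs_self _).trans ?_
  have i := int_RR n hn (s := 2 * n + 2) (by linarith)
  have : (4 * ∫ p, RR n p ^ (-(2 * n + 2 : ℝ))) * a ^ 2 = ∫ p, (4 * a ^ 2) * RR n p ^ (-(2 * n + 2 : ℝ)) := by
    rw [integral_const_mul]; ring
  rw [this]
  rw [← Real.norm_eq_abs]
  refine norm_integral_le_of_norm_le (i.const_mul _) (Eventually.of_forall fun p => ?_)
  have hp := RR_pos n p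
  have e : RR n p ^ (-(2 * n + 2 : ℝ)) = RR n p ^ (-(n:ℝ)) * RR n p ^ (-((n:ℝ) + 2)) := by
    rw [← Real.rpow_add hp]; congr 1; ring
  have b1 := (Complex.abs_re_le_norm _).trans (h1 (WD n p))
  have b2 := (Complex.abs_re_le_norm _).trans (h2 (WD n p))
  have e1 : ((WD n p : Dk) : ℂ) = Wf (eta n p) := rfl
  rw [e1] at b1 b2
  rw [e, uc, hc, norm_mul, norm_mul, norm_mul, norm_mul, Real.norm_of_nonneg (by positivity : (0:ℝ) ≤ RR n p ^ (-(n:ℝ))),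
    Real.norm_of_nonneg (by positivity : (0:ℝ) ≤ RR n p ^ (-((n:ℝ) + 2))), Real.norm_eq_abs, Real.norm_eq_abs, Real.norm_eq_abs]
  have b3 := mul_le_mul b1 b2 (abs_nonneg _) ((abs_nonneg _).trans b1)
  have b4 : (0:ℝ) ≤ 4 * (RR n p ^ (-(n:ℝ)) * RR n p ^ (-((n:ℝ) + 2))) := by positivity
  have b5 := mul_le_mul_of_nonneg_left b3 b4
  have : |(4:ℝ)| = 4 := by norm_num
  rw [this]
  linarith

lemma weak_core {n : ℕ} (hn : 1 ≤ n) (v h : V) (H : Gr n v h) :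
    ∃ G : Pt n → (Fin n → ℝ) × (Fin n → ℝ), HasWeakHGrad n (fun p => RR n p ^ (-(n:ℝ)) * v (WD n p)) G ∧
      ∀ φ, TestFun n φ → ∫ p, gDot n G φ p = ∫ p, (4 * RR n p ^ (-((n:ℝ) + 2)) * h (WD n p)) * φ p := by
  choose c hcc using fun i : ℕ => H (1 / ((i:ℝ) + 1)) (by positivity)
  set K := 4 * ∫ p, RR n p ^ (-(2 * n + 2 : ℝ)) with hKd
  have hK : 0 ≤ K := mul_nonneg (by norm_num) (integral_nonneg fun p => by have := RR_pos n p; positivity)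
  have k1 : ‖(1:ℂ)‖ = 1 := by simp
  have kI : ‖I‖ = 1 := by simp
  have sm := fun i => (nice_uc n (c i)).smooth
  have dif : ∀ j σ i k p, DD n j σ (uc n (c i)) p - DD n j σ (uc n (c k)) p = DD n j σ (uc n (c i - c k)) p := by
    intro j σ i k p
    have : uc n (c i) = fun p => uc n (c i - c k) p + uc n (c k) p := by
      ext p; simp [uc, map_sub, mul_sub]
    rw [this, DD_add j σ ((nice_uc n (c i - c k)).smooth.differentiable (by simp) p) ((sm k).differentiable (by simp) p)]
    ring
  have en : ∀ j i k, ∫ p, (DD n j 1 (uc n (c i)) p - DD n j 1 (uc n (c k)) p) ^ 2 ≤ K * (1 / (i + 1) + 1 / (k + 1)) ^ 2 ∧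
      ∫ p, (DD n j I (uc n (c i)) p - DD n j I (uc n (c k)) p) ^ 2 ≤ K * (1 / (i + 1) + 1 / (k + 1)) ^ 2 := by
    intro j i k
    simp only [dif]
    have tri : ∀ a b d : ℂ, ‖a - b‖ ≤ 1 / ((i:ℝ) + 1) → ‖a - d‖ ≤ 1 / ((k:ℝ) + 1) → ‖b - d‖ ≤ 1 / ((i:ℝ) + 1) + 1 / ((k:ℝ) + 1) := by
      intro a b d h1 h2
      have : b - d = -(a - b) + (a - d) := by ring
      rw [this]
      refine (norm_add_le _ _).trans ?_
      rw [norm_neg]; linarith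
    have b := energy_uc hn (c i - c k) (a := 1 / ((i:ℝ) + 1) + 1 / ((k:ℝ) + 1))
      (fun w => by rw [map_sub, Pi.sub_apply]; exact tri _ _ _ (hcc i w).1 (hcc k w).1)
      (fun w => by rw [map_sub, map_sub, Pi.sub_apply]; exact tri _ _ _ (hcc i w).2 (hcc k w).2)
    have a := energy hn (nice_uc n (c i - c k)) j
    exact ⟨a.1.trans b, a.2.trans b⟩
  have mem : ∀ j σ, ‖σ‖ = 1 → ∀ i, MemLp (DD n j σ (uc n (c i))) 2 volume := by
    intro j σ hσ i
    have hD := DD_cont j σ (sm i)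
    rw [memLp_two_iff_integrable_sq hD.aestronglyMeasurable]
    simp only [sq]
    exact (((nice_uc n (c i)).bd1 j σ hσ).mul ((nice_uc n (c i)).bd1 j σ hσ)).int hn (by linarith) (hD.mul hD)
  choose g1 hg1 hg1' using fun j => L2lim (mem j 1 k1) hK (fun i k => (en j i k).1)
  choose gI hgI hgI' using fun j => L2lim (mem j I kI) hK (fun i k => (en j i k).2)
  have tm : ∀ {ψ : Pt n → ℝ}, Continuous ψ → HasCompactSupport ψ → MemLp ψ 2 volume := fun h1 h2 =>
    h1.memLp_of_hasCompactSupport h2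
  have hWc := WD_cont n
  have vc : Continuous (fun p => v (WD n p)) := v.continuous.comp hWc
  have hcn : Continuous (fun p => h (WD n p)) := h.continuous.comp hWc
  have uC : Continuous (fun p => RR n p ^ (-(n:ℝ)) * v (WD n p)) := (RRp_cont n _).mul vc
  have uB : ∀ (i : ℕ) p, |uc n (c i) p - RR n p ^ (-(n:ℝ)) * v (WD n p)| ≤ 4 * (1 / ((i:ℝ) + 1)) := by
    intro i p
    have b := (Complex.abs_re_le_norm _).trans (hcc i (WD n p)).1
    have hp := RR_pos n p
    rw [uc, ← mul_sub, abs_mul, abs_of_nonneg (by positivity : (0:ℝ) ≤ RR n p ^ (-(n:ℝ))), abs_sub_comm]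
    have b2 : |v (WD n p) - (ev (c i) (Wf (eta n p))).re| ≤ 1 / ((i:ℝ) + 1) := by simpa [WD] using b
    have b3 : (0:ℝ) ≤ 1 / ((i:ℝ) + 1) := by positivity
    calc _ ≤ 1 * |v (WD n p) - (ev (c i) (Wf (eta n p))).re| := by gcongr; exact RRp_le n (by positivity) p
      _ ≤ _ := by linarith
  have hcC : ∀ i, Continuous (hc n (c i)) := by
    intro i
    unfold hc
    have h1 := (ev_cont (Lp n (c i))).comp (continuous_subtype_val.comp hWc)
    have h2 : Continuous fun p => ev (Lp n (c i)) (Wf (eta n p)) := h1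
    exact (continuous_const.mul (RRp_cont n _)).mul (Complex.continuous_re.comp h2)
  have hB : ∀ (i : ℕ) p, |hc n (c i) p - 4 * RR n p ^ (-((n:ℝ) + 2)) * h (WD n p)| ≤ 4 * (1 / ((i:ℝ) + 1)) := by
    intro i p
    have b := (Complex.abs_re_le_norm _).trans (hcc i (WD n p)).2
    have hp := RR_pos n p
    rw [hc, ← mul_sub, abs_mul, abs_of_nonneg (by positivity : (0:ℝ) ≤ 4 * RR n p ^ (-((n:ℝ) + 2))), abs_sub_comm]
    have b2 : |h (WD n p) - (ev (Lp n (c i)) (Wf (eta n p))).re| ≤ 1 / ((i:ℝ) + 1) := by simpa [WD] using b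
    have b4 := RRp_le n (s := (n:ℝ) + 2) (by positivity) p
    calc _ ≤ 4 * 1 * |h (WD n p) - (ev (Lp n (c i)) (Wf (eta n p))).re| := by gcongr
      _ ≤ _ := by linarith
  have wk : ∀ j σ, (g : Pt n → ℝ) → (∀ φ : Pt n → ℝ, MemLp φ 2 volume →
      Tendsto (fun i => ∫ p, DD n j σ (uc n (c i)) p * φ p) atTop (𝓝 (∫ p, g p * φ p))) → ∀ φ, TestFun n φ →
      ∫ p, RR n p ^ (-(n:ℝ)) * v (WD n p) * DD n j σ φ p = -∫ p, g p * φ p := by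
    intro j σ g hg φ hφ
    have t1 := unifl (fun i => (sm i).continuous) uC (DD_cont j σ hφ.1) (DD_supp j σ hφ.2) uB
    have t2 := (hg φ (tm hφ.1.continuous hφ.2)).neg
    refine tendsto_nhds_unique (t1.congr fun i => ?_) t2
    exact ibpt j σ (sm i) hφ
  refine ⟨fun p => (fun j => g1 j p, fun j => gI j p), ⟨fun j => ⟨hg1 j, hgI j⟩, fun φ hφ j => ?_⟩, fun φ hφ => ?_⟩
  · rw [Xd_eq, Yd_eq]
    exact ⟨wk j 1 (g1 j) (hg1' j) φ hφ, wk j I (gI j) (hgI' j) φ hφ⟩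
  · have md : ∀ j σ, MemLp (DD n j σ φ) 2 volume := fun j σ => tm (DD_cont j σ hφ.1) (DD_supp j σ hφ.2)
    have e1 : ∫ p, gDot n (fun p => (fun j => g1 j p, fun j => gI j p)) φ p
        = ∑ j, ((∫ p, g1 j p * DD n j 1 φ p) + ∫ p, gI j p * DD n j I φ p) := by
      unfold gDot
      simp only [Xd_eq, Yd_eq]
      have ii : ∀ j, Integrable (fun p => g1 j p * DD n j 1 φ p) := fun j => (hg1 j).integrable_mul (md j 1)
      have ii' : ∀ j, Integrable (fun p => gI j p * DD n j I φ p) := fun j => (hgI j).integrable_mul (md j I)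
      exact int_sum2 ii ii'
    rw [e1]
    have t1 := tendsto_finsetSum Finset.univ fun j _ => (hg1' j _ (md j 1)).add (hgI' j _ (md j I))
    have t2 := unifl hcC ((continuous_const.mul (RRp_cont n _)).mul hcn) hφ.1.continuous hφ.2 hB
    refine tendsto_nhds_unique t1 (t2.congr fun i => ?_)
    have e2 : ∀ j σ, ∫ p, DD n j σ (uc n (c i)) p * DD n j σ φ p = ∫ p, -(DD n j σ (DD n j σ (uc n (c i))) p * φ p) := fun j σ => by
      rw [ibpt j σ (DD_smooth j σ (sm i)) hφ, integral_neg]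
    simp only [e2]
    have ii : ∀ j σ, Integrable (fun p => -(DD n j σ (DD n j σ (uc n (c i))) p * φ p)) := fun j σ =>
      (((DD_cont j σ (DD_smooth j σ (sm i))).mul hφ.1.continuous).integrable_of_hasCompactSupport hφ.2.mul_left).neg
    rw [← int_sum2 (fun j => ii j 1) (fun j => ii j I)]
    refine integral_congr_ae (Eventually.of_forall fun p => ?_)
    have h1 := (nice_uc n (c i)).eq p
    have h2 : hc n (c i) p = -∑ j, (DD n j 1 (DD n j 1 (uc n (c i))) p + DD n j I (DD n j I (uc n (c i))) p) := by rw [h1, neg_neg]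
    simp only [h2, neg_mul, Finset.sum_mul, ← Finset.sum_neg_distrib]
    exact Finset.sum_congr rfl fun j _ => by ring

end Heis

namespace Heis
open Complex (I)

lemma cyl_u (n : ℕ) (v : V) : IsCyl n (fun p => RR n p ^ (-(n:ℝ)) * v (WD n p)) := by
  have h0 : ∀ r t : ℝ, 0 ≤ (⟨r ^ 2, -t⟩ : ℂ).re := fun r t => sq_nonneg r
  refine ⟨fun r t => ‖1 + (⟨r ^ 2, -t⟩ : ℂ)‖ ^ (-(n:ℝ)) * v ⟨Wf ⟨r ^ 2, -t⟩, mem_closedBall_zero_iff.2 (Wf_le (h0 r t))⟩, fun p => ?_⟩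
  have e : eta n p = ⟨znorm n p ^ 2, -p.2.2⟩ := by
    rw [eta, znorm, Real.sq_sqrt (by positivity), z2]
  have e2 : WD n p = ⟨Wf ⟨znorm n p ^ 2, -p.2.2⟩, mem_closedBall_zero_iff.2 (Wf_le (h0 _ _))⟩ :=
    Subtype.ext (congrArg Wf e)
  simp only [RR, e, e2]

lemma Qs_eq (n : ℕ) (hn : 1 ≤ n) : Qs n = (2 * n + 2) / n := by
  have : (0:ℝ) < n := by exact_mod_cast hn
  unfold Qs Qh
  rw [div_eq_div_iff (by linarith) this.ne']; ring

lemma mem_u (n : ℕ) (hn : 1 ≤ n) (v : V) :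
    MemLp (fun p => RR n p ^ (-(n:ℝ)) * v (WD n p)) (ENNReal.ofReal (Qs n)) volume := by
  have hn0 : (0:ℝ) < n := by exact_mod_cast hn
  have hq : 0 < Qs n := by rw [Qs_eq n hn]; positivity
  have m : MemLp (fun p => RR n p ^ (-(n:ℝ))) (ENNReal.ofReal (Qs n)) volume := by
    rw [← integrable_norm_rpow_iff (RRp_cont n _).aestronglyMeasurable (by simpa using hq) ENNReal.ofReal_ne_top,
      ENNReal.toReal_ofReal hq.le]
    refine (int_RR n hn (s := 2 * n + 2) (by linarith)).congr (Eventually.of_forall fun p => ?_)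
    have hp := RR_pos n p
    simp only
    rw [Real.norm_of_nonneg (by positivity), ← Real.rpow_mul hp.le, Qs_eq n hn]
    congr 1; field_simp
  refine m.of_le_mul (c := ‖v‖) ((RRp_cont n _).mul (v.continuous.comp (WD_cont n))).aestronglyMeasurable
    (Eventually.of_forall fun p => ?_)
  rw [norm_mul, mul_comm]
  exact mul_le_mul_of_nonneg_right (V_le v _) (norm_nonneg _)

lemma to_sol (n : ℕ) (hn : 1 ≤ n) (k : Pt n → ℝ) (κ : V) (hk : ∀ p, κ (WD n p) = k p) (ε : ℝ) (v : V) (hv : ∀ w, 0 < v w)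
    (H : Gr n v ((n:ℝ)^2 • ((1 + ε • κ) * Pw n v))) : ∃ u : Pt n → ℝ, IsWeakSol n (fun p => 1 + ε * k p) u := by
  have hn0 : (0:ℝ) < n := by exact_mod_cast hn
  set A : ℝ := (2 * n : ℝ) ^ (n:ℝ) with hA
  have hA0 : 0 < A := by positivity
  obtain ⟨G, hG, hG'⟩ := weak_core hn _ _ (H.smul A)
  refine ⟨_, cyl_u n (A • v), mem_u n hn (A • v), Eventually.of_forall fun p => ?_, G, hG, fun φ hφ => ?_⟩
  · have hp := RR_pos n p
    have := hv (WD n p)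
    change 0 < RR n p ^ (-(n:ℝ)) * (A * v (WD n p))
    positivity
  · rw [hG' φ hφ]
    refine integral_congr_ae (Eventually.of_forall fun p => ?_)
    have hp := RR_pos n p
    have hvp := hv (WD n p)
    change 4 * RR n p ^ (-((n:ℝ) + 2)) * (A * ((n:ℝ)^2 * ((1 + ε * κ (WD n p)) * |v (WD n p)| ^ pp n))) * φ p
      = (1 + ε * k p) * (RR n p ^ (-(n:ℝ)) * (A * v (WD n p))) ^ (Qs n - 1) * φ p
    have e0 : Qs n - 1 = pp n := by rw [Qs_eq n hn, pp]; field_simp; ring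
    have e1 : (RR n p ^ (-(n:ℝ))) ^ pp n = RR n p ^ (-((n:ℝ) + 2)) := by
      rw [← Real.rpow_mul hp.le, pp]; congr 1; field_simp
    have e2 : A ^ pp n = A * (2 * n) ^ 2 := by
      rw [hA, ← Real.rpow_mul (by positivity), ← Real.rpow_natCast, ← Real.rpow_add (by positivity), pp]
      congr 1; push_cast; field_simp
    rw [e0, Real.mul_rpow (by positivity) (by positivity), Real.mul_rpow hA0.le hvp.le, e1, e2, hk, abs_of_pos hvp]
    ring

end Heis

/-- Theorem 1.3, perturbative existence via the behavior on the axis.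
Let `k` be cylindrically symmetric such that `k ∘ F` extends to a smooth function on
the sphere `S^{2n+1}` (`F` the Cayley transform). If `k(0,s̄) = sup_σ k(0,σ)` and
`Δ_{x,y} k(0,s̄) > 0` for some `s̄`, then `-Δ_{ℍⁿ} u = (1 + εk) u^{Q*-1}` has a
positive cylindrically symmetric finite-energy weak solution for all `|ε|` small. -/
theorem webster_existence_perturbative_axis (n : ℕ) (hn : 1 ≤ n)
    (k : Pt n → ℝ)
    (hkcyl : IsCyl n k)
    (hsmooth : ∃ kbar : (Fin (n + 1) → ℂ) → ℝ, ContDiff ℝ (⊤ : ℕ∞) kbar ∧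
        ∀ ζ : Fin (n + 1) → ℂ, (∑ i, Complex.normSq (ζ i)) = 1 →
          ζ (Fin.last n) ≠ -1 → k (cayley n ζ) = kbar ζ)
    (sbar : ℝ)
    (hmax : ∀ σ : ℝ, k (0, 0, σ) ≤ k (0, 0, sbar))
    (hlap : 0 < lapXY n k (0, 0, sbar)) :
    ∃ ε₀ : ℝ, 0 < ε₀ ∧ ∀ ε : ℝ, |ε| < ε₀ →
      ∃ u : Pt n → ℝ, IsWeakSol n (fun p => 1 + ε * k p) u := by
  obtain ⟨kbar, hks, hb⟩ := hsmooth
  set κC : ℂ → ℝ := fun w => kbar (kv n w) with hκC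
  have hcont : Continuous κC := hks.continuous.comp (kv_cont n)
  have hW : ∀ p, k p = κC (Wf (eta n p)) := kW n hn k hkcyl kbar hb
  set κ : V := ⟨fun w => κC w, hcont.comp continuous_subtype_val⟩ with hκ
  have circ := circ_le n κC hcont (k (0, 0, sbar)) (fun σ => by rw [← hW]; exact hmax σ)
  obtain ⟨e, he, hpos⟩ := k_dir n k sbar hlap
  have H := k_loc n k (k_smooth n k kbar hks hb) κC hW sbar hmax e he hpos
  obtain ⟨g1, hg1⟩ := G1 n κ κC (fun w => rfl) _ sbar H
  obtain ⟨ε₀, h0, h⟩ := reduce n hn κ _ g1 hg1 (G2 n κ _ fun w hw => circ w hw)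
  refine ⟨ε₀, h0, fun ε hε => ?_⟩
  obtain ⟨v, hv, hG⟩ := h ε hε
  exact to_sol n hn k κ (fun p => (hW p).symm) ε v hv hG
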